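/- Let F and G be constant-coefficient trilinear (resp. bilinear) classical null forms on ℝ^{1+3} and let n be a nonnegative integer. There exist constants C > 0, δ > 0 and ε0 > 0 such that the following holds for every 0 < ε < ε0. Suppose ζ is a smooth solution on [0,∞)×ℝ³ of □ζ + F(dζ, d²ζ) = G(dζ, dζ) with ζ(0,·) = ζ^{(0)}, ∂_tζ(0,·) = ζ^{(1)}, where |∂̂^k ζ^{(0)}| ≤ ε(1+r)^{−k−2} and |∂̂^k ζ^{(1)}| ≤ ε(1+r)^{−k−3} for all 0 ≤ k ≤ n+7. Then: (i) for every list I of at most n vector fields from K, one has pointwise |∂̄^{(0)} V^I ζ| ≤ C ε /((1+r²)(1+|u|)^δ) and |∂ V^I ζ| ≤ C ε /((1+v)(1+|u|)^{1+δ}); and (ii) for every list I of at most n+4 vector fields from K and every t ≥ 0, ‖∂ V^I ζ‖_{L²(Σ_t)} ≤ C ε. -/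

import Mathlib

open MeasureTheory

noncomputable section

/-- A spacetime point in `ℝ^{1+3}`; index `0` is the time coordinate. -/
abbrev Pt : Type := Fin 4 → ℝ

/-- A spatial point in `ℝ³`. -/
abbrev Sp : Type := Fin 3 → ℝ

/-- The inclusion of spatial indices into spacetime indices. -/
def sidx (i : Fin 3) : Fin 4 := i.succ

/-- Coordinate partial derivative `∂_i` on spacetime. -/
def pd (i : Fin 4) (f : Pt → ℝ) : Pt → ℝ := fun p => fderiv ℝ f p (Pi.single i 1)

/-- Derivative of `f` along the (spacetime) vector field `X`. -/
def vApp (X : Pt → Pt) (f : Pt → ℝ) : Pt → ℝ := fun p => fderiv ℝ f p (X p)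

/-- Successive application of a list of vector fields: `vIter [X₁, …, Xₘ] f = X₁ X₂ ⋯ Xₘ f`. -/
def vIter : List (Pt → Pt) → (Pt → ℝ) → Pt → ℝ
  | [], f => f
  | X :: L, f => vApp X (vIter L f)

/-- The Minkowski quadratic form on `ℝ^{1+3}`. -/
def mink (ξ : Pt) : ℝ := -(ξ 0) ^ 2 + (ξ 1) ^ 2 + (ξ 2) ^ 2 + (ξ 3) ^ 2

/-- The wave operator `□ = −∂_t² + Δ`. -/
def box (f : Pt → ℝ) : Pt → ℝ := fun p =>
  -pd 0 (pd 0 f) p + pd 1 (pd 1 f) p + pd 2 (pd 2 f) p + pd 3 (pd 3 f) p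

/-- A constant-coefficient trilinear classical null form. -/
def NullForm3 (F : Fin 4 → Fin 4 → Fin 4 → ℝ) : Prop :=
  ∀ ξ : Pt, mink ξ = 0 → (∑ a, ∑ b, ∑ c, F a b c * ξ a * ξ b * ξ c) = 0

/-- A constant-coefficient bilinear classical null form. -/
def NullForm2 (G : Fin 4 → Fin 4 → ℝ) : Prop :=
  ∀ ξ : Pt, mink ξ = 0 → (∑ a, ∑ b, G a b * ξ a * ξ b) = 0

/-- `F(dη, d²ζ) = F^{αβγ} ∂_αη ∂_β∂_γζ`. -/
def nf3 (F : Fin 4 → Fin 4 → Fin 4 → ℝ) (η ζ : Pt → ℝ) : Pt → ℝ := fun p =>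
  ∑ a, ∑ b, ∑ c, F a b c * pd a η p * pd b (pd c ζ) p

/-- `G(dη, dζ) = G^{αβ} ∂_αη ∂_βζ`. -/
def nf2 (G : Fin 4 → Fin 4 → ℝ) (η ζ : Pt → ℝ) : Pt → ℝ := fun p =>
  ∑ a, ∑ b, G a b * pd a η p * pd b ζ p

/-- Glue a time and a spatial point into a spacetime point. -/
def stp (t : ℝ) (x : Sp) : Pt := ![t, x 0, x 1, x 2]

/-- Euclidean length of a spatial point. -/
def rad3 (x : Sp) : ℝ := Real.sqrt ((x 0) ^ 2 + (x 1) ^ 2 + (x 2) ^ 2)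

/-- Euclidean distance between two spatial points. -/
def dist3 (x y : Sp) : ℝ := rad3 (x - y)

/-- Distance from the spatial part of the spacetime point `p` to the spatial center `q`. -/
def radq (q : Sp) (p : Pt) : ℝ :=
  Real.sqrt ((p 1 - q 0) ^ 2 + (p 2 - q 1) ^ 2 + (p 3 - q 2) ^ 2)

/-- `|∂f|` : the sum of the absolute values of the four coordinate derivatives. -/
def pdAbs (f : Pt → ℝ) (p : Pt) : ℝ :=
  |pd 0 f p| + |pd 1 f p| + |pd 2 f p| + |pd 3 f p|

/-- Sum of `|∂_a ∂_b f|` over all pairs of coordinate directions. -/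
def pd2Abs (f : Pt → ℝ) (p : Pt) : ℝ := ∑ a, ∑ b, |pd a (pd b f) p|

/-- Sum of `|∂_a ∂_b ∂_c f|` over all triples of coordinate directions. -/
def pd3Abs (f : Pt → ℝ) (p : Pt) : ℝ := ∑ a, ∑ b, ∑ c, |pd a (pd b (pd c f)) p|

/-- The null (outgoing) direction `∂_t + ∂_{r_q}` adapted to the spatial center `q`. -/
def nullVF (q : Sp) : Pt → Pt := fun p =>
  ![1, (p 1 - q 0) / radq q p, (p 2 - q 1) / radq q p, (p 3 - q 2) / radq q p]

/-- Rotation vector field about the center `q` in the spatial plane `(i,j)`. -/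
def rotVF (q : Sp) (i j : Fin 3) : Pt → Pt := fun p =>
  (p (sidx i) - q i) • (Pi.single (sidx j) 1 : Pt) -
    (p (sidx j) - q j) • (Pi.single (sidx i) 1 : Pt)

/-- `|∂̄^{(q)} f|` : sum of the absolute values of the good derivatives adapted to the
center `q`, namely `∂_t + ∂_{r_q}` and `(1+r_q)⁻¹` times each rotation about `q`. -/
def goodAbs (q : Sp) (f : Pt → ℝ) (p : Pt) : ℝ :=
  |vApp (nullVF q) f p|
    + (1 + radq q p)⁻¹ * |vApp (rotVF q 0 1) f p|
    + (1 + radq q p)⁻¹ * |vApp (rotVF q 0 2) f p|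
    + (1 + radq q p)⁻¹ * |vApp (rotVF q 1 2) f p|

/-- Translation vector field `∂_a`. -/
def transVF (a : Fin 4) : Pt → Pt := fun _ => Pi.single a 1

/-- Lorentz boost `t∂_{x_i} + (x_i − q_i)∂_t` centered at `q`. -/
def boostVF (q : Sp) (i : Fin 3) : Pt → Pt := fun p =>
  (p 0) • (Pi.single (sidx i) 1 : Pt) + (p (sidx i) - q i) • (Pi.single 0 1 : Pt)

/-- Scaling vector field `t∂_t + (x−q)·∇` centered at `q`. -/
def scaleVF (q : Sp) : Pt → Pt := fun p => ![p 0, p 1 - q 0, p 2 - q 1, p 3 - q 2]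

/-- Rescaling of a vector field by a constant. -/
def smulVF (c : ℝ) (X : Pt → Pt) : Pt → Pt := fun p => c • X p

/-- The spatial origin. -/
def o3 : Sp := ![0, 0, 0]

/-- The point `(a,0,0)` on the x-axis. -/
def axisPt (a : ℝ) : Sp := ![a, 0, 0]

/-- The eleven fields of `K` centered at `q`: translations, rotations, boosts and scaling. -/
def Kfields (q : Sp) : List (Pt → Pt) :=
  [transVF 0, transVF 1, transVF 2, transVF 3,
   rotVF q 0 1, rotVF q 0 2, rotVF q 1 2,
   boostVF q 0, boostVF q 1, boostVF q 2, scaleVF q]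

/-- `K_R` centered at `q`: the translations together with `R⁻¹` times the rotations,
boosts and scaling. -/
def KRfields (R : ℝ) (q : Sp) : List (Pt → Pt) :=
  [transVF 0, transVF 1, transVF 2, transVF 3] ++
    ([rotVF q 0 1, rotVF q 0 2, rotVF q 1 2,
      boostVF q 0, boostVF q 1, boostVF q 2, scaleVF q].map (smulVF R⁻¹))

/-- `Γ^{(a)}`: the good fields `Γ̄` (the rotation and boosts not involving `x`), the
translations, and `R⁻¹` times the rotations, boosts and scaling centered at `(a,0,0)`. -/
def GammaFields (R a : ℝ) : List (Pt → Pt) :=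
  [rotVF (axisPt a) 1 2, boostVF (axisPt a) 1, boostVF (axisPt a) 2,
   transVF 0, transVF 1, transVF 2, transVF 3] ++
    ([rotVF (axisPt a) 0 1, rotVF (axisPt a) 0 2, rotVF (axisPt a) 1 2,
      boostVF (axisPt a) 0, boostVF (axisPt a) 1, boostVF (axisPt a) 2,
      scaleVF (axisPt a)].map (smulVF R⁻¹))

/-- Spatial coordinate partial derivative. -/
def spd (i : Fin 3) (g : Sp → ℝ) : Sp → ℝ := fun x => fderiv ℝ g x (Pi.single i 1)

/-- Iterated spatial derivative along a list of coordinate directions. -/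
def spdIter : List (Fin 3) → (Sp → ℝ) → Sp → ℝ
  | [], g => g
  | i :: L, g => spd i (spdIter L g)

/-- `|∂̂^k g|` : the sum of the absolute values of all `k`-fold iterated spatial
coordinate partial derivatives of `g`. -/
def hatD (k : ℕ) (g : Sp → ℝ) (x : Sp) : ℝ :=
  ∑ I : Fin k → Fin 3, |spdIter (List.ofFn I) g x|

/-- The `L²(Σ_t)` norm of `f` on the time slice `Σ_t`. -/
def slice2 (f : Pt → ℝ) (t : ℝ) : ℝ := Real.sqrt (∫ x : Sp, (f (stp t x)) ^ 2)

/-- The `H^k(ℝ³)` Sobolev norm (square root of the sum of the squared `L²` norms of all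
iterated spatial derivatives of order at most `k`). -/
def sobNorm (k : ℕ) (g : Sp → ℝ) : ℝ :=
  Real.sqrt (∑ j ∈ Finset.range (k + 1), ∑ I : Fin j → Fin 3,
    ∫ x : Sp, (spdIter (List.ofFn I) g x) ^ 2)

/-- Derivative of `g : ℝ³ → ℝ` along a spatial vector field. -/
def svApp (X : Sp → Sp) (g : Sp → ℝ) : Sp → ℝ := fun x => fderiv ℝ g x (X x)

/-- Successive application of a list of spatial vector fields. -/
def svIter : List (Sp → Sp) → (Sp → ℝ) → Sp → ℝ
  | [], g => g
  | X :: L, g => svApp X (svIter L g)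

/-- The point of the unit sphere with spherical angles `(θ, φ)` (measured from the x-axis). -/
def sphPt (θ φ : ℝ) : Sp :=
  ![Real.cos θ, Real.sin θ * Real.cos φ, Real.sin θ * Real.sin φ]

/-- The point of the hyperboloid `H_τ` with parameters `(α, x, φ)`. -/
def hpt (τ α x φ : ℝ) : Pt :=
  ![τ * Real.cosh α, x, τ * Real.sinh α * Real.cos φ, τ * Real.sinh α * Real.sin φ]


open scoped ContDiff

theorem pd_contDiff {f : Pt → ℝ} (hf : ContDiff ℝ ∞ f) (a : Fin 4) : ContDiff ℝ ∞ (pd a f) :=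
  (hf.fderiv_right (m := ∞) (by simp)).clm_apply contDiff_const

theorem contDiff_differentiable {f : Pt → ℝ} (hf : ContDiff ℝ ∞ f) : Differentiable ℝ f :=
  hf.differentiable (by simp)

theorem fderiv_eq_sum_pd (f : Pt → ℝ) (p w : Pt) : fderiv ℝ f p w = ∑ a, w a * pd a f p := by
  have := LinearMap.pi_apply_eq_sum_univ (fderiv ℝ f p).toLinearMap w
  simp only [ContinuousLinearMap.coe_coe] at this
  rw [this]
  refine Finset.sum_congr rfl fun a _ => ?_
  rw [smul_eq_mul, pd]
  congr 2
  ext j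
  simp [Pi.single_apply, eq_comm]

theorem vApp_eq_sum (X : Pt → Pt) (f : Pt → ℝ) (p : Pt) :
    vApp X f p = ∑ a, X p a * pd a f p := fderiv_eq_sum_pd f p (X p)

theorem vApp_contDiff {X : Pt → Pt} {f : Pt → ℝ} (hX : ContDiff ℝ ∞ X) (hf : ContDiff ℝ ∞ f) :
    ContDiff ℝ ∞ (vApp X f) :=
  (hf.fderiv_right (m := ∞) (by simp)).clm_apply hX

theorem pd_comm {f : Pt → ℝ} (hf : ContDiff ℝ ∞ f) (a b : Fin 4) (p : Pt) :
    pd a (pd b f) p = pd b (pd a f) p := by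
  have h : IsSymmSndFDerivAt ℝ f p := hf.contDiffAt.isSymmSndFDerivAt (by
    simp only [minSmoothness_of_isRCLikeNormedField]; exact WithTop.coe_le_coe.2 le_top)
  have hd : DifferentiableAt ℝ (fderiv ℝ f) p :=
    ((hf.fderiv_right (m := ∞) (by simp)).differentiable (by simp)) p
  have key : ∀ v w : Pt, fderiv ℝ (fun q => fderiv ℝ f q v) p w = fderiv ℝ (fderiv ℝ f) p w v := by
    intro v w
    rw [fderiv_clm_apply hd (by fun_prop)]
    simp
  unfold pd
  rw [key, key]
  exact h _ _

theorem pd_add {f g : Pt → ℝ} {p : Pt} (hf : DifferentiableAt ℝ f p) (hg : DifferentiableAt ℝ g p)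
    (a : Fin 4) : pd a (fun q => f q + g q) p = pd a f p + pd a g p := by
  simp only [pd]; rw [fderiv_fun_add hf hg]; rfl

theorem pd_sub {f g : Pt → ℝ} {p : Pt} (hf : DifferentiableAt ℝ f p) (hg : DifferentiableAt ℝ g p)
    (a : Fin 4) : pd a (fun q => f q - g q) p = pd a f p - pd a g p := by
  simp only [pd]; rw [fderiv_fun_sub hf hg]; rfl

theorem pd_mul {f g : Pt → ℝ} {p : Pt} (hf : DifferentiableAt ℝ f p) (hg : DifferentiableAt ℝ g p)
    (a : Fin 4) : pd a (fun q => f q * g q) p = pd a f p * g p + f p * pd a g p := by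
  simp only [pd]; rw [fderiv_fun_mul hf hg]; simp; ring

theorem pd_const_mul {f : Pt → ℝ} {p : Pt} (hf : DifferentiableAt ℝ f p) (c : ℝ)
    (a : Fin 4) : pd a (fun q => c * f q) p = c * pd a f p := by
  simp only [pd]; rw [fderiv_const_mul hf]; simp

theorem pd_sum {ι : Type*} (s : Finset ι) {f : ι → Pt → ℝ} {p : Pt}
    (hf : ∀ i ∈ s, DifferentiableAt ℝ (f i) p) (a : Fin 4) :
    pd a (fun q => ∑ i ∈ s, f i q) p = ∑ i ∈ s, pd a (f i) p := by
  simp only [pd]; rw [fderiv_fun_sum hf]; simp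

theorem pd_zero (a : Fin 4) (p : Pt) : pd a (fun _ => 0) p = 0 := by simp [pd]

theorem vApp_add {X : Pt → Pt} {f g : Pt → ℝ} {p : Pt} (hf : DifferentiableAt ℝ f p)
    (hg : DifferentiableAt ℝ g p) : vApp X (fun q => f q + g q) p = vApp X f p + vApp X g p := by
  simp only [vApp]; rw [fderiv_fun_add hf hg]; rfl

theorem vApp_sub {X : Pt → Pt} {f g : Pt → ℝ} {p : Pt} (hf : DifferentiableAt ℝ f p)
    (hg : DifferentiableAt ℝ g p) : vApp X (fun q => f q - g q) p = vApp X f p - vApp X g p := by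
  simp only [vApp]; rw [fderiv_fun_sub hf hg]; rfl

theorem vApp_mul {X : Pt → Pt} {f g : Pt → ℝ} {p : Pt} (hf : DifferentiableAt ℝ f p)
    (hg : DifferentiableAt ℝ g p) :
    vApp X (fun q => f q * g q) p = vApp X f p * g p + f p * vApp X g p := by
  simp only [vApp]; rw [fderiv_fun_mul hf hg]; simp; ring

theorem vApp_const_mul {X : Pt → Pt} {f : Pt → ℝ} {p : Pt} (hf : DifferentiableAt ℝ f p) (c : ℝ) :
    vApp X (fun q => c * f q) p = c * vApp X f p := by
  simp only [vApp]; rw [fderiv_const_mul hf]; simp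

/-- An affine vector field that is conformally Killing for the Minkowski metric, written
with constant part `b`, linear part `M` and conformal factor `l`. -/
structure CKField (X : Pt → Pt) (b : Pt) (M : Fin 4 → Fin 4 → ℝ) (l : ℝ) : Prop where
  eq : ∀ p a, X p a = b a + ∑ c, M a c * p c
  diag0 : 2 * M 0 0 = l
  diag : ∀ i : Fin 3, 2 * M i.succ i.succ = l
  boost : ∀ i : Fin 3, M 0 i.succ = M i.succ 0
  rot : ∀ i j : Fin 3, i ≠ j → M i.succ j.succ = - M j.succ i.succ

theorem CKField.contDiff {X : Pt → Pt} {b : Pt} {M : Fin 4 → Fin 4 → ℝ} {l : ℝ}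
    (h : CKField X b M l) : ContDiff ℝ ∞ X := by
  have : X = fun p a => b a + ∑ c, M a c * p c := by ext p a; exact h.eq p a
  rw [this]
  fun_prop

theorem CKField.pd_coeff {X : Pt → Pt} {b : Pt} {M : Fin 4 → Fin 4 → ℝ} {l : ℝ}
    (h : CKField X b M l) (a c : Fin 4) (p : Pt) : pd a (fun q => X q c) p = M c a := by
  have : (fun q => X q c) = fun q => b c + ∑ d, M c d * q d := by ext q; exact h.eq q c
  rw [this, pd]
  have h2 : HasFDerivAt (fun q : Pt => b c + ∑ d, M c d * q d)
      (∑ d, M c d • (ContinuousLinearMap.proj d : Pt →L[ℝ] ℝ)) p := by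
    apply HasFDerivAt.const_add
    apply HasFDerivAt.fun_sum
    intro d _
    exact ((ContinuousLinearMap.proj (R := ℝ) (φ := fun _ : Fin 4 => ℝ) d).hasFDerivAt).const_mul _
  rw [h2.fderiv]
  simp [Pi.single_apply]

/-- Commutator of a conformal Killing field with a coordinate derivative. -/
theorem CKField.pd_vApp {X : Pt → Pt} {b : Pt} {M : Fin 4 → Fin 4 → ℝ} {l : ℝ}
    (h : CKField X b M l) {f : Pt → ℝ} (hf : ContDiff ℝ ∞ f) (a : Fin 4) (p : Pt) :
    pd a (vApp X f) p = vApp X (pd a f) p + ∑ c, M c a * pd c f p := by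
  have e : vApp X f = fun q => ∑ c, X q c * pd c f q := funext (vApp_eq_sum X f)
  have hX : ∀ c, Differentiable ℝ (fun q => X q c) := fun c =>
    (contDiff_pi.1 h.contDiff c).differentiable (by simp)
  have hp : ∀ c, Differentiable ℝ (pd c f) := fun c => contDiff_differentiable (pd_contDiff hf c)
  rw [e, pd_sum _ (fun c _ => ((hX c).fun_mul (hp c)) p), vApp_eq_sum, ← Finset.sum_add_distrib]
  refine Finset.sum_congr rfl fun c _ => ?_
  rw [pd_mul (hX c p) (hp c p), h.pd_coeff, pd_comm hf a c]
  ring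

theorem box_contDiff {f : Pt → ℝ} (hf : ContDiff ℝ ∞ f) : ContDiff ℝ ∞ (box f) := by
  have h : ∀ a, ContDiff ℝ ∞ (pd a (pd a f)) := fun a => pd_contDiff (pd_contDiff hf a) a
  have := ((((h 0).neg).add (h 1)).add (h 2)).add (h 3)
  exact this

theorem box_eq_sum (f : Pt → ℝ) (p : Pt) :
    box f p = ∑ a : Fin 4, (if a = 0 then -1 else 1) * pd a (pd a f) p := by
  simp [Fin.sum_univ_four, box]

theorem CKField.box_vApp {X : Pt → Pt} {b : Pt} {M : Fin 4 → Fin 4 → ℝ} {l : ℝ}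
    (h : CKField X b M l) {f : Pt → ℝ} (hf : ContDiff ℝ ∞ f) (p : Pt) :
    box (vApp X f) p = vApp X (box f) p + l * box f p := by
  have hX := h.contDiff
  have hp : ∀ c, ContDiff ℝ ∞ (pd c f) := fun c => pd_contDiff hf c
  have h2 : ∀ a, pd a (pd a (vApp X f)) p
      = vApp X (pd a (pd a f)) p + 2 * ∑ c, M c a * pd c (pd a f) p := by
    intro a
    have e : pd a (vApp X f) = fun q => vApp X (pd a f) q + ∑ c, M c a * pd c f q :=
      funext fun q => h.pd_vApp hf a q
    rw [e, pd_add (contDiff_differentiable (vApp_contDiff hX (hp a)) p)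
      (contDiff_differentiable (ContDiff.sum fun c _ => contDiff_const.mul (hp c)) p),
      h.pd_vApp (hp a), pd_sum _ (fun c _ => (contDiff_differentiable
        (contDiff_const.mul (hp c))) p), two_mul, add_assoc]
    congr 2
    refine Finset.sum_congr rfl fun c _ => ?_
    rw [pd_const_mul (contDiff_differentiable (hp c) p), pd_comm hf]
  have hb : vApp X (box f) p = ∑ a : Fin 4, (if a = 0 then -1 else 1) * vApp X (pd a (pd a f)) p := by
    have : box f = fun q => (((-1) * pd 0 (pd 0 f) q + pd 1 (pd 1 f) q) + pd 2 (pd 2 f) q)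
        + pd 3 (pd 3 f) q := by ext q; simp [box]
    have hd : ∀ a, Differentiable ℝ (pd a (pd a f)) := fun a =>
      contDiff_differentiable (pd_contDiff (hp a) a)
    rw [this, vApp_add (by fun_prop) (by fun_prop), vApp_add (by fun_prop) (by fun_prop),
      vApp_add (by fun_prop) (by fun_prop), vApp_const_mul (by fun_prop)]
    simp [Fin.sum_univ_four]
  rw [box_eq_sum, hb, box_eq_sum]
  simp only [h2, Fin.sum_univ_four]
  have c := fun i j => pd_comm hf i j p
  have d0 := h.diag0
  have d1 := h.diag 0
  have d2 := h.diag 1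
  have d3 := h.diag 2
  have b1 := h.boost 0
  have b2 := h.boost 1
  have b3 := h.boost 2
  have r1 := h.rot 0 1 (by decide)
  have r2 := h.rot 0 2 (by decide)
  have r3 := h.rot 1 2 (by decide)
  simp only [show (Fin.succ (0 : Fin 3) : Fin 4) = 1 from rfl,
    show (Fin.succ (1 : Fin 3) : Fin 4) = 2 from rfl,
    show (Fin.succ (2 : Fin 3) : Fin 4) = 3 from rfl] at *
  rw [c 1 0, c 2 0, c 3 0, c 2 1, c 3 1, c 3 2, r1, r2, r3, b1, b2, b3]
  simp
  linear_combination (-pd 0 (pd 0 f) p) * d0 + (pd 1 (pd 1 f) p) * d1 + (pd 2 (pd 2 f) p) * d2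
    + (pd 3 (pd 3 f) p) * d3

/-- The eleven fields of `Kfields o3`, indexed. -/
def KF : Fin 11 → Pt → Pt :=
  ![transVF 0, transVF 1, transVF 2, transVF 3,
   rotVF o3 0 1, rotVF o3 0 2, rotVF o3 1 2,
   boostVF o3 0, boostVF o3 1, boostVF o3 2, scaleVF o3]

theorem exists_index_of_mem_Kfields {X : Pt → Pt} (hX : X ∈ Kfields o3) : ∃ i, KF i = X := by
  simp only [Kfields, List.mem_cons, List.not_mem_nil, or_false] at hX
  rcases hX with h | h | h | h | h | h | h | h | h | h | h
  exacts [⟨0, h.symm⟩, ⟨1, h.symm⟩, ⟨2, h.symm⟩, ⟨3, h.symm⟩, ⟨4, h.symm⟩, ⟨5, h.symm⟩,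
    ⟨6, h.symm⟩, ⟨7, h.symm⟩, ⟨8, h.symm⟩, ⟨9, h.symm⟩, ⟨10, h.symm⟩]

theorem exists_map_of_forall_mem_Kfields {I : List (Pt → Pt)} (h : ∀ X ∈ I, X ∈ Kfields o3) :
    ∃ J : List (Fin 11), J.map KF = I := by
  induction I with
  | nil => exact ⟨[], rfl⟩
  | cons X I ih =>
    obtain ⟨J, hJ⟩ := ih fun Y hY => h Y (List.mem_cons_of_mem _ hY)
    obtain ⟨i, hi⟩ := exists_index_of_mem_Kfields (h X List.mem_cons_self)
    exact ⟨i :: J, by simp [hJ, hi]⟩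

/-- Iterated application of the fields `KF`. -/
def kv (I : List (Fin 11)) (f : Pt → ℝ) : Pt → ℝ := vIter (I.map KF) f

theorem kv_nil (f : Pt → ℝ) : kv [] f = f := rfl

theorem kv_cons (i : Fin 11) (I : List (Fin 11)) (f : Pt → ℝ) :
    kv (i :: I) f = vApp (KF i) (kv I f) := rfl

/-- Linear parts of the fields `KF`, as integer matrices. -/
def KMz : Fin 11 → Fin 4 → Fin 4 → ℤ :=
  ![0, 0, 0, 0,
    ![![0,0,0,0],![0,0,-1,0],![0,1,0,0],![0,0,0,0]],
    ![![0,0,0,0],![0,0,0,-1],![0,0,0,0],![0,1,0,0]],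
    ![![0,0,0,0],![0,0,0,0],![0,0,0,-1],![0,0,1,0]],
    ![![0,1,0,0],![1,0,0,0],![0,0,0,0],![0,0,0,0]],
    ![![0,0,1,0],![0,0,0,0],![1,0,0,0],![0,0,0,0]],
    ![![0,0,0,1],![0,0,0,0],![0,0,0,0],![1,0,0,0]],
    ![![1,0,0,0],![0,1,0,0],![0,0,1,0],![0,0,0,1]]]

/-- Linear parts of the fields `KF`. -/
def KM (i : Fin 11) (a c : Fin 4) : ℝ := (KMz i a c : ℤ)

/-- Constant parts of the fields `KF`. -/
def KB : Fin 11 → Pt :=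
  ![Pi.single 0 1, Pi.single 1 1, Pi.single 2 1, Pi.single 3 1, 0, 0, 0, 0, 0, 0, 0]

/-- Conformal factors of the fields `KF`. -/
def Kl (i : Fin 11) : ℝ := ((2 * KMz i 0 0 : ℤ) : ℝ)

theorem KF_ckField (i : Fin 11) : CKField (KF i) (KB i) (KM i) (Kl i) := by
  have h1 : ∀ (i : Fin 11) (j : Fin 3), 2 * KMz i j.succ j.succ = 2 * KMz i 0 0 := by decide
  have h2 : ∀ (i : Fin 11) (j : Fin 3), KMz i 0 j.succ = KMz i j.succ 0 := by decide
  have h3 : ∀ (i : Fin 11) (j k : Fin 3), j ≠ k → KMz i j.succ k.succ = - KMz i k.succ j.succ := by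
    decide
  refine ⟨fun p a => ?_, ?_, fun j => ?_, fun j => ?_, fun j k hjk => ?_⟩
  · fin_cases i <;> fin_cases a <;>
      simp [KF, KB, KM, KMz, transVF, rotVF, boostVF, scaleVF, sidx, o3, Fin.sum_univ_four,
        Fin.ext_iff]
  · simp [Kl, KM]
  · rw [KM, Kl, ← h1 i j]; push_cast; rfl
  · rw [KM, KM, h2]
  · rw [KM, KM, h3 i j k hjk]; push_cast; rfl

theorem KF_contDiff (i : Fin 11) : ContDiff ℝ ∞ (KF i) := (KF_ckField i).contDiff

theorem kv_contDiff {f : Pt → ℝ} (hf : ContDiff ℝ ∞ f) (I : List (Fin 11)) :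
    ContDiff ℝ ∞ (kv I f) := by
  induction I with
  | nil => exact hf
  | cons i I ih => exact vApp_contDiff (KF_contDiff i) ih

/-- Spatial radius of a spacetime point. -/
def rr (p : Pt) : ℝ := √(p 1 ^ 2 + p 2 ^ 2 + p 3 ^ 2)

/-- Japanese bracket of the spatial part. -/
def jb (p : Pt) : ℝ := √(1 + (p 1 ^ 2 + p 2 ^ 2 + p 3 ^ 2))

/-- Outgoing weight `1 + t + r`. -/
def vv (p : Pt) : ℝ := 1 + p 0 + rr p

/-- Distance weight `1 + |t - r|` to the light cone. -/
def uu (p : Pt) : ℝ := 1 + |p 0 - rr p|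

theorem rr_nonneg (p : Pt) : 0 ≤ rr p := Real.sqrt_nonneg _

theorem rr_sq (p : Pt) : rr p ^ 2 = p 1 ^ 2 + p 2 ^ 2 + p 3 ^ 2 := Real.sq_sqrt (by positivity)

theorem jb_sq (p : Pt) : jb p ^ 2 = 1 + (p 1 ^ 2 + p 2 ^ 2 + p 3 ^ 2) :=
  Real.sq_sqrt (by positivity)

theorem jb_pos (p : Pt) : 0 < jb p := Real.sqrt_pos.2 (by positivity)

theorem one_le_jb (p : Pt) : 1 ≤ jb p := by
  rw [jb, Real.one_le_sqrt]; nlinarith [sq_nonneg (p 1), sq_nonneg (p 2), sq_nonneg (p 3)]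

theorem rr_le_jb (p : Pt) : rr p ≤ jb p := Real.sqrt_le_sqrt (by linarith)

theorem jb_le (p : Pt) : jb p ≤ 1 + rr p := by
  have := jb_sq p; have := rr_sq p; have := rr_nonneg p; have := jb_pos p
  nlinarith

theorem one_le_uu (p : Pt) : 1 ≤ uu p := by have := abs_nonneg (p 0 - rr p); rw [uu]; linarith

theorem one_le_vv {p : Pt} (hp : 0 ≤ p 0) : 1 ≤ vv p := by
  have := rr_nonneg p; rw [vv]; linarith

theorem uu_le_vv {p : Pt} (hp : 0 ≤ p 0) : uu p ≤ vv p := by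
  have := rr_nonneg p
  rw [uu, vv]
  have : |p 0 - rr p| ≤ p 0 + rr p := abs_le.2 ⟨by linarith, by linarith⟩
  linarith

theorem vv_le_jb_mul_uu (p : Pt) : vv p ≤ 3 * (jb p * uu p) := by
  have h1 := one_le_uu p
  have h2 := one_le_jb p
  have h3 := rr_le_jb p
  have h4 : vv p ≤ uu p + 2 * jb p := by
    rw [vv, uu]; have := le_abs_self (p 0 - rr p); linarith
  nlinarith

theorem abs_coord_le_rr (p : Pt) (i : Fin 3) : |p i.succ| ≤ rr p := by
  rw [rr]
  apply Real.abs_le_sqrt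
  fin_cases i
  · change p 1 ^ 2 ≤ _; nlinarith [sq_nonneg (p 2), sq_nonneg (p 3)]
  · change p 2 ^ 2 ≤ _; nlinarith [sq_nonneg (p 1), sq_nonneg (p 3)]
  · change p 3 ^ 2 ≤ _; nlinarith [sq_nonneg (p 1), sq_nonneg (p 2)]

/-- The approximately null covector `(1, -x/⟨x⟩)`. -/
def nul (p : Pt) : Pt := fun a => if a = 0 then 1 else - (p a / jb p)

/-- Tangential derivatives `∂_i + (x_i/⟨x⟩) ∂_t` (and zero for the time index). -/
def Tg (a : Fin 4) (f : Pt → ℝ) (p : Pt) : ℝ := pd a f p - nul p a * pd 0 f p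

theorem Tg_zero (f : Pt → ℝ) (p : Pt) : Tg 0 f p = 0 := by simp [Tg, nul]

/-- Sum of the absolute values of the coordinate derivatives. -/
def D1 (f : Pt → ℝ) (p : Pt) : ℝ := ∑ a, |pd a f p|

/-- Sum of the absolute values of the tangential derivatives. -/
def TA (f : Pt → ℝ) (p : Pt) : ℝ := ∑ a, |Tg a f p|

/-- Sum of the absolute values of the second coordinate derivatives. -/
def D2 (f : Pt → ℝ) (p : Pt) : ℝ := ∑ c, D1 (pd c f) p

/-- Sum of the absolute values of the tangential derivatives of the coordinate derivatives. -/
def T2 (f : Pt → ℝ) (p : Pt) : ℝ := ∑ c, TA (pd c f) p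

theorem D1_nonneg (f : Pt → ℝ) (p : Pt) : 0 ≤ D1 f p := Finset.sum_nonneg fun _ _ => abs_nonneg _
theorem TA_nonneg (f : Pt → ℝ) (p : Pt) : 0 ≤ TA f p := Finset.sum_nonneg fun _ _ => abs_nonneg _
theorem D2_nonneg (f : Pt → ℝ) (p : Pt) : 0 ≤ D2 f p := Finset.sum_nonneg fun _ _ => D1_nonneg _ _
theorem T2_nonneg (f : Pt → ℝ) (p : Pt) : 0 ≤ T2 f p := Finset.sum_nonneg fun _ _ => TA_nonneg _ _

theorem abs_pd_le_D1 (f : Pt → ℝ) (p : Pt) (a : Fin 4) : |pd a f p| ≤ D1 f p :=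
  Finset.single_le_sum (f := fun a => |pd a f p|) (fun _ _ => abs_nonneg _) (Finset.mem_univ a)
theorem abs_Tg_le_TA (f : Pt → ℝ) (p : Pt) (a : Fin 4) : |Tg a f p| ≤ TA f p :=
  Finset.single_le_sum (f := fun a => |Tg a f p|) (fun _ _ => abs_nonneg _) (Finset.mem_univ a)
theorem D1_pd_le_D2 (f : Pt → ℝ) (p : Pt) (c : Fin 4) : D1 (pd c f) p ≤ D2 f p :=
  Finset.single_le_sum (f := fun c => D1 (pd c f) p) (fun _ _ => D1_nonneg _ _) (Finset.mem_univ c)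
theorem TA_pd_le_T2 (f : Pt → ℝ) (p : Pt) (c : Fin 4) : TA (pd c f) p ≤ T2 f p :=
  Finset.single_le_sum (f := fun c => TA (pd c f) p) (fun _ _ => TA_nonneg _ _) (Finset.mem_univ c)

theorem abs_nul_le (p : Pt) (a : Fin 4) : |nul p a| ≤ 1 := by
  rw [nul]
  split_ifs with h
  · simp
  · obtain ⟨i, rfl⟩ := Fin.exists_succ_eq.2 h
    rw [abs_neg, abs_div, abs_of_pos (jb_pos p), div_le_one (jb_pos p)]
    exact (abs_coord_le_rr p i).trans (rr_le_jb p)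

theorem TA_le_D1 (f : Pt → ℝ) (p : Pt) : TA f p ≤ 5 * D1 f p := by
  have h : ∀ a, |Tg a f p| ≤ |pd a f p| + |pd 0 f p| := fun a => by
    rw [Tg]
    refine (abs_sub _ _).trans ?_
    rw [abs_mul]
    have := mul_le_mul_of_nonneg_right (abs_nul_le p a) (abs_nonneg (pd 0 f p))
    linarith
  calc TA f p ≤ ∑ a, (|pd a f p| + |pd 0 f p|) := Finset.sum_le_sum fun a _ => h a
    _ = D1 f p + 4 * |pd 0 f p| := by rw [Finset.sum_add_distrib]; simp [D1]
    _ ≤ _ := by linarith [abs_pd_le_D1 f p 0]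

theorem T2_le_D2 (f : Pt → ℝ) (p : Pt) : T2 f p ≤ 5 * D2 f p := by
  rw [T2, D2, Finset.mul_sum]
  exact Finset.sum_le_sum fun c _ => TA_le_D1 _ p

/-- The size of a trilinear null form. -/
def g3 (f g : Pt → ℝ) (p : Pt) : ℝ :=
  TA f p * D2 g p + D1 f p * T2 g p + (jb p ^ 2)⁻¹ * (D1 f p * D2 g p)

/-- The size of a bilinear null form. -/
def g2 (f g : Pt → ℝ) (p : Pt) : ℝ :=
  TA f p * D1 g p + D1 f p * TA g p + (jb p ^ 2)⁻¹ * (D1 f p * D1 g p)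

/-- The null covector `(r/⟨x⟩, -x/⟨x⟩)`. -/
def nul' (p : Pt) : Pt := fun a => if a = 0 then rr p / jb p else - (p a / jb p)

theorem mink_nul' (p : Pt) : mink (nul' p) = 0 := by
  have h := rr_sq p
  have := (jb_pos p).ne'
  simp only [mink, nul']
  simp
  field_simp
  linarith

theorem abs_nul'_le (p : Pt) (a : Fin 4) : |nul' p a| ≤ 1 := by
  by_cases h : a = 0
  · rw [nul', if_pos h, abs_of_nonneg (div_nonneg (rr_nonneg p) (jb_pos p).le),
      div_le_one (jb_pos p)]
    exact rr_le_jb p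
  · have := abs_nul_le p a
    simp only [nul, if_neg h] at this
    simpa only [nul', if_neg h] using this

theorem abs_nul_sub_nul'_le (p : Pt) (a : Fin 4) : |nul p a - nul' p a| ≤ (jb p ^ 2)⁻¹ := by
  by_cases h : a = 0
  · simp only [nul, nul', h, if_true]
    have h1 := jb_pos p
    have h2 := rr_le_jb p
    have h3 := rr_nonneg p
    have h4 : 1 - rr p / jb p = (jb p * (jb p - rr p)) / jb p ^ 2 := by field_simp
    have h5 : jb p ^ 2 = 1 + rr p ^ 2 := by rw [jb_sq, rr_sq]
    rw [h4, abs_of_nonneg (by apply div_nonneg _ (by positivity); apply mul_nonneg <;> linarith),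
      ← one_div]
    apply div_le_div_of_nonneg_right _ (by positivity)
    nlinarith
  · simp only [nul, nul', h, if_false, sub_self, abs_zero]
    have := jb_pos p
    positivity

theorem abs_mul_sub_mul_le {x y x' y' d : ℝ} (hx : |x - x'| ≤ d) (hy : |y - y'| ≤ d)
    (h1 : |x| ≤ 1) (h2 : |y'| ≤ 1) : |x * y - x' * y'| ≤ 2 * d := by
  have : x * y - x' * y' = x * (y - y') + (x - x') * y' := by ring
  rw [this]
  refine (abs_add_le _ _).trans ?_
  rw [abs_mul, abs_mul]
  have h3 := mul_le_mul h1 hy (abs_nonneg _) zero_le_one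
  have h4 := mul_le_mul hx h2 (abs_nonneg _) ((abs_nonneg _).trans hx)
  linarith

theorem nf3_bound {F : Fin 4 → Fin 4 → Fin 4 → ℝ} (hF : NullForm3 F) {f g : Pt → ℝ}
    (hg : ContDiff ℝ ∞ g) (p : Pt) :
    |nf3 F f g p| ≤ (3 * ∑ a, ∑ b, ∑ c, |F a b c|) * g3 f g p := by
  set d := (jb p ^ 2)⁻¹ with hd
  have hd0 : 0 ≤ d := by positivity
  have key : ∀ a b c, |pd a f p * pd b (pd c g) p
      - nul' p a * nul' p b * nul' p c * (pd 0 f p * pd 0 (pd 0 g) p)| ≤ 3 * g3 f g p := by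
    intro a b c
    have e : pd a f p * pd b (pd c g) p
      - nul' p a * nul' p b * nul' p c * (pd 0 f p * pd 0 (pd 0 g) p)
      = Tg a f p * pd b (pd c g) p + nul p a * (pd 0 f p * Tg b (pd c g) p)
        + (nul p a * nul p b) * (pd 0 f p * Tg c (pd 0 g) p)
        + (nul p a * nul p b * nul p c - nul' p a * nul' p b * nul' p c)
          * (pd 0 f p * pd 0 (pd 0 g) p) := by
      simp only [Tg]
      rw [pd_comm hg 0 c p]
      ring
    rw [e]
    have s1 : |Tg a f p * pd b (pd c g) p| ≤ TA f p * D2 g p := by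
      rw [abs_mul]
      exact mul_le_mul (abs_Tg_le_TA f p a) ((abs_pd_le_D1 _ p b).trans (D1_pd_le_D2 g p c))
        (abs_nonneg _) (TA_nonneg f p)
    have s2 : ∀ x : ℝ, |x| ≤ 1 → ∀ b c, |x * (pd 0 f p * Tg b (pd c g) p)| ≤ D1 f p * T2 g p := by
      intro x hx b c
      rw [abs_mul, abs_mul]
      have := mul_le_mul (abs_pd_le_D1 f p 0) ((abs_Tg_le_TA (pd c g) p b).trans
        (TA_pd_le_T2 g p c)) (abs_nonneg _) (D1_nonneg f p)
      exact (mul_le_of_le_one_left (by positivity) hx).trans this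
    have s3 : |nul p a * nul p b| ≤ 1 := by
      rw [abs_mul]; exact mul_le_one₀ (abs_nul_le p a) (abs_nonneg _) (abs_nul_le p b)
    have s4 : |nul p a * nul p b * nul p c - nul' p a * nul' p b * nul' p c| ≤ 3 * d := by
      have h1 := abs_mul_sub_mul_le (abs_nul_sub_nul'_le p a) (abs_nul_sub_nul'_le p b)
        (abs_nul_le p a) (abs_nul'_le p b)
      have : nul p a * nul p b * nul p c - nul' p a * nul' p b * nul' p c
        = nul p a * nul p b * (nul p c - nul' p c)
          + (nul p a * nul p b - nul' p a * nul' p b) * nul' p c := by ring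
      rw [this]
      refine (abs_add_le _ _).trans ?_
      rw [abs_mul, abs_mul _ (nul' p c)]
      have h3 := mul_le_mul s3 (abs_nul_sub_nul'_le p c) (abs_nonneg _) zero_le_one
      have h4 := mul_le_mul h1 (abs_nul'_le p c) (abs_nonneg _) ((abs_nonneg _).trans h1)
      linarith
    have s5 : |pd 0 f p * pd 0 (pd 0 g) p| ≤ D1 f p * D2 g p := by
      rw [abs_mul]
      exact mul_le_mul (abs_pd_le_D1 f p 0) ((abs_pd_le_D1 _ p 0).trans (D1_pd_le_D2 g p 0))
        (abs_nonneg _) (D1_nonneg f p)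
    have s6 := mul_le_mul s4 s5 (abs_nonneg _) (by positivity)
    rw [← abs_mul] at s6
    have t1 := s2 _ (abs_nul_le p a) b c
    have t2 := s2 _ s3 c 0
    have t3 : 0 ≤ TA f p * D2 g p := mul_nonneg (TA_nonneg _ _) (D2_nonneg _ _)
    have t4 : 0 ≤ D1 f p * T2 g p := mul_nonneg (D1_nonneg _ _) (T2_nonneg _ _)
    refine (abs_add_le _ _).trans ?_
    refine (add_le_add_left ((abs_add_le _ _).trans (add_le_add_left (abs_add_le _ _) _)) _).trans ?_
    rw [g3]
    linarith
  have e : nf3 F f g p = ∑ a, ∑ b, ∑ c, F a b c * (pd a f p * pd b (pd c g) p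
      - nul' p a * nul' p b * nul' p c * (pd 0 f p * pd 0 (pd 0 g) p)) := by
    have h0 := hF (nul' p) (mink_nul' p)
    have : nf3 F f g p = nf3 F f g p - (∑ a, ∑ b, ∑ c, F a b c * nul' p a * nul' p b * nul' p c)
        * (pd 0 f p * pd 0 (pd 0 g) p) := by rw [h0]; ring
    rw [this, nf3]
    simp only [Finset.sum_mul, ← Finset.sum_sub_distrib]
    refine Finset.sum_congr rfl fun a _ => Finset.sum_congr rfl fun b _ =>
      Finset.sum_congr rfl fun c _ => ?_
    ring
  rw [e, mul_comm 3, mul_assoc, Finset.sum_mul]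
  refine (Finset.abs_sum_le_sum_abs _ _).trans (Finset.sum_le_sum fun a _ => ?_)
  rw [Finset.sum_mul]
  refine (Finset.abs_sum_le_sum_abs _ _).trans (Finset.sum_le_sum fun b _ => ?_)
  rw [Finset.sum_mul]
  refine (Finset.abs_sum_le_sum_abs _ _).trans (Finset.sum_le_sum fun c _ => ?_)
  rw [abs_mul]
  exact mul_le_mul_of_nonneg_left (key a b c) (abs_nonneg _)

theorem nf2_bound {G : Fin 4 → Fin 4 → ℝ} (hG : NullForm2 G) (f g : Pt → ℝ) (p : Pt) :
    |nf2 G f g p| ≤ (3 * ∑ a, ∑ b, |G a b|) * g2 f g p := by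
  set d := (jb p ^ 2)⁻¹ with hd
  have hd0 : 0 ≤ d := by positivity
  have key : ∀ a b, |pd a f p * pd b g p
      - nul' p a * nul' p b * (pd 0 f p * pd 0 g p)| ≤ 3 * g2 f g p := by
    intro a b
    have e : pd a f p * pd b g p - nul' p a * nul' p b * (pd 0 f p * pd 0 g p)
      = Tg a f p * pd b g p + nul p a * (pd 0 f p * Tg b g p)
        + (nul p a * nul p b - nul' p a * nul' p b) * (pd 0 f p * pd 0 g p) := by
      simp only [Tg]
      ring
    rw [e]
    have s1 : |Tg a f p * pd b g p| ≤ TA f p * D1 g p := by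
      rw [abs_mul]
      exact mul_le_mul (abs_Tg_le_TA f p a) (abs_pd_le_D1 _ p b) (abs_nonneg _) (TA_nonneg f p)
    have s2 : |nul p a * (pd 0 f p * Tg b g p)| ≤ D1 f p * TA g p := by
      rw [abs_mul, abs_mul]
      have := mul_le_mul (abs_pd_le_D1 f p 0) (abs_Tg_le_TA g p b) (abs_nonneg _) (D1_nonneg f p)
      exact (mul_le_of_le_one_left (by positivity) (abs_nul_le p a)).trans this
    have h1 := abs_mul_sub_mul_le (abs_nul_sub_nul'_le p a) (abs_nul_sub_nul'_le p b)
        (abs_nul_le p a) (abs_nul'_le p b)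
    have s5 : |pd 0 f p * pd 0 g p| ≤ D1 f p * D1 g p := by
      rw [abs_mul]
      exact mul_le_mul (abs_pd_le_D1 f p 0) (abs_pd_le_D1 _ p 0) (abs_nonneg _) (D1_nonneg f p)
    have s6 := mul_le_mul h1 s5 (abs_nonneg _) (by positivity)
    rw [← abs_mul] at s6
    have t3 : 0 ≤ TA f p * D1 g p := mul_nonneg (TA_nonneg _ _) (D1_nonneg _ _)
    have t4 : 0 ≤ D1 f p * TA g p := mul_nonneg (D1_nonneg _ _) (TA_nonneg _ _)
    have t5 : 0 ≤ d * (D1 f p * D1 g p) := mul_nonneg hd0 (mul_nonneg (D1_nonneg _ _) (D1_nonneg _ _))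
    refine (abs_add_le _ _).trans ((add_le_add_left (abs_add_le _ _) _).trans ?_)
    rw [g2]
    linarith
  have e : nf2 G f g p = ∑ a, ∑ b, G a b * (pd a f p * pd b g p
      - nul' p a * nul' p b * (pd 0 f p * pd 0 g p)) := by
    have h0 := hG (nul' p) (mink_nul' p)
    have : nf2 G f g p = nf2 G f g p - (∑ a, ∑ b, G a b * nul' p a * nul' p b)
        * (pd 0 f p * pd 0 g p) := by rw [h0]; ring
    rw [this, nf2]
    simp only [Finset.sum_mul, ← Finset.sum_sub_distrib]
    refine Finset.sum_congr rfl fun a _ => Finset.sum_congr rfl fun b _ => ?_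
    ring
  rw [e, mul_comm 3, mul_assoc, Finset.sum_mul]
  refine (Finset.abs_sum_le_sum_abs _ _).trans (Finset.sum_le_sum fun a _ => ?_)
  rw [Finset.sum_mul]
  refine (Finset.abs_sum_le_sum_abs _ _).trans (Finset.sum_le_sum fun b _ => ?_)
  rw [abs_mul]
  exact mul_le_mul_of_nonneg_left (key a b) (abs_nonneg _)

/-- Sum of the absolute values of the derivatives along the fields `KF`. -/
def dK (f : Pt → ℝ) (p : Pt) : ℝ := ∑ i, |vApp (KF i) f p|

theorem dK_nonneg (f : Pt → ℝ) (p : Pt) : 0 ≤ dK f p := Finset.sum_nonneg fun _ _ => abs_nonneg _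

theorem abs_KF_le_dK (f : Pt → ℝ) (p : Pt) (i : Fin 11) : |vApp (KF i) f p| ≤ dK f p :=
  Finset.single_le_sum (f := fun i => |vApp (KF i) f p|) (fun _ _ => abs_nonneg _)
    (Finset.mem_univ i)

theorem vApp_KF (f : Pt → ℝ) (p : Pt) :
    vApp (KF 0) f p = pd 0 f p ∧ vApp (KF 1) f p = pd 1 f p ∧ vApp (KF 2) f p = pd 2 f p ∧
    vApp (KF 3) f p = pd 3 f p ∧ vApp (KF 4) f p = p 1 * pd 2 f p - p 2 * pd 1 f p ∧
    vApp (KF 5) f p = p 1 * pd 3 f p - p 3 * pd 1 f p ∧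
    vApp (KF 6) f p = p 2 * pd 3 f p - p 3 * pd 2 f p ∧
    vApp (KF 7) f p = p 0 * pd 1 f p + p 1 * pd 0 f p ∧
    vApp (KF 8) f p = p 0 * pd 2 f p + p 2 * pd 0 f p ∧
    vApp (KF 9) f p = p 0 * pd 3 f p + p 3 * pd 0 f p ∧
    vApp (KF 10) f p = p 0 * pd 0 f p + p 1 * pd 1 f p + p 2 * pd 2 f p + p 3 * pd 3 f p := by
  refine ⟨?_, ?_, ?_, ?_, ?_, ?_, ?_, ?_, ?_, ?_, ?_⟩ <;>
    rw [vApp_eq_sum] <;>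
    simp only [(KF_ckField _).eq, KB, KM, KMz, Fin.sum_univ_four] <;>
    simp [Fin.ext_iff] <;> ring

theorem abs_pd_le_dK (f : Pt → ℝ) (p : Pt) (a : Fin 4) : |pd a f p| ≤ dK f p := by
  obtain ⟨h0, h1, h2, h3, -⟩ := vApp_KF f p
  fin_cases a
  · change |pd 0 f p| ≤ _; rw [← h0]; exact abs_KF_le_dK f p 0
  · change |pd 1 f p| ≤ _; rw [← h1]; exact abs_KF_le_dK f p 1
  · change |pd 2 f p| ≤ _; rw [← h2]; exact abs_KF_le_dK f p 2
  · change |pd 3 f p| ≤ _; rw [← h3]; exact abs_KF_le_dK f p 3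

/-- Cauchy-Schwarz free bound for combinations with bounded coefficients. -/
theorem abs_mul_le_of_le {x y m d : ℝ} (hx : |x| ≤ m) (hy : |y| ≤ d) : |x * y| ≤ m * d := by
  rw [abs_mul]; exact mul_le_mul hx hy (abs_nonneg _) ((abs_nonneg _).trans hx)

theorem uu_mul_abs_pd_le {p : Pt} (hp : 0 ≤ p 0) (f : Pt → ℝ) (a : Fin 4) :
    uu p * |pd a f p| ≤ 7 * dK f p := by
  obtain ⟨h0, h1, h2, h3, h4, h5, h6, h7, h8, h9, h10⟩ := vApp_KF f p
  have hk := abs_KF_le_dK f p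
  have hr := rr_nonneg p
  have hr2 := rr_sq p
  have x1 : |p 1| ≤ rr p := abs_coord_le_rr p 0
  have x2 : |p 2| ≤ rr p := abs_coord_le_rr p 1
  have x3 : |p 3| ≤ rr p := abs_coord_le_rr p 2
  have ht : |p 0| ≤ p 0 := (abs_of_nonneg hp).le
  have hd := dK_nonneg f p
  suffices h : (p 0 + rr p) * |(p 0 - rr p) * pd a f p| ≤ (p 0 + rr p) * (6 * dK f p) by
    rcases eq_or_lt_of_le (add_nonneg hp hr) with h' | h'
    · have e1 : p 0 = 0 := by linarith
      have e2 : rr p = 0 := by linarith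
      rw [uu, e1, e2]; simp; linarith [abs_pd_le_dK f p a]
    · have := le_of_mul_le_mul_left h h'
      rw [abs_mul] at this
      rw [uu, add_mul]; linarith [abs_pd_le_dK f p a]
  rw [← abs_of_nonneg (add_nonneg hp hr), ← abs_mul, abs_of_nonneg (add_nonneg hp hr)]
  have hb := fun i => abs_mul_le_of_le ht (hk i)
  have b1 := fun i => abs_mul_le_of_le x1 (hk i)
  have b2 := fun i => abs_mul_le_of_le x2 (hk i)
  have b3 := fun i => abs_mul_le_of_le x3 (hk i)
  have hpd := mul_nonneg hp hd
  have hrd := mul_nonneg hr hd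
  have key : ∀ x y z w : ℝ, |x| ≤ p 0 * dK f p → |y| ≤ rr p * dK f p → |z| ≤ rr p * dK f p →
      |w| ≤ rr p * dK f p → |x - y - z - w| ≤ (p 0 + rr p) * (6 * dK f p) := by
    intro x y z w hx hy hz hw
    rw [abs_le] at *
    constructor <;> linarith
  fin_cases a <;> simp only [Fin.zero_eta, Fin.mk_one, Fin.reduceFinMk]
  · rw [show (p 0 + rr p) * ((p 0 - rr p) * pd 0 f p) = p 0 * vApp (KF 10) f p
      - p 1 * vApp (KF 7) f p - p 2 * vApp (KF 8) f p - p 3 * vApp (KF 9) f p by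
        rw [h10, h7, h8, h9]; linear_combination (-pd 0 f p) * hr2]
    exact key _ _ _ _ (hb 10) (b1 7) (b2 8) (b3 9)
  · rw [show (p 0 + rr p) * ((p 0 - rr p) * pd 1 f p) = p 0 * vApp (KF 7) f p
      - p 1 * vApp (KF 10) f p - (-(p 2 * vApp (KF 4) f p)) - (-(p 3 * vApp (KF 5) f p)) by
        rw [h10, h7, h4, h5]; linear_combination (-pd 1 f p) * hr2]
    exact key _ _ _ _ (hb 7) (b1 10) (by rw [abs_neg]; exact b2 4) (by rw [abs_neg]; exact b3 5)
  · rw [show (p 0 + rr p) * ((p 0 - rr p) * pd 2 f p) = p 0 * vApp (KF 8) f p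
      - p 2 * vApp (KF 10) f p - (p 1 * vApp (KF 4) f p) - (-(p 3 * vApp (KF 6) f p)) by
        rw [h10, h8, h4, h6]; linear_combination (-pd 2 f p) * hr2]
    exact key _ _ _ _ (hb 8) (b2 10) (b1 4) (by rw [abs_neg]; exact b3 6)
  · rw [show (p 0 + rr p) * ((p 0 - rr p) * pd 3 f p) = p 0 * vApp (KF 9) f p
      - p 3 * vApp (KF 10) f p - (p 1 * vApp (KF 5) f p) - (p 2 * vApp (KF 6) f p) by
        rw [h10, h9, h5, h6]; linear_combination (-pd 3 f p) * hr2]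
    exact key _ _ _ _ (hb 9) (b3 10) (b1 5) (b2 6)

theorem uu_mul_D1_le {p : Pt} (hp : 0 ≤ p 0) (f : Pt → ℝ) : uu p * D1 f p ≤ 28 * dK f p := by
  rw [D1, Finset.mul_sum]
  refine (Finset.sum_le_sum fun a _ => uu_mul_abs_pd_le hp f a).trans ?_
  simp; linarith [dK_nonneg f p]

theorem vv_mul_abs_Tg_le {p : Pt} (hp : 0 ≤ p 0) (f : Pt → ℝ) (a : Fin 4) :
    vv p * |Tg a f p| ≤ 48 * dK f p := by
  have hd := dK_nonneg f p
  have hr := rr_nonneg p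
  have hT : |Tg a f p| ≤ |pd a f p| + |pd 0 f p| := by
    rw [Tg]
    refine (abs_sub _ _).trans ?_
    rw [abs_mul]
    have := mul_le_mul_of_nonneg_right (abs_nul_le p a) (abs_nonneg (pd 0 f p))
    linarith
  rcases le_total (p 0) (2 * jb p) with h | h
  · by_cases ha : a = 0
    · rw [ha, Tg_zero]; simp; linarith
    obtain ⟨i, rfl⟩ := Fin.exists_succ_eq.2 ha
    have hj := (jb_pos p).ne'
    have hL : |p 0 * pd i.succ f p + p i.succ * pd 0 f p| ≤ dK f p := by
      obtain ⟨-, -, -, -, -, -, -, h7, h8, h9, -⟩ := vApp_KF f p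
      fin_cases i
      · change |p 0 * pd 1 f p + p 1 * pd 0 f p| ≤ _; rw [← h7]; exact abs_KF_le_dK f p 7
      · change |p 0 * pd 2 f p + p 2 * pd 0 f p| ≤ _; rw [← h8]; exact abs_KF_le_dK f p 8
      · change |p 0 * pd 3 f p + p 3 * pd 0 f p| ≤ _; rw [← h9]; exact abs_KF_le_dK f p 9
    have e : jb p * Tg i.succ f p = (p 0 * pd i.succ f p + p i.succ * pd 0 f p)
        + (jb p - p 0) * pd i.succ f p := by
      simp only [Tg, nul, if_neg ha]
      field_simp
      ring
    have h1 : |jb p - p 0| ≤ uu p := by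
      have e1 := abs_sub_abs_le_abs_sub (jb p - p 0) (rr p - p 0)
      have e2 : |jb p - p 0 - (rr p - p 0)| ≤ 1 := by
        rw [abs_le]; constructor <;> linarith [jb_le p, rr_le_jb p]
      rw [uu, abs_sub_comm (p 0)]
      linarith
    have h2 : jb p * |Tg i.succ f p| ≤ 8 * dK f p := by
      rw [show jb p * |Tg i.succ f p| = |jb p * Tg i.succ f p| by
        rw [abs_mul, abs_of_pos (jb_pos p)], e]
      refine (abs_add_le _ _).trans ?_
      rw [abs_mul]
      have := mul_le_mul_of_nonneg_right h1 (abs_nonneg (pd i.succ f p))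
      have := uu_mul_abs_pd_le hp f i.succ
      linarith
    have h3 : vv p ≤ 4 * jb p := by rw [vv]; linarith [rr_le_jb p, one_le_jb p]
    have := mul_le_mul_of_nonneg_right h3 (abs_nonneg (Tg i.succ f p))
    linarith
  · have h3 : vv p ≤ 3 * uu p := by
      rw [vv, uu]; linarith [rr_le_jb p, le_abs_self (p 0 - rr p)]
    have h4 := mul_le_mul_of_nonneg_right h3 (abs_nonneg (Tg a f p))
    have h5 := mul_le_mul_of_nonneg_left hT (zero_le_one.trans (one_le_uu p))
    have h6 := uu_mul_abs_pd_le hp f a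
    have h7 := uu_mul_abs_pd_le hp f 0
    linarith

theorem vv_mul_TA_le {p : Pt} (hp : 0 ≤ p 0) (f : Pt → ℝ) : vv p * TA f p ≤ 192 * dK f p := by
  rw [TA, Finset.mul_sum]
  refine (Finset.sum_le_sum fun a _ => vv_mul_abs_Tg_le hp f a).trans ?_
  simp; linarith [dK_nonneg f p]

/-- Sum of `|∂ V f|` over the fields `KF`. -/
def DK (f : Pt → ℝ) (p : Pt) : ℝ := ∑ i, D1 (vApp (KF i) f) p

theorem abs_KM_le (i : Fin 11) (a c : Fin 4) : |KM i a c| ≤ 1 := by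
  have : ∀ i a c, |KMz i a c| ≤ 1 := by decide
  rw [KM, ← Int.cast_abs]
  exact_mod_cast this i a c

theorem dK_pd_le {f : Pt → ℝ} (hf : ContDiff ℝ ∞ f) (p : Pt) (c : Fin 4) :
    dK (pd c f) p ≤ DK f p + 11 * D1 f p := by
  have : ∀ i, |vApp (KF i) (pd c f) p| ≤ D1 (vApp (KF i) f) p + D1 f p := by
    intro i
    have e : vApp (KF i) (pd c f) p = pd c (vApp (KF i) f) p - ∑ d, KM i d c * pd d f p := by
      rw [(KF_ckField i).pd_vApp hf]; ring
    rw [e]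
    refine (abs_sub _ _).trans (add_le_add (abs_pd_le_D1 _ p c) ?_)
    refine (Finset.abs_sum_le_sum_abs _ _).trans (Finset.sum_le_sum fun d _ => ?_)
    rw [abs_mul]
    exact mul_le_of_le_one_left (abs_nonneg _) (abs_KM_le i d c)
  refine (Finset.sum_le_sum fun i _ => this i).trans ?_
  rw [Finset.sum_add_distrib]
  simp [DK]

theorem uu_mul_D2_le {f : Pt → ℝ} (hf : ContDiff ℝ ∞ f) {p : Pt} (hp : 0 ≤ p 0) :
    uu p * D2 f p ≤ 112 * (DK f p + 11 * D1 f p) := by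
  rw [D2, Finset.mul_sum]
  refine (Finset.sum_le_sum fun c _ => (uu_mul_D1_le hp (pd c f)).trans
    (mul_le_mul_of_nonneg_left (dK_pd_le hf p c) (by norm_num))).trans ?_
  simp; linarith

theorem vv_mul_T2_le {f : Pt → ℝ} (hf : ContDiff ℝ ∞ f) {p : Pt} (hp : 0 ≤ p 0) :
    vv p * T2 f p ≤ 768 * (DK f p + 11 * D1 f p) := by
  rw [T2, Finset.mul_sum]
  refine (Finset.sum_le_sum fun c _ => (vv_mul_TA_le hp (pd c f)).trans
    (mul_le_mul_of_nonneg_left (dK_pd_le hf p c) (by norm_num))).trans ?_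
  simp; linarith

theorem DK_nonneg (f : Pt → ℝ) (p : Pt) : 0 ≤ DK f p := Finset.sum_nonneg fun _ _ => D1_nonneg _ _

/-- Through a nonzero null covector, in a direction tangent to the null cone, there is a
differentiable curve inside the cone. -/
theorem exists_null_curve {ξ w : Pt} (hξ : mink ξ = 0) (h0 : ξ ≠ 0)
    (hw : -(ξ 0 * w 0) + ξ 1 * w 1 + ξ 2 * w 2 + ξ 3 * w 3 = 0) :
    ∃ c : ℝ → Pt, c 0 = ξ ∧ (∀ s, mink (c s) = 0) ∧ ∀ a, HasDerivAt (fun s => c s a) (w a) 0 := by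
  have hm : ξ 0 ^ 2 = ξ 1 ^ 2 + ξ 2 ^ 2 + ξ 3 ^ 2 := by rw [mink] at hξ; linarith
  have hne : ξ 0 ≠ 0 := by
    intro h
    apply h0
    rw [h] at hm
    have e1 : ξ 1 = 0 := by nlinarith [sq_nonneg (ξ 1), sq_nonneg (ξ 2), sq_nonneg (ξ 3)]
    have e2 : ξ 2 = 0 := by nlinarith [sq_nonneg (ξ 1), sq_nonneg (ξ 2), sq_nonneg (ξ 3)]
    have e3 : ξ 3 = 0 := by nlinarith [sq_nonneg (ξ 1), sq_nonneg (ξ 2), sq_nonneg (ξ 3)]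
    funext a
    fin_cases a <;> assumption
  set q : ℝ → ℝ := fun s => (ξ 1 + s * w 1) ^ 2 + (ξ 2 + s * w 2) ^ 2 + (ξ 3 + s * w 3) ^ 2 with hq
  have hq0 : q 0 = ξ 0 ^ 2 := by rw [hm]; simp [hq]
  have hl : ∀ a, HasDerivAt (fun s : ℝ => ξ a + s * w a) (w a) 0 := fun a => by
    simpa using ((hasDerivAt_id (0 : ℝ)).mul_const (w a)).const_add (ξ a)
  have hdq : HasDerivAt q (2 * (ξ 0 * w 0)) 0 := by
    have := (((hl 1).pow 2).add ((hl 2).pow 2)).add ((hl 3).pow 2)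
    exact this.congr_deriv (by simp; linarith)
  have hsq : HasDerivAt (fun s => √(q s) * (ξ 0 / |ξ 0|)) (w 0) 0 := by
    have h := (hdq.sqrt (by rw [hq0]; positivity)).mul_const (ξ 0 / |ξ 0|)
    refine h.congr_deriv ?_
    rw [hq0, Real.sqrt_sq_eq_abs]
    have h2 : |ξ 0| ≠ 0 := abs_ne_zero.2 hne
    have h3 : |ξ 0| ^ 2 = ξ 0 ^ 2 := sq_abs _
    field_simp
    rw [h3]
    ring
  refine ⟨fun s => ![√(q s) * (ξ 0 / |ξ 0|), ξ 1 + s * w 1, ξ 2 + s * w 2, ξ 3 + s * w 3],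
    ?_, fun s => ?_, fun a => ?_⟩
  · funext a
    have h2 : |ξ 0| ≠ 0 := abs_ne_zero.2 hne
    fin_cases a <;> simp [hq0, Real.sqrt_sq_eq_abs]
    field_simp
  · have h2 : |ξ 0| ≠ 0 := abs_ne_zero.2 hne
    have h3 : (ξ 0 / |ξ 0|) ^ 2 = 1 := by rw [div_pow, sq_abs]; field_simp
    have h4 : √(q s) ^ 2 = q s := Real.sq_sqrt (by positivity)
    simp [mink, mul_pow, h3, h4]
    simp only [hq]
    ring
  · fin_cases a
    · exact hsq
    · exact hl 1
    · exact hl 2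
    · exact hl 3

/-- The image of a covector under the transpose of the linear part of a field is tangent to
the null cone. -/
theorem CKField.tangent {X : Pt → Pt} {b : Pt} {M : Fin 4 → Fin 4 → ℝ} {l : ℝ}
    (h : CKField X b M l) {ξ : Pt} (hξ : mink ξ = 0) (w : Pt) (hw : ∀ d, w d = ∑ a, M a d * ξ a) :
    -(ξ 0 * w 0) + ξ 1 * w 1 + ξ 2 * w 2 + ξ 3 * w 3 = 0 := by
  have d0 := h.diag0
  have d1 := h.diag 0
  have d2 := h.diag 1
  have d3 := h.diag 2
  have b1 := h.boost 0
  have b2 := h.boost 1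
  have b3 := h.boost 2
  have r1 := h.rot 0 1 (by decide)
  have r2 := h.rot 0 2 (by decide)
  have r3 := h.rot 1 2 (by decide)
  simp only [show (Fin.succ (0 : Fin 3) : Fin 4) = 1 from rfl,
    show (Fin.succ (1 : Fin 3) : Fin 4) = 2 from rfl,
    show (Fin.succ (2 : Fin 3) : Fin 4) = 3 from rfl] at *
  rw [mink] at hξ
  rw [hw 0, hw 1, hw 2, hw 3]
  simp only [Fin.sum_univ_four]
  rw [r1, r2, r3, b1, b2, b3]
  linear_combination (l / 2) * hξ - (ξ 0 ^ 2 / 2) * d0 + (ξ 1 ^ 2 / 2) * d1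
    + (ξ 2 ^ 2 / 2) * d2 + (ξ 3 ^ 2 / 2) * d3

/-- Coefficients of the commutator of a trilinear null form with a field. -/
def comm3 (M : Fin 4 → Fin 4 → ℝ) (F : Fin 4 → Fin 4 → Fin 4 → ℝ) (a b c : Fin 4) : ℝ :=
  - ∑ d, (M a d * F d b c + M b d * F a d c + M c d * F a b d)

/-- Coefficients of the commutator of a bilinear null form with a field. -/
def comm2 (M : Fin 4 → Fin 4 → ℝ) (G : Fin 4 → Fin 4 → ℝ) (a b : Fin 4) : ℝ :=
  - ∑ d, (M a d * G d b + M b d * G a d)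

theorem NullForm3.comm {X : Pt → Pt} {b : Pt} {M : Fin 4 → Fin 4 → ℝ} {l : ℝ}
    (h : CKField X b M l) {F : Fin 4 → Fin 4 → Fin 4 → ℝ} (hF : NullForm3 F) :
    NullForm3 (comm3 M F) := by
  intro ξ hξ
  by_cases h0 : ξ = 0
  · simp [h0]
  obtain ⟨c, hc0, hc, hd⟩ := exists_null_curve (w := fun d => ∑ a, M a d * ξ a) hξ h0
    (h.tangent hξ _ fun d => rfl)
  have e1 : HasDerivAt (fun s => ∑ a, ∑ b, ∑ e, F a b e * c s a * c s b * c s e)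
      (∑ a, ∑ b, ∑ e, (F a b e * (∑ i, M i a * ξ i) * ξ b * ξ e
        + F a b e * ξ a * (∑ i, M i b * ξ i) * ξ e
        + F a b e * ξ a * ξ b * (∑ i, M i e * ξ i))) 0 := by
    refine HasDerivAt.fun_sum fun a _ => HasDerivAt.fun_sum fun b _ => HasDerivAt.fun_sum fun e _ => ?_
    have := (((hd a).const_mul (F a b e)).mul (hd b)).mul (hd e)
    refine this.congr_deriv ?_
    simp only [hc0, Pi.mul_apply]
    ring
  have e2 : (fun s => ∑ a, ∑ b, ∑ e, F a b e * c s a * c s b * c s e) = fun _ => 0 :=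
    funext fun s => hF _ (hc s)
  rw [e2] at e1
  have e3 := e1.unique (hasDerivAt_const _ _)
  rw [← neg_eq_zero, ← e3]
  simp only [comm3, Fin.sum_univ_four]
  ring

theorem NullForm2.comm {X : Pt → Pt} {b : Pt} {M : Fin 4 → Fin 4 → ℝ} {l : ℝ}
    (h : CKField X b M l) {G : Fin 4 → Fin 4 → ℝ} (hG : NullForm2 G) :
    NullForm2 (comm2 M G) := by
  intro ξ hξ
  by_cases h0 : ξ = 0
  · simp [h0]
  obtain ⟨c, hc0, hc, hd⟩ := exists_null_curve (w := fun d => ∑ a, M a d * ξ a) hξ h0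
    (h.tangent hξ _ fun d => rfl)
  have e1 : HasDerivAt (fun s => ∑ a, ∑ b, G a b * c s a * c s b)
      (∑ a, ∑ b, (G a b * (∑ i, M i a * ξ i) * ξ b
        + G a b * ξ a * (∑ i, M i b * ξ i))) 0 := by
    refine HasDerivAt.fun_sum fun a _ => HasDerivAt.fun_sum fun b _ => ?_
    have := ((hd a).const_mul (G a b)).mul (hd b)
    refine this.congr_deriv ?_
    simp only [hc0]
  have e2 : (fun s => ∑ a, ∑ b, G a b * c s a * c s b) = fun _ => 0 :=
    funext fun s => hG _ (hc s)
  rw [e2] at e1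
  have e3 := e1.unique (hasDerivAt_const _ _)
  rw [← neg_eq_zero, ← e3]
  simp only [comm2, Fin.sum_univ_four]
  ring

theorem vApp_sum {ι : Type*} (s : Finset ι) {X : Pt → Pt} {f : ι → Pt → ℝ} {p : Pt}
    (hf : ∀ i ∈ s, DifferentiableAt ℝ (f i) p) :
    vApp X (fun q => ∑ i ∈ s, f i q) p = ∑ i ∈ s, vApp X (f i) p := by
  simp only [vApp]; rw [fderiv_fun_sum hf]; simp

theorem nf3_contDiff (F : Fin 4 → Fin 4 → Fin 4 → ℝ) {f g : Pt → ℝ} (hf : ContDiff ℝ ∞ f)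
    (hg : ContDiff ℝ ∞ g) : ContDiff ℝ ∞ (nf3 F f g) :=
  ContDiff.sum fun a _ => ContDiff.sum fun b _ => ContDiff.sum fun c _ =>
    (contDiff_const.mul (pd_contDiff hf a)).mul (pd_contDiff (pd_contDiff hg c) b)

theorem nf2_contDiff (G : Fin 4 → Fin 4 → ℝ) {f g : Pt → ℝ} (hf : ContDiff ℝ ∞ f)
    (hg : ContDiff ℝ ∞ g) : ContDiff ℝ ∞ (nf2 G f g) :=
  ContDiff.sum fun a _ => ContDiff.sum fun b _ =>
    (contDiff_const.mul (pd_contDiff hf a)).mul (pd_contDiff hg b)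

theorem CKField.vApp_pd {X : Pt → Pt} {b : Pt} {M : Fin 4 → Fin 4 → ℝ} {l : ℝ}
    (h : CKField X b M l) {f : Pt → ℝ} (hf : ContDiff ℝ ∞ f) (a : Fin 4) (p : Pt) :
    vApp X (pd a f) p = pd a (vApp X f) p - ∑ c, M c a * pd c f p := by
  rw [h.pd_vApp hf]; ring

theorem CKField.vApp_pd_pd {X : Pt → Pt} {b : Pt} {M : Fin 4 → Fin 4 → ℝ} {l : ℝ}
    (h : CKField X b M l) {f : Pt → ℝ} (hf : ContDiff ℝ ∞ f) (a e : Fin 4) (p : Pt) :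
    vApp X (pd a (pd e f)) p = pd a (pd e (vApp X f)) p - ∑ c, M c e * pd a (pd c f) p
      - ∑ c, M c a * pd c (pd e f) p := by
  rw [h.vApp_pd (pd_contDiff hf e)]
  congr 1
  have : vApp X (pd e f) = fun q => pd e (vApp X f) q - ∑ c, M c e * pd c f q :=
    funext fun q => h.vApp_pd hf e q
  have hd : ∀ c, Differentiable ℝ (pd c f) := fun c => contDiff_differentiable (pd_contDiff hf c)
  rw [this, pd_sub (contDiff_differentiable (pd_contDiff (vApp_contDiff h.contDiff hf) e) p)
    (by fun_prop), pd_sum _ (by fun_prop)]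
  congr 1
  exact Finset.sum_congr rfl fun c _ => pd_const_mul (hd c p) _ _

theorem CKField.vApp_nf3 {X : Pt → Pt} {b : Pt} {M : Fin 4 → Fin 4 → ℝ} {l : ℝ}
    (h : CKField X b M l) (F : Fin 4 → Fin 4 → Fin 4 → ℝ) {f g : Pt → ℝ} (hf : ContDiff ℝ ∞ f)
    (hg : ContDiff ℝ ∞ g) (p : Pt) :
    vApp X (nf3 F f g) p = nf3 F (vApp X f) g p + nf3 F f (vApp X g) p
      + nf3 (comm3 M F) f g p := by
  have hd1 : ∀ c, Differentiable ℝ (pd c f) := fun c => contDiff_differentiable (pd_contDiff hf c)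
  have hd2 : ∀ b c, Differentiable ℝ (pd b (pd c g)) := fun b c =>
    contDiff_differentiable (pd_contDiff (pd_contDiff hg c) b)
  have e : vApp X (nf3 F f g) p = ∑ a, ∑ b, ∑ c, F a b c * (vApp X (pd a f) p * pd b (pd c g) p
      + pd a f p * vApp X (pd b (pd c g)) p) := by
    unfold nf3
    rw [vApp_sum _ (by fun_prop)]
    refine Finset.sum_congr rfl fun a _ => ?_
    rw [vApp_sum _ (by fun_prop)]
    refine Finset.sum_congr rfl fun b _ => ?_
    rw [vApp_sum _ (by fun_prop)]
    refine Finset.sum_congr rfl fun c _ => ?_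
    rw [vApp_mul (by fun_prop) (by fun_prop), vApp_const_mul (by fun_prop)]
    ring
  have e1 : ∑ a, ∑ b, ∑ c, F a b c * ((∑ d, M d a * pd d f p) * pd b (pd c g) p)
      = ∑ a, ∑ b, ∑ c, (∑ d, M a d * F d b c) * (pd a f p * pd b (pd c g) p) := by
    simp only [Finset.sum_mul, Finset.mul_sum]
    simp_rw [Finset.sum_comm (γ := Fin 4) (s := Finset.univ) (t := Finset.univ)
      (f := fun c d => F _ _ c * (M d _ * pd d f p * pd _ (pd c g) p))]
    simp_rw [Finset.sum_comm (γ := Fin 4) (s := Finset.univ) (t := Finset.univ)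
      (f := fun b d => ∑ c, F _ b c * (M d _ * pd d f p * pd b (pd c g) p))]
    rw [Finset.sum_comm]
    refine Finset.sum_congr rfl fun a _ => ?_
    rw [Finset.sum_comm]
    refine Finset.sum_congr rfl fun b _ => ?_
    rw [Finset.sum_comm]
    refine Finset.sum_congr rfl fun c _ => Finset.sum_congr rfl fun d _ => ?_
    ring
  have e2 : ∑ a, ∑ b, ∑ c, F a b c * (pd a f p * ∑ d, M d b * pd d (pd c g) p)
      = ∑ a, ∑ b, ∑ c, (∑ d, M b d * F a d c) * (pd a f p * pd b (pd c g) p) := by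
    refine Finset.sum_congr rfl fun a _ => ?_
    simp only [Finset.sum_mul, Finset.mul_sum]
    simp_rw [Finset.sum_comm (γ := Fin 4) (s := Finset.univ) (t := Finset.univ)
      (f := fun c d => F a _ c * (pd a f p * (M d _ * pd d (pd c g) p)))]
    rw [Finset.sum_comm]
    refine Finset.sum_congr rfl fun b _ => ?_
    rw [Finset.sum_comm]
    refine Finset.sum_congr rfl fun c _ => Finset.sum_congr rfl fun d _ => ?_
    ring
  have e3 : ∑ a, ∑ b, ∑ c, F a b c * (pd a f p * ∑ d, M d c * pd b (pd d g) p)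
      = ∑ a, ∑ b, ∑ c, (∑ d, M c d * F a b d) * (pd a f p * pd b (pd c g) p) := by
    refine Finset.sum_congr rfl fun a _ => Finset.sum_congr rfl fun b _ => ?_
    simp only [Finset.sum_mul, Finset.mul_sum]
    rw [Finset.sum_comm]
    refine Finset.sum_congr rfl fun c _ => Finset.sum_congr rfl fun d _ => ?_
    ring
  have e4 : nf3 (comm3 M F) f g p
      = - (∑ a, ∑ b, ∑ c, F a b c * ((∑ d, M d a * pd d f p) * pd b (pd c g) p))
        - (∑ a, ∑ b, ∑ c, F a b c * (pd a f p * ∑ d, M d b * pd d (pd c g) p))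
        - ∑ a, ∑ b, ∑ c, F a b c * (pd a f p * ∑ d, M d c * pd b (pd d g) p) := by
    rw [e1, e2, e3, nf3]
    simp only [comm3, ← Finset.sum_neg_distrib, ← Finset.sum_sub_distrib]
    refine Finset.sum_congr rfl fun a _ => Finset.sum_congr rfl fun b _ =>
      Finset.sum_congr rfl fun c _ => ?_
    rw [Finset.sum_neg_distrib, Finset.sum_add_distrib, Finset.sum_add_distrib]
    ring
  rw [e, e4]
  simp only [h.vApp_pd hf, h.vApp_pd_pd hg, nf3, ← Finset.sum_neg_distrib,
    ← Finset.sum_sub_distrib, ← Finset.sum_add_distrib]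
  refine Finset.sum_congr rfl fun a _ => Finset.sum_congr rfl fun b _ =>
      Finset.sum_congr rfl fun c _ => ?_
  ring

theorem CKField.vApp_nf2 {X : Pt → Pt} {b : Pt} {M : Fin 4 → Fin 4 → ℝ} {l : ℝ}
    (h : CKField X b M l) (G : Fin 4 → Fin 4 → ℝ) {f g : Pt → ℝ} (hf : ContDiff ℝ ∞ f)
    (hg : ContDiff ℝ ∞ g) (p : Pt) :
    vApp X (nf2 G f g) p = nf2 G (vApp X f) g p + nf2 G f (vApp X g) p
      + nf2 (comm2 M G) f g p := by
  have hd1 : ∀ c, Differentiable ℝ (pd c f) := fun c => contDiff_differentiable (pd_contDiff hf c)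
  have hd2 : ∀ c, Differentiable ℝ (pd c g) := fun c => contDiff_differentiable (pd_contDiff hg c)
  have e : vApp X (nf2 G f g) p = ∑ a, ∑ b, G a b * (vApp X (pd a f) p * pd b g p
      + pd a f p * vApp X (pd b g) p) := by
    unfold nf2
    rw [vApp_sum _ (by fun_prop)]
    refine Finset.sum_congr rfl fun a _ => ?_
    rw [vApp_sum _ (by fun_prop)]
    refine Finset.sum_congr rfl fun b _ => ?_
    rw [vApp_mul (by fun_prop) (by fun_prop), vApp_const_mul (by fun_prop)]
    ring
  have e1 : ∑ a, ∑ b, G a b * ((∑ d, M d a * pd d f p) * pd b g p)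
      = ∑ a, ∑ b, (∑ d, M a d * G d b) * (pd a f p * pd b g p) := by
    simp only [Finset.sum_mul, Finset.mul_sum]
    simp_rw [Finset.sum_comm (γ := Fin 4) (s := Finset.univ) (t := Finset.univ)
      (f := fun b d => G _ b * (M d _ * pd d f p * pd b g p))]
    rw [Finset.sum_comm]
    refine Finset.sum_congr rfl fun a _ => ?_
    rw [Finset.sum_comm]
    refine Finset.sum_congr rfl fun b _ => Finset.sum_congr rfl fun d _ => ?_
    ring
  have e2 : ∑ a, ∑ b, G a b * (pd a f p * ∑ d, M d b * pd d g p)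
      = ∑ a, ∑ b, (∑ d, M b d * G a d) * (pd a f p * pd b g p) := by
    refine Finset.sum_congr rfl fun a _ => ?_
    simp only [Finset.sum_mul, Finset.mul_sum]
    rw [Finset.sum_comm]
    refine Finset.sum_congr rfl fun b _ => Finset.sum_congr rfl fun d _ => ?_
    ring
  have e4 : nf2 (comm2 M G) f g p
      = - (∑ a, ∑ b, G a b * ((∑ d, M d a * pd d f p) * pd b g p))
        - ∑ a, ∑ b, G a b * (pd a f p * ∑ d, M d b * pd d g p) := by
    rw [e1, e2, nf2]
    simp only [comm2, ← Finset.sum_neg_distrib, ← Finset.sum_sub_distrib]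
    refine Finset.sum_congr rfl fun a _ => Finset.sum_congr rfl fun b _ => ?_
    rw [Finset.sum_neg_distrib, Finset.sum_add_distrib]
    ring
  rw [e, e4]
  simp only [h.vApp_pd hf, h.vApp_pd hg, nf2, ← Finset.sum_neg_distrib,
    ← Finset.sum_sub_distrib, ← Finset.sum_add_distrib]
  refine Finset.sum_congr rfl fun a _ => Finset.sum_congr rfl fun b _ => ?_
  ring

/-- Functionals that are finite linear combinations of null forms in the iterated derivatives,
with at most `m` derivatives in total and at most `m - 1` on the twice differentiated factor. -/
inductive NullFun : ℕ → ((Pt → ℝ) → Pt → ℝ) → Prop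
  | zero (m : ℕ) : NullFun m (fun _ _ => 0)
  | add {m : ℕ} {q q' : (Pt → ℝ) → Pt → ℝ} (h : NullFun m q) (h' : NullFun m q') :
      NullFun m (fun f p => q f p + q' f p)
  | smul {m : ℕ} {q : (Pt → ℝ) → Pt → ℝ} (c : ℝ) (h : NullFun m q) :
      NullFun m (fun f p => c * q f p)
  | cubic {m : ℕ} {F : Fin 4 → Fin 4 → Fin 4 → ℝ} (hF : NullForm3 F) {A B : List (Fin 11)}
      (h : A.length + B.length ≤ m) (h' : B.length + 1 ≤ m) :
      NullFun m (fun f => nf3 F (kv A f) (kv B f))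
  | quad {m : ℕ} {G : Fin 4 → Fin 4 → ℝ} (hG : NullForm2 G) {A B : List (Fin 11)}
      (h : A.length + B.length ≤ m) : NullFun m (fun f => nf2 G (kv A f) (kv B f))

theorem NullFun.mono {m m' : ℕ} {q : (Pt → ℝ) → Pt → ℝ} (h : NullFun m q) (hm : m ≤ m') :
    NullFun m' q := by
  induction h with
  | zero => exact NullFun.zero _
  | add _ _ ih ih' => exact ih.add ih'
  | smul c _ ih => exact ih.smul c
  | cubic hF h h' => exact NullFun.cubic hF (h.trans hm) (h'.trans hm)
  | quad hG h => exact NullFun.quad hG (h.trans hm)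

theorem NullFun.contDiff {m : ℕ} {q : (Pt → ℝ) → Pt → ℝ} (h : NullFun m q) {f : Pt → ℝ}
    (hf : ContDiff ℝ ∞ f) : ContDiff ℝ ∞ (q f) := by
  induction h with
  | zero => exact contDiff_const
  | add _ _ ih ih' => exact ih.add ih'
  | smul c _ ih => exact contDiff_const.mul ih
  | cubic hF h h' => exact nf3_contDiff _ (kv_contDiff hf _) (kv_contDiff hf _)
  | quad hG h => exact nf2_contDiff _ (kv_contDiff hf _) (kv_contDiff hf _)

theorem NullFun.deriv {m : ℕ} {q : (Pt → ℝ) → Pt → ℝ} (h : NullFun m q) (i : Fin 11) :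
    ∃ q', NullFun (m + 1) q' ∧ ∀ f, ContDiff ℝ ∞ f → ∀ p, vApp (KF i) (q f) p = q' f p := by
  induction h with
  | zero => exact ⟨_, NullFun.zero _, fun f _ p => by simp [vApp]⟩
  | add h h' ih ih' =>
    obtain ⟨r, hr, e⟩ := ih
    obtain ⟨r', hr', e'⟩ := ih'
    exact ⟨_, hr.add hr', fun f hf p => by
      rw [vApp_add (contDiff_differentiable (h.contDiff hf) p)
        (contDiff_differentiable (h'.contDiff hf) p), e f hf, e' f hf]⟩
  | smul c h ih =>
    obtain ⟨r, hr, e⟩ := ih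
    exact ⟨_, hr.smul c, fun f hf p => by
      rw [vApp_const_mul (contDiff_differentiable (h.contDiff hf) p), e f hf]⟩
  | @cubic F hF A B h h' =>
    refine ⟨_, ((NullFun.cubic hF (A := i :: A) (B := B) ?_ ?_).add
      (NullFun.cubic hF (A := A) (B := i :: B) ?_ ?_)).add
      (NullFun.cubic (hF.comm (KF_ckField i)) (A := A) (B := B) ?_ ?_), fun f hf p =>
      (KF_ckField i).vApp_nf3 F (kv_contDiff hf A) (kv_contDiff hf B) p⟩ <;>
    (try simp only [List.length_cons]) <;> omega
  | @quad G hG A B h =>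
    refine ⟨_, ((NullFun.quad hG (A := i :: A) (B := B) ?_).add
      (NullFun.quad hG (A := A) (B := i :: B) ?_)).add
      (NullFun.quad (hG.comm (KF_ckField i)) (A := A) (B := B) ?_), fun f hf p =>
      (KF_ckField i).vApp_nf2 G (kv_contDiff hf A) (kv_contDiff hf B) p⟩ <;>
    (try simp only [List.length_cons]) <;> omega

theorem vApp_congr_of_eventuallyEq {X : Pt → Pt} {f g : Pt → ℝ} {p : Pt}
    (h : f =ᶠ[nhds p] g) : vApp X f p = vApp X g p := by
  rw [vApp, vApp, h.fderiv_eq]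

/-- The equation satisfied by the commuted unknowns. -/
theorem exists_commuted_equation {F : Fin 4 → Fin 4 → Fin 4 → ℝ} {G : Fin 4 → Fin 4 → ℝ}
    (hF : NullForm3 F) (hG : NullForm2 G) (I : List (Fin 11)) :
    ∃ q, NullFun I.length q ∧ ∀ f, ContDiff ℝ ∞ f →
      (∀ p : Pt, 0 ≤ p 0 → box f p + nf3 F f f p = nf2 G f f p) →
      ∀ p : Pt, 0 ≤ p 0 → box (kv I f) p + nf3 F f (kv I f) p = q f p := by
  suffices H : ∃ q, NullFun I.length q ∧ ∀ f, ContDiff ℝ ∞ f →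
      (∀ p : Pt, 0 ≤ p 0 → box f p + nf3 F f f p = nf2 G f f p) →
      ∀ p : Pt, 0 < p 0 → box (kv I f) p + nf3 F f (kv I f) p = q f p by
    obtain ⟨q, hq, h⟩ := H
    refine ⟨q, hq, fun f hf he p hp => ?_⟩
    have hc1 : Continuous fun s : ℝ => (fun a => p a + if a = 0 then s else 0 : Pt) := by
      refine continuous_pi fun a => ?_
      split_ifs <;> fun_prop
    have hc2 : Continuous fun x => box (kv I f) x + nf3 F f (kv I f) x :=
      (box_contDiff (kv_contDiff hf I)).continuous.add
        (nf3_contDiff F hf (kv_contDiff hf I)).continuous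
    have hc3 : Continuous (q f) := (hq.contDiff hf).continuous
    have h1 := ((hc2.comp hc1).tendsto 0).mono_left (nhdsWithin_le_nhds (s := Set.Ioi 0))
    have h2 := ((hc3.comp hc1).tendsto 0).mono_left (nhdsWithin_le_nhds (s := Set.Ioi 0))
    have h3 := tendsto_nhds_unique (h1.congr' (by
      filter_upwards [self_mem_nhdsWithin] with s hs
      refine h f hf he _ ?_
      simp only [if_true]
      exact add_pos_of_nonneg_of_pos hp hs)) h2
    simpa using h3
  induction I with
  | nil =>
    exact ⟨_, NullFun.quad hG (A := []) (B := []) (by simp), fun f hf he p hp => he p hp.le⟩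
  | cons i I ih =>
    obtain ⟨q, hq, h⟩ := ih
    obtain ⟨q', hq', e'⟩ := hq.deriv i
    refine ⟨_, (((NullFun.cubic hF (A := [i]) (B := I) ?_ ?_).smul (-1)).add
      (((NullFun.cubic (hF.comm (KF_ckField i)) (A := []) (B := I) ?_ ?_).smul (-1)).add
      (((NullFun.cubic hF (A := []) (B := I) ?_ ?_).smul (-Kl i)).add
      (hq'.add ((hq.mono (Nat.le_succ _)).smul (Kl i)))))), fun f hf he p hp => ?_⟩
    · simp; omega
    · simp
    · simp
    · simp
    · simp
    · simp
    have hI := kv_contDiff hf I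
    have hev : (fun x => box (kv I f) x + nf3 F f (kv I f) x) =ᶠ[nhds p] q f := by
      have : {x : Pt | 0 < x 0} ∈ nhds p :=
        (isOpen_lt continuous_const (continuous_apply 0)).mem_nhds hp
      filter_upwards [this] with x hx
      exact h f hf he x hx
    have h1 := vApp_congr_of_eventuallyEq (X := KF i) hev
    rw [vApp_add (contDiff_differentiable (box_contDiff hI) p)
      (contDiff_differentiable (nf3_contDiff F hf hI) p), (KF_ckField i).vApp_nf3 F hf hI,
      e' f hf] at h1
    have h2 := h f hf he p hp
    rw [kv_cons, (KF_ckField i).box_vApp hI]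
    simp only [kv_cons, kv_nil]
    linear_combination h1 + Kl i * h2

/-- A null functional is controlled by any common bound of its building blocks. -/
theorem NullFun.bound {m : ℕ} {q : (Pt → ℝ) → Pt → ℝ} (h : NullFun m q) :
    ∃ C : ℝ, 0 ≤ C ∧ ∀ f, ContDiff ℝ ∞ f → ∀ (p : Pt) (X : ℝ), 0 ≤ X →
      (∀ A B : List (Fin 11), A.length + B.length ≤ m → B.length + 1 ≤ m →
        g3 (kv A f) (kv B f) p ≤ X) →
      (∀ A B : List (Fin 11), A.length + B.length ≤ m → g2 (kv A f) (kv B f) p ≤ X) →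
      |q f p| ≤ C * X := by
  induction h with
  | zero => exact ⟨0, le_rfl, fun f _ p X _ _ _ => by simp⟩
  | add _ _ ih ih' =>
    obtain ⟨C, hC, h⟩ := ih
    obtain ⟨C', hC', h'⟩ := ih'
    refine ⟨C + C', add_nonneg hC hC', fun f hf p X hX h1 h2 => (abs_add_le _ _).trans ?_⟩
    rw [add_mul]
    exact add_le_add (h f hf p X hX h1 h2) (h' f hf p X hX h1 h2)
  | smul c _ ih =>
    obtain ⟨C, hC, h⟩ := ih
    refine ⟨|c| * C, by positivity, fun f hf p X hX h1 h2 => ?_⟩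
    rw [abs_mul, mul_assoc]
    exact mul_le_mul_of_nonneg_left (h f hf p X hX h1 h2) (abs_nonneg c)
  | @cubic F hF A B h h' =>
    refine ⟨3 * ∑ a, ∑ b, ∑ c, |F a b c|, by positivity, fun f hf p X hX h1 h2 => ?_⟩
    exact (nf3_bound hF (kv_contDiff hf B) p).trans
      (mul_le_mul_of_nonneg_left (h1 A B h h') (by positivity))
  | @quad G hG A B h =>
    refine ⟨3 * ∑ a, ∑ b, |G a b|, by positivity, fun f hf p X hX h1 h2 => ?_⟩
    exact (nf2_bound hG _ _ p).trans (mul_le_mul_of_nonneg_left (h2 A B h) (by positivity))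

/-- Constants depending on a list can be chosen uniformly over lists of bounded length. -/
theorem exists_uniform_list {P : List (Fin 11) → ℝ → Prop}
    (hmono : ∀ I c c', c ≤ c' → P I c → P I c') (h : ∀ I, ∃ c, P I c) (k : ℕ) :
    ∃ c, 0 ≤ c ∧ ∀ I, I.length ≤ k → P I c := by
  choose c hc using h
  have hfin := List.finite_length_le (Fin 11) k
  obtain ⟨M, hM⟩ := (hfin.image c).bddAbove
  exact ⟨max M 0, le_max_right _ _, fun I hI =>
    hmono I _ _ ((hM ⟨I, hI, rfl⟩).trans (le_max_left _ _)) (hc I)⟩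

/-- The inhomogeneity of the commuted equations is controlled by the null structure. -/
theorem exists_commuted_bound {F : Fin 4 → Fin 4 → Fin 4 → ℝ} {G : Fin 4 → Fin 4 → ℝ}
    (hF : NullForm3 F) (hG : NullForm2 G) (k : ℕ) :
    ∃ C : ℝ, 0 ≤ C ∧ ∀ I : List (Fin 11), I.length ≤ k → ∀ f, ContDiff ℝ ∞ f →
      (∀ p : Pt, 0 ≤ p 0 → box f p + nf3 F f f p = nf2 G f f p) →
      ∀ (p : Pt) (X : ℝ), 0 ≤ p 0 → 0 ≤ X →
      (∀ A B : List (Fin 11), A.length + B.length ≤ I.length → B.length + 1 ≤ I.length →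
        g3 (kv A f) (kv B f) p ≤ X) →
      (∀ A B : List (Fin 11), A.length + B.length ≤ I.length → g2 (kv A f) (kv B f) p ≤ X) →
      |box (kv I f) p + nf3 F f (kv I f) p| ≤ C * X := by
  refine exists_uniform_list (fun I c c' hc h f hf he p X hp hX h1 h2 =>
    (h f hf he p X hp hX h1 h2).trans (mul_le_mul_of_nonneg_right hc hX)) (fun I => ?_) k
  obtain ⟨q, hq, e⟩ := exists_commuted_equation hF hG I
  obtain ⟨C, hC, h⟩ := hq.bound
  exact ⟨C, fun f hf he p X hp hX h1 h2 => by
    rw [e f hf he p hp]; exact h f hf p X hX h1 h2⟩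

/-- The linear inclusion of space in spacetime. -/
def spIncl : Sp →L[ℝ] Pt :=
  ContinuousLinearMap.pi ![0, ContinuousLinearMap.proj 0, ContinuousLinearMap.proj 1,
    ContinuousLinearMap.proj 2]

theorem stp_eq (t : ℝ) (x : Sp) : stp t x = spIncl x + t • (Pi.single 0 1 : Pt) := by
  ext i; fin_cases i <;> simp [stp, spIncl]

theorem spIncl_single (i : Fin 3) : spIncl (Pi.single i 1) = Pi.single i.succ 1 := by
  ext j; fin_cases i <;> fin_cases j <;> simp [spIncl]

@[simp] theorem stp_zero_apply (t : ℝ) (x : Sp) : stp t x 0 = t := rfl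

@[simp] theorem stp_succ_apply (t : ℝ) (x : Sp) (i : Fin 3) : stp t x i.succ = x i := by
  fin_cases i <;> rfl

theorem stp_eta (p : Pt) : stp (p 0) (fun i => p i.succ) = p := by
  ext i; fin_cases i <;> rfl

theorem stp_contDiff : ContDiff ℝ ∞ (fun q : ℝ × Sp => stp q.1 q.2) := by
  simp only [stp_eq]
  exact (spIncl.contDiff.comp contDiff_snd).add (contDiff_fst.smul contDiff_const)

theorem stp_continuous : Continuous (fun q : ℝ × Sp => stp q.1 q.2) := stp_contDiff.continuous

theorem continuous_stp_right (t : ℝ) : Continuous (stp t) :=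
  stp_continuous.comp (Continuous.prodMk_right t)

theorem hasDerivAt_stp_time {f : Pt → ℝ} (hf : ContDiff ℝ ∞ f) (t : ℝ) (x : Sp) :
    HasDerivAt (fun s => f (stp s x)) (pd 0 f (stp t x)) t := by
  have h : HasDerivAt (fun s => stp s x) (Pi.single 0 1 : Pt) t := by
    simp only [stp_eq]
    simpa using ((hasDerivAt_id t).smul_const (Pi.single 0 1 : Pt)).const_add (spIncl x)
  exact ((contDiff_differentiable hf) _).hasFDerivAt.comp_hasDerivAt t h

theorem hasFDerivAt_stp_space {f : Pt → ℝ} (hf : ContDiff ℝ ∞ f) (t : ℝ) (x : Sp) :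
    HasFDerivAt (fun y => f (stp t y)) ((fderiv ℝ f (stp t x)).comp spIncl) x := by
  have h : HasFDerivAt (stp t) spIncl x := by
    have : stp t = fun y => spIncl y + t • (Pi.single 0 1 : Pt) := funext (stp_eq t)
    rw [this]
    exact spIncl.hasFDerivAt.add_const _
  exact ((contDiff_differentiable hf) _).hasFDerivAt.comp x h

theorem spd_stp {f : Pt → ℝ} (hf : ContDiff ℝ ∞ f) (t : ℝ) (x : Sp) (i : Fin 3) :
    spd i (fun y => f (stp t y)) x = pd i.succ f (stp t x) := by
  rw [spd, (hasFDerivAt_stp_space hf t x).fderiv]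
  simp [spIncl_single, pd]

theorem norm_le_rr_stp (t : ℝ) (x : Sp) : ‖x‖ ≤ rr (stp t x) := by
  rw [pi_norm_le_iff_of_nonneg (rr_nonneg _)]
  intro i
  rw [Real.norm_eq_abs, ← stp_succ_apply t x i]
  exact abs_coord_le_rr _ i

theorem integrable_of_slice {g : Sp → ℝ} (hg : Continuous g) {R : ℝ}
    (h : ∀ x, R < ‖x‖ → g x = 0) : Integrable g := by
  refine hg.integrable_of_hasCompactSupport (HasCompactSupport.intro
    (isCompact_closedBall (0 : Sp) R) fun x hx => h x ?_)
  simpa using hx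

theorem integral_pd_slice {g : Pt → ℝ} (hg : ContDiff ℝ ∞ g) {R t : ℝ}
    (h : ∀ x : Sp, R < ‖x‖ → g (stp t x) = 0) (i : Fin 3) :
    ∫ x : Sp, pd i.succ g (stp t x) = 0 := by
  have hc : ContDiff ℝ ∞ (fun x => g (stp t x)) :=
    hg.comp (stp_contDiff.comp (contDiff_prodMk_right t))
  have h1 := integrable_of_slice hc.continuous h
  have h2 : Integrable (fun x => fderiv ℝ (fun x => g (stp t x)) x (Pi.single i 1)) := by
    refine ((hc.continuous_fderiv (by simp)).clm_apply
      continuous_const).integrable_of_hasCompactSupport ?_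
    refine HasCompactSupport.fderiv_apply ℝ (HasCompactSupport.intro
      (isCompact_closedBall (0 : Sp) R) fun x hx => h x ?_) _
    simpa using hx
  have := integral_mul_fderiv_eq_neg_fderiv_mul_of_integrable (μ := (volume : Measure Sp))
    (f := fun _ => (1 : ℝ)) (g := fun x => g (stp t x)) (v := Pi.single i 1)
    (by simp) (by simpa using h2) (by simpa using h1) (fun x _ => differentiableAt_const _)
    (fun x _ => hc.differentiable (by simp) x)
  simp only [one_mul, fderiv_fun_const, Pi.zero_apply, zero_apply, zero_mul,
    integral_zero, neg_zero] at this
  rw [← this]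
  exact integral_congr_ae (Filter.Eventually.of_forall fun x => (spd_stp hg t x i).symm)

theorem hasDerivAt_integral_slice {K : Fin 4 → Pt → ℝ} (hK : ∀ a, ContDiff ℝ ∞ (K a)) {R : ℝ}
    (h : ∀ a p, R < 2 * p 0 + jb p → K a p = 0) (t : ℝ) :
    HasDerivAt (fun s => ∫ x : Sp, K 0 (stp s x)) (∫ x : Sp, ∑ a, pd a (K a) (stp t x)) t := by
  have hbig : ∀ a s (x : Sp), R - 2 * s < ‖x‖ → K a (stp s x) = 0 := fun a s x hx =>
    h a _ (by have := norm_le_rr_stp s x; have := rr_le_jb (stp s x); simp; linarith)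
  have hpd : ∀ a p, R < 2 * p 0 + jb p → pd a (K a) p = 0 := by
    intro a p hp
    have hcont : Continuous fun q : Pt => 2 * q 0 + jb q := by unfold jb; fun_prop
    have : K a =ᶠ[nhds p] fun _ => 0 := by
      filter_upwards [hcont.continuousAt.eventually (lt_mem_nhds hp)] with q hq
      exact h a q hq
    rw [pd, this.fderiv_eq]; simp
  have hpdbig : ∀ a s (x : Sp), R - 2 * s < ‖x‖ → pd a (K a) (stp s x) = 0 := fun a s x hx =>
    hpd a _ (by have := norm_le_rr_stp s x; have := rr_le_jb (stp s x); simp; linarith)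
  have hcpd : ∀ a, Continuous (pd a (K a)) := fun a => (pd_contDiff (hK a) a).continuous
  have hsum : ∫ x : Sp, ∑ a, pd a (K a) (stp t x) = ∫ x : Sp, pd 0 (K 0) (stp t x) := by
    rw [integral_finsetSum]
    · rw [Fin.sum_univ_succ, Finset.sum_eq_zero, add_zero]
      intro i _
      exact integral_pd_slice (hK _) (hbig _ t) i
    · intro a _
      exact integrable_of_slice ((hcpd a).comp (continuous_stp_right t)) (hpdbig a t)
  rw [hsum]
  set S := R - 2 * (t - 1) with hS
  obtain ⟨M, hM⟩ := ((isCompact_Icc (a := t - 1) (b := t + 1)).prod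
    (isCompact_closedBall (0 : Sp) S)).exists_bound_of_continuousOn
    ((hcpd 0).comp stp_continuous).continuousOn
  refine (hasDerivAt_integral_of_dominated_loc_of_deriv_le (s := Set.Icc (t - 1) (t + 1))
    (F := fun s x => K 0 (stp s x)) (F' := fun s x => pd 0 (K 0) (stp s x))
    (bound := (Metric.closedBall (0 : Sp) S).indicator fun _ => M)
    (Icc_mem_nhds (by linarith) (by linarith)) ?_ ?_ ?_ ?_ ?_ ?_).2
  · exact Filter.Eventually.of_forall fun s =>
      ((hK 0).continuous.comp (continuous_stp_right s)).aestronglyMeasurable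
  · exact integrable_of_slice ((hK 0).continuous.comp (continuous_stp_right t)) (hbig 0 t)
  · exact ((hcpd 0).comp (continuous_stp_right t)).aestronglyMeasurable
  · refine Filter.Eventually.of_forall fun x s hs => ?_
    by_cases hx : x ∈ Metric.closedBall (0 : Sp) S
    · rw [Set.indicator_of_mem hx]
      exact hM (s, x) ⟨hs, hx⟩
    · rw [Set.indicator_of_notMem hx, hpdbig 0 s x, norm_zero]
      simp only [Metric.mem_closedBall, dist_zero_right, not_le] at hx
      linarith [hs.1]
  · exact (integrable_indicator_iff measurableSet_closedBall).2
      (integrableOn_const (measure_closedBall_lt_top).ne)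
  · exact Filter.Eventually.of_forall fun x s _ => hasDerivAt_stp_time (hK 0) s x

/-- A compactly supported current with nonpositive divergence has nonincreasing flux. -/
theorem slice_integral_le_initial {K : Fin 4 → Pt → ℝ} (hK : ∀ a, ContDiff ℝ ∞ (K a)) {R T : ℝ}
    (h : ∀ a p, R < 2 * p 0 + jb p → K a p = 0)
    (hdiv : ∀ p : Pt, 0 < p 0 → p 0 < T → ∑ a, pd a (K a) p ≤ 0) {t : ℝ} (ht : 0 ≤ t)
    (htT : t < T) : ∫ x : Sp, K 0 (stp t x) ≤ ∫ x : Sp, K 0 (stp 0 x) := by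
  refine antitoneOn_of_deriv_nonpos (convex_Icc 0 t)
    (fun s _ => (hasDerivAt_integral_slice hK h s).continuousAt.continuousWithinAt)
    (fun s _ => (hasDerivAt_integral_slice hK h s).differentiableAt.differentiableWithinAt) ?_
    (Set.left_mem_Icc.2 ht) (Set.right_mem_Icc.2 ht) ht
  intro s hs
  rw [interior_Icc] at hs
  rw [(hasDerivAt_integral_slice hK h s).deriv]
  exact integral_nonpos fun x => hdiv _ (by simpa using hs.1) (by simpa using hs.2.trans htT)

theorem pd_comp {φ : ℝ → ℝ} {g : Pt → ℝ} {p : Pt} (hφ : DifferentiableAt ℝ φ (g p))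
    (hg : DifferentiableAt ℝ g p) (a : Fin 4) :
    pd a (fun q => φ (g q)) p = deriv φ (g p) * pd a g p := by
  have := (hφ.hasDerivAt.comp_hasFDerivAt p hg.hasFDerivAt).fderiv
  simp only [pd]
  rw [show (fun q => φ (g q)) = φ ∘ g from rfl, this]; simp

theorem pd_coord (a b : Fin 4) (p : Pt) : pd a (fun q => q b) p = if b = a then 1 else 0 := by
  have : fderiv ℝ (fun q : Pt => q b) p = ContinuousLinearMap.proj b :=
    (ContinuousLinearMap.proj (R := ℝ) (φ := fun _ : Fin 4 => ℝ) b).fderiv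
  simp only [pd, this, ContinuousLinearMap.proj_apply, Pi.single_apply]

theorem coord_contDiff (b : Fin 4) : ContDiff ℝ ∞ (fun q : Pt => q b) := contDiff_apply ℝ ℝ b

theorem jb_contDiff : ContDiff ℝ ∞ jb := by
  refine ContDiff.sqrt ?_ fun p => ne_of_gt (by positivity)
  exact contDiff_const.add ((((coord_contDiff 1).pow 2).add ((coord_contDiff 2).pow 2)).add
    ((coord_contDiff 3).pow 2))

theorem pd_jb (a : Fin 4) (p : Pt) : pd a jb p = if a = 0 then 0 else p a / jb p := by
  have h : (fun q => jb q * jb q) = fun q : Pt => 1 + ((q 1 * q 1 + q 2 * q 2) + q 3 * q 3) := by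
    funext q; have := jb_sq q; nlinarith
  have hd := contDiff_differentiable jb_contDiff p
  have hc : ∀ b, DifferentiableAt ℝ (fun q : Pt => q b) p := fun b =>
    contDiff_differentiable (coord_contDiff b) p
  have h1 := pd_mul hd hd a
  have hm : ∀ b, DifferentiableAt ℝ (fun q : Pt => q b * q b) p := fun b => (hc b).mul (hc b)
  rw [h, pd_add (differentiableAt_const _) (((hm 1).fun_add (hm 2)).fun_add (hm 3)),
    pd_add ((hm 1).fun_add (hm 2)) (hm 3), pd_add (hm 1) (hm 2), pd_mul (hc 1) (hc 1),
    pd_mul (hc 2) (hc 2), pd_mul (hc 3) (hc 3)] at h1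
  simp only [pd_coord] at h1
  have hz : pd a (fun _ => (1 : ℝ)) p = 0 := by simp [pd]
  have := (jb_pos p).ne'
  rw [hz] at h1
  have h2 : pd a jb p * jb p = if a = 0 then 0 else p a := by
    fin_cases a <;> simp at h1 ⊢ <;> grind
  rw [← eq_div_iff this] at h2
  rw [h2]; split_ifs <;> simp

/-- The energy current of `ψ` for the metric coefficients `g`, with multiplier `∂_t`. -/
def cur (g : Fin 4 → Fin 4 → Pt → ℝ) (ψ : Pt → ℝ) (a : Fin 4) (p : Pt) : ℝ :=
  -((∑ c, g a c p * pd c ψ p) * pd 0 ψ p) +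
    (if a = 0 then 1 / 2 else 0) * ∑ b, ∑ c, g b c p * (pd b ψ p * pd c ψ p)

theorem cur_contDiff {g : Fin 4 → Fin 4 → Pt → ℝ} (hg : ∀ b c, ContDiff ℝ ∞ (g b c)) {ψ : Pt → ℝ}
    (hψ : ContDiff ℝ ∞ ψ) (a : Fin 4) : ContDiff ℝ ∞ (cur g ψ a) := by
  have hp := pd_contDiff hψ
  exact ((ContDiff.sum fun c _ => (hg a c).mul (hp c)).mul (hp 0)).neg.add
    (contDiff_const.mul (ContDiff.sum fun b _ => ContDiff.sum fun c _ =>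
      (hg b c).mul ((hp b).mul (hp c))))

theorem cur_div {g : Fin 4 → Fin 4 → Pt → ℝ} (hg : ∀ b c, ContDiff ℝ ∞ (g b c))
    (hsymm : ∀ b c, g b c = g c b) {ψ : Pt → ℝ} (hψ : ContDiff ℝ ∞ ψ) (p : Pt) :
    ∑ a, pd a (cur g ψ a) p = -(pd 0 ψ p * ∑ b, ∑ c, g b c p * pd b (pd c ψ) p)
      - (∑ b, ∑ c, pd b (g b c) p * pd c ψ p) * pd 0 ψ p
      + 1 / 2 * ∑ b, ∑ c, pd 0 (g b c) p * (pd b ψ p * pd c ψ p) := by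
  have hp := fun a => contDiff_differentiable (pd_contDiff hψ a) p
  have hG := fun a b => contDiff_differentiable (hg a b) p
  have hpp : ∀ b c, DifferentiableAt ℝ (fun q => pd b ψ q * pd c ψ q) p :=
    fun b c => (hp b).mul (hp c)
  have hs1 : ∀ b c, DifferentiableAt ℝ (fun q => g b c q * pd c ψ q) p :=
    fun b c => (hG b c).mul (hp c)
  have hs2 : ∀ b c, DifferentiableAt ℝ (fun q => g b c q * (pd b ψ q * pd c ψ q)) p :=
    fun b c => (hG b c).mul (hpp b c)
  have hs3 : ∀ a, DifferentiableAt ℝ (fun q => ∑ c, g a c q * pd c ψ q) p :=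
    fun a => DifferentiableAt.fun_sum fun c _ => hs1 a c
  have hs5 : ∀ b, DifferentiableAt ℝ (fun q => ∑ c, g b c q * (pd b ψ q * pd c ψ q)) p :=
    fun b => DifferentiableAt.fun_sum fun c _ => hs2 b c
  have hs4 : DifferentiableAt ℝ (fun q => ∑ b, ∑ c, g b c q * (pd b ψ q * pd c ψ q)) p :=
    DifferentiableAt.fun_sum fun b _ => hs5 b
  have key : ∀ a, pd a (cur g ψ a) p =
      -((∑ c, (pd a (g a c) p * pd c ψ p + g a c p * pd a (pd c ψ) p)) * pd 0 ψ p
        + (∑ c, g a c p * pd c ψ p) * pd a (pd 0 ψ) p)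
      + (if a = 0 then 1 / 2 else 0) * ∑ b, ∑ c, (pd a (g b c) p * (pd b ψ p * pd c ψ p)
        + g b c p * (pd a (pd b ψ) p * pd c ψ p + pd b ψ p * pd a (pd c ψ) p)) := by
    intro a
    have e : cur g ψ a = fun q => (-1) * ((∑ c, g a c q * pd c ψ q) * pd 0 ψ q) +
      (if a = 0 then 1 / 2 else 0) * ∑ b, ∑ c, g b c q * (pd b ψ q * pd c ψ q) := by
      funext q; rw [cur]; ring
    rw [e, pd_add (((hs3 a).fun_mul (hp 0)).const_mul _) (hs4.const_mul _),
      pd_const_mul ((hs3 a).fun_mul (hp 0)), pd_mul (hs3 a) (hp 0), pd_const_mul hs4,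
      pd_sum _ fun c _ => hs1 a c, pd_sum _ fun b _ => hs5 b]
    simp only [pd_sum _ fun c _ => hs2 _ c, pd_mul (hG _ _) (hpp _ _), pd_mul (hp _) (hp _),
      pd_mul (hG _ _) (hp _)]
    ring
  simp only [key]
  have h0 : ∀ a, pd a (pd 0 ψ) p = pd 0 (pd a ψ) p := fun a => pd_comm hψ a 0 p
  rw [Finset.sum_add_distrib]
  simp only [ite_mul, zero_mul, Finset.sum_ite_eq', Finset.mem_univ, if_true]
  simp only [Finset.sum_add_distrib, mul_add, Finset.sum_neg_distrib, h0, add_mul, Finset.sum_mul,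
    Finset.mul_sum]
  have e1 : ∑ b, ∑ c, (1 / 2 : ℝ) * (g b c p * (pd 0 (pd b ψ) p * pd c ψ p)) =
      1 / 2 * ∑ b, ∑ c, g b c p * pd c ψ p * pd 0 (pd b ψ) p := by
    simp only [Finset.mul_sum]
    exact Finset.sum_congr rfl fun b _ => Finset.sum_congr rfl fun c _ => by ring
  have e2 : ∑ b, ∑ c, (1 / 2 : ℝ) * (g b c p * (pd b ψ p * pd 0 (pd c ψ) p)) =
      1 / 2 * ∑ b, ∑ c, g b c p * pd c ψ p * pd 0 (pd b ψ) p := by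
    rw [Finset.sum_comm]
    simp only [Finset.mul_sum]
    exact Finset.sum_congr rfl fun b _ => Finset.sum_congr rfl fun c _ => by rw [hsymm c b]; ring
  have e3 : ∑ b, ∑ c, g b c p * pd b (pd c ψ) p * pd 0 ψ p =
      ∑ b, ∑ c, pd 0 ψ p * (g b c p * pd b (pd c ψ) p) :=
    Finset.sum_congr rfl fun b _ => Finset.sum_congr rfl fun c _ => by ring
  rw [e1, e2, e3]
  ring

/-- Sum of the squares of the coordinate derivatives. -/
def es (ψ : Pt → ℝ) (p : Pt) : ℝ := ∑ a, pd a ψ p ^ 2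

theorem es_nonneg (ψ : Pt → ℝ) (p : Pt) : 0 ≤ es ψ p := Finset.sum_nonneg fun _ _ => sq_nonneg _

theorem D1_sq_le_es (ψ : Pt → ℝ) (p : Pt) : D1 ψ p ^ 2 ≤ 4 * es ψ p := by
  have := sq_sum_le_card_mul_sum_sq (s := (Finset.univ : Finset (Fin 4)))
    (f := fun a => |pd a ψ p|)
  simpa [D1, es] using this

theorem es_le_D1_sq (ψ : Pt → ℝ) (p : Pt) : es ψ p ≤ D1 ψ p ^ 2 := by
  have h : ∀ a, pd a ψ p ^ 2 ≤ |pd a ψ p| * D1 ψ p := fun a => by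
    rw [← sq_abs, sq]
    exact mul_le_mul_of_nonneg_left (abs_pd_le_D1 ψ p a) (abs_nonneg _)
  calc es ψ p ≤ ∑ a, |pd a ψ p| * D1 ψ p := Finset.sum_le_sum fun a _ => h a
    _ = D1 ψ p ^ 2 := by rw [← Finset.sum_mul, sq]; rfl

/-- Cutoff to the truncated domain of dependence `2t + ⟨x⟩ < R`. -/
def cw (m R : ℝ) (p : Pt) : ℝ := Real.smoothTransition (m * (R - 2 * p 0 - jb p))

theorem cw_contDiff (m R : ℝ) : ContDiff ℝ ∞ (cw m R) :=
  Real.smoothTransition.contDiff.comp (contDiff_const.mul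
    ((contDiff_const.sub (contDiff_const.mul (coord_contDiff 0))).sub jb_contDiff))

theorem cw_nonneg (m R : ℝ) (p : Pt) : 0 ≤ cw m R p := Real.smoothTransition.nonneg _

theorem cw_le_one (m R : ℝ) (p : Pt) : cw m R p ≤ 1 := Real.smoothTransition.le_one _

theorem cw_eq_zero {m R : ℝ} (hm : 0 < m) {p : Pt} (h : R ≤ 2 * p 0 + jb p) : cw m R p = 0 :=
  Real.smoothTransition.zero_of_nonpos (mul_nonpos_of_nonneg_of_nonpos hm.le (by linarith))

theorem cw_eq_one {m R : ℝ} {p : Pt} (h : 1 ≤ m * (R - 2 * p 0 - jb p)) : cw m R p = 1 :=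
  Real.smoothTransition.one_of_one_le h

theorem exists_pd_cw {m : ℝ} (hm : 0 ≤ m) (R : ℝ) (p : Pt) :
    ∃ k, 0 ≤ k ∧ ∀ a, pd a (cw m R) p = k * (nul p a - if a = 0 then 3 else 0) := by
  have hχ : Differentiable ℝ Real.smoothTransition :=
    (Real.smoothTransition.contDiff (n := 1)).differentiable (by simp)
  have hd0 := contDiff_differentiable (coord_contDiff 0) p
  have hdj := contDiff_differentiable jb_contDiff p
  have hs : DifferentiableAt ℝ (fun q : Pt => R - 2 * q 0) p :=
    (differentiableAt_const _).sub (hd0.const_mul _)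
  have hg : DifferentiableAt ℝ (fun q : Pt => R - 2 * q 0 - jb q) p := hs.fun_sub hdj
  refine ⟨m * deriv Real.smoothTransition (m * (R - 2 * p 0 - jb p)),
    mul_nonneg hm Real.smoothTransition.monotone.deriv_nonneg, fun a => ?_⟩
  rw [show cw m R = fun q => Real.smoothTransition (m * (R - 2 * q 0 - jb q)) from rfl,
    pd_comp (hχ _) (hg.const_mul m), pd_const_mul hg, pd_sub hs hdj,
    pd_sub (differentiableAt_const _) (hd0.const_mul _), pd_const_mul hd0, pd_coord, pd_jb]
  have hz : pd a (fun _ => R) p = 0 := by simp [pd]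
  rw [hz, nul]
  by_cases h : a = 0
  · subst h; simp; ring
  · simp [h, Ne.symm h]; ring

/-- Coefficients of the Minkowski metric. -/
def mg (b c : Fin 4) : ℝ := if b = c then (if b = 0 then -1 else 1) else 0

/-- Perturbation of the metric coefficients produced by the quasilinear term. -/
def hm (F : Fin 4 → Fin 4 → Fin 4 → ℝ) (f : Pt → ℝ) (b c : Fin 4) (p : Pt) : ℝ :=
  ∑ a, (F a b c + F a c b) / 2 * pd a f p

theorem hm_contDiff (F : Fin 4 → Fin 4 → Fin 4 → ℝ) {f : Pt → ℝ} (hf : ContDiff ℝ ∞ f)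
    (b c : Fin 4) : ContDiff ℝ ∞ (hm F f b c) :=
  ContDiff.sum fun a _ => contDiff_const.mul (pd_contDiff hf a)

theorem abs_coeff_le (F : Fin 4 → Fin 4 → Fin 4 → ℝ) (a b c : Fin 4) :
    |(F a b c + F a c b) / 2| ≤ ∑ a, ∑ b, ∑ c, |F a b c| := by
  have h : ∀ b c, |F a b c| ≤ ∑ a, ∑ b, ∑ c, |F a b c| := fun b c =>
    (Finset.single_le_sum (f := fun c => |F a b c|) (fun _ _ => abs_nonneg _)
      (Finset.mem_univ c)).trans <|
    (Finset.single_le_sum (f := fun b => ∑ c, |F a b c|)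
      (fun _ _ => Finset.sum_nonneg fun _ _ => abs_nonneg _) (Finset.mem_univ b)).trans <|
    Finset.single_le_sum (f := fun a => ∑ b, ∑ c, |F a b c|)
      (fun _ _ => Finset.sum_nonneg fun _ _ => Finset.sum_nonneg fun _ _ => abs_nonneg _)
      (Finset.mem_univ a)
  rw [abs_div, abs_two, div_le_iff₀ two_pos]
  linarith [abs_add_le (F a b c) (F a c b), h b c, h c b]

theorem abs_hm_le (F : Fin 4 → Fin 4 → Fin 4 → ℝ) (f : Pt → ℝ) (b c : Fin 4) (p : Pt) :
    |hm F f b c p| ≤ (∑ a, ∑ b, ∑ c, |F a b c|) * D1 f p := by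
  rw [D1, Finset.mul_sum]
  refine (Finset.abs_sum_le_sum_abs _ _).trans (Finset.sum_le_sum fun a _ => ?_)
  rw [abs_mul]
  exact mul_le_mul_of_nonneg_right (abs_coeff_le F a b c) (abs_nonneg _)

theorem abs_pd_hm_le (F : Fin 4 → Fin 4 → Fin 4 → ℝ) {f : Pt → ℝ} (hf : ContDiff ℝ ∞ f)
    (d b c : Fin 4) (p : Pt) :
    |pd d (hm F f b c) p| ≤ (∑ a, ∑ b, ∑ c, |F a b c|) * D2 f p := by
  have hd := fun a => contDiff_differentiable (pd_contDiff hf a) p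
  have e : pd d (hm F f b c) p = ∑ a, (F a b c + F a c b) / 2 * pd d (pd a f) p := by
    have : hm F f b c = fun q => ∑ a, (F a b c + F a c b) / 2 * pd a f q := rfl
    rw [this, pd_sum _ fun a _ => (hd a).const_mul _]
    exact Finset.sum_congr rfl fun a _ => pd_const_mul (hd a) _ _
  rw [e, D2, Finset.mul_sum]
  refine (Finset.abs_sum_le_sum_abs _ _).trans (Finset.sum_le_sum fun a _ => ?_)
  rw [abs_mul]
  exact mul_le_mul (abs_coeff_le F a b c) (abs_pd_le_D1 _ p d) (abs_nonneg _)
    (Finset.sum_nonneg fun _ _ => Finset.sum_nonneg fun _ _ => Finset.sum_nonneg fun _ _ =>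
      abs_nonneg _)

theorem cur_add (g h : Fin 4 → Fin 4 → Pt → ℝ) (ψ : Pt → ℝ) (a : Fin 4) (p : Pt) :
    cur (fun b c q => g b c q + h b c q) ψ a p = cur g ψ a p + cur h ψ a p := by
  simp only [cur, add_mul, Finset.sum_add_distrib]; ring

theorem cur_mg_zero (ψ : Pt → ℝ) (p : Pt) : cur (fun b c _ => mg b c) ψ 0 p = es ψ p / 2 := by
  simp [cur, mg, es, Fin.sum_univ_four]; ring

theorem cur_mg_succ (ψ : Pt → ℝ) (p : Pt) (i : Fin 3) :
    cur (fun b c _ => mg b c) ψ i.succ p = -(pd i.succ ψ p * pd 0 ψ p) := by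
  simp [cur, mg]

theorem sum_sum_abs_le {h : Fin 4 → Fin 4 → ℝ} {η : ℝ} (hη : ∀ b c, |h b c| ≤ η) (ψ : Pt → ℝ)
    (p : Pt) : |∑ b, ∑ c, h b c * (pd b ψ p * pd c ψ p)| ≤ 4 * η * es ψ p := by
  have h0 : 0 ≤ η := (abs_nonneg _).trans (hη 0 0)
  calc |∑ b, ∑ c, h b c * (pd b ψ p * pd c ψ p)|
      ≤ ∑ b, ∑ c, η * (|pd b ψ p| * |pd c ψ p|) :=
        (Finset.abs_sum_le_sum_abs _ _).trans <| Finset.sum_le_sum fun b _ =>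
          (Finset.abs_sum_le_sum_abs _ _).trans <| Finset.sum_le_sum fun c _ => by
            rw [abs_mul, abs_mul]
            exact mul_le_mul_of_nonneg_right (hη b c) (by positivity)
    _ = η * D1 ψ p ^ 2 := by
        simp only [← Finset.mul_sum, ← Finset.sum_mul, sq]; rfl
    _ ≤ η * (4 * es ψ p) := mul_le_mul_of_nonneg_left (D1_sq_le_es ψ p) h0
    _ = _ := by ring

theorem abs_sum_mul_pd_zero_le {h : Fin 4 → ℝ} {η : ℝ} (hη : ∀ c, |h c| ≤ η) (ψ : Pt → ℝ)
    (p : Pt) : |(∑ c, h c * pd c ψ p) * pd 0 ψ p| ≤ 4 * η * es ψ p := by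
  have h0 : 0 ≤ η := (abs_nonneg _).trans (hη 0)
  have := sum_sum_abs_le (h := fun b c => if b = 0 then h c else 0) (η := η)
    (fun b c => by split_ifs; exacts [hη c, by simpa using h0]) ψ p
  rw [Finset.sum_eq_single (M := ℝ) 0 (fun b _ hb => by simp [hb]) (by simp)] at this
  refine (congrArg abs ?_).trans_le this
  rw [Finset.sum_mul]
  exact Finset.sum_congr rfl fun c _ => by simp; ring

theorem abs_cur_le {h : Fin 4 → Fin 4 → Pt → ℝ} {η : ℝ} {p : Pt} (hη : ∀ b c, |h b c p| ≤ η)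
    (ψ : Pt → ℝ) (a : Fin 4) : |cur h ψ a p| ≤ 6 * η * es ψ p := by
  have h1 := abs_sum_mul_pd_zero_le (hη a) ψ p
  have h2 := sum_sum_abs_le hη ψ p
  have h3 : |(if a = 0 then 1 / 2 else 0 : ℝ)| ≤ 1 / 2 := by split_ifs <;> norm_num
  have h4 := mul_le_mul h3 h2 (abs_nonneg _) (by norm_num)
  rw [← abs_mul] at h4
  rw [cur]
  refine (abs_add_le _ _).trans ?_
  rw [abs_neg]
  linarith

theorem inv_jb_sq (p : Pt) : (jb p ^ 2)⁻¹ = 1 - (nul p 1 ^ 2 + nul p 2 ^ 2 + nul p 3 ^ 2) := by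
  have : jb p ^ 2 * (jb p ^ 2)⁻¹ = 1 := mul_inv_cancel₀ (pow_ne_zero 2 (jb_pos p).ne')
  simp [nul, div_eq_mul_inv, mul_pow]
  linear_combination this - (jb p ^ 2)⁻¹ * jb_sq p

theorem sum_nul_cur_mg (ψ : Pt → ℝ) (p : Pt) :
    ∑ a, nul p a * cur (fun b c _ => mg b c) ψ a p =
      (∑ a, Tg a ψ p ^ 2 + (jb p ^ 2)⁻¹ * pd 0 ψ p ^ 2) / 2 := by
  have h0 : nul p 0 = 1 := rfl
  have c1 := cur_mg_succ ψ p 0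
  have c2 := cur_mg_succ ψ p 1
  have c3 := cur_mg_succ ψ p 2
  simp only [Fin.sum_univ_four, cur_mg_zero, Tg, inv_jb_sq, h0, es]
  change cur _ ψ 1 p = -(pd 1 ψ p * pd 0 ψ p) at c1
  change cur _ ψ 2 p = -(pd 2 ψ p * pd 0 ψ p) at c2
  change cur _ ψ 3 p = -(pd 3 ψ p * pd 0 ψ p) at c3
  rw [c1, c2, c3]
  ring

/-- The perturbed metric coefficients. -/
def gm (F : Fin 4 → Fin 4 → Fin 4 → ℝ) (f : Pt → ℝ) (b c : Fin 4) (p : Pt) : ℝ :=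
  mg b c + hm F f b c p

theorem gm_contDiff (F : Fin 4 → Fin 4 → Fin 4 → ℝ) {f : Pt → ℝ} (hf : ContDiff ℝ ∞ f)
    (b c : Fin 4) : ContDiff ℝ ∞ (gm F f b c) := contDiff_const.add (hm_contDiff F hf b c)

theorem sum_gm (F : Fin 4 → Fin 4 → Fin 4 → ℝ) (f : Pt → ℝ) {ψ : Pt → ℝ} (hψ : ContDiff ℝ ∞ ψ)
    (p : Pt) : ∑ b, ∑ c, gm F f b c p * pd b (pd c ψ) p = box ψ p + nf3 F f ψ p := by
  have e1 : ∑ b, ∑ c, mg b c * pd b (pd c ψ) p = box ψ p := by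
    simp [mg, box, Fin.sum_univ_four]
  have e2 : ∑ b, ∑ c, hm F f b c p * pd b (pd c ψ) p = nf3 F f ψ p := by
    have hsw : ∑ a, ∑ b, ∑ c, F a c b * pd a f p * pd b (pd c ψ) p = nf3 F f ψ p := by
      rw [nf3]
      refine Finset.sum_congr rfl fun a _ => ?_
      rw [Finset.sum_comm]
      exact Finset.sum_congr rfl fun b _ => Finset.sum_congr rfl fun c _ => by rw [pd_comm hψ]
    have : ∑ b, ∑ c, hm F f b c p * pd b (pd c ψ) p =
        1 / 2 * nf3 F f ψ p + 1 / 2 * ∑ a, ∑ b, ∑ c, F a c b * pd a f p * pd b (pd c ψ) p := by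
      simp only [hm, nf3, Finset.sum_mul, Finset.mul_sum, ← Finset.sum_add_distrib]
      calc _ = ∑ b, ∑ a, ∑ c, (F a b c + F a c b) / 2 * pd a f p * pd b (pd c ψ) p :=
            Finset.sum_congr rfl fun b _ => Finset.sum_comm
        _ = _ := by
            rw [Finset.sum_comm]
            exact Finset.sum_congr rfl fun a _ => Finset.sum_congr rfl fun b _ =>
              Finset.sum_congr rfl fun c _ => by ring
    rw [this, hsw]; ring
  simp only [gm, add_mul, Finset.sum_add_distrib, e1, e2]

theorem pd_weight_mul {W : Pt → ℝ} (hW : ContDiff ℝ ∞ W) {J : Fin 4 → Pt → ℝ}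
    (hJ : ∀ a, ContDiff ℝ ∞ (J a)) (p : Pt) :
    ∑ a, pd a (fun q => W q * J a q) p = ∑ a, pd a W p * J a p + W p * ∑ a, pd a (J a) p := by
  rw [Finset.mul_sum, ← Finset.sum_add_distrib]
  exact Finset.sum_congr rfl fun a _ =>
    pd_mul (contDiff_differentiable hW p) (contDiff_differentiable (hJ a) p) a

theorem sum_nul_sub_cur_mg_le (ψ : Pt → ℝ) (p : Pt) :
    ∑ a, (nul p a - if a = 0 then 3 else 0) * cur (fun b c _ => mg b c) ψ a p ≤ -(es ψ p / 2) := by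
  have h := sum_nul_cur_mg ψ p
  have h1 : ∑ a, Tg a ψ p ^ 2 + (jb p ^ 2)⁻¹ * pd 0 ψ p ^ 2 ≤ 2 * es ψ p := by
    have e : ∑ a, Tg a ψ p ^ 2 + (jb p ^ 2)⁻¹ * pd 0 ψ p ^ 2 +
        ∑ a : Fin 3, (pd a.succ ψ p + nul p a.succ * pd 0 ψ p) ^ 2 +
          (jb p ^ 2)⁻¹ * pd 0 ψ p ^ 2 = 2 * es ψ p := by
      have h0 : nul p 0 = 1 := rfl
      rw [inv_jb_sq]
      simp only [Fin.sum_univ_four, Fin.sum_univ_three, Tg, es, h0]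
      change _ + ((pd 1 ψ p + nul p 1 * pd 0 ψ p) ^ 2 + (pd 2 ψ p + nul p 2 * pd 0 ψ p) ^ 2
        + (pd 3 ψ p + nul p 3 * pd 0 ψ p) ^ 2) + _ = _
      ring
    have : 0 ≤ ∑ a : Fin 3, (pd a.succ ψ p + nul p a.succ * pd 0 ψ p) ^ 2 :=
      Finset.sum_nonneg fun _ _ => sq_nonneg _
    have : 0 ≤ (jb p ^ 2)⁻¹ * pd 0 ψ p ^ 2 := by positivity
    linarith
  simp only [sub_mul, Finset.sum_sub_distrib, h, ite_mul, zero_mul, Finset.sum_ite_eq',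
    Finset.mem_univ, if_true, cur_mg_zero]
  linarith

section
variable {F : Fin 4 → Fin 4 → Fin 4 → ℝ} {f ψ : Pt → ℝ} {p : Pt}

theorem abs_cur_hm_le (h : (∑ a, ∑ b, ∑ c, |F a b c|) * D1 f p ≤ 1 / 60) (a : Fin 4) :
    |cur (hm F f) ψ a p| ≤ es ψ p / 10 := by
  have := abs_cur_le (fun b c => (abs_hm_le F f b c p).trans h) ψ a
  linarith

theorem cur_gm_bounds (h : (∑ a, ∑ b, ∑ c, |F a b c|) * D1 f p ≤ 1 / 60) :
    es ψ p / 4 ≤ cur (gm F f) ψ 0 p ∧ cur (gm F f) ψ 0 p ≤ es ψ p := by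
  have h1 := abs_le.1 (abs_cur_hm_le (ψ := ψ) h 0)
  have h2 := es_nonneg ψ p
  have e : cur (gm F f) ψ 0 p = _ := cur_add (fun b c _ => mg b c) (hm F f) ψ 0 p
  rw [e, cur_mg_zero]
  constructor <;> linarith [h1.1, h1.2]

/-- Divergence of the cut-off energy current of the quasilinear equation. -/
theorem div_cw_cur_gm_le (hf : ContDiff ℝ ∞ f) (hψ : ContDiff ℝ ∞ ψ) {m R : ℝ} (hm0 : 0 ≤ m)
    (h : (∑ a, ∑ b, ∑ c, |F a b c|) * D1 f p ≤ 1 / 60) :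
    ∑ a, pd a (fun q => cw m R q * cur (gm F f) ψ a q) p ≤
      cw m R p * (|pd 0 ψ p| * |box ψ p + nf3 F f ψ p| +
        18 * (∑ a, ∑ b, ∑ c, |F a b c|) * D2 f p * es ψ p) := by
  set S := ∑ a, ∑ b, ∑ c, |F a b c| with hS
  have hg := gm_contDiff F hf
  have he := es_nonneg ψ p
  rw [pd_weight_mul (cw_contDiff m R) (cur_contDiff hg hψ)]
  obtain ⟨k, hk, hkd⟩ := exists_pd_cw hm0 R p
  have h1 : ∑ a, pd a (cw m R) p * cur (gm F f) ψ a p ≤ 0 := by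
    have e : ∑ a, pd a (cw m R) p * cur (gm F f) ψ a p =
        k * (∑ a, (nul p a - if a = 0 then 3 else 0) * cur (fun b c _ => mg b c) ψ a p +
          ∑ a, (nul p a - if a = 0 then 3 else 0) * cur (hm F f) ψ a p) := by
      rw [← Finset.sum_add_distrib, Finset.mul_sum]
      refine Finset.sum_congr rfl fun a _ => ?_
      rw [hkd, show cur (gm F f) ψ a p = _ from cur_add (fun b c _ => mg b c) (hm F f) ψ a p]
      ring
    rw [e]
    refine mul_nonpos_of_nonneg_of_nonpos hk ?_
    have h2 := sum_nul_sub_cur_mg_le ψ p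
    have h3 : ∀ a : Fin 4, (nul p a - if a = 0 then 3 else 0) * cur (hm F f) ψ a p ≤
        (if a = 0 then 2 else 1) * (es ψ p / 10) := by
      intro a
      have hb : |nul p a - if a = 0 then 3 else 0| ≤ if a = 0 then 2 else 1 := by
        by_cases ha : a = 0
        · subst ha; simp [nul]; norm_num
        · simpa [ha] using abs_nul_le p a
      refine (le_abs_self _).trans ?_
      rw [abs_mul]
      exact mul_le_mul hb (abs_cur_hm_le h a) (abs_nonneg _) (by split_ifs <;> norm_num)
    have h4 := Finset.sum_le_sum fun a (_ : a ∈ Finset.univ) => h3 a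
    have h5 : ∑ a : Fin 4, (if a = 0 then 2 else 1 : ℝ) * (es ψ p / 10) = es ψ p / 2 := by
      simp [Fin.sum_univ_four]; ring
    linarith
  have hsymm : ∀ b c, gm F f b c = gm F f c b := fun b c => by
    funext q
    simp only [gm, hm, mg, eq_comm (a := b) (b := c)]
    congr 1
    · by_cases hbc : c = b <;> simp [hbc]
    · exact Finset.sum_congr rfl fun a _ => by ring
  have hpdg : ∀ d b c, pd d (gm F f b c) p = pd d (hm F f b c) p := fun d b c => by
    have := pd_add (differentiableAt_const (mg b c))
      (contDiff_differentiable (hm_contDiff F hf b c) p) d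
    rw [show gm F f b c = fun q => mg b c + hm F f b c q from rfl, this]; simp [pd]
  rw [cur_div hg hsymm hψ, sum_gm F f hψ]
  simp only [hpdg]
  have h6 : |∑ b, ∑ c, pd 0 (hm F f b c) p * (pd b ψ p * pd c ψ p)| ≤ 4 * (S * D2 f p) * es ψ p :=
    sum_sum_abs_le (h := fun b c => pd 0 (hm F f b c) p) (fun b c => abs_pd_hm_le F hf 0 b c p) ψ p
  have h7 : |(∑ b, ∑ c, pd b (hm F f b c) p * pd c ψ p) * pd 0 ψ p| ≤
      4 * (4 * (S * D2 f p) * es ψ p) := by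
    rw [Finset.sum_mul]
    refine (Finset.abs_sum_le_sum_abs _ _).trans ((Finset.sum_le_sum fun b _ =>
      abs_sum_mul_pd_zero_le (fun c => abs_pd_hm_le F hf b b c p) ψ p).trans (le_of_eq ?_))
    rw [Finset.sum_const, ← hS]; simp
  have h8 : -(pd 0 ψ p * (box ψ p + nf3 F f ψ p)) ≤ |pd 0 ψ p| * |box ψ p + nf3 F f ψ p| := by
    rw [← abs_mul]; exact neg_le_abs _
  have h9 := mul_le_mul_of_nonneg_left
    (show -(pd 0 ψ p * (box ψ p + nf3 F f ψ p))
      - (∑ b, ∑ c, pd b (hm F f b c) p * pd c ψ p) * pd 0 ψ p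
      + 1 / 2 * ∑ b, ∑ c, pd 0 (hm F f b c) p * (pd b ψ p * pd c ψ p) ≤
      |pd 0 ψ p| * |box ψ p + nf3 F f ψ p| + 18 * S * D2 f p * es ψ p by
      have := (abs_le.1 h6).2; have := (abs_le.1 h7).1; linarith) (cw_nonneg m R p)
  linarith
end

/-- The ghost weight. -/
def gw (p : Pt) : ℝ := 3 - Real.arctan (p 0 - jb p)

theorem gw_contDiff : ContDiff ℝ ∞ gw :=
  contDiff_const.sub (Real.contDiff_arctan.comp ((coord_contDiff 0).sub jb_contDiff))

theorem one_le_gw (p : Pt) : 1 ≤ gw p := by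
  have := Real.arctan_lt_pi_div_two (p 0 - jb p); have := Real.pi_lt_d2; rw [gw]; linarith

theorem gw_le (p : Pt) : gw p ≤ 5 := by
  have := Real.neg_pi_div_two_lt_arctan (p 0 - jb p); have := Real.pi_lt_d2; rw [gw]; linarith

theorem pd_gw (a : Fin 4) (p : Pt) :
    pd a gw p = -(1 / (1 + (p 0 - jb p) ^ 2)) * nul p a := by
  have hd0 := contDiff_differentiable (coord_contDiff 0) p
  have hdj := contDiff_differentiable jb_contDiff p
  have hd := hd0.fun_sub hdj
  rw [show gw = fun q => 3 - Real.arctan (q 0 - jb q) from rfl,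
    pd_sub (differentiableAt_const _) ((Real.differentiableAt_arctan _).fun_comp' p hd),
    pd_comp (Real.differentiable_arctan _) hd, pd_sub hd0 hdj, pd_coord, pd_jb]
  have hz : pd a (fun _ => (3 : ℝ)) p = 0 := by simp [pd]
  rw [hz, nul, Real.deriv_arctan]
  by_cases h : a = 0
  · subst h; simp
  · simp [h, Ne.symm h]

theorem one_add_sq_le_uu (p : Pt) : 1 + (p 0 - jb p) ^ 2 ≤ 2 * uu p ^ 2 := by
  have h1 := one_le_uu p
  have h2 : |p 0 - jb p| ≤ uu p := by
    have a1 := jb_le p; have a2 := rr_le_jb p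
    have a3 := le_abs_self (p 0 - rr p)
    have a4 := neg_abs_le (p 0 - rr p)
    rw [uu, abs_le]; constructor <;> linarith
  have h3 := sq_le_sq' (by linarith [(abs_le.1 h2).1]) (abs_le.1 h2).2
  nlinarith

/-- Divergence of the cut-off and ghost-weighted flat energy current. -/
theorem div_ghost_le {ψ : Pt → ℝ} (hψ : ContDiff ℝ ∞ ψ) {m R : ℝ} (hm0 : 0 ≤ m) (p : Pt) :
    ∑ a, pd a (fun q => cw m R q * gw q * cur (fun b c _ => mg b c) ψ a q) p ≤
      cw m R p * (5 * (|pd 0 ψ p| * |box ψ p|) -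
        1 / 4 * (uu p ^ 2)⁻¹ * (∑ a, Tg a ψ p ^ 2 + (jb p ^ 2)⁻¹ * pd 0 ψ p ^ 2)) := by
  set E := ∑ a, Tg a ψ p ^ 2 + (jb p ^ 2)⁻¹ * pd 0 ψ p ^ 2 with hE
  have hE0 : 0 ≤ E := by positivity
  have hg : ∀ b c : Fin 4, ContDiff ℝ ∞ (fun _ : Pt => mg b c) := fun _ _ => contDiff_const
  have hsymm : ∀ b c : Fin 4, (fun _ : Pt => mg b c) = fun _ => mg c b := fun b c => by
    funext q; simp only [mg]; by_cases hbc : b = c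
    · rw [hbc]
    · rw [if_neg hbc, if_neg (Ne.symm hbc)]
  have hz : ∀ d b c : Fin 4, pd d (fun _ => mg b c) p = 0 := fun d b c => by simp [pd]
  have hbox : ∑ b, ∑ c, mg b c * pd b (pd c ψ) p = box ψ p := by
    simp [mg, box, Fin.sum_univ_four]
  rw [pd_weight_mul ((cw_contDiff m R).mul gw_contDiff) (cur_contDiff hg hψ),
    cur_div hg hsymm hψ]
  simp only [hz, hbox, zero_mul, Finset.sum_const_zero, mul_zero, sub_zero, add_zero]
  obtain ⟨k, hk, hkd⟩ := exists_pd_cw hm0 R p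
  have hw := one_le_gw p
  have e : ∑ a, pd a (fun q => cw m R q * gw q) p * cur (fun b c _ => mg b c) ψ a p =
      gw p * k * (∑ a, (nul p a - if a = 0 then 3 else 0) * cur (fun b c _ => mg b c) ψ a p) -
        cw m R p * (1 / (1 + (p 0 - jb p) ^ 2)) *
          ∑ a, nul p a * cur (fun b c _ => mg b c) ψ a p := by
    rw [Finset.mul_sum, Finset.mul_sum, ← Finset.sum_sub_distrib]
    refine Finset.sum_congr rfl fun a _ => ?_
    rw [pd_mul (contDiff_differentiable (cw_contDiff m R) p)
      (contDiff_differentiable gw_contDiff p), hkd, pd_gw]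
    ring
  have h1 : gw p * k * (∑ a, (nul p a - if a = 0 then 3 else 0) *
      cur (fun b c _ => mg b c) ψ a p) ≤ 0 :=
    mul_nonpos_of_nonneg_of_nonpos (by positivity)
      ((sum_nul_sub_cur_mg_le ψ p).trans (by linarith [es_nonneg ψ p]))
  have h2 : 1 / 2 * (uu p ^ 2)⁻¹ ≤ 1 / (1 + (p 0 - jb p) ^ 2) := by
    rw [one_div, ← mul_inv, ← one_div]
    exact one_div_le_one_div_of_le (by positivity) (one_add_sq_le_uu p)
  have h3 := mul_le_mul_of_nonneg_left (mul_le_mul_of_nonneg_right h2 hE0) (cw_nonneg m R p)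
  have h4 : -(gw p * (pd 0 ψ p * box ψ p)) ≤ 5 * (|pd 0 ψ p| * |box ψ p|) := by
    refine (neg_le_abs _).trans ?_
    rw [abs_mul, abs_mul, abs_of_nonneg (by linarith)]
    exact mul_le_mul_of_nonneg_right (gw_le p) (by positivity)
  have h5 := mul_le_mul_of_nonneg_left h4 (cw_nonneg m R p)
  rw [e, sum_nul_cur_mg, ← hE]
  nlinarith

theorem abs_le_integral_of_ray {φ φ1 φ2 g : ℝ → ℝ} (h1 : ∀ s, HasDerivAt φ (φ1 s) s)
    (h2 : ∀ s, HasDerivAt φ1 (φ2 s) s) (hg : Continuous g)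
    (hb : ∀ s ∈ Set.Icc (0 : ℝ) 1, |φ s| ≤ g s ∧ |φ1 s| ≤ g s ∧ |φ2 s| ≤ g s) :
    |φ 0| ≤ ∫ σ in (0 : ℝ)..1, 14 * σ ^ 3 * g (σ ^ 2) := by
  have hw : ∀ s, HasDerivAt (fun s : ℝ => 1 - s) (-1) s := fun s => by
    simpa using (hasDerivAt_id s).const_sub 1
  -- for `ψ s = (1 - s)² φ s`, differentiate `s ↦ s * deriv ψ s - ψ s`
  have hP : ∀ s, HasDerivAt (fun s => s * ((1 - s) ^ 2 * φ1 s - 2 * (1 - s) * φ s)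
      - (1 - s) ^ 2 * φ s) (s * ((1 - s) ^ 2 * φ2 s - 4 * (1 - s) * φ1 s + 2 * φ s)) s := by
    intro s
    refine ((((hasDerivAt_id s).mul ((((hw s).pow 2).mul (h2 s)).sub
      (((hw s).const_mul 2).mul (h1 s)))).sub (((hw s).pow 2).mul (h1 s)))).congr_deriv ?_
    simp; ring
  have hQ : ∀ σ, HasDerivAt (fun σ : ℝ => σ ^ 2 * ((1 - σ ^ 2) ^ 2 * φ1 (σ ^ 2) - 2 * (1 - σ ^ 2) *
      φ (σ ^ 2)) - (1 - σ ^ 2) ^ 2 * φ (σ ^ 2)) (2 * σ * (σ ^ 2 * ((1 - σ ^ 2) ^ 2 * φ2 (σ ^ 2)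
      - 4 * (1 - σ ^ 2) * φ1 (σ ^ 2) + 2 * φ (σ ^ 2)))) σ := by
    intro σ
    refine ((hP (σ ^ 2)).comp σ (hasDerivAt_pow 2 σ)).congr_deriv ?_
    simp; ring
  have hc : Continuous fun σ : ℝ => 14 * σ ^ 3 * g (σ ^ 2) := by fun_prop
  have hB : ∀ σ, HasDerivAt (fun σ => ∫ τ in (0 : ℝ)..σ, 14 * τ ^ 3 * g (τ ^ 2))
      (14 * σ ^ 3 * g (σ ^ 2)) σ := by
    intro σ
    exact (hc.integral_hasStrictDerivAt 0 σ).hasDerivAt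
  have key := image_norm_le_of_norm_deriv_right_le_deriv_boundary (a := 0) (b := 1)
    (f := fun σ : ℝ => (σ ^ 2 * ((1 - σ ^ 2) ^ 2 * φ1 (σ ^ 2) - 2 * (1 - σ ^ 2) * φ (σ ^ 2))
      - (1 - σ ^ 2) ^ 2 * φ (σ ^ 2)) + φ 0)
    (fun σ _ => ((hQ σ).add_const (φ 0)).continuousAt.continuousWithinAt)
    (fun σ _ => ((hQ σ).add_const (φ 0)).hasDerivWithinAt) (B := fun σ =>
      ∫ τ in (0 : ℝ)..σ, 14 * τ ^ 3 * g (τ ^ 2)) (by simp) hB ?_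
    (x := 1) (by simp)
  · simpa using key
  · intro σ hσ
    have h0 := hσ.1
    have hs : σ ^ 2 ∈ Set.Icc (0 : ℝ) 1 := ⟨by positivity, by nlinarith [hσ.2]⟩
    obtain ⟨b0, b1, b2⟩ := hb _ hs
    have hg0 : 0 ≤ g (σ ^ 2) := (abs_nonneg _).trans b0
    set w := 1 - σ ^ 2 with hw
    have hw0 : 0 ≤ w := by linarith [hs.2]
    have hw1 : w ≤ 1 := by linarith [hs.1]
    have e2 : |w ^ 2 * φ2 (σ ^ 2)| ≤ g (σ ^ 2) := by
      rw [abs_mul, abs_of_nonneg (by positivity : 0 ≤ w ^ 2)]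
      exact (mul_le_of_le_one_left (abs_nonneg _) (by nlinarith)).trans b2
    have e1 : |4 * w * φ1 (σ ^ 2)| ≤ 4 * g (σ ^ 2) := by
      rw [abs_mul, abs_of_nonneg (by positivity : 0 ≤ 4 * w)]
      exact mul_le_mul (by linarith) b1 (abs_nonneg _) (by norm_num)
    have e0 : |2 * φ (σ ^ 2)| ≤ 2 * g (σ ^ 2) := by rw [abs_mul, abs_two]; linarith
    have e : |w ^ 2 * φ2 (σ ^ 2) - 4 * w * φ1 (σ ^ 2) + 2 * φ (σ ^ 2)| ≤ 7 * g (σ ^ 2) :=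
      (abs_add_le _ _).trans (by linarith [abs_sub (w ^ 2 * φ2 (σ ^ 2)) (4 * w * φ1 (σ ^ 2))])
    rw [Real.norm_eq_abs, abs_mul (2 * σ), abs_mul (σ ^ 2), abs_of_nonneg (by positivity : 0 ≤ 2 * σ),
      abs_of_nonneg hs.1]
    calc _ ≤ 2 * σ * (σ ^ 2 * (7 * g (σ ^ 2))) := by gcongr
      _ = _ := by ring

theorem setIntegral_cube_smul_le {g : Sp → ℝ} (hg : Continuous g) (hg0 : ∀ y, 0 ≤ g y) {s : ℝ}
    (h0 : 0 ≤ s) (h1 : s ≤ 1) :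
    s ^ 3 * ∫ y in Set.Icc (0 : Sp) 1, g (s • y) ≤ ∫ y in Set.Icc (0 : Sp) 1, g y := by
  rcases h0.eq_or_lt with rfl | hs
  · simpa using setIntegral_nonneg measurableSet_Icc fun y _ => hg0 y
  have h := Measure.setIntegral_comp_smul_of_pos (volume : Measure Sp) g (Set.Icc (0 : Sp) 1) hs
  rw [h]
  have e : Module.finrank ℝ Sp = 3 := by simp
  rw [e, smul_eq_mul, ← mul_assoc, mul_inv_cancel₀ (by positivity), one_mul]
  refine setIntegral_mono_set (hg.continuousOn.integrableOn_compact isCompact_Icc)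
    (Filter.Eventually.of_forall hg0) (LE.le.eventuallyLE ?_)
  rintro _ ⟨y, hy, rfl⟩
  refine ⟨fun i => mul_nonneg h0 (hy.1 i), fun i => ?_⟩
  exact mul_le_one₀ h1 (hy.1 i) (hy.2 i)

theorem sq_le_integral_cube {g : Sp → ℝ} (hg : Continuous g) {h0 : ℝ}
    (h : ∀ y ∈ Set.Icc (0 : Sp) 1, |h0| ≤ ∫ σ in (0 : ℝ)..1, 14 * σ ^ 3 * g (σ ^ 2 • y)) :
    h0 ^ 2 ≤ 196 * ∫ y in Set.Icc (0 : Sp) 1, g y ^ 2 := by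
  set A := ∫ y in Set.Icc (0 : Sp) 1, g y ^ 2 with hA
  have hA0 : 0 ≤ A := setIntegral_nonneg measurableSet_Icc fun y _ => sq_nonneg _
  have hvol : volume.real (Set.Icc (0 : Sp) 1) = 1 := by
    simp [Measure.real, Real.volume_Icc_pi]
  set ν := (volume : Measure ℝ).restrict (Set.Ioc 0 1) with hν
  set μ := (volume : Measure Sp).restrict (Set.Icc 0 1) with hμ
  have : IsFiniteMeasure μ := ⟨by simp [hμ, Real.volume_Icc_pi]⟩
  have key : ∀ l : ℝ, 0 < l → |h0| ≤ 7 * (l + l⁻¹ * A) := by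
    intro l hl
    set G : Sp → ℝ → ℝ := fun y σ => 7 * (l + l⁻¹ * (σ ^ 6 * g (σ ^ 2 • y) ^ 2)) with hG
    have hGc : Continuous (Function.uncurry G) := by
      simp only [hG, Function.uncurry_def]; fun_prop
    have hint : Integrable (Function.uncurry G) (μ.prod ν) := by
      rw [hμ, hν, Measure.prod_restrict]
      exact (hGc.continuousOn.integrableOn_compact
        ((isCompact_Icc (a := (0 : Sp)) (b := 1)).prod (isCompact_Icc (a := (0 : ℝ)) (b := 1)))).mono_set
          (Set.prod_mono le_rfl Set.Ioc_subset_Icc_self)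
    have hpt : ∀ y ∈ Set.Icc (0 : Sp) 1, |h0| ≤ ∫ σ, G y σ ∂ν := by
      intro y hy
      refine (h y hy).trans ?_
      rw [intervalIntegral.integral_of_le zero_le_one]
      refine setIntegral_mono_on ?_ ?_ measurableSet_Ioc fun σ hσ => ?_
      · exact (Continuous.integrableOn_Ioc (by fun_prop))
      · exact (Continuous.integrableOn_Ioc (by simp only [hG]; fun_prop))
      · have h3 := sq_nonneg (l - σ ^ 3 * g (σ ^ 2 • y))
        have : l⁻¹ * (l - σ ^ 3 * g (σ ^ 2 • y)) ^ 2 =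
            l + l⁻¹ * (σ ^ 6 * g (σ ^ 2 • y) ^ 2) - 2 * σ ^ 3 * g (σ ^ 2 • y) := by
          field_simp; ring
        have := mul_nonneg (inv_nonneg.2 hl.le) h3
        simp only [hG]; linarith
    have h4 : |h0| ≤ ∫ y, ∫ σ, G y σ ∂ν ∂μ := by
      have e : |h0| = ∫ _ in Set.Icc (0 : Sp) 1, |h0| := by
        rw [setIntegral_const, hvol, one_smul]
      rw [e]
      exact setIntegral_mono_on (integrableOn_const (by simp [Real.volume_Icc_pi]))
        hint.integral_prod_left measurableSet_Icc hpt
    rw [integral_integral_swap hint] at h4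
    refine h4.trans ?_
    have h5 : ∀ σ ∈ Set.Ioc (0 : ℝ) 1, ∫ y, G y σ ∂μ ≤ 7 * (l + l⁻¹ * A) := by
      intro σ hσ
      have hs := setIntegral_cube_smul_le (g := fun y => g y ^ 2) (by fun_prop)
        (fun _ => sq_nonneg _) (sq_nonneg σ) (by nlinarith [hσ.1, hσ.2] : σ ^ 2 ≤ 1)
      have hi : Integrable (fun y => g (σ ^ 2 • y) ^ 2) μ :=
        (Continuous.continuousOn (by fun_prop)).integrableOn_compact isCompact_Icc
      have e : ∫ y, G y σ ∂μ = 7 * (l + l⁻¹ * ((σ ^ 2) ^ 3 * ∫ y, g (σ ^ 2 • y) ^ 2 ∂μ)) := by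
        simp only [hG]
        rw [integral_const_mul, integral_add (integrable_const _)
          ((hi.const_mul _).const_mul _), integral_const_mul, integral_const_mul,
          setIntegral_const, hvol, one_smul]
        ring
      rw [e]
      have := mul_le_mul_of_nonneg_left hs (inv_nonneg.2 hl.le)
      linarith
    calc ∫ σ, ∫ y, G y σ ∂μ ∂ν ≤ ∫ _ in Set.Ioc (0 : ℝ) 1, 7 * (l + l⁻¹ * A) :=
          setIntegral_mono_on hint.swap.integral_prod_left
            (integrableOn_const (by simp)) measurableSet_Ioc h5
      _ = _ := by simp
  rcases eq_or_ne h0 0 with rfl | hne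
  · simp; positivity
  have hp : 0 < |h0| := abs_pos.2 hne
  have := key (|h0| / 14) (by positivity)
  have e : (|h0| / 14)⁻¹ * A = 14 * A / |h0| := by field_simp
  rw [e] at this
  have h6 : |h0| * |h0| ≤ 7 * (|h0| / 14 * |h0| + 14 * A) := by
    have h7 := mul_le_mul_of_nonneg_right this hp.le
    have e7 : 7 * (|h0| / 14 + 14 * A / |h0|) * |h0| = 7 * (|h0| / 14 * |h0| + 14 * A) := by
      field_simp
    linarith
  rw [← sq_abs]; nlinarith

/-- The size of `f` together with up to two fields applied to it. -/
def KW (f : Pt → ℝ) (p : Pt) : ℝ := |f p| + dK f p + ∑ i, dK (vApp (KF i) f) p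

theorem sum_dK_nonneg (f : Pt → ℝ) (p : Pt) : 0 ≤ ∑ i, dK (vApp (KF i) f) p :=
  Finset.sum_nonneg fun _ _ => dK_nonneg _ _

theorem dK_continuous {f : Pt → ℝ} (hf : ContDiff ℝ ∞ f) : Continuous (dK f) :=
  continuous_finsetSum _ fun i _ => (vApp_contDiff (KF_contDiff i) hf).continuous.abs

theorem KW_continuous {f : Pt → ℝ} (hf : ContDiff ℝ ∞ f) : Continuous (KW f) :=
  (hf.continuous.abs.add (dK_continuous hf)).add
    (continuous_finsetSum _ fun i _ => dK_continuous (vApp_contDiff (KF_contDiff i) hf))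

/-- Indices of the spatial translations and rotations among the fields `KF`. -/
def trIdx : Fin 6 → Fin 11 := ![1, 2, 3, 4, 5, 6]

/-- Weights giving the spatial translations the length `L`. -/
def trWt (L : ℝ) : Fin 6 → ℝ := ![L, L, L, 1, 1, 1]

theorem uu_mul_DK_le {f : Pt → ℝ} {p : Pt} (hp : 0 ≤ p 0) :
    uu p * DK f p ≤ 28 * ∑ i, dK (vApp (KF i) f) p := by
  rw [DK, Finset.mul_sum, Finset.mul_sum]
  exact Finset.sum_le_sum fun i _ => uu_mul_D1_le hp _

theorem trWt_mul_le {f : Pt → ℝ} {p : Pt} (hp : 0 ≤ p 0) {L : ℝ} (h0 : 0 ≤ L) (hL : L ≤ uu p)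
    (j : Fin 6) : |trWt L j * vApp (KF (trIdx j)) f p| ≤ 7 * dK f p := by
  obtain ⟨-, h1, h2, h3, -⟩ := vApp_KF f p
  have hk := abs_KF_le_dK f p
  have hd := dK_nonneg f p
  have ht : ∀ a : Fin 4, |L * pd a f p| ≤ 7 * dK f p := fun a => by
    rw [abs_mul, abs_of_nonneg h0]
    exact (mul_le_mul_of_nonneg_right hL (abs_nonneg _)).trans (uu_mul_abs_pd_le hp f a)
  fin_cases j <;> simp only [trWt, trIdx, Fin.zero_eta, Fin.mk_one, Fin.reduceFinMk, Matrix.cons_val]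
  · rw [h1]; exact ht 1
  · rw [h2]; exact ht 2
  · rw [h3]; exact ht 3
  all_goals rw [one_mul]; exact (hk _).trans (by linarith)

theorem trWt_mul_mul_le {f : Pt → ℝ} (hf : ContDiff ℝ ∞ f) {p : Pt} (hp : 0 ≤ p 0) {L : ℝ}
    (h0 : 0 ≤ L) (hL : L ≤ uu p) (j l : Fin 6) :
    |trWt L j * (trWt L l * vApp (KF (trIdx l)) (vApp (KF (trIdx j)) f) p)| ≤ 2156 * KW f p := by
  obtain ⟨-, h1, h2, h3, -⟩ : _ := vApp_KF f p
  have hpd : ∀ a : Fin 4, KF (a.castLE (by norm_num)) = transVF a := by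
    intro a; fin_cases a <;> rfl
  have hd := dK_nonneg f p
  have hs := sum_dK_nonneg f p
  have hl := trWt_mul_le (f := vApp (KF (trIdx j)) f) hp h0 hL l
  have ht : ∀ a : Fin 4, L * (7 * dK (pd a f) p) ≤ 2156 * KW f p := fun a => by
    have h4 := mul_le_mul_of_nonneg_left (dK_pd_le hf p a) h0
    have h5 := mul_le_mul_of_nonneg_right hL
      (add_nonneg (DK_nonneg f p) (mul_nonneg (by norm_num : (0 : ℝ) ≤ 11) (D1_nonneg f p)))
    have h6 := uu_mul_DK_le (f := f) hp
    have h7 := uu_mul_D1_le hp f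
    rw [KW]; linarith [abs_nonneg (f p)]
  have hr : ∀ i : Fin 11, 1 * (7 * dK (vApp (KF i) f) p) ≤ 2156 * KW f p := fun i => by
    have h4 := Finset.single_le_sum (f := fun i => dK (vApp (KF i) f) p)
      (fun i _ => dK_nonneg _ _) (Finset.mem_univ i)
    rw [KW]; linarith [abs_nonneg (f p)]
  have hw : 0 ≤ trWt L j := by fin_cases j <;> simp [trWt, h0]
  rw [abs_mul, abs_of_nonneg hw]
  refine (mul_le_mul_of_nonneg_left hl hw).trans ?_
  have e : ∀ a : Fin 4, vApp (KF (a.castLE (by norm_num))) f = pd a f := fun a => by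
    rw [hpd]; rfl
  fin_cases j
  · exact (e 1) ▸ ht 1
  · exact (e 2) ▸ ht 2
  · exact (e 3) ▸ ht 3
  · exact hr 4
  · exact hr 5
  · exact hr 6

theorem hasDerivAt_comp_curve {f : Pt → ℝ} (hf : ContDiff ℝ ∞ f) {t L : ℝ} {γ : ℝ → Sp}
    {c : Fin 6 → ℝ → ℝ} (hγ : ∀ s, HasDerivAt γ (fun i => ∑ j, c j s * (trWt L j *
      KF (trIdx j) (stp t (γ s)) i.succ)) s) (s : ℝ) :
    HasDerivAt (fun s => f (stp t (γ s)))
      (∑ j, c j s * (trWt L j * vApp (KF (trIdx j)) f (stp t (γ s)))) s := by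
  refine ((hasFDerivAt_stp_space hf t (γ s)).comp_hasDerivAt s (hγ s)).congr_deriv ?_
  have e : ∀ j, KF (trIdx j) (stp t (γ s)) = spIncl fun i => KF (trIdx j) (stp t (γ s)) i.succ := by
    intro j
    have h0 : KF (trIdx j) (stp t (γ s)) 0 = 0 := by
      rw [(KF_ckField _).eq]
      fin_cases j <;> simp [trIdx, KB, KM, KMz, Fin.sum_univ_four]
    ext a
    fin_cases a
    · simp [spIncl, h0]
    all_goals rfl
  simp only [vApp, ContinuousLinearMap.comp_apply]
  have e2 : (fun i : Fin 3 => ∑ j, c j s * (trWt L j * KF (trIdx j) (stp t (γ s)) i.succ)) =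
      ∑ j, (c j s * trWt L j) • fun i : Fin 3 => KF (trIdx j) (stp t (γ s)) i.succ := by
    ext i; simp [mul_assoc]
  rw [e2, map_sum, map_sum]
  refine Finset.sum_congr rfl fun j _ => ?_
  rw [map_smul, map_smul, ← e j, smul_eq_mul, mul_assoc]

theorem curve_bounds {f : Pt → ℝ} (hf : ContDiff ℝ ∞ f) {t : ℝ} (ht : 0 ≤ t) {L M : ℝ} (h0 : 0 ≤ L)
    (hM : 1 ≤ M) {γ : ℝ → Sp} {c c' : Fin 6 → ℝ → ℝ} (hc : ∀ j s, HasDerivAt (c j) (c' j s) s)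
    (hγ : ∀ s, HasDerivAt γ (fun i => ∑ j, c j s * (trWt L j *
      KF (trIdx j) (stp t (γ s)) i.succ)) s) :
    ∃ φ1 φ2 : ℝ → ℝ, (∀ s, HasDerivAt (fun s => f (stp t (γ s))) (φ1 s) s) ∧
      (∀ s, HasDerivAt φ1 (φ2 s) s) ∧ ∀ s, L ≤ uu (stp t (γ s)) → (∀ j, |c j s| ≤ M) →
      (∀ j, |c' j s| ≤ M) → |φ1 s| ≤ 80000 * M ^ 2 * KW f (stp t (γ s)) ∧
      |φ2 s| ≤ 80000 * M ^ 2 * KW f (stp t (γ s)) := by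
  refine ⟨fun s => ∑ j, c j s * (trWt L j * vApp (KF (trIdx j)) f (stp t (γ s))),
    fun s => ∑ j, (c' j s * (trWt L j * vApp (KF (trIdx j)) f (stp t (γ s))) +
      c j s * (∑ l, c l s * (trWt L j * (trWt L l *
        vApp (KF (trIdx l)) (vApp (KF (trIdx j)) f) (stp t (γ s)))))),
    hasDerivAt_comp_curve hf hγ, fun s => ?_, fun s hL hcs hcs' => ?_⟩
  · refine HasDerivAt.fun_sum fun j _ => ((hc j s).mul ((hasDerivAt_comp_curve
      (vApp_contDiff (KF_contDiff (trIdx j)) hf) hγ s).const_mul (trWt L j))).congr_deriv ?_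
    rw [Finset.mul_sum]
    congr 2
    exact Finset.sum_congr rfl fun l _ => by ring
  · set p := stp t (γ s) with hp
    have hp0 : 0 ≤ p 0 := ht
    have hK : dK f p ≤ KW f p := by
      rw [KW]; linarith [abs_nonneg (f p), sum_dK_nonneg f p]
    have hK0 : 0 ≤ KW f p := (dK_nonneg f p).trans hK
    have hM0 : 0 ≤ M := by linarith
    have hMM : M ≤ M ^ 2 := by nlinarith
    have hb1 : ∀ j, |trWt L j * vApp (KF (trIdx j)) f p| ≤ 7 * KW f p := fun j =>
      (trWt_mul_le hp0 h0 hL j).trans (by linarith)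
    have hMK := mul_le_mul_of_nonneg_right hMM hK0
    constructor
    · refine (Finset.abs_sum_le_sum_abs _ _).trans ((Finset.sum_le_sum fun j _ =>
        abs_mul_le_of_le (hcs j) (hb1 j)).trans ?_)
      simp only [Finset.sum_const, Finset.card_univ, Fintype.card_fin, nsmul_eq_mul]
      push_cast; nlinarith
    · have hb2 : ∀ j, |∑ l, c l s * (trWt L j * (trWt L l *
          vApp (KF (trIdx l)) (vApp (KF (trIdx j)) f) p))| ≤ 6 * (M * (2156 * KW f p)) := fun j => by
        refine (Finset.abs_sum_le_sum_abs _ _).trans ((Finset.sum_le_sum fun l _ =>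
          abs_mul_le_of_le (hcs l) (trWt_mul_mul_le hf hp0 h0 hL j l)).trans ?_)
        simp
      refine (Finset.abs_sum_le_sum_abs _ _).trans ((Finset.sum_le_sum fun j _ =>
        (abs_add_le _ _).trans (add_le_add (abs_mul_le_of_le (hcs' j) (hb1 j))
          (abs_mul_le_of_le (hcs j) (hb2 j)))).trans ?_)
      simp only [Finset.sum_const, Finset.card_univ, Fintype.card_fin, nsmul_eq_mul]
      push_cast; nlinarith

/-- A Sobolev inequality adapted to a chart `Φ` of the unit cube whose rays are adapted curves. -/
theorem sq_mul_le_of_chart {f : Pt → ℝ} (hf : ContDiff ℝ ∞ f) {t : ℝ} (ht : 0 ≤ t) {L M J : ℝ}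
    (h0 : 0 ≤ L) (hM : 1 ≤ M) {Φ : Sp → Sp} {Φ' : Sp → Sp →L[ℝ] Sp} {B : Set Sp}
    (hΦ : ∀ y, HasFDerivAt Φ (Φ' y) y) (hinj : Set.InjOn Φ (Set.Icc 0 1))
    (hdet : ∀ y ∈ Set.Icc (0 : Sp) 1, J ≤ |(Φ' y).det|) (hB : IsCompact B)
    (hΦB : ∀ y ∈ Set.Icc (0 : Sp) 1, Φ y ∈ B)
    (hL : ∀ y ∈ Set.Icc (0 : Sp) 1, L ≤ uu (stp t (Φ y)))
    (hray : ∀ y ∈ Set.Icc (0 : Sp) 1, ∃ c c' : Fin 6 → ℝ → ℝ, (∀ j s, HasDerivAt (c j) (c' j s) s) ∧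
      (∀ s, HasDerivAt (fun s : ℝ => Φ (s • y)) (fun i => ∑ j, c j s * (trWt L j *
        KF (trIdx j) (stp t (Φ (s • y))) i.succ)) s) ∧
      ∀ s ∈ Set.Icc (0 : ℝ) 1, (∀ j, |c j s| ≤ M) ∧ ∀ j, |c' j s| ≤ M) :
    J * f (stp t (Φ 0)) ^ 2 ≤ 196 * (80000 * M ^ 2) ^ 2 * ∫ x in B, KW f (stp t x) ^ 2 := by
  have hW : Continuous fun x => KW f (stp t x) := (KW_continuous hf).comp (continuous_stp_right t)
  have hΦc : Continuous Φ := continuous_iff_continuousAt.2 fun y => (hΦ y).continuousAt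
  have hK0 : ∀ p, 0 ≤ KW f p := fun p => by
    rw [KW]; linarith [abs_nonneg (f p), sum_dK_nonneg f p, dK_nonneg f p]
  have hM2 : 1 ≤ M ^ 2 := one_le_pow₀ hM
  have hg : Continuous fun y => 80000 * M ^ 2 * KW f (stp t (Φ y)) :=
    continuous_const.mul (hW.comp hΦc)
  have h1 : f (stp t (Φ 0)) ^ 2 ≤
      196 * ∫ y in Set.Icc (0 : Sp) 1, (80000 * M ^ 2 * KW f (stp t (Φ y))) ^ 2 := by
    refine sq_le_integral_cube hg fun y hy => ?_
    obtain ⟨c, c', hc, hγ, hb⟩ := hray y hy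
    obtain ⟨φ1, φ2, d1, d2, hφ⟩ := curve_bounds hf ht h0 hM hc hγ
    have := abs_le_integral_of_ray d1 d2
      (g := fun s => 80000 * M ^ 2 * KW f (stp t (Φ (s • y)))) (hg.comp (by fun_prop))
      fun s hs => by
        have hsy : s • y ∈ Set.Icc (0 : Sp) 1 :=
          ⟨fun i => mul_nonneg hs.1 (hy.1 i), fun i => mul_le_one₀ hs.2 (hy.1 i) (hy.2 i)⟩
        refine ⟨?_, hφ s (hL _ hsy) (hb s hs).1 (hb s hs).2⟩
        have : |f (stp t (Φ (s • y)))| ≤ KW f (stp t (Φ (s • y))) := by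
          rw [KW]; linarith [sum_dK_nonneg f (stp t (Φ (s • y))), dK_nonneg f (stp t (Φ (s • y)))]
        nlinarith [hK0 (stp t (Φ (s • y)))]
    simpa using this
  have hcv := integral_image_eq_integral_abs_det_fderiv_smul volume measurableSet_Icc
    (fun y _ => (hΦ y).hasFDerivWithinAt) hinj fun x => KW f (stp t x) ^ 2
  have hsub : Φ '' Set.Icc 0 1 ⊆ B := by rintro _ ⟨y, hy, rfl⟩; exact hΦB y hy
  have hintB : IntegrableOn (fun x => KW f (stp t x) ^ 2) B :=
    (hW.pow 2).continuousOn.integrableOn_compact hB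
  have h2 : ∫ y in Set.Icc (0 : Sp) 1, J * KW f (stp t (Φ y)) ^ 2 ≤
      ∫ x in B, KW f (stp t x) ^ 2 := by
    refine le_trans ?_ (setIntegral_mono_set hintB
      (Filter.Eventually.of_forall fun x => sq_nonneg _) (LE.le.eventuallyLE hsub))
    rw [hcv]
    refine setIntegral_mono_on ((continuous_const.mul ((hW.comp hΦc).pow
      2)).continuousOn.integrableOn_compact isCompact_Icc) ?_ measurableSet_Icc fun y hy => ?_
    · exact (integrableOn_image_iff_integrableOn_abs_det_fderiv_smul volume measurableSet_Icc
        (fun y _ => (hΦ y).hasFDerivWithinAt) hinj _).1 (hintB.mono_set hsub)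
    · rw [smul_eq_mul]
      exact mul_le_mul_of_nonneg_right (hdet y hy) (sq_nonneg _)
  rw [integral_const_mul] at h2
  have e : ∫ y in Set.Icc (0 : Sp) 1, (80000 * M ^ 2 * KW f (stp t (Φ y))) ^ 2 =
      (80000 * M ^ 2) ^ 2 * ∫ y in Set.Icc (0 : Sp) 1, KW f (stp t (Φ y)) ^ 2 := by
    rw [← integral_const_mul]; simp only [mul_pow]
  rw [e] at h1
  rcases le_or_gt 0 J with hJ | hJ
  · calc J * f (stp t (Φ 0)) ^ 2 ≤ J * (196 * ((80000 * M ^ 2) ^ 2 *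
          ∫ y in Set.Icc (0 : Sp) 1, KW f (stp t (Φ y)) ^ 2)) := mul_le_mul_of_nonneg_left h1 hJ
      _ = 196 * (80000 * M ^ 2) ^ 2 * (J * ∫ y in Set.Icc (0 : Sp) 1, KW f (stp t (Φ y)) ^ 2) := by
          ring
      _ ≤ _ := mul_le_mul_of_nonneg_left h2 (by positivity)
  · refine (mul_nonpos_of_nonpos_of_nonneg hJ.le (sq_nonneg _)).trans ?_
    exact mul_nonneg (by positivity) (integral_nonneg fun x => sq_nonneg _)

/-- Rotation matrices: orthogonal of determinant one. -/
structure IsRot (E : Matrix (Fin 3) (Fin 3) ℝ) : Prop where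
  orth : E.transpose * E = 1
  det : E.det = 1

theorem exists_isRot {n : Sp} (hn : n 0 ^ 2 + n 1 ^ 2 + n 2 ^ 2 = 1) :
    ∃ E, IsRot E ∧ ∀ i, E i 0 = n i := by
  have main : ∀ a b c : ℝ, a ^ 2 + b ^ 2 + c ^ 2 = 1 → 0 ≤ c → ∃ k : ℝ, k * (1 + c) = 1 ∧
      (a ^ 2 + b ^ 2) * k = 1 - c := by
    intro a b c h hc
    refine ⟨(1 + c)⁻¹, inv_mul_cancel₀ (by linarith), ?_⟩
    have : a ^ 2 + b ^ 2 = (1 - c) * (1 + c) := by linarith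
    rw [this, mul_assoc, mul_inv_cancel₀ (by linarith), mul_one]
  rcases le_total 0 (n 2) with h | h
  · obtain ⟨k, hk, h1⟩ := main _ _ _ hn h
    refine ⟨!![n 0, 1 - n 0 ^ 2 * k, -(n 0 * n 1 * k); n 1, -(n 0 * n 1 * k), 1 - n 1 ^ 2 * k;
      n 2, -n 0, -n 1], ⟨?_, ?_⟩, fun i => by fin_cases i <;> rfl⟩
    · ext i j
      fin_cases i <;> fin_cases j <;> simp [Matrix.mul_apply, Fin.sum_univ_three]
      · linear_combination hn
      · linear_combination -n 0 * h1
      · linear_combination -n 1 * h1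
      · linear_combination -n 0 * h1
      · linear_combination n 0 ^ 2 * k * h1 - n 0 ^ 2 * hk
      · linear_combination n 0 * n 1 * k * h1 - n 0 * n 1 * hk
      · linear_combination -n 1 * h1
      · linear_combination n 0 * n 1 * k * h1 - n 0 * n 1 * hk
      · linear_combination n 1 ^ 2 * k * h1 - n 1 ^ 2 * hk
    · simp [Matrix.det_fin_three]
      linear_combination hn - n 2 * h1
  · obtain ⟨k, hk, h1⟩ := main (-n 0) (-n 1) (-n 2) (by linarith) (by linarith)
    refine ⟨!![n 0, -(n 0 * n 1 * k), 1 - n 0 ^ 2 * k; n 1, 1 - n 1 ^ 2 * k, -(n 0 * n 1 * k);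
      n 2, n 1, n 0], ⟨?_, ?_⟩, fun i => by fin_cases i <;> rfl⟩
    · ext i j
      fin_cases i <;> fin_cases j <;> simp [Matrix.mul_apply, Fin.sum_univ_three]
      · linear_combination hn
      · linear_combination -n 1 * h1
      · linear_combination -n 0 * h1
      · linear_combination -n 1 * h1
      · linear_combination n 1 ^ 2 * k * h1 - n 1 ^ 2 * hk
      · linear_combination n 0 * n 1 * k * h1 - n 0 * n 1 * hk
      · linear_combination -n 0 * h1
      · linear_combination n 0 * n 1 * k * h1 - n 0 * n 1 * hk
      · linear_combination n 0 ^ 2 * k * h1 - n 0 ^ 2 * hk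
    · simp [Matrix.det_fin_three]
      linear_combination hn + n 2 * h1

namespace IsRot
variable {E : Matrix (Fin 3) (Fin 3) ℝ}

theorem orth' (h : IsRot E) : E * E.transpose = 1 := mul_eq_one_comm.1 h.orth

theorem col (h : IsRot E) (j k : Fin 3) :
    E 0 j * E 0 k + E 1 j * E 1 k + E 2 j * E 2 k = if j = k then 1 else 0 := by
  have := congrFun₂ h.orth j k
  simpa [Matrix.mul_apply, Fin.sum_univ_three, Matrix.one_apply] using this

theorem row (h : IsRot E) (j k : Fin 3) :
    E j 0 * E k 0 + E j 1 * E k 1 + E j 2 * E k 2 = if j = k then 1 else 0 := by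
  have := congrFun₂ h.orth' j k
  simpa [Matrix.mul_apply, Fin.sum_univ_three, Matrix.one_apply] using this

theorem adj (h : IsRot E) : E.adjugate = E.transpose := by
  have h1 : E.adjugate * E = 1 := by rw [Matrix.adjugate_mul, h.det, one_smul]
  calc E.adjugate = E.adjugate * (E * E.transpose) := by rw [h.orth', mul_one]
    _ = E.transpose := by rw [← mul_assoc, h1, one_mul]

theorem abs_le_one (h : IsRot E) (i j : Fin 3) : |E i j| ≤ 1 := by
  have := h.row i i
  rw [if_pos rfl] at this
  refine abs_le_one_iff_mul_self_le_one.2 ?_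
  fin_cases j <;> simp only [Fin.zero_eta, Fin.mk_one, Fin.reduceFinMk] <;>
    nlinarith [mul_self_nonneg (E i 0), mul_self_nonneg (E i 1), mul_self_nonneg (E i 2)]

theorem mulVec_sq (h : IsRot E) (v : Sp) : (E.mulVec v 0) ^ 2 + (E.mulVec v 1) ^ 2 +
    (E.mulVec v 2) ^ 2 = v 0 ^ 2 + v 1 ^ 2 + v 2 ^ 2 := by
  have a := h.col 0 0
  have b := h.col 1 1
  have c := h.col 2 2
  have d := h.col 0 1
  have e := h.col 0 2
  have f := h.col 1 2
  simp only [if_true, Fin.reduceEq, if_false] at a b c d e f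
  simp only [Matrix.mulVec, dotProduct, Fin.sum_univ_three]
  linear_combination v 0 ^ 2 * a + v 1 ^ 2 * b + v 2 ^ 2 * c + 2 * v 0 * v 1 * d +
    2 * v 0 * v 2 * e + 2 * v 1 * v 2 * f

theorem mulVec_injective (h : IsRot E) : Function.Injective E.mulVec := fun v w hvw => by
  have := congrArg E.transpose.mulVec hvw
  simpa [Matrix.mulVec_mulVec, h.orth] using this

/-- Rotations commute with cross products. -/
theorem cross (h : IsRot E) (v w : Sp) :
    (E.mulVec v 1 * E.mulVec w 2 - E.mulVec v 2 * E.mulVec w 1 =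
      E.mulVec ![v 1 * w 2 - v 2 * w 1, v 2 * w 0 - v 0 * w 2, v 0 * w 1 - v 1 * w 0] 0) ∧
    (E.mulVec v 2 * E.mulVec w 0 - E.mulVec v 0 * E.mulVec w 2 =
      E.mulVec ![v 1 * w 2 - v 2 * w 1, v 2 * w 0 - v 0 * w 2, v 0 * w 1 - v 1 * w 0] 1) ∧
    (E.mulVec v 0 * E.mulVec w 1 - E.mulVec v 1 * E.mulVec w 0 =
      E.mulVec ![v 1 * w 2 - v 2 * w 1, v 2 * w 0 - v 0 * w 2, v 0 * w 1 - v 1 * w 0] 2) := by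
  have e : ∀ i j, E.adjugate j i = E i j := fun i j => by rw [h.adj]; rfl
  rw [Matrix.adjugate_fin_three] at e
  have e' := fun i => And.intro (e i 0) (And.intro (e i 1) (e i 2))
  obtain ⟨a0, b0, c0⟩ := e' 0
  obtain ⟨a1, b1, c1⟩ := e' 1
  obtain ⟨a2, b2, c2⟩ := e' 2
  simp only [Matrix.of_apply, Matrix.cons_val', Matrix.cons_val_zero, Matrix.cons_val_one,
    Matrix.cons_val, Matrix.cons_val_fin_one] at a0 b0 c0 a1 b1 c1 a2 b2 c2
  simp only [Matrix.mulVec, dotProduct, Fin.sum_univ_three, Matrix.cons_val]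
  refine ⟨?_, ?_, ?_⟩
  · linear_combination (v 1 * w 2 - v 2 * w 1) * a0 + (v 2 * w 0 - v 0 * w 2) * b0 +
      (v 0 * w 1 - v 1 * w 0) * c0
  · linear_combination (v 1 * w 2 - v 2 * w 1) * a1 + (v 2 * w 0 - v 0 * w 2) * b1 +
      (v 0 * w 1 - v 1 * w 0) * c1
  · linear_combination (v 1 * w 2 - v 2 * w 1) * a2 + (v 2 * w 0 - v 0 * w 2) * b2 +
      (v 0 * w 1 - v 1 * w 0) * c2

end IsRot

/-- Unit vectors in spherical coordinates adapted to the equator. -/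
def sph (a b : ℝ) : Sp := ![Real.cos a * Real.cos b, Real.sin a * Real.cos b, Real.sin b]

theorem sph_sq (a b : ℝ) : sph a b 0 ^ 2 + sph a b 1 ^ 2 + sph a b 2 ^ 2 = 1 := by
  simp only [sph, Matrix.cons_val]
  linear_combination Real.cos b ^ 2 * Real.sin_sq_add_cos_sq a + Real.sin_sq_add_cos_sq b

theorem abs_mulVec_le {E : Matrix (Fin 3) (Fin 3) ℝ} (hE : IsRot E) {v : Sp} {m : ℝ}
    (hv : ∀ i, |v i| ≤ m) (i : Fin 3) : |E.mulVec v i| ≤ 3 * m := by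
  simp only [Matrix.mulVec, dotProduct]
  refine (Finset.abs_sum_le_sum_abs _ _).trans ((Finset.sum_le_sum fun j _ =>
    abs_mul_le_of_le (hE.abs_le_one i j) (hv j)).trans ?_)
  simp

theorem hasDerivAt_mulVec {E : Matrix (Fin 3) (Fin 3) ℝ} {v : ℝ → Sp} {v' : Sp} {s : ℝ}
    (h : ∀ i, HasDerivAt (fun s => v s i) (v' i) s) (i : Fin 3) :
    HasDerivAt (fun s => E.mulVec (v s) i) (E.mulVec v' i) s := by
  simp only [Matrix.mulVec, dotProduct]
  exact HasDerivAt.fun_sum fun j _ => (h j).const_mul _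

theorem sum_trWt_KF (c : Fin 6 → ℝ) (L t : ℝ) (x : Sp) (i : Fin 3) :
    ∑ j, c j * (trWt L j * KF (trIdx j) (stp t x) i.succ) =
      ![c 0 * L - c 3 * x 1 - c 4 * x 2, c 1 * L + c 3 * x 0 - c 5 * x 2,
        c 2 * L + c 4 * x 0 + c 5 * x 1] i := by
  simp only [Fin.sum_univ_six, trIdx, trWt, Matrix.cons_val]
  fin_cases i <;>
    simp [KF, transVF, rotVF, sidx, o3, stp, Fin.ext_iff] <;> ring

/-- The rays of a rotated spherical chart are adapted curves. -/
theorem spherical_ray {E : Matrix (Fin 3) (Fin 3) ℝ} (hE : IsRot E) {y : Sp}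
    (hy : y ∈ Set.Icc (0 : Sp) 1) (t r0 L : ℝ) {Φ : Sp → Sp}
    (hΦ : Φ = fun y => (r0 - L * y 0) • E.mulVec (sph (y 1) (y 2))) :
    ∃ c c' : Fin 6 → ℝ → ℝ, (∀ j s, HasDerivAt (c j) (c' j s) s) ∧
      (∀ s, HasDerivAt (fun s : ℝ => Φ (s • y)) (fun i => ∑ j, c j s * (trWt L j *
        KF (trIdx j) (stp t (Φ (s • y))) i.succ)) s) ∧
      ∀ s ∈ Set.Icc (0 : ℝ) 1, (∀ j, |c j s| ≤ 6) ∧ ∀ j, |c' j s| ≤ 6 := by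
  have hy0 : ∀ i, |y i| ≤ 1 := fun i => abs_le.2 ⟨by linarith [hy.1 i, show (0 : Sp) i = 0 from rfl],
    hy.2 i⟩
  have hlin : ∀ (k : ℝ) (s : ℝ), HasDerivAt (fun s : ℝ => s * k) k s := fun k s => by
    simpa using (hasDerivAt_id s).mul_const k
  set ν : ℝ → Sp := fun s => sph (s * y 1) (s * y 2) with hν
  set ν' : ℝ → Sp := fun s => ![-(Real.sin (s * y 1) * y 1) * Real.cos (s * y 2) -
      Real.cos (s * y 1) * (Real.sin (s * y 2) * y 2),
    (Real.cos (s * y 1) * y 1) * Real.cos (s * y 2) -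
      Real.sin (s * y 1) * (Real.sin (s * y 2) * y 2), Real.cos (s * y 2) * y 2] with hν'
  set w : ℝ → Sp := fun s => ![y 2 * Real.sin (s * y 1), -(y 2 * Real.cos (s * y 1)), y 1] with hw
  set w' : ℝ → Sp := fun s => ![y 2 * (Real.cos (s * y 1) * y 1),
    y 2 * (Real.sin (s * y 1) * y 1), 0] with hw'
  have dν : ∀ s i, HasDerivAt (fun s => ν s i) (ν' s i) s := by
    intro s i
    have h1 := (hlin (y 1) s).cos
    have h2 := (hlin (y 1) s).sin
    have h3 := (hlin (y 2) s).cos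
    have h4 := (hlin (y 2) s).sin
    fin_cases i <;> simp only [hν, hν', sph, Fin.zero_eta, Fin.mk_one, Fin.reduceFinMk,
      Matrix.cons_val]
    · exact (h1.fun_mul h3).congr_deriv (by ring)
    · exact (h2.fun_mul h3).congr_deriv (by ring)
    · exact h4
  have dw : ∀ s i, HasDerivAt (fun s => w s i) (w' s i) s := by
    intro s i
    have h1 := (hlin (y 1) s).cos
    have h2 := (hlin (y 1) s).sin
    fin_cases i <;> simp only [hw, hw', Fin.zero_eta, Fin.mk_one, Fin.reduceFinMk,
      Matrix.cons_val]
    · exact h2.const_mul _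
    · exact (h1.const_mul _).fun_neg.congr_deriv (by ring)
    · exact hasDerivAt_const _ _
  have hs1 : ∀ z, |Real.sin z| ≤ 1 := Real.abs_sin_le_one
  have hc1 : ∀ z, |Real.cos z| ≤ 1 := Real.abs_cos_le_one
  have m1 : ∀ {x z : ℝ}, |x| ≤ 1 → |z| ≤ 1 → |x * z| ≤ 1 := fun hx hz => by
    simpa using abs_mul_le_of_le hx hz
  have bν : ∀ s i, |ν s i| ≤ 2 := by
    intro s i
    have h1 := m1 (hc1 (s * y 1)) (hc1 (s * y 2))
    have h2 := m1 (hs1 (s * y 1)) (hc1 (s * y 2))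
    have h3 := hs1 (s * y 2)
    fin_cases i <;> simp only [hν, sph, Fin.zero_eta, Fin.mk_one, Fin.reduceFinMk,
      Matrix.cons_val] <;> linarith
  have bν' : ∀ s i, |ν' s i| ≤ 2 := by
    intro s i
    have h1 := m1 (m1 (hs1 (s * y 1)) (hy0 1)) (hc1 (s * y 2))
    have h2 := m1 (hc1 (s * y 1)) (m1 (hs1 (s * y 2)) (hy0 2))
    have h3 := m1 (m1 (hc1 (s * y 1)) (hy0 1)) (hc1 (s * y 2))
    have h4 := m1 (hs1 (s * y 1)) (m1 (hs1 (s * y 2)) (hy0 2))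
    have h5 := m1 (hc1 (s * y 2)) (hy0 2)
    fin_cases i <;> simp only [hν', Fin.zero_eta, Fin.mk_one, Fin.reduceFinMk,
      Matrix.cons_val]
    · refine (abs_sub _ _).trans ?_; rw [neg_mul, abs_neg]; linarith
    · refine (abs_sub _ _).trans ?_; linarith
    · linarith
  have bw : ∀ s i, |w s i| ≤ 2 := by
    intro s i
    have h1 := m1 (hy0 2) (hs1 (s * y 1))
    have h2 := m1 (hy0 2) (hc1 (s * y 1))
    have h3 := hy0 1
    fin_cases i <;> simp only [hw, Fin.zero_eta, Fin.mk_one, Fin.reduceFinMk,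
      Matrix.cons_val, abs_neg] <;> linarith
  have bw' : ∀ s i, |w' s i| ≤ 2 := by
    intro s i
    have h1 := m1 (hy0 2) (m1 (hc1 (s * y 1)) (hy0 1))
    have h2 := m1 (hy0 2) (m1 (hs1 (s * y 1)) (hy0 1))
    fin_cases i <;> simp only [hw', Fin.zero_eta, Fin.mk_one, Fin.reduceFinMk,
      Matrix.cons_val, abs_zero] <;> linarith
  have eν := fun s => abs_mulVec_le hE (bν s)
  have eν' := fun s => abs_mulVec_le hE (bν' s)
  have ew := fun s => abs_mulVec_le hE (bw s)
  have ew' := fun s => abs_mulVec_le hE (bw' s)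
  have n6 : ∀ {x : ℝ}, |x| ≤ 3 * 2 → |-y 0 * x| ≤ 6 := fun {x} hx => by
    have := abs_mul_le_of_le ((abs_neg (y 0)).trans_le (hy0 0)) hx
    linarith
  refine ⟨fun j s => ![-y 0 * E.mulVec (ν s) 0, -y 0 * E.mulVec (ν s) 1, -y 0 * E.mulVec (ν s) 2,
      E.mulVec (w s) 2, -E.mulVec (w s) 1, E.mulVec (w s) 0] j,
    fun j s => ![-y 0 * E.mulVec (ν' s) 0, -y 0 * E.mulVec (ν' s) 1, -y 0 * E.mulVec (ν' s) 2,
      E.mulVec (w' s) 2, -E.mulVec (w' s) 1, E.mulVec (w' s) 0] j, fun j s => ?_, fun s => ?_,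
    fun s _ => ⟨fun j => ?_, fun j => ?_⟩⟩
  · have d1 := hasDerivAt_mulVec (E := E) (dν s)
    have d2 := hasDerivAt_mulVec (E := E) (dw s)
    fin_cases j <;> simp only [Fin.zero_eta, Fin.mk_one, Fin.reduceFinMk, Matrix.cons_val]
    exacts [(d1 0).const_mul _, (d1 1).const_mul _, (d1 2).const_mul _, d2 2, (d2 1).fun_neg, d2 0]
  · have hρ : HasDerivAt (fun s : ℝ => r0 - L * (s * y 0)) (-(L * y 0)) s :=
      ((hlin (y 0) s).const_mul L).const_sub r0
    have hcr : (![w s 1 * ν s 2 - w s 2 * ν s 1, w s 2 * ν s 0 - w s 0 * ν s 2,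
        w s 0 * ν s 1 - w s 1 * ν s 0] : Sp) = ν' s := by
      ext i
      fin_cases i <;> simp only [hν, hν', hw, sph, Fin.zero_eta, Fin.mk_one, Fin.reduceFinMk,
        Matrix.cons_val]
      · ring
      · ring
      · linear_combination y 2 * Real.cos (s * y 2) * Real.sin_sq_add_cos_sq (s * y 1)
    obtain ⟨c0, c1, c2⟩ := hE.cross (w s) (ν s)
    rw [hcr] at c0 c1 c2
    have hγ : (fun s : ℝ => Φ (s • y)) = fun s i => (r0 - L * (s * y 0)) * E.mulVec (ν s) i := by
      rw [hΦ]; rfl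
    have hv : ∀ i, Φ (s • y) i = (r0 - L * (s * y 0)) * E.mulVec (ν s) i := fun i =>
      congrFun (congrFun hγ s) i
    rw [hγ]
    refine hasDerivAt_pi.2 fun i => ((hρ.fun_mul (hasDerivAt_mulVec (E := E) (dν s) i))).congr_deriv ?_
    rw [sum_trWt_KF]
    simp only [hv]
    fin_cases i <;> simp only [Fin.zero_eta, Fin.mk_one, Fin.reduceFinMk, Matrix.cons_val]
    · linear_combination (-(r0 - L * (s * y 0))) * c0
    · linear_combination (-(r0 - L * (s * y 0))) * c1
    · linear_combination (-(r0 - L * (s * y 0))) * c2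
  · fin_cases j <;> simp only [Fin.zero_eta, Fin.mk_one, Fin.reduceFinMk, Matrix.cons_val, abs_neg]
    exacts [n6 (eν s 0), n6 (eν s 1), n6 (eν s 2), by linarith [ew s 2], by linarith [ew s 1],
      by linarith [ew s 0]]
  · fin_cases j <;> simp only [Fin.zero_eta, Fin.mk_one, Fin.reduceFinMk, Matrix.cons_val, abs_neg]
    exacts [n6 (eν' s 0), n6 (eν' s 1), n6 (eν' s 2), by linarith [ew' s 2], by linarith [ew' s 1],
      by linarith [ew' s 0]]

theorem rr_stp (t : ℝ) (x : Sp) : rr (stp t x) = rad3 x := by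
  simp [rr, rad3, stp]

theorem rad3_nonneg (x : Sp) : 0 ≤ rad3 x := Real.sqrt_nonneg _

theorem rad3_sq (x : Sp) : rad3 x ^ 2 = x 0 ^ 2 + x 1 ^ 2 + x 2 ^ 2 := Real.sq_sqrt (by positivity)

theorem rad3_continuous : Continuous rad3 := by unfold rad3; fun_prop

theorem rad3_smul (c : ℝ) (x : Sp) : rad3 (c • x) = |c| * rad3 x := by
  rw [rad3, rad3, ← Real.sqrt_sq_eq_abs, ← Real.sqrt_mul (sq_nonneg c)]
  congr 1
  simp; ring

theorem rad3_mulVec {E : Matrix (Fin 3) (Fin 3) ℝ} (hE : IsRot E) (x : Sp) :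
    rad3 (E.mulVec x) = rad3 x := by
  rw [rad3, hE.mulVec_sq, rad3]

theorem isCompact_rad3_le (ρ : ℝ) : IsCompact {x : Sp | rad3 x ≤ ρ} := by
  refine Metric.isCompact_of_isClosed_isBounded (isClosed_le rad3_continuous continuous_const) ?_
  refine (Metric.isBounded_closedBall (x := (0 : Sp)) (r := ρ)).subset fun x hx => ?_
  rw [mem_closedBall_zero_iff]
  exact (norm_le_rr_stp 0 x).trans ((rr_stp 0 x).trans_le hx)

theorem rad3_add_le (x y : Sp) : rad3 (x + y) ≤ rad3 x + rad3 y := by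
  refine abs_le_of_sq_le_sq' ?_ (add_nonneg (rad3_nonneg x) (rad3_nonneg y)) |>.2
  have h : x 0 * y 0 + x 1 * y 1 + x 2 * y 2 ≤ rad3 x * rad3 y := by
    refine abs_le_of_sq_le_sq' ?_ (mul_nonneg (rad3_nonneg x) (rad3_nonneg y)) |>.2
    rw [mul_pow, rad3_sq, rad3_sq]
    linarith [sq_nonneg (x 0 * y 1 - x 1 * y 0), sq_nonneg (x 0 * y 2 - x 2 * y 0),
      sq_nonneg (x 1 * y 2 - x 2 * y 1)]
  rw [add_sq, rad3_sq, rad3_sq, rad3_sq]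
  simp only [Pi.add_apply]
  linarith

theorem rad3_le_two_of_mem {y : Sp} (hy : y ∈ Set.Icc (0 : Sp) 1) : rad3 y ≤ 2 := by
  refine Real.sqrt_le_iff.2 ⟨by norm_num, ?_⟩
  have h : ∀ i, y i ^ 2 ≤ 1 := fun i => pow_le_one₀ (hy.1 i) (hy.2 i)
  linarith [h 0, h 1, h 2]

theorem exists_spherical {x : Sp} (hx : 0 < rad3 x) :
    ∃ E, IsRot E ∧ x = rad3 x • E.mulVec (sph 0 0) := by
  obtain ⟨E, hE, h⟩ := exists_isRot (n := (rad3 x)⁻¹ • x) (by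
    have := rad3_sq x
    simp only [Pi.smul_apply, smul_eq_mul, mul_pow]
    rw [← mul_add, ← mul_add, ← this, ← mul_pow, inv_mul_cancel₀ hx.ne', one_pow])
  refine ⟨E, hE, ?_⟩
  ext i
  have e : E.mulVec (sph 0 0) i = E i 0 := by
    simp [Matrix.mulVec, dotProduct, Fin.sum_univ_three, sph]
  rw [Pi.smul_apply, e, h i, Pi.smul_apply, smul_eq_mul, smul_eq_mul, ← mul_assoc,
    mul_inv_cancel₀ hx.ne', one_mul]

theorem det_pi (J : Matrix (Fin 3) (Fin 3) ℝ) :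
    (LinearMap.toContinuousLinearMap (Matrix.toLin' J)).det = J.det := by
  simp [ContinuousLinearMap.det]

theorem one_half_lt_cos_one : 1 / 2 < Real.cos 1 := by
  linarith [Real.one_sub_sq_div_two_lt_cos (x := 1) (by norm_num)]

theorem cos_ge_half {b : ℝ} (h0 : 0 ≤ b) (h1 : b ≤ 1) : 1 / 2 ≤ Real.cos b := by
  have := Real.cos_le_cos_of_nonneg_of_le_pi h0 (by linarith [Real.pi_gt_three]) h1
  linarith [one_half_lt_cos_one]

/-- Jacobian matrix of the spherical chart. -/
def sphJ (ρ L a b : ℝ) : Matrix (Fin 3) (Fin 3) ℝ :=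
  !![-L * (Real.cos a * Real.cos b), -(ρ * (Real.sin a * Real.cos b)), -(ρ * (Real.cos a * Real.sin b));
    -L * (Real.sin a * Real.cos b), ρ * (Real.cos a * Real.cos b), -(ρ * (Real.sin a * Real.sin b));
    -L * Real.sin b, 0, ρ * Real.cos b]

theorem det_sphJ (ρ L a b : ℝ) : (sphJ ρ L a b).det = -(L * ρ ^ 2 * Real.cos b) := by
  simp only [sphJ, Matrix.det_fin_three, Matrix.of_apply, Matrix.cons_val', Matrix.cons_val_zero,
    Matrix.cons_val_one, Matrix.cons_val, Matrix.cons_val_fin_one]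
  have h1 := Real.sin_sq_add_cos_sq a
  have h2 := Real.sin_sq_add_cos_sq b
  linear_combination (-(L * ρ ^ 2 * Real.cos b * (Real.cos b ^ 2 + Real.sin b ^ 2))) * h1 -
    (L * ρ ^ 2 * Real.cos b) * h2

theorem hasFDerivAt_spherical (r0 L : ℝ) (y : Sp) :
    HasFDerivAt (fun y : Sp => (r0 - L * y 0) • sph (y 1) (y 2))
      (LinearMap.toContinuousLinearMap (Matrix.toLin' (sphJ (r0 - L * y 0) L (y 1) (y 2)))) y := by
  have hk : ∀ k : Fin 3, HasFDerivAt (fun y : Sp => y k) (ContinuousLinearMap.proj (R := ℝ) k) y := fun k =>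
    hasFDerivAt_apply (𝕜 := ℝ) (F' := fun _ : Fin 3 => ℝ) k y
  have h0 := ((hk 0).const_mul L).const_sub r0
  have h1 := (hk 1).cos
  have h2 := (hk 1).sin
  have h3 := (hk 2).cos
  have h4 := (hk 2).sin
  refine hasFDerivAt_pi'.2 fun i => ?_
  fin_cases i
  · refine (h0.fun_mul (h1.fun_mul h3)).congr_fderiv ?_
    ext v
    simp [sphJ, dotProduct, Fin.sum_univ_three]; ring
  · refine (h0.fun_mul (h2.fun_mul h3)).congr_fderiv ?_
    ext v
    simp [sphJ, dotProduct, Fin.sum_univ_three]; ring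
  · refine (h0.fun_mul h4).congr_fderiv ?_
    ext v
    simp [sphJ, dotProduct, Fin.sum_univ_three]; ring

theorem sph_eq_smul {ρ ρ' a b a' b' : ℝ} (hρ : 0 < ρ) (hρ' : 0 < ρ') (ha : a ∈ Set.Icc (0 : ℝ) 1)
    (ha' : a' ∈ Set.Icc (0 : ℝ) 1) (hb : b ∈ Set.Icc (0 : ℝ) 1) (hb' : b' ∈ Set.Icc (0 : ℝ) 1)
    (h : ρ • sph a b = ρ' • sph a' b') : ρ = ρ' ∧ a = a' ∧ b = b' := by
  have hpi := Real.pi_gt_three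
  have h0 := congrFun h 0
  have h1 := congrFun h 1
  have h2 := congrFun h 2
  have e := sph_sq a b
  have e' := sph_sq a' b'
  simp only [Pi.smul_apply, smul_eq_mul] at h0 h1 h2
  have hρρ : ρ = ρ' := by
    refine (pow_left_inj₀ hρ.le hρ'.le two_ne_zero).1 ?_
    linear_combination -(ρ ^ 2 * e) + ρ' ^ 2 * e' + (ρ * sph a b 0 + ρ' * sph a' b' 0) * h0 +
      (ρ * sph a b 1 + ρ' * sph a' b' 1) * h1 + (ρ * sph a b 2 + ρ' * sph a' b' 2) * h2
  subst hρρ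
  replace h0 := mul_left_cancel₀ hρ.ne' h0
  replace h2 := mul_left_cancel₀ hρ.ne' h2
  simp only [sph, Matrix.cons_val] at h0 h2
  have hbb : b = b' := Real.injOn_sin ⟨by linarith [hb.1], by linarith [hb.2]⟩
    ⟨by linarith [hb'.1], by linarith [hb'.2]⟩ h2
  subst hbb
  refine ⟨rfl, ?_, rfl⟩
  exact Real.injOn_cos ⟨ha.1, by linarith [ha.2]⟩ ⟨ha'.1, by linarith [ha'.2]⟩
    (mul_right_cancel₀ (by linarith [cos_ge_half hb.1 hb.2]) h0)

theorem sobolev_interior {f : Pt → ℝ} (hf : ContDiff ℝ ∞ f) {t : ℝ} (ht : 0 ≤ t) {x : Sp}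
    (hx : rad3 x ≤ (1 + t) / 2) : ((1 + t) / 8) ^ 3 * f (stp t x) ^ 2 ≤
      196 * (80000 * 1 ^ 2) ^ 2 * ∫ y in {y : Sp | rad3 y ≤ 3 * (1 + t) / 4}, KW f (stp t y) ^ 2 := by
  set L := (1 + t) / 8 with hL
  have hL0 : 0 < L := by positivity
  have hb : ∀ y ∈ Set.Icc (0 : Sp) 1, rad3 (x + L • y) ≤ 3 * (1 + t) / 4 := fun y hy => by
    have := rad3_add_le x (L • y)
    have h2 := mul_le_mul_of_nonneg_left (rad3_le_two_of_mem hy) hL0.le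
    rw [rad3_smul, abs_of_pos hL0] at this
    linarith
  have hΦ : ∀ y : Sp, HasFDerivAt (fun y => x + L • y) (L • ContinuousLinearMap.id ℝ Sp) y :=
    fun y => ((hasFDerivAt_id y).const_smul L).const_add x
  have := sq_mul_le_of_chart hf ht hL0.le le_rfl (J := L ^ 3) (Φ := fun y => x + L • y)
    (Φ' := fun _ => L • ContinuousLinearMap.id ℝ Sp) (B := {y : Sp | rad3 y ≤ 3 * (1 + t) / 4})
    hΦ ?_ ?_ (isCompact_rad3_le _) hb ?_ ?_
  · simpa using this
  · intro y _ z _ h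
    exact smul_right_injective Sp hL0.ne' (add_left_cancel h)
  · intro y _
    have e : (L • ContinuousLinearMap.id ℝ Sp).det = L ^ 3 := by
      rw [ContinuousLinearMap.det, ContinuousLinearMap.toLinearMap_smul, LinearMap.det_smul]
      simp
    rw [e]; exact le_abs_self _
  · intro y hy
    rw [uu, rr_stp, stp_zero_apply]
    linarith [le_abs_self (t - rad3 (x + L • y)), hb y hy]
  · intro y hy
    refine ⟨fun j _ => ![y 0, y 1, y 2, 0, 0, 0] j, fun _ _ => 0, fun j s => hasDerivAt_const _ _,
      fun s => ?_, fun s _ => ⟨fun j => ?_, fun j => by simp⟩⟩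
    · refine hasDerivAt_pi.2 fun i => ?_
      rw [sum_trWt_KF]
      have h := ((hasDerivAt_id s).mul_const (y i)).const_mul L |>.const_add (x i)
      refine h.congr_deriv ?_
      fin_cases i <;> simp [mul_comm]
    · have : ∀ i, |y i| ≤ 1 := fun i => abs_le.2 ⟨by linarith [hy.1 i, show (0 : Sp) i = 0 from rfl],
        hy.2 i⟩
      fin_cases j <;> simp [this]

theorem sobolev_exterior {f : Pt → ℝ} (hf : ContDiff ℝ ∞ f) {t : ℝ} (ht : 0 ≤ t) {x : Sp}
    (hx : (1 + t) / 2 ≤ rad3 x) :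
    (1 + |t - rad3 x|) / 8 * (5 / 8 * rad3 x) ^ 2 * (1 / 2) * f (stp t x) ^ 2 ≤
      196 * (80000 * 6 ^ 2) ^ 2 * ∫ y in {y : Sp | rad3 y ≤ rad3 x}, KW f (stp t y) ^ 2 := by
  set r0 := rad3 x with hr0
  have hr : 0 < r0 := by linarith
  obtain ⟨E, hE, hxE⟩ := exists_spherical (x := x) hr
  set L := (1 + |t - r0|) / 8 with hL
  have hL0 : 0 < L := by positivity
  have hLr : L ≤ 3 / 8 * r0 := by
    have : |t - r0| ≤ t + r0 := abs_sub_le_iff.2 ⟨by linarith, by linarith⟩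
    rw [hL]; linarith
  set Ψ : Sp → Sp := fun y => (r0 - L * y 0) • sph (y 1) (y 2) with hΨ
  have hρ : ∀ y ∈ Set.Icc (0 : Sp) 1, 5 / 8 * r0 ≤ r0 - L * y 0 ∧ r0 - L * y 0 ≤ r0 := fun y hy => by
    have h0 : 0 ≤ y 0 := hy.1 0
    have h1 : y 0 ≤ 1 := hy.2 0
    constructor
    · linarith [mul_le_of_le_one_right hL0.le h1]
    · linarith [mul_nonneg hL0.le h0]
  have hΦ : (fun y => E.mulVec (Ψ y)) = fun y => (r0 - L * y 0) • E.mulVec (sph (y 1) (y 2)) := by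
    ext y i
    simp only [hΨ, Matrix.mulVec_smul]
  have hrad : ∀ y ∈ Set.Icc (0 : Sp) 1, rad3 (E.mulVec (Ψ y)) = r0 - L * y 0 := fun y hy => by
    have h1 := hρ y hy
    have h2 : rad3 (sph (y 1) (y 2)) = 1 := by rw [rad3, sph_sq, Real.sqrt_one]
    rw [rad3_mulVec hE, hΨ, rad3_smul, h2, mul_one, abs_of_pos (by linarith)]
  have := sq_mul_le_of_chart hf ht hL0.le (by norm_num : (1 : ℝ) ≤ 6)
    (J := L * (5 / 8 * r0) ^ 2 * (1 / 2))
    (Φ := fun y => E.mulVec (Ψ y)) (Φ' := fun y => LinearMap.toContinuousLinearMap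
      (Matrix.toLin' (E * sphJ (r0 - L * y 0) L (y 1) (y 2)))) (B := {y : Sp | rad3 y ≤ r0})
    ?_ ?_ ?_ (isCompact_rad3_le _) ?_ ?_ ?_
  · have e : E.mulVec (Ψ 0) = x := by
      rw [hxE, ← Matrix.mulVec_smul, ← hr0]; simp [hΨ]
    rw [e] at this
    exact this
  · intro y
    have h1 := (LinearMap.toContinuousLinearMap (Matrix.toLin' E)).hasFDerivAt.comp y
      (hasFDerivAt_spherical r0 L y)
    refine h1.congr_fderiv ?_
    ext v i
    simp
  · intro y hy z hz h
    have h1 := hρ y hy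
    have h2 := hρ z hz
    obtain ⟨e1, e2, e3⟩ := sph_eq_smul (by linarith) (by linarith) ⟨hy.1 1, hy.2 1⟩
      ⟨hz.1 1, hz.2 1⟩ ⟨hy.1 2, hy.2 2⟩ ⟨hz.1 2, hz.2 2⟩ (hE.mulVec_injective h)
    have e0 : y 0 = z 0 := mul_left_cancel₀ hL0.ne' (by linarith)
    ext i; fin_cases i
    exacts [e0, e2, e3]
  · intro y hy
    rw [det_pi, Matrix.det_mul, hE.det, one_mul, det_sphJ, abs_neg]
    have h1 := cos_ge_half (hy.1 2) (hy.2 2)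
    have h2 := hρ y hy
    refine le_trans ?_ (le_abs_self _)
    gcongr
    exact h2.1
  · intro y hy
    exact (hrad y hy).trans_le (hρ y hy).2
  · intro y hy
    rw [uu, rr_stp, stp_zero_apply, hrad y hy]
    have h0 : 0 ≤ y 0 := hy.1 0
    have h1 : y 0 ≤ 1 := hy.2 0
    have h2 : |t - r0| ≤ |t - (r0 - L * y 0)| + |L * y 0| := by
      have := abs_sub (t - (r0 - L * y 0)) (L * y 0)
      rwa [show t - (r0 - L * y 0) - L * y 0 = t - r0 by ring] at this
    rw [abs_of_nonneg (mul_nonneg hL0.le h0)] at h2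
    linarith [mul_le_of_le_one_right hL0.le h1]
  · intro y hy
    exact spherical_ray hE hy t r0 L hΦ

/-- The Klainerman–Sobolev inequality on balls. -/
theorem klainerman_sobolev : ∃ C : ℝ, 0 ≤ C ∧ ∀ f : Pt → ℝ, ContDiff ℝ ∞ f → ∀ t : ℝ, 0 ≤ t →
    ∀ x : Sp, vv (stp t x) ^ 2 * uu (stp t x) * f (stp t x) ^ 2 ≤
      C * ∫ y in {y : Sp | rad3 y ≤ max (rad3 x) (3 * (1 + t) / 4)}, KW f (stp t y) ^ 2 := by
  set K : ℝ := 196 * (80000 * 6 ^ 2) ^ 2 with hK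
  refine ⟨2000 * K, by positivity, fun f hf t ht x => ?_⟩
  have hmono : ∀ ρ ≤ max (rad3 x) (3 * (1 + t) / 4),
      ∫ y in {y : Sp | rad3 y ≤ ρ}, KW f (stp t y) ^ 2 ≤
      ∫ y in {y : Sp | rad3 y ≤ max (rad3 x) (3 * (1 + t) / 4)}, KW f (stp t y) ^ 2 := fun ρ h =>
    setIntegral_mono_set ((((KW_continuous hf).comp
      (continuous_stp_right t)).pow 2).continuousOn.integrableOn_compact (isCompact_rad3_le _))
      (Filter.Eventually.of_forall fun _ => sq_nonneg _)
      (LE.le.eventuallyLE fun y (hy : rad3 y ≤ ρ) => hy.trans h)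
  have hf2 := sq_nonneg (f (stp t x))
  have hr := rad3_nonneg x
  rw [vv, uu, rr_stp, stp_zero_apply]
  rcases le_total (rad3 x) ((1 + t) / 2) with h | h
  · have h1 := sobolev_interior hf ht h
    have h2 := hmono _ (le_max_right _ _)
    have hI : 0 ≤ ∫ y in {y : Sp | rad3 y ≤ 3 * (1 + t) / 4}, KW f (stp t y) ^ 2 :=
      integral_nonneg fun _ => sq_nonneg _
    have h3 : (1 + t + rad3 x) ^ 2 * (1 + |t - rad3 x|) ≤ 2000 * ((1 + t) / 8) ^ 3 := by
      have e1 : 1 + t + rad3 x ≤ 3 / 2 * (1 + t) := by linarith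
      have e2 : 1 + |t - rad3 x| ≤ 3 / 2 * (1 + t) := by
        have : |t - rad3 x| ≤ t + 1 / 2 := abs_sub_le_iff.2 ⟨by linarith, by linarith⟩
        linarith
      calc _ ≤ (3 / 2 * (1 + t)) ^ 2 * (3 / 2 * (1 + t)) := by gcongr
        _ ≤ _ := by linarith [pow_pos (by linarith : 0 < 1 + t) 3]
    calc _ ≤ 2000 * ((1 + t) / 8) ^ 3 * f (stp t x) ^ 2 := by gcongr
      _ ≤ 2000 * (K * ∫ y in {y : Sp | rad3 y ≤ 3 * (1 + t) / 4}, KW f (stp t y) ^ 2) := by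
        rw [mul_assoc]; refine mul_le_mul_of_nonneg_left (h1.trans ?_) (by norm_num)
        exact mul_le_mul_of_nonneg_right (by norm_num [hK]) hI
      _ ≤ _ := by rw [← mul_assoc]; gcongr
  · have h1 := sobolev_exterior hf ht h
    have h2 := hmono _ (le_max_left _ _)
    have h3 : (1 + t + rad3 x) ^ 2 * (1 + |t - rad3 x|) ≤
        2000 * ((1 + |t - rad3 x|) / 8 * (5 / 8 * rad3 x) ^ 2 * (1 / 2)) := by
      have e1 : 1 + t + rad3 x ≤ 3 * rad3 x := by linarith
      calc _ ≤ (3 * rad3 x) ^ 2 * (1 + |t - rad3 x|) := by gcongr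
        _ ≤ _ := by linarith [mul_nonneg (sq_nonneg (rad3 x)) (by positivity : 0 ≤ 1 + |t - rad3 x|)]
    calc _ ≤ 2000 * ((1 + |t - rad3 x|) / 8 * (5 / 8 * rad3 x) ^ 2 * (1 / 2)) * f (stp t x) ^ 2 := by
          gcongr
      _ ≤ 2000 * (K * ∫ y in {y : Sp | rad3 y ≤ rad3 x}, KW f (stp t y) ^ 2) := by
        rw [mul_assoc]; exact mul_le_mul_of_nonneg_left h1 (by norm_num)
      _ ≤ _ := by rw [← mul_assoc]; gcongr

theorem interval_swap {F : ℝ → ℝ → ℝ} (hF : Continuous fun q : ℝ × ℝ => F q.1 q.2)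
    (a b c d : ℝ) :
    ∫ x in a..b, ∫ y in c..d, F x y = ∫ y in c..d, ∫ x in a..b, F x y :=
  intervalIntegral_intervalIntegral_swap <|
    (hF.continuousOn.integrableOn_compact (isCompact_uIcc.prod isCompact_uIcc)).mono_set
      (Set.prod_mono Set.uIoc_subset_uIcc Set.uIoc_subset_uIcc)

/-- Integrating a divergence over a box, when the flux through two pairs of faces cancels. -/
theorem integral_box_divergence {a₀ a₁ a₂ H A B σ : ℝ → ℝ → ℝ → ℝ} {a b c d T : ℝ}
    (h0 : Continuous fun q : ℝ × ℝ × ℝ => a₀ q.1 q.2.1 q.2.2)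
    (h1 : Continuous fun q : ℝ × ℝ × ℝ => a₁ q.1 q.2.1 q.2.2)
    (h2 : Continuous fun q : ℝ × ℝ × ℝ => a₂ q.1 q.2.1 q.2.2)
    (d0 : ∀ x y z, HasDerivAt (fun z => H x y z) (a₀ x y z) z)
    (d1 : ∀ x y z, HasDerivAt (fun x => A x y z) (a₁ x y z) x)
    (d2 : ∀ x y z, HasDerivAt (fun y => B x y z) (a₂ x y z) y)
    (hA : ∀ y z, A a y z = A b y z) (hB : ∀ x z, B x c z = B x d z)
    (hσ : ∀ x y z, a₀ x y z + a₁ x y z + a₂ x y z = σ x y z) :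
    ∫ x in a..b, ∫ y in c..d, (H x y T - H x y 0) =
      ∫ x in a..b, ∫ y in c..d, ∫ z in (0 : ℝ)..T, σ x y z := by
  simp_rw [← hσ]
  have e0 : ∀ x y, ∫ z in (0 : ℝ)..T, a₀ x y z = H x y T - H x y 0 := fun x y =>
    intervalIntegral.integral_eq_sub_of_hasDerivAt (fun z _ => d0 x y z)
      (Continuous.intervalIntegrable (by fun_prop) _ _)
  have e1 : ∀ y z, ∫ x in a..b, a₁ x y z = 0 := fun y z => by
    rw [intervalIntegral.integral_eq_sub_of_hasDerivAt (fun x _ => d1 x y z)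
      (Continuous.intervalIntegrable (by fun_prop) _ _), hA, sub_self]
  have e2 : ∀ x z, ∫ y in c..d, a₂ x y z = 0 := fun x z => by
    rw [intervalIntegral.integral_eq_sub_of_hasDerivAt (fun y _ => d2 x y z)
      (Continuous.intervalIntegrable (by fun_prop) _ _), hB, sub_self]
  have z2 : ∀ x, ∫ y in c..d, ∫ z in (0 : ℝ)..T, a₂ x y z = 0 := fun x => by
    rw [interval_swap (F := fun y z => a₂ x y z) (by fun_prop)]
    simp [e2]
  have c0 : Continuous fun q : ℝ × ℝ => ∫ z in (0 : ℝ)..T, a₀ q.1 q.2 z := by fun_prop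
  have c1 : Continuous fun q : ℝ × ℝ => ∫ z in (0 : ℝ)..T, a₁ q.1 q.2 z := by fun_prop
  have c2 : Continuous fun q : ℝ × ℝ => ∫ z in (0 : ℝ)..T, a₂ q.1 q.2 z := by fun_prop
  have z1 : ∫ x in a..b, ∫ y in c..d, ∫ z in (0 : ℝ)..T, a₁ x y z = 0 := by
    rw [interval_swap (F := fun x y => ∫ z in (0 : ℝ)..T, a₁ x y z) c1]
    have : ∀ y, ∫ x in a..b, ∫ z in (0 : ℝ)..T, a₁ x y z = 0 := fun y => by
      rw [interval_swap (F := fun x z => a₁ x y z) (by fun_prop)]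
      simp [e1]
    simp [this]
  have s : ∀ x y, ∫ z in (0 : ℝ)..T, (a₀ x y z + a₁ x y z + a₂ x y z) =
      (∫ z in (0 : ℝ)..T, a₀ x y z) + (∫ z in (0 : ℝ)..T, a₁ x y z) +
        ∫ z in (0 : ℝ)..T, a₂ x y z := fun x y => by
    rw [intervalIntegral.integral_add (Continuous.intervalIntegrable (by fun_prop) _ _)
      (Continuous.intervalIntegrable (by fun_prop) _ _), intervalIntegral.integral_add
      (Continuous.intervalIntegrable (by fun_prop) _ _)
      (Continuous.intervalIntegrable (by fun_prop) _ _)]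
  have s' : ∀ x, ∫ y in c..d, ∫ z in (0 : ℝ)..T, (a₀ x y z + a₁ x y z + a₂ x y z) =
      (∫ y in c..d, ∫ z in (0 : ℝ)..T, a₀ x y z) + ∫ y in c..d, ∫ z in (0 : ℝ)..T, a₁ x y z :=
    fun x => by
    simp_rw [s]
    rw [intervalIntegral.integral_add (Continuous.intervalIntegrable (by fun_prop) _ _)
      (Continuous.intervalIntegrable (by fun_prop) _ _), intervalIntegral.integral_add
      (Continuous.intervalIntegrable (by fun_prop) _ _)
      (Continuous.intervalIntegrable (by fun_prop) _ _), z2, add_zero]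
  simp_rw [s']
  rw [intervalIntegral.integral_add (Continuous.intervalIntegrable (by fun_prop) _ _)
      (Continuous.intervalIntegrable (by fun_prop) _ _), z1, add_zero]
  simp_rw [e0]

/-- Spherical coordinates with polar axis the first column of `E`. -/
def polar (E : Matrix (Fin 3) (Fin 3) ℝ) (θ φ : ℝ) : Sp :=
  E.mulVec ![Real.cos θ, Real.sin θ * Real.cos φ, Real.sin θ * Real.sin φ]

/-- The unit tangent vector along meridians. -/
def polarTh (E : Matrix (Fin 3) (Fin 3) ℝ) (θ φ : ℝ) : Sp :=
  E.mulVec ![-Real.sin θ, Real.cos θ * Real.cos φ, Real.cos θ * Real.sin φ]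

/-- The unit tangent vector along parallels. -/
def polarPh (E : Matrix (Fin 3) (Fin 3) ℝ) (φ : ℝ) : Sp :=
  E.mulVec ![0, -Real.sin φ, Real.cos φ]

/-- Points of the backward light cone from `(T, x)`. -/
def conePt (E : Matrix (Fin 3) (Fin 3) ℝ) (T : ℝ) (x : Sp) (θ φ ρ : ℝ) : Pt :=
  stp (T - ρ) (x + ρ • polar E θ φ)

section

variable {E : Matrix (Fin 3) (Fin 3) ℝ}

theorem hasDerivAt_polar_left (θ φ : ℝ) (i : Fin 3) :
    HasDerivAt (fun θ => polar E θ φ i) (polarTh E θ φ i) θ :=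
  hasDerivAt_mulVec (fun i => by
    fin_cases i
    · exact Real.hasDerivAt_cos θ
    · exact (Real.hasDerivAt_sin θ).mul_const _
    · exact (Real.hasDerivAt_sin θ).mul_const _) i

theorem hasDerivAt_polar_right (θ φ : ℝ) (i : Fin 3) :
    HasDerivAt (fun φ => polar E θ φ i) (Real.sin θ * polarPh E φ i) φ := by
  have : Real.sin θ * polarPh E φ i = E.mulVec ![0, Real.sin θ * -Real.sin φ,
      Real.sin θ * Real.cos φ] i := by
    simp only [polarPh, Matrix.mulVec, dotProduct, Fin.sum_univ_three, Matrix.cons_val]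
    ring
  rw [this]
  exact hasDerivAt_mulVec (fun i => by
    fin_cases i
    · exact hasDerivAt_const _ _
    · exact (Real.hasDerivAt_cos φ).const_mul _
    · exact (Real.hasDerivAt_sin φ).const_mul _) i

theorem hasDerivAt_polarTh (θ φ : ℝ) (i : Fin 3) :
    HasDerivAt (fun θ => polarTh E θ φ i) (-polar E θ φ i) θ := by
  have : -polar E θ φ i = E.mulVec ![-Real.cos θ, -Real.sin θ * Real.cos φ,
      -Real.sin θ * Real.sin φ] i := by
    simp only [polar, Matrix.mulVec, dotProduct, Fin.sum_univ_three, Matrix.cons_val]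
    ring
  rw [this]
  exact hasDerivAt_mulVec (fun i => by
    fin_cases i
    · exact (Real.hasDerivAt_sin θ).fun_neg
    · exact (Real.hasDerivAt_cos θ).mul_const _
    · exact (Real.hasDerivAt_cos θ).mul_const _) i

theorem hasDerivAt_polarPh (θ φ : ℝ) (i : Fin 3) :
    HasDerivAt (fun φ => polarPh E φ i)
      (-(Real.sin θ * polar E θ φ i + Real.cos θ * polarTh E θ φ i)) φ := by
  have : -(Real.sin θ * polar E θ φ i + Real.cos θ * polarTh E θ φ i) =
      E.mulVec ![0, -Real.cos φ, -Real.sin φ] i := by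
    simp only [polar, polarTh, Matrix.mulVec, dotProduct, Fin.sum_univ_three, Matrix.cons_val]
    linear_combination (-(E i 1 * Real.cos φ + E i 2 * Real.sin φ)) * Real.sin_sq_add_cos_sq θ
  rw [this]
  exact hasDerivAt_mulVec (fun i => by
    fin_cases i
    · exact hasDerivAt_const _ _
    · exact (Real.hasDerivAt_sin φ).fun_neg
    · exact Real.hasDerivAt_cos φ) i

theorem polar_frame (hE : IsRot E) (θ φ : ℝ) (i j : Fin 3) :
    polar E θ φ i * polar E θ φ j + polarTh E θ φ i * polarTh E θ φ j +
      polarPh E φ i * polarPh E φ j = if i = j then 1 else 0 := by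
  rw [← hE.row i j]
  simp only [polar, polarTh, polarPh, Matrix.mulVec, dotProduct, Fin.sum_univ_three,
    Matrix.cons_val]
  linear_combination (E i 0 * E j 0 + (E i 1 * Real.cos φ + E i 2 * Real.sin φ) *
    (E j 1 * Real.cos φ + E j 2 * Real.sin φ)) * Real.sin_sq_add_cos_sq θ +
    (E i 1 * E j 1 + E i 2 * E j 2) * Real.sin_sq_add_cos_sq φ

theorem hasDerivAt_comp_stp {f : Pt → ℝ} (hf : ContDiff ℝ ∞ f) {s : ℝ → ℝ} {y : ℝ → Sp}
    {t c : ℝ} {w : Sp} (hτ : HasDerivAt s c t) (hy : ∀ i, HasDerivAt (fun t => y t i) (w i) t) :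
    HasDerivAt (fun t => f (stp (s t) (y t)))
      (c * pd 0 f (stp (s t) (y t)) + ∑ i : Fin 3, w i * pd i.succ f (stp (s t) (y t))) t := by
  have h : HasDerivAt (fun t => stp (s t) (y t)) (stp c w) t :=
    hasDerivAt_pi.2 fun a => by
      fin_cases a
      · exact hτ
      · exact hy 0
      · exact hy 1
      · exact hy 2
  refine ((contDiff_differentiable hf _).hasFDerivAt.comp_hasDerivAt t h).congr_deriv ?_
  rw [fderiv_eq_sum_pd, Fin.sum_univ_succ]
  rfl

end

section
variable {E : Matrix (Fin 3) (Fin 3) ℝ} {T : ℝ} {x : Sp} {ψ : Pt → ℝ}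

theorem conePt_continuous (E : Matrix (Fin 3) (Fin 3) ℝ) (T : ℝ) (x : Sp) :
    Continuous fun q : ℝ × ℝ × ℝ => conePt E T x q.1 q.2.1 q.2.2 := by
  refine stp_continuous.comp (f := fun q : ℝ × ℝ × ℝ =>
    (T - q.2.2, x + q.2.2 • polar E q.1 q.2.1)) (Continuous.prodMk
    (continuous_const.sub (continuous_snd.comp continuous_snd)) ?_)
  refine continuous_const.add (Continuous.smul (continuous_snd.comp continuous_snd) (continuous_pi fun i => ?_))
  simp only [polar, Matrix.mulVec, dotProduct, Fin.sum_univ_three, Matrix.cons_val]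
  fun_prop

theorem hasDerivAt_cone_radius (hf : ContDiff ℝ ∞ ψ) (θ φ ρ : ℝ) :
    HasDerivAt (fun ρ => ψ (conePt E T x θ φ ρ)) (-1 * pd 0 ψ (conePt E T x θ φ ρ) +
      ∑ i : Fin 3, polar E θ φ i * pd i.succ ψ (conePt E T x θ φ ρ)) ρ :=
  hasDerivAt_comp_stp hf ((hasDerivAt_id ρ).const_sub T) fun i =>
    (((hasDerivAt_id ρ).mul_const (polar E θ φ i)).const_add (x i)).congr_deriv (by simp)

theorem hasDerivAt_cone_left (hf : ContDiff ℝ ∞ ψ) (θ φ ρ : ℝ) :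
    HasDerivAt (fun θ => ψ (conePt E T x θ φ ρ)) (0 * pd 0 ψ (conePt E T x θ φ ρ) +
      ∑ i : Fin 3, ρ * polarTh E θ φ i * pd i.succ ψ (conePt E T x θ φ ρ)) θ :=
  hasDerivAt_comp_stp hf (hasDerivAt_const θ (T - ρ)) fun i =>
    ((hasDerivAt_polar_left θ φ i).const_mul ρ).const_add (x i)

theorem hasDerivAt_cone_right (hf : ContDiff ℝ ∞ ψ) (θ φ ρ : ℝ) :
    HasDerivAt (fun φ => ψ (conePt E T x θ φ ρ)) (0 * pd 0 ψ (conePt E T x θ φ ρ) +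
      ∑ i : Fin 3, ρ * (Real.sin θ * polarPh E φ i) * pd i.succ ψ (conePt E T x θ φ ρ)) φ :=
  hasDerivAt_comp_stp hf (hasDerivAt_const φ (T - ρ)) fun i =>
    ((hasDerivAt_polar_right θ φ i).const_mul ρ).const_add (x i)

/-- The spherical integrand in Kirchhoff's formula. -/
def sphMean (E : Matrix (Fin 3) (Fin 3) ℝ) (T : ℝ) (x : Sp) (ψ : Pt → ℝ) (θ φ ρ : ℝ) : ℝ :=
  ρ * (∑ i : Fin 3, polar E θ φ i * pd i.succ ψ (conePt E T x θ φ ρ) +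
    pd 0 ψ (conePt E T x θ φ ρ)) + ψ (conePt E T x θ φ ρ)

theorem sphMean_continuous (hψ : ContDiff ℝ ∞ ψ) :
    Continuous fun q : ℝ × ℝ => Real.sin q.1 * sphMean E T x ψ q.1 q.2 T := by
  have cc : Continuous fun q : ℝ × ℝ => conePt E T x q.1 q.2 T :=
    (conePt_continuous E T x).comp (f := fun q : ℝ × ℝ => (q.1, q.2, T)) (by fun_prop)
  have q0 : Continuous fun q : ℝ × ℝ => ψ (conePt E T x q.1 q.2 T) := hψ.continuous.comp cc
  have q1 : ∀ a, Continuous fun q : ℝ × ℝ => pd a ψ (conePt E T x q.1 q.2 T) :=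
    fun a => (pd_contDiff hψ a).continuous.comp cc
  have cw : ∀ i, Continuous fun q : ℝ × ℝ => polar E q.1 q.2 i := fun i => by
    simp only [polar, Matrix.mulVec, dotProduct, Fin.sum_univ_three, Matrix.cons_val]
    fun_prop
  unfold sphMean
  fun_prop

theorem integral_polar_sub {f : ℝ → ℝ → ℝ} (hf : Continuous fun q : ℝ × ℝ => f q.1 q.2) (c : ℝ) :
    ∫ θ in (0 : ℝ)..Real.pi, ∫ φ in (0 : ℝ)..2 * Real.pi, (f θ φ - Real.sin θ * c) =
      (∫ θ in (0 : ℝ)..Real.pi, ∫ φ in (0 : ℝ)..2 * Real.pi, f θ φ) - 4 * Real.pi * c := by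
  have h : ∀ θ, ∫ φ in (0 : ℝ)..2 * Real.pi, (f θ φ - Real.sin θ * c) =
      (∫ φ in (0 : ℝ)..2 * Real.pi, f θ φ) - Real.sin θ * (2 * Real.pi * c) := fun θ => by
    rw [intervalIntegral.integral_sub (Continuous.intervalIntegrable (by fun_prop) _ _)
      intervalIntegrable_const, intervalIntegral.integral_const, smul_eq_mul]
    ring
  simp_rw [h]
  rw [intervalIntegral.integral_sub (Continuous.intervalIntegrable (by fun_prop) _ _)
    (Continuous.intervalIntegrable (by fun_prop) _ _), intervalIntegral.integral_mul_const,
    integral_sin, Real.cos_zero, Real.cos_pi]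
  ring

/-- **Kirchhoff's formula** in spherical coordinates. -/
theorem kirchhoff (hE : IsRot E) (hψ : ContDiff ℝ ∞ ψ) :
    4 * Real.pi * ψ (stp T x) =
      (∫ θ in (0 : ℝ)..Real.pi, ∫ φ in (0 : ℝ)..2 * Real.pi,
        Real.sin θ * sphMean E T x ψ θ φ T) -
      ∫ θ in (0 : ℝ)..Real.pi, ∫ φ in (0 : ℝ)..2 * Real.pi, ∫ ρ in (0 : ℝ)..T,
        Real.sin θ * (ρ * box ψ (conePt E T x θ φ ρ)) := by
  have hp : ∀ a, ContDiff ℝ ∞ (pd a ψ) := pd_contDiff hψ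
  have cc := conePt_continuous E T x
  have c0 := hψ.continuous
  have c1 : ∀ a, Continuous (pd a ψ) := fun a => (hp a).continuous
  have c2 : ∀ a b, Continuous (pd a (pd b ψ)) := fun a b => (pd_contDiff (hp b) a).continuous
  have cw : ∀ i, Continuous fun q : ℝ × ℝ × ℝ => polar E q.1 q.2.1 i := fun i => by
    simp only [polar, Matrix.mulVec, dotProduct, Fin.sum_univ_three, Matrix.cons_val]
    fun_prop
  have ct : ∀ i, Continuous fun q : ℝ × ℝ × ℝ => polarTh E q.1 q.2.1 i := fun i => by
    simp only [polarTh, Matrix.mulVec, dotProduct, Fin.sum_univ_three, Matrix.cons_val]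
    fun_prop
  have cp : ∀ i, Continuous fun q : ℝ × ℝ × ℝ => polarPh E q.2.1 i := fun i => by
    simp only [polarPh, Matrix.mulVec, dotProduct, Fin.sum_univ_three, Matrix.cons_val]
    fun_prop
  have d0 : ∀ θ φ ρ, HasDerivAt (fun ρ => Real.sin θ * sphMean E T x ψ θ φ ρ) _ ρ :=
    fun θ φ ρ => ((((hasDerivAt_id ρ).fun_mul ((HasDerivAt.fun_sum fun i (_ : i ∈ Finset.univ) =>
      (hasDerivAt_cone_radius (hp (Fin.succ i)) θ φ ρ).const_mul (polar E θ φ i)).fun_add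
      (hasDerivAt_cone_radius (hp 0) θ φ ρ))).fun_add
      (hasDerivAt_cone_radius hψ θ φ ρ)).const_mul (Real.sin θ))
  have d1 : ∀ θ φ ρ, HasDerivAt (fun θ => Real.sin θ *
      ∑ i : Fin 3, polarTh E θ φ i * pd i.succ ψ (conePt E T x θ φ ρ)) _ θ :=
    fun θ φ ρ => (Real.hasDerivAt_sin θ).fun_mul (HasDerivAt.fun_sum
      fun i (_ : i ∈ Finset.univ) => (hasDerivAt_polarTh θ φ i).fun_mul
        (hasDerivAt_cone_left (hp (Fin.succ i)) θ φ ρ))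
  have d2 : ∀ θ φ ρ, HasDerivAt (fun φ =>
      ∑ i : Fin 3, polarPh E φ i * pd i.succ ψ (conePt E T x θ φ ρ)) _ φ :=
    fun θ φ ρ => HasDerivAt.fun_sum
      fun i (_ : i ∈ Finset.univ) => (hasDerivAt_polarPh θ φ i).fun_mul
        (hasDerivAt_cone_right (hp (Fin.succ i)) θ φ ρ)
  have q0 : Continuous fun q : ℝ × ℝ × ℝ => ψ (conePt E T x q.1 q.2.1 q.2.2) := c0.comp cc
  have q1 : ∀ a, Continuous fun q : ℝ × ℝ × ℝ => pd a ψ (conePt E T x q.1 q.2.1 q.2.2) :=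
    fun a => (c1 a).comp cc
  have q2 : ∀ a b, Continuous fun q : ℝ × ℝ × ℝ => pd a (pd b ψ) (conePt E T x q.1 q.2.1 q.2.2) :=
    fun a b => (c2 a b).comp cc
  have key := integral_box_divergence (a := 0) (b := Real.pi) (c := 0) (d := 2 * Real.pi) (T := T)
    (σ := fun θ φ ρ => Real.sin θ * (ρ * box ψ (conePt E T x θ φ ρ)))
    ?_ ?_ ?_ d0 d1 d2 (by simp) (fun θ ρ => ?_) (fun θ φ ρ => ?_)
  · have hs : ∀ θ φ, Real.sin θ * sphMean E T x ψ θ φ 0 = Real.sin θ * ψ (stp T x) := fun θ φ => by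
      simp [sphMean, conePt]
    simp_rw [hs] at key
    rw [← key]
    rw [integral_polar_sub (f := fun θ φ => Real.sin θ * sphMean E T x ψ θ φ T)
      (sphMean_continuous hψ)]
    ring
  · fun_prop
  · fun_prop
  · fun_prop
  · have : conePt E T x θ (2 * Real.pi) ρ = conePt E T x θ 0 ρ := by simp [conePt, polar]
    simp [polarPh, this]
  · have f := polar_frame hE θ φ
    have f00 := f 0 0
    have f11 := f 1 1
    have f22 := f 2 2
    have f01 := f 0 1
    have f02 := f 0 2
    have f12 := f 1 2
    have s : ∀ a b, pd a (pd b ψ) = pd b (pd a ψ) := fun a b => funext (pd_comm hψ a b)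
    simp only [if_true, Fin.reduceEq, if_false] at f00 f11 f22 f01 f02 f12
    simp only [box, Fin.sum_univ_three, id, Fin.succ_zero_eq_one, Fin.succ_one_eq_two,
      show (2 : Fin 3).succ = (3 : Fin 4) from rfl]
    rw [s 0 1, s 0 2, s 0 3, s 2 1, s 3 1, s 3 2]
    linear_combination ρ * Real.sin θ * (f00 * pd 1 (pd 1 ψ) (conePt E T x θ φ ρ) +
      f11 * pd 2 (pd 2 ψ) (conePt E T x θ φ ρ) + f22 * pd 3 (pd 3 ψ) (conePt E T x θ φ ρ) +
      2 * f01 * pd 1 (pd 2 ψ) (conePt E T x θ φ ρ) + 2 * f02 * pd 1 (pd 3 ψ) (conePt E T x θ φ ρ) +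
      2 * f12 * pd 2 (pd 3 ψ) (conePt E T x θ φ ρ))

/-- Distance to the origin of the points of the backward cone. -/
def lam (r ρ θ : ℝ) : ℝ := √(r ^ 2 + ρ ^ 2 + 2 * (r * ρ) * Real.cos θ)

theorem rad3_cone (hE : IsRot E) {r : ℝ} (hx : x = r • E.mulVec ![1, 0, 0]) (θ φ ρ : ℝ) :
    rad3 (x + ρ • polar E θ φ) = lam r ρ θ := by
  rw [hx, polar, ← Matrix.mulVec_smul, ← Matrix.mulVec_smul, ← Matrix.mulVec_add, rad3_mulVec hE,
    rad3, lam]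
  congr 1
  simp only [Pi.add_apply, Pi.smul_apply, Matrix.cons_val, smul_eq_mul]
  linear_combination ρ ^ 2 * Real.sin θ ^ 2 * Real.sin_sq_add_cos_sq φ +
    ρ ^ 2 * Real.sin_sq_add_cos_sq θ

theorem lam_le {r ρ : ℝ} (hr : 0 ≤ r) (hρ : 0 ≤ ρ) (θ : ℝ) : lam r ρ θ ≤ r + ρ := by
  refine Real.sqrt_le_iff.2 ⟨add_nonneg hr hρ, ?_⟩
  have := mul_le_mul_of_nonneg_left (Real.cos_le_one θ) (mul_nonneg hr hρ)
  linarith [sq_nonneg (r - ρ)]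

theorem rad3_polar (hE : IsRot E) (θ φ : ℝ) : rad3 (polar E θ φ) = 1 := by
  have := rad3_cone (x := 0) (r := 0) hE (by simp) θ φ 1
  simpa [lam] using this

theorem abs_coord_le_rad3 (x : Sp) (i : Fin 3) : |x i| ≤ rad3 x := by
  have := abs_coord_le_rr (stp 0 x) i
  rwa [rr_stp, stp_succ_apply] at this

theorem abs_sphMean_le (hE : IsRot E) (hT : 0 ≤ T) (θ φ : ℝ) :
    |sphMean E T x ψ θ φ T| ≤
      T * D1 ψ (stp 0 (x + T • polar E θ φ)) + |ψ (stp 0 (x + T • polar E θ φ))| := by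
  have hc : conePt E T x θ φ T = stp 0 (x + T • polar E θ φ) := by rw [conePt, sub_self]
  rw [sphMean, hc]
  refine (abs_add_le _ _).trans (add_le_add ?_ le_rfl)
  rw [abs_mul, abs_of_nonneg hT]
  refine mul_le_mul_of_nonneg_left ?_ hT
  refine (abs_add_le _ _).trans ?_
  rw [D1, Fin.sum_univ_succ (fun a => |pd a ψ _|), add_comm |pd 0 ψ _|]
  refine add_le_add ?_ le_rfl
  refine (Finset.abs_sum_le_sum_abs _ _).trans (Finset.sum_le_sum fun i _ => ?_)
  rw [abs_mul]
  exact mul_le_of_le_one_left (abs_nonneg _)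
    ((abs_coord_le_rad3 _ i).trans_eq (rad3_polar hE θ φ))

/-- Kirchhoff's formula with radial majorants. -/
theorem kirchhoff_le (hE : IsRot E) (hψ : ContDiff ℝ ∞ ψ) {r : ℝ}
    (hx : x = r • E.mulVec ![1, 0, 0]) (hr : 0 ≤ r) (hT : 0 ≤ T) {h : ℝ → ℝ} {S : ℝ → ℝ → ℝ}
    (hh : Continuous h) (hS : Continuous fun q : ℝ × ℝ => S q.1 q.2)
    (h1 : ∀ y, rad3 y ≤ r + T → T * D1 ψ (stp 0 y) + |ψ (stp 0 y)| ≤ h (rad3 y))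
    (h2 : ∀ ρ, 0 ≤ ρ → ρ ≤ T → ∀ y, rad3 y ≤ r + ρ → |box ψ (stp (T - ρ) y)| ≤ S ρ (rad3 y)) :
    2 * |ψ (stp T x)| ≤ (∫ θ in (0 : ℝ)..Real.pi, h (lam r T θ) * Real.sin θ) +
      ∫ θ in (0 : ℝ)..Real.pi, ∫ ρ in (0 : ℝ)..T, ρ * S ρ (lam r ρ θ) * Real.sin θ := by
  have hπ := Real.pi_pos
  have cl : Continuous fun q : ℝ × ℝ => lam r q.1 q.2 := by unfold lam; fun_prop
  have clT : Continuous fun θ => lam r T θ := by unfold lam; fun_prop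
  have cS : Continuous fun q : ℝ × ℝ => S q.2 (lam r q.2 q.1) :=
    hS.comp (Continuous.prodMk continuous_snd (cl.comp continuous_swap))
  have b1 := intervalIntegral.norm_integral_le_of_norm_le (μ := volume) (a := 0) (b := Real.pi)
    (f := fun θ => ∫ φ in (0 : ℝ)..2 * Real.pi, Real.sin θ * sphMean E T x ψ θ φ T)
    (g := fun θ => 2 * Real.pi * (h (lam r T θ) * Real.sin θ)) hπ.le
    (Filter.Eventually.of_forall fun θ hθ => by
      have hs := Real.sin_nonneg_of_nonneg_of_le_pi hθ.1.le hθ.2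
      refine (intervalIntegral.norm_integral_le_of_norm_le (g := fun _ => h (lam r T θ) * Real.sin θ)
        (by positivity) (Filter.Eventually.of_forall fun φ _ => ?_) (by simp)).trans_eq
        (by rw [intervalIntegral.integral_const, smul_eq_mul, sub_zero])
      rw [Real.norm_eq_abs, abs_mul, abs_of_nonneg hs, mul_comm]
      refine mul_le_mul_of_nonneg_right ((abs_sphMean_le hE hT θ φ).trans ?_) hs
      rw [← rad3_cone hE hx θ φ]
      exact h1 _ (by rw [rad3_cone hE hx]; exact lam_le hr hT θ))
    (Continuous.intervalIntegrable (by fun_prop) _ _)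
  have b2 := intervalIntegral.norm_integral_le_of_norm_le (μ := volume) (a := 0) (b := Real.pi)
    (f := fun θ => ∫ φ in (0 : ℝ)..2 * Real.pi, ∫ ρ in (0 : ℝ)..T,
      Real.sin θ * (ρ * box ψ (conePt E T x θ φ ρ)))
    (g := fun θ => 2 * Real.pi * ∫ ρ in (0 : ℝ)..T, ρ * S ρ (lam r ρ θ) * Real.sin θ) hπ.le
    (Filter.Eventually.of_forall fun θ hθ => by
      have hs := Real.sin_nonneg_of_nonneg_of_le_pi hθ.1.le hθ.2
      refine (intervalIntegral.norm_integral_le_of_norm_le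
        (g := fun _ => ∫ ρ in (0 : ℝ)..T, ρ * S ρ (lam r ρ θ) * Real.sin θ)
        (by positivity) (Filter.Eventually.of_forall fun φ _ => ?_) (by simp)).trans_eq
        (by rw [intervalIntegral.integral_const, smul_eq_mul, sub_zero])
      refine intervalIntegral.norm_integral_le_of_norm_le hT
        (Filter.Eventually.of_forall fun ρ hρ => ?_)
        (Continuous.intervalIntegrable ((continuous_id.mul
          (cS.comp (Continuous.prodMk_right θ))).mul continuous_const) _ _)
      rw [Real.norm_eq_abs, abs_mul, abs_mul, abs_of_nonneg hs, abs_of_pos hρ.1, mul_comm]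
      refine mul_le_mul_of_nonneg_right (mul_le_mul_of_nonneg_left ?_ hρ.1.le) hs
      rw [← rad3_cone hE hx θ φ]
      exact h2 ρ hρ.1.le hρ.2 _ (by rw [rad3_cone hE hx]; exact lam_le hr hρ.1.le θ))
    (Continuous.intervalIntegrable (continuous_const.mul
      (intervalIntegral.continuous_parametric_intervalIntegral_of_continuous'
        (f := fun θ ρ => ρ * S ρ (lam r ρ θ) * Real.sin θ) (by
          exact (continuous_snd.mul cS).mul (Real.continuous_sin.comp continuous_fst)) _ _)) _ _)
  rw [intervalIntegral.integral_const_mul] at b1 b2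
  have k := (abs_sub _ _).trans (add_le_add b1 b2)
  rw [← kirchhoff hE hψ, abs_mul, abs_of_pos (by positivity), ← mul_add] at k
  refine le_of_mul_le_mul_left (k.trans_eq' ?_) (by positivity : 0 < 2 * Real.pi)
  ring
end

theorem lam_substitution {g : ℝ → ℝ} (hg : Continuous g) {r ρ : ℝ} (hr : 0 ≤ r) (hρ : 0 ≤ ρ) :
    r * ρ * ∫ θ in (0 : ℝ)..Real.pi, g (lam r ρ θ) * Real.sin θ =
      ∫ l in |r - ρ|..(r + ρ), g l * l := by
  have hG : Continuous fun s => g √s := by fun_prop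
  have e1 := intervalIntegral.integral_comp_mul_deriv (a := 0) (b := Real.pi)
    (f := fun θ => r ^ 2 + ρ ^ 2 + 2 * (r * ρ) * Real.cos θ) (g := fun s => g √s)
    (fun θ _ => ((Real.hasDerivAt_cos θ).const_mul (2 * (r * ρ))).const_add (r ^ 2 + ρ ^ 2))
    (by fun_prop) hG
  have e2 := intervalIntegral.integral_comp_mul_deriv (a := |r - ρ|) (b := r + ρ)
    (f := fun l => l ^ 2) (g := fun s => g √s) (f' := fun l => 2 * l)
    (fun l _ => by simpa using hasDerivAt_pow 2 l) (by fun_prop) hG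
  have e3 : ∫ l in |r - ρ|..(r + ρ), g l * (2 * l) =
      ∫ l in |r - ρ|..(r + ρ), ((fun s => g √s) ∘ fun l => l ^ 2) l * (2 * l) := by
    refine intervalIntegral.integral_congr fun l hl => ?_
    have : 0 ≤ l := (le_min (abs_nonneg _) (add_nonneg hr hρ)).trans hl.1
    simp only [Function.comp, Real.sqrt_sq this]
  have e4 : ∫ l in |r - ρ|..(r + ρ), g l * (2 * l) = 2 * ∫ l in |r - ρ|..(r + ρ), g l * l := by
    rw [← intervalIntegral.integral_const_mul]
    exact intervalIntegral.integral_congr fun l _ => by ring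
  have e5 : ∫ θ in (0 : ℝ)..Real.pi, ((fun s => g √s) ∘
      fun θ => r ^ 2 + ρ ^ 2 + 2 * (r * ρ) * Real.cos θ) θ * (2 * (r * ρ) * -Real.sin θ) =
      -(2 * (r * ρ)) * ∫ θ in (0 : ℝ)..Real.pi, g (lam r ρ θ) * Real.sin θ := by
    rw [← intervalIntegral.integral_const_mul]
    refine intervalIntegral.integral_congr fun θ _ => ?_
    simp only [Function.comp, lam]
    ring
  rw [e5] at e1
  rw [← e3, e4, sq_abs] at e2
  have e6 : r ^ 2 + ρ ^ 2 + 2 * (r * ρ) * Real.cos 0 = (r + ρ) ^ 2 := by rw [Real.cos_zero]; ring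
  have e7 : r ^ 2 + ρ ^ 2 + 2 * (r * ρ) * Real.cos Real.pi = (r - ρ) ^ 2 := by
    rw [Real.cos_pi]; ring
  rw [e6, e7, intervalIntegral.integral_symm ((r - ρ) ^ 2), ← e2] at e1
  linarith

theorem source_integral_le {r T : ℝ} (hr : 0 ≤ r) (hT : 0 ≤ T) {S : ℝ → ℝ → ℝ} {w k : ℝ → ℝ}
    (hS : Continuous fun q : ℝ × ℝ => S q.1 q.2) (hw : Continuous w) (hk : Continuous k)
    (w0 : ∀ q, 0 ≤ w q) (k0 : ∀ y, 0 ≤ k y) (hki : Integrable k)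
    (h : ∀ ρ, 0 ≤ ρ → ρ ≤ T → ∀ l, 0 ≤ l → S ρ l * l ≤ w (T - ρ + l) * k (T - ρ - l)) :
    r * ∫ θ in (0 : ℝ)..Real.pi, ∫ ρ in (0 : ℝ)..T, ρ * S ρ (lam r ρ θ) * Real.sin θ ≤
      (∫ y, k y) / 2 * ∫ q in |T - r|..(T + r), w q := by
  have hle : |T - r| ≤ T + r := abs_sub_le_iff.2 ⟨by linarith, by linarith⟩
  have cl : Continuous fun q : ℝ × ℝ => lam r q.1 q.2 := by unfold lam; fun_prop
  have cS : Continuous fun q : ℝ × ℝ => S q.1 (lam r q.1 q.2) :=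
    hS.comp (continuous_fst.prodMk cl)
  have cS2 : ∀ ρ, Continuous (S ρ) := fun ρ => hS.comp (Continuous.prodMk_right ρ)
  rw [interval_swap (F := fun θ ρ => ρ * S ρ (lam r ρ θ) * Real.sin θ)
    ((continuous_snd.mul (cS.comp continuous_swap)).mul (Real.continuous_sin.comp continuous_fst)),
    ← intervalIntegral.integral_const_mul]
  have e : ∀ ρ, r * ∫ θ in (0 : ℝ)..Real.pi, ρ * S ρ (lam r ρ θ) * Real.sin θ =
      r * ρ * ∫ θ in (0 : ℝ)..Real.pi, S ρ (lam r ρ θ) * Real.sin θ := fun ρ => by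
    simp_rw [mul_assoc, intervalIntegral.integral_const_mul]
  simp_rw [e]
  have inner : ∀ ρ ∈ Set.Icc 0 T, r * ρ * ∫ θ in (0 : ℝ)..Real.pi, S ρ (lam r ρ θ) * Real.sin θ ≤
      ∫ q in |T - r|..(T + r), w q * k (2 * T - q - 2 * ρ) := fun ρ hρ => by
    have hab : |r - ρ| ≤ r + ρ := abs_sub_le_iff.2 ⟨by linarith [hρ.1], by linarith⟩
    have hsub := intervalIntegral.integral_comp_add_right (a := |r - ρ|) (b := r + ρ)
      (fun q => w q * k (2 * T - q - 2 * ρ)) (T - ρ)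
    rw [lam_substitution (cS2 ρ) hr hρ.1]
    calc _ ≤ ∫ l in |r - ρ|..(r + ρ), w (l + (T - ρ)) * k (2 * T - (l + (T - ρ)) - 2 * ρ) := by
          refine intervalIntegral.integral_mono_on hab
            (Continuous.intervalIntegrable (by fun_prop) _ _)
            (Continuous.intervalIntegrable (by fun_prop) _ _) fun l hl => ?_
          convert h ρ hρ.1 hρ.2 l ((abs_nonneg _).trans hl.1) using 3 <;> ring
      _ = _ := hsub
      _ ≤ _ := by
          refine intervalIntegral.integral_mono_interval ?_ (by linarith) (by linarith)
            (Filter.Eventually.of_forall fun q => mul_nonneg (w0 _) (k0 _))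
            (Continuous.intervalIntegrable (by fun_prop) _ _)
          have := abs_sub_abs_le_abs_sub (T - r) (ρ - r)
          rw [show T - r - (ρ - r) = T - ρ by ring, abs_of_nonneg (by linarith [hρ.2] : 0 ≤ T - ρ),
            abs_sub_comm ρ r] at this
          linarith
  calc _ ≤ ∫ ρ in (0 : ℝ)..T, ∫ q in |T - r|..(T + r), w q * k (2 * T - q - 2 * ρ) := by
        refine intervalIntegral.integral_mono_on hT (Continuous.intervalIntegrable ?_ _ _)
          (Continuous.intervalIntegrable (by fun_prop) _ _) inner
        exact (continuous_const.mul continuous_id).mul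
          (intervalIntegral.continuous_parametric_intervalIntegral_of_continuous'
            (f := fun ρ θ => S ρ (lam r ρ θ) * Real.sin θ)
            (cS.mul (Real.continuous_sin.comp continuous_snd)) _ _)
    _ = ∫ q in |T - r|..(T + r), w q * ∫ ρ in (0 : ℝ)..T, k (2 * T - q - 2 * ρ) := by
        rw [interval_swap (F := fun ρ q => w q * k (2 * T - q - 2 * ρ)) (by fun_prop)]
        simp_rw [intervalIntegral.integral_const_mul]
    _ ≤ ∫ q in |T - r|..(T + r), w q * ((∫ y, k y) / 2) := by
        refine intervalIntegral.integral_mono_on hle (Continuous.intervalIntegrable (by fun_prop) _ _)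
          (Continuous.intervalIntegrable (by fun_prop) _ _) fun q _ =>
            mul_le_mul_of_nonneg_left ?_ (w0 q)
        rw [intervalIntegral.integral_comp_sub_mul _ two_ne_zero, smul_eq_mul,
          intervalIntegral.integral_of_le (by linarith), div_eq_inv_mul]
        exact mul_le_mul_of_nonneg_left (setIntegral_le_integral hki (Filter.Eventually.of_forall k0))
          (by norm_num)
    _ = _ := by rw [intervalIntegral.integral_mul_const, mul_comm]

theorem data_integral_le {r T : ℝ} (hr : 0 < r) (hT : 0 < T) :
    ∫ θ in (0 : ℝ)..Real.pi, (T / (1 + |lam r T θ|) ^ 3 + 1 / (1 + |lam r T θ|) ^ 2) * Real.sin θ ≤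
      16 / ((1 + (T + r)) * (1 + |T - r|)) := by
  have habs : ∀ l : ℝ, 1 + |l| ≠ 0 := fun l => by positivity
  have hc : Continuous fun l : ℝ => T / (1 + |l|) ^ 3 + 1 / (1 + |l|) ^ 2 := by
    refine (continuous_const.div (by fun_prop) fun l => pow_ne_zero _ (habs l)).add
      (continuous_const.div (by fun_prop) fun l => pow_ne_zero _ (habs l))
  set u := 1 + |T - r| with hu
  set v := 1 + (T + r) with hv
  have hle : |T - r| ≤ T + r := abs_sub_le_iff.2 ⟨by linarith, by linarith⟩
  have hu1 : 1 ≤ u := le_add_of_nonneg_right (abs_nonneg _)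
  have huv : u ≤ v := add_le_add_right hle _
  have hu0 : 0 < u := by linarith
  have hv0 : 0 < v := by linarith
  rcases lt_or_ge v 2 with h2 | h2
  · have h4 : ∫ θ in (0 : ℝ)..Real.pi, (T / (1 + |lam r T θ|) ^ 3 + 1 / (1 + |lam r T θ|) ^ 2) *
        Real.sin θ ≤ ∫ θ in (0 : ℝ)..Real.pi, 2 * Real.sin θ := by
      refine intervalIntegral.integral_mono_on Real.pi_pos.le (Continuous.intervalIntegrable
        ((hc.comp (by unfold lam; fun_prop)).mul Real.continuous_sin) _ _)
        (Continuous.intervalIntegrable (by fun_prop) _ _) fun θ hθ =>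
          mul_le_mul_of_nonneg_right ?_ (Real.sin_nonneg_of_nonneg_of_le_pi hθ.1 hθ.2)
      have h1 : (1 : ℝ) ≤ 1 + |lam r T θ| := le_add_of_nonneg_right (abs_nonneg _)
      have a := div_le_self hT.le (one_le_pow₀ h1 (n := 3))
      have b := div_le_self zero_le_one (one_le_pow₀ h1 (n := 2))
      linarith
    rw [intervalIntegral.integral_const_mul, integral_sin, Real.cos_zero, Real.cos_pi] at h4
    refine h4.trans ((le_div_iff₀ (by positivity)).2 ?_)
    have := mul_le_mul h2.le (huv.trans h2.le) hu0.le zero_le_two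
    linarith
  · have hsub := lam_substitution hc hr.le hT.le
    have hF : ∀ l ∈ Set.uIcc |r - T| (r + T), HasDerivAt
        (fun l => -(T * (1 + l)⁻¹) + u⁻¹ * l) (T / (1 + l) ^ 2 + u⁻¹) l := fun l hl => by
      have hl0 : 0 ≤ l := (le_min (abs_nonneg _) (by linarith)).trans hl.1
      have h1 : 1 + l ≠ 0 := by positivity
      refine (((((hasDerivAt_id l).const_add 1).fun_inv h1).const_mul T).fun_neg.fun_add
        ((hasDerivAt_id l).const_mul u⁻¹)).congr_deriv ?_
      simp only [id]
      field_simp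
    have hcI : ContinuousOn (fun l : ℝ => T / (1 + l) ^ 2 + u⁻¹) (Set.uIcc |r - T| (r + T)) := by
      refine ContinuousOn.add (continuousOn_const.div (by fun_prop) fun l hl => ?_) continuousOn_const
      have hl0 : 0 ≤ l := (le_min (abs_nonneg _) (by linarith)).trans hl.1
      positivity
    have hint := intervalIntegral.integral_eq_sub_of_hasDerivAt hF hcI.intervalIntegrable
    have hmono : ∫ l in |r - T|..(r + T), (T / (1 + |l|) ^ 3 + 1 / (1 + |l|) ^ 2) * l ≤
        ∫ l in |r - T|..(r + T), (T / (1 + l) ^ 2 + u⁻¹) := by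
      refine intervalIntegral.integral_mono_on (by rw [abs_sub_comm, add_comm]; exact hle)
        (Continuous.intervalIntegrable (by fun_prop) _ _) hcI.intervalIntegrable fun l hl => ?_
      have hl0 : 0 ≤ l := (abs_nonneg _).trans hl.1
      have hlu : u ≤ 1 + l := by rw [hu, abs_sub_comm]; linarith [hl.1]
      rw [abs_of_nonneg hl0, add_mul]
      have h1 : 0 < 1 + l := by positivity
      refine add_le_add ?_ ?_
      · rw [div_mul_eq_mul_div, div_le_div_iff₀ (by positivity) (by positivity)]
        have := mul_nonneg hT.le (sq_nonneg (1 + l))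
        linarith [show T * (1 + l) ^ 3 - T * l * (1 + l) ^ 2 = T * (1 + l) ^ 2 by ring]
      · rw [div_mul_eq_mul_div, one_mul, inv_eq_one_div, div_le_div_iff₀ (by positivity) hu0]
        have := mul_le_mul_of_nonneg_left hlu hl0
        linarith [show (1 + l) ^ 2 - l * (1 + l) = 1 + l by ring]
    rw [← hsub, hint] at hmono
    rw [abs_sub_comm, add_comm r T, ← hu, ← hv] at hmono
    set I := ∫ θ in (0 : ℝ)..Real.pi, (T / (1 + |lam r T θ|) ^ 3 + 1 / (1 + |lam r T θ|) ^ 2) *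
      Real.sin θ with hI
    have hvu : T + r - |T - r| = v - u := by rw [hv, hu]; ring
    have hkey : r * T * I * (u * v) ≤ (T + v) * (v - u) := by
      have e : -(T * v⁻¹) + u⁻¹ * (T + r) - (-(T * u⁻¹) + u⁻¹ * |T - r|) =
          (T + v) * (v - u) / (u * v) := by
        field_simp
        linear_combination v * hvu
      rw [e] at hmono
      rwa [le_div_iff₀ (by positivity)] at hmono
    rw [le_div_iff₀ (by positivity), mul_comm v u]
    refine le_of_mul_le_mul_left (hkey.trans' (le_of_eq (by ring)) |>.trans ?_) (mul_pos hr hT)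
    rcases le_total r T with h | h
    · have hm : v - u = 2 * r := by rw [hv, hu, abs_of_nonneg (by linarith)]; ring
      rw [hm]
      have : T + v ≤ 8 * T := by linarith
      linarith [mul_le_mul_of_nonneg_left this hr.le]
    · have hm : v - u = 2 * T := by rw [hv, hu, abs_of_nonpos (by linarith)]; ring
      rw [hm]
      have : T + v ≤ 8 * r := by linarith
      linarith [mul_le_mul_of_nonneg_left this hT.le]

/-- The truncated backward cone on which the bootstrap is carried out. -/
def Dm (R T : ℝ) (p : Pt) : Prop := 0 ≤ p 0 ∧ p 0 < T ∧ 2 * p 0 + jb p < R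

theorem jb_stp_sq (t : ℝ) (x : Sp) : jb (stp t x) ^ 2 = 1 + rad3 x ^ 2 := by
  rw [jb_sq, rad3_sq]; simp [stp]

theorem jb_stp_le {x y : Sp} {ρ t s : ℝ} (hρ : 0 ≤ ρ) (h : rad3 y ≤ rad3 x + ρ) :
    jb (stp s y) ≤ jb (stp t x) + ρ := by
  refine abs_le_of_sq_le_sq' ?_ (add_nonneg (jb_pos _).le hρ) |>.2
  rw [jb_stp_sq, add_sq, jb_stp_sq]
  have h1 := rr_le_jb (stp t x)
  rw [rr_stp] at h1
  have h2 := pow_le_pow_left₀ (rad3_nonneg y) h 2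
  linarith [mul_le_mul_of_nonneg_left h1 hρ]

theorem vv_stp (t : ℝ) (x : Sp) : vv (stp t x) = 1 + (t + rad3 x) := by
  rw [vv, rr_stp, stp_zero_apply, add_assoc]

theorem uu_stp (t : ℝ) (x : Sp) : uu (stp t x) = 1 + |t - rad3 x| := by
  rw [uu, rr_stp, stp_zero_apply]

/-- The hypotheses of the wave decay estimates: decaying data and a bounded source. -/
structure WaveData (ψ : Pt → ℝ) (R T A B s : ℝ) : Prop where
  smooth : ContDiff ℝ ∞ ψ
  source_nonneg : 0 ≤ A
  data_nonneg : 0 ≤ B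
  data : ∀ x, jb (stp 0 x) < R → |ψ (stp 0 x)| ≤ B / (1 + rad3 x) ^ 2
  data_D1 : ∀ x, jb (stp 0 x) < R → D1 ψ (stp 0 x) ≤ B / (1 + rad3 x) ^ 3
  source : ∀ p, Dm R T p → |box ψ p| ≤ A * (vv p ^ (-(1 + s)) * uu p ^ (-(9 / 8 : ℝ)))

/-- The mass of the kernel controlling integration in the retarded time. -/
def kerMass : ℝ := ∫ y : ℝ, (1 + |y|) ^ (-(9 / 8 : ℝ))

theorem continuous_one_add_abs_rpow {X : Type*} [TopologicalSpace X] {f : X → ℝ}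
    (hf : Continuous f) (a : ℝ) : Continuous fun y => (1 + |f y|) ^ a :=
  Continuous.rpow_const (by fun_prop) fun y => Or.inl (by positivity)

theorem WaveData.le_off_axis {ψ : Pt → ℝ} {R T A B s : ℝ} (H : WaveData ψ R T A B s) {t : ℝ}
    {x : Sp} (hp : Dm R T (stp t x)) (ht : 0 < t) (hx : 0 < rad3 x) :
    2 * |ψ (stp t x)| ≤ B * (16 / ((1 + (t + rad3 x)) * (1 + |t - rad3 x|))) +
      A * (kerMass / 2 * ((∫ q in |t - rad3 x|..(t + rad3 x), (1 + |q|) ^ (-s)) / rad3 x)) := by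
  obtain ⟨E, hE, hxE⟩ := exists_spherical hx
  have hsph : sph 0 0 = ![1, 0, 0] := by simp [sph]
  rw [hsph] at hxE
  obtain ⟨-, htT, hR⟩ := hp
  rw [stp_zero_apply] at htT hR
  set r := rad3 x with hr
  have habs : ∀ l : ℝ, 1 + |l| ≠ 0 := fun l => by positivity
  set h : ℝ → ℝ := fun l => B * (t / (1 + |l|) ^ 3 + 1 / (1 + |l|) ^ 2) with hh
  set S : ℝ → ℝ → ℝ := fun ρ l => A * ((1 + (|t - ρ| + |l|)) ^ (-(1 + s)) *
    (1 + |(|t - ρ| - |l|)|) ^ (-(9 / 8 : ℝ))) with hS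
  have hc : Continuous h := continuous_const.mul
    ((continuous_const.div (by fun_prop) fun l => pow_ne_zero _ (habs l)).add
      (continuous_const.div (by fun_prop) fun l => pow_ne_zero _ (habs l)))
  have hSc : Continuous fun q : ℝ × ℝ => S q.1 q.2 :=
    continuous_const.mul ((Continuous.rpow_const (by fun_prop) fun q => Or.inl (by positivity)).mul
      (continuous_one_add_abs_rpow (by fun_prop) _))
  have hk := kirchhoff_le hE H.smooth hxE hx.le ht.le hc hSc (fun y hy => by
      have hjb : jb (stp 0 y) < R := by
        linarith [jb_stp_le (t := t) (s := 0) ht.le hy]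
      simp only [hh]
      rw [abs_of_nonneg (rad3_nonneg y)]
      have := mul_le_mul_of_nonneg_left (H.data_D1 y hjb) ht.le
      refine (add_le_add this (H.data y hjb)).trans_eq ?_
      ring) (fun ρ h0 hρ y hy => by
      refine (H.source _ ⟨?_, ?_, ?_⟩).trans_eq ?_
      · rw [stp_zero_apply]; linarith
      · rw [stp_zero_apply]; linarith
      · rw [stp_zero_apply]
        linarith [jb_stp_le (t := t) (s := t - ρ) h0 hy]
      · simp only [hS]
        rw [vv_stp, uu_stp, abs_of_nonneg (by linarith : 0 ≤ t - ρ), abs_of_nonneg (rad3_nonneg y)])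
  have hsrc := source_integral_le (r := r) (T := t) hx.le ht.le hSc
    (w := fun q => A * (1 + |q|) ^ (-s)) (k := fun y => (1 + |y|) ^ (-(9 / 8 : ℝ)))
    (continuous_const.mul (continuous_one_add_abs_rpow continuous_id _))
    (continuous_one_add_abs_rpow continuous_id _) (fun q => mul_nonneg H.source_nonneg (by positivity))
    (fun y => by positivity) (by
      simpa using integrable_one_add_norm (E := ℝ) (μ := volume) (r := 9 / 8) (by norm_num))
    (fun ρ h0 hρ l hl => by
      simp only [hS]
      rw [abs_of_nonneg (by linarith : 0 ≤ t - ρ), abs_of_nonneg hl,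
        abs_of_nonneg (by linarith : 0 ≤ t - ρ + l), mul_assoc A, mul_assoc A]
      refine mul_le_mul_of_nonneg_left ?_ H.source_nonneg
      rw [mul_right_comm]
      refine mul_le_mul_of_nonneg_right ?_ (by positivity)
      have hq : 0 < 1 + (t - ρ + l) := by linarith
      rw [show -(1 + s) = -s - 1 by ring, Real.rpow_sub_one hq.ne', div_mul_eq_mul_div,
        div_le_iff₀ hq]
      exact mul_le_mul_of_nonneg_left (by linarith) (by positivity))
  have hd := mul_le_mul_of_nonneg_left (data_integral_le hx ht) H.data_nonneg
  rw [← intervalIntegral.integral_const_mul] at hd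
  simp only [hh, mul_assoc] at hk
  refine hk.trans (add_le_add hd ?_)
  rw [intervalIntegral.integral_const_mul, ← kerMass, mul_comm, ← le_div_iff₀ hx] at hsrc
  simp only [mul_assoc] at hsrc
  refine hsrc.trans_eq ?_
  ring

theorem kerMass_nonneg : 0 ≤ kerMass := integral_nonneg fun y => by positivity

theorem WaveData.decay {s α β K : ℝ} (hα : α ≤ 1) (hβ : β ≤ 1) (hK0 : 0 ≤ K)
    (hK : ∀ r t : ℝ, 0 < r → 0 ≤ t → (∫ q in |t - r|..(t + r), (1 + |q|) ^ (-s)) / r ≤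
      K * ((1 + (t + r)) ^ (-α) * (1 + |t - r|) ^ (-β))) {ψ : Pt → ℝ} {R T A B : ℝ}
    (H : WaveData ψ R T A B s) {p : Pt} (hp : Dm R T p) :
    |ψ p| ≤ (8 + kerMass / 4 * K) * (A + B) * (vv p ^ (-α) * uu p ^ (-β)) := by
  have hM := kerMass_nonneg
  have hA := H.source_nonneg
  have hB := H.data_nonneg
  have hstep : ∀ {v u : ℝ}, 1 ≤ v → 1 ≤ u → 1 / (v * u) ≤ v ^ (-α) * u ^ (-β) := fun hv hu => by
    rw [one_div, mul_inv, ← Real.rpow_neg_one, ← Real.rpow_neg_one]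
    exact mul_le_mul (Real.rpow_le_rpow_of_exponent_le hv (by linarith))
      (Real.rpow_le_rpow_of_exponent_le hu (by linarith)) (by positivity) (by positivity)
  have main : ∀ t x, Dm R T (stp t x) → 0 < rad3 x → |ψ (stp t x)| ≤
      (8 + kerMass / 4 * K) * (A + B) * ((1 + (t + rad3 x)) ^ (-α) * (1 + |t - rad3 x|) ^ (-β)) := by
    intro t x hp hx
    have ht : 0 ≤ t := by simpa using hp.1
    have hv : 1 ≤ 1 + (t + rad3 x) := by linarith
    have hu : 1 ≤ 1 + |t - rad3 x| := le_add_of_nonneg_right (abs_nonneg _)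
    have hs := hstep hv hu
    set Φ := (1 + (t + rad3 x)) ^ (-α) * (1 + |t - rad3 x|) ^ (-β) with hΦ
    have hΦ0 : 0 ≤ Φ := by positivity
    have hBA : 0 ≤ A * Φ * 8 + B * Φ * (kerMass / 4 * K) := by positivity
    rcases ht.eq_or_lt with rfl | ht
    · have := H.data x (by simpa using hp.2.2)
      rw [zero_sub, abs_neg, zero_add, abs_of_pos hx, ← sq] at hs
      have h2 := mul_le_mul_of_nonneg_left hs hB
      rw [mul_one_div] at h2
      have : 0 ≤ B * Φ * 7 + A * Φ * (kerMass / 4 * K) := by positivity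
      linarith
    · have h1 := H.le_off_axis hp ht hx
      have h2 := mul_le_mul_of_nonneg_left (hK _ _ hx ht.le)
        (mul_nonneg hA (by positivity : 0 ≤ kerMass / 2))
      have h3 := mul_le_mul_of_nonneg_left hs (mul_nonneg (by norm_num : (0:ℝ) ≤ 16) hB)
      have e : B * (16 / ((1 + (t + rad3 x)) * (1 + |t - rad3 x|))) =
        16 * B * (1 / ((1 + (t + rad3 x)) * (1 + |t - rad3 x|))) := by ring
      linarith
  obtain ⟨t, x, rfl⟩ : ∃ t x, p = stp t x := ⟨p 0, fun i => p i.succ, (stp_eta p).symm⟩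
  rw [vv_stp, uu_stp]
  rcases (rad3_nonneg x).eq_or_lt with hx | hx
  · have hx0 : x = 0 := by
      ext i
      exact abs_nonpos_iff.1 ((abs_coord_le_rad3 x i).trans hx.ge)
    have hrad : ∀ {a : ℝ}, 0 ≤ a → rad3 (a • (Pi.single 0 1 : Sp)) = a := fun {a} ha => by
      simp [rad3, Real.sqrt_sq ha]
    have hcurve : Continuous fun a : ℝ => stp t (a • (Pi.single 0 1 : Sp)) :=
      (continuous_stp_right t).comp (by fun_prop)
    have c1 : Filter.Tendsto (fun a : ℝ => |ψ (stp t (a • (Pi.single 0 1 : Sp)))|)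
        (nhdsWithin 0 (Set.Ioi 0)) (nhds |ψ (stp t ((0 : ℝ) • (Pi.single 0 1 : Sp)))|) :=
      (((H.smooth.continuous.comp hcurve).abs).tendsto 0).mono_left nhdsWithin_le_nhds
    have c2 : ContinuousAt (fun a : ℝ => (8 + kerMass / 4 * K) * (A + B) *
        ((1 + (t + a)) ^ (-α) * (1 + |t - a|) ^ (-β))) 0 := by
      have ht : 0 ≤ t := by simpa using hp.1
      refine continuousAt_const.mul (ContinuousAt.mul ?_ ?_)
      · exact ContinuousAt.rpow_const (by fun_prop) (Or.inl (by positivity))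
      · exact ContinuousAt.rpow_const (by fun_prop) (Or.inl (by positivity))
    have hdm : ∀ᶠ a : ℝ in nhds 0, Dm R T (stp t (a • (Pi.single 0 1 : Sp))) := by
      have hj : Continuous fun a : ℝ => 2 * t + jb (stp t (a • (Pi.single 0 1 : Sp))) :=
        continuous_const.add (jb_contDiff.continuous.comp hcurve)
      have := hj.tendsto 0 |>.eventually_lt_const (u := R) (by
        simpa [hx0] using hp.2.2)
      filter_upwards [this] with a ha
      exact ⟨by simpa using hp.1, by simpa using hp.2.1, by simpa using ha⟩
    have := le_of_tendsto_of_tendsto c1 (c2.tendsto.mono_left nhdsWithin_le_nhds)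
      (by
        filter_upwards [hdm.filter_mono nhdsWithin_le_nhds, self_mem_nhdsWithin] with a ha ha0
        have := main t _ ha (by rw [hrad (le_of_lt ha0)]; exact ha0)
        rwa [hrad (le_of_lt ha0)] at this)
    rw [← hx]
    simpa [hx0] using this
  · exact main t x hp hx

theorem integral_one_add_abs_rpow_le {a b s : ℝ} (ha : 0 ≤ a) (hab : a ≤ b) (hs : 0 ≤ s) :
    ∫ q in a..b, (1 + |q|) ^ (-s) ≤ (b - a) * (1 + a) ^ (-s) := by
  calc _ ≤ ∫ q in a..b, (1 + a) ^ (-s) := by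
        refine intervalIntegral.integral_mono_on hab (Continuous.intervalIntegrable
          (continuous_one_add_abs_rpow continuous_id _) _ _) (by simp) fun q hq => ?_
        rw [abs_of_nonneg (ha.trans hq.1)]
        exact Real.rpow_le_rpow_of_nonpos (by positivity) (by linarith [hq.1]) (by linarith)
    _ = _ := by simp

theorem integral_one_add_abs_rpow {a b s : ℝ} (ha : 0 ≤ a) (hab : a ≤ b) (hs : s ≠ 1) :
    ∫ q in a..b, (1 + |q|) ^ (-s) = ((1 + b) ^ (1 - s) - (1 + a) ^ (1 - s)) / (1 - s) := by
  have h1 : 1 - s ≠ 0 := fun h => hs (by linarith)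
  have : ∀ q ∈ Set.uIcc a b, HasDerivAt (fun q => (1 + q) ^ (1 - s) / (1 - s))
      ((1 + |q|) ^ (-s)) q := fun q hq => by
    rw [Set.uIcc_of_le hab] at hq
    have hq0 : 0 ≤ q := ha.trans hq.1
    refine ((((hasDerivAt_id q).const_add 1).rpow_const (p := 1 - s)
      (Or.inl (by simp only [id]; positivity))).div_const (1 - s)).congr_deriv ?_
    rw [abs_of_nonneg hq0, show 1 - s - 1 = -s by ring, one_mul, id]
    field_simp
  rw [intervalIntegral.integral_eq_sub_of_hasDerivAt this (Continuous.intervalIntegrable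
    (continuous_one_add_abs_rpow continuous_id _) _ _)]
  ring

theorem one_div_le_of_far {t r : ℝ} (hr : 0 < r) (hv : 0 < 1 + (t + r)) (h : 1 + (t + r) ≤ 8 * r) :
    1 / r ≤ 8 * (1 + (t + r))⁻¹ := by
  rw [← div_eq_mul_inv, div_le_div_iff₀ hr hv]
  linarith

theorem three_mul_le_of_near {t r : ℝ} (h : 8 * r < 1 + (t + r)) :
    3 / 4 * (1 + (t + r)) ≤ 1 + |t - r| := by
  linarith [le_abs_self (t - r)]

/-- Interior decay for sources with an integrable factor in the advanced time. -/
theorem WaveData.decay_strong {ψ : Pt → ℝ} {R T A B : ℝ} (H : WaveData ψ R T A B (5 / 4)) {p : Pt}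
    (hp : Dm R T p) :
    |ψ p| ≤ (8 + kerMass / 4 * 32) * (A + B) * (vv p ^ (-1 : ℝ) * uu p ^ (-(1 / 4) : ℝ)) := by
  refine WaveData.decay le_rfl (by norm_num) (by norm_num) (fun r t hr ht => ?_) H hp
  have hab : |t - r| ≤ t + r := abs_sub_le_iff.2 ⟨by linarith, by linarith⟩
  have hv : 0 < 1 + (t + r) := by linarith
  have hu : 0 < 1 + |t - r| := by positivity
  rw [Real.rpow_neg_one]
  rcases le_or_gt (1 + (t + r)) (8 * r) with h | h
  · rw [integral_one_add_abs_rpow (abs_nonneg _) hab (by norm_num)]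
    have h1 := one_div_le_of_far hr hv h
    have h2 : (0:ℝ) ≤ (1 + (t + r)) ^ (-(1 / 4) : ℝ) := by positivity
    rw [div_eq_mul_one_div, show (1 - 5 / 4 : ℝ) = -(1 / 4) by norm_num]
    calc _ ≤ (4 * (1 + |t - r|) ^ (-(1 / 4) : ℝ)) * (8 * (1 + (t + r))⁻¹) :=
          mul_le_mul (by linarith) h1 (by positivity) (by positivity)
      _ = _ := by ring
  · have h1 := three_mul_le_of_near h
    have h2 := integral_one_add_abs_rpow_le (abs_nonneg (t - r)) hab (by norm_num : (0:ℝ) ≤ 5 / 4)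
    rw [div_le_iff₀ hr]
    have h3 : t + r - |t - r| ≤ 2 * r := by linarith [le_abs_self (t - r)]
    have h4 : (1 + |t - r|)⁻¹ ≤ 4 / 3 * (1 + (t + r))⁻¹ := by
      rw [inv_le_comm₀ hu (by positivity), mul_inv, inv_inv]
      linarith
    have e : (1 + |t - r|) ^ (-(5 / 4) : ℝ) = (1 + |t - r|)⁻¹ * (1 + |t - r|) ^ (-(1 / 4) : ℝ) := by
      rw [← Real.rpow_neg_one, ← Real.rpow_add hu]
      norm_num
    rw [e] at h2
    have hq : (0:ℝ) ≤ (1 + |t - r|) ^ (-(1 / 4) : ℝ) := by positivity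
    have h5 := mul_le_mul_of_nonneg_right h4 hq
    have h6 := mul_le_mul h3 h5 (by positivity) (by positivity)
    have h7 : 0 ≤ (1 + (t + r))⁻¹ * (1 + |t - r|) ^ (-(1 / 4) : ℝ) * r := by positivity
    linarith

/-- Decay for slowly decaying sources. -/
theorem WaveData.decay_weak {ψ : Pt → ℝ} {R T A B : ℝ} (H : WaveData ψ R T A B (3 / 4)) {p : Pt}
    (hp : Dm R T p) :
    |ψ p| ≤ (8 + kerMass / 4 * 32) * (A + B) * vv p ^ (-(3 / 4) : ℝ) := by
  refine (WaveData.decay (α := 3 / 4) (β := 0) (by norm_num) (by norm_num) (K := 32) (by norm_num)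
    (fun r t hr ht => ?_) H hp).trans_eq (by simp)
  have hab : |t - r| ≤ t + r := abs_sub_le_iff.2 ⟨by linarith, by linarith⟩
  have hv : 0 < 1 + (t + r) := by linarith
  have hu : 0 < 1 + |t - r| := by positivity
  rw [neg_zero, Real.rpow_zero, mul_one]
  rcases le_or_gt (1 + (t + r)) (8 * r) with h | h
  · rw [integral_one_add_abs_rpow (abs_nonneg _) hab (by norm_num)]
    have h1 := one_div_le_of_far hr hv h
    have h2 : (0:ℝ) ≤ (1 + |t - r|) ^ (1 / 4 : ℝ) := by positivity
    rw [div_eq_mul_one_div, show (1 - 3 / 4 : ℝ) = 1 / 4 by norm_num]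
    calc _ ≤ (4 * (1 + (t + r)) ^ (1 / 4 : ℝ)) * (8 * (1 + (t + r))⁻¹) :=
          mul_le_mul (by linarith) h1 (by positivity) (by positivity)
      _ = 32 * ((1 + (t + r)) ^ (1 / 4 : ℝ) * (1 + (t + r))⁻¹) := by ring
      _ = _ := by
        rw [← Real.rpow_neg_one, ← Real.rpow_add hv]
        norm_num
  · have h1 := three_mul_le_of_near h
    have h2 := integral_one_add_abs_rpow_le (abs_nonneg (t - r)) hab (by norm_num : (0:ℝ) ≤ 3 / 4)
    rw [div_le_iff₀ hr]
    have h3 : t + r - |t - r| ≤ 2 * r := by linarith [le_abs_self (t - r)]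
    have h4 : (1 + |t - r|) ^ (-(3 / 4) : ℝ) ≤ 2 * (1 + (t + r)) ^ (-(3 / 4) : ℝ) := by
      calc _ ≤ (3 / 4 * (1 + (t + r))) ^ (-(3 / 4) : ℝ) :=
            Real.rpow_le_rpow_of_nonpos (by positivity) h1 (by norm_num)
        _ = (3 / 4) ^ (-(3 / 4) : ℝ) * (1 + (t + r)) ^ (-(3 / 4) : ℝ) :=
            Real.mul_rpow (by norm_num) hv.le
        _ ≤ _ := by
          refine mul_le_mul_of_nonneg_right ?_ (by positivity)
          calc ((3 / 4 : ℝ)) ^ (-(3 / 4) : ℝ) ≤ (3 / 4) ^ (-1 : ℝ) :=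
                Real.rpow_le_rpow_of_exponent_ge (by norm_num) (by norm_num) (by norm_num)
            _ ≤ 2 := by rw [Real.rpow_neg_one]; norm_num
    have h6 := mul_le_mul h3 h4 (by positivity) (by positivity)
    have h7 : 0 ≤ (1 + (t + r)) ^ (-(3 / 4) : ℝ) * r := by positivity
    linarith

/-- `g` and its derivatives of order at most `M`, at most `j` of them in time, decay at time `0`
like a symbol of order `-s`. -/
def SymbolBound (C : ℝ) : ℕ → ℕ → ℕ → (Pt → ℝ) → Prop
  | 0, _, s, g => ∀ x, |g (stp 0 x)| ≤ C / (1 + rad3 x) ^ s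
  | M + 1, j, s, g => (∀ x, |g (stp 0 x)| ≤ C / (1 + rad3 x) ^ s) ∧
      ∀ a k, k + (if a = 0 then 1 else 0) ≤ j → SymbolBound C M k (s + 1) (pd a g)

namespace SymbolBound

variable {C C' : ℝ} {M j s : ℕ} {f g : Pt → ℝ}

theorem bound (h : SymbolBound C M j s g) (x : Sp) : |g (stp 0 x)| ≤ C / (1 + rad3 x) ^ s := by
  cases M with
  | zero => exact h x
  | succ M => exact h.1 x

theorem mono (h : SymbolBound C M j s g) {M' j' s' : ℕ} (h0 : 0 ≤ C) (hC : C ≤ C') (hM : M' ≤ M)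
    (hj : j' ≤ j) (hs : s' ≤ s) : SymbolBound C' M' j' s' g := by
  have hb : ∀ {s s' : ℕ} {g : Pt → ℝ}, s' ≤ s → (∀ x, |g (stp 0 x)| ≤ C / (1 + rad3 x) ^ s) →
      ∀ x, |g (stp 0 x)| ≤ C' / (1 + rad3 x) ^ s' := fun {s s' g} hs h x => by
    have := rad3_nonneg x
    exact (h x).trans (div_le_div₀ (h0.trans hC) hC (by positivity)
      (pow_le_pow_right₀ (by linarith) hs))
  induction M' generalizing M j j' s s' g with
  | zero => exact hb hs h.bound
  | succ M' ih =>
    obtain ⟨M, rfl⟩ : ∃ N, M = N + 1 := ⟨M - 1, by omega⟩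
    exact ⟨hb hs h.bound, fun a k hk =>
      ih (h.2 a k (hk.trans hj)) (by omega) le_rfl (by omega)⟩

theorem add (hf : ContDiff ℝ ∞ f) (hg : ContDiff ℝ ∞ g) (h : SymbolBound C M j s f)
    (h' : SymbolBound C' M j s g) : SymbolBound (C + C') M j s (fun p => f p + g p) := by
  induction M generalizing j s f g with
  | zero => exact fun x => (abs_add_le _ _).trans (by rw [add_div]; exact add_le_add (h x) (h' x))
  | succ M ih =>
    refine ⟨fun x => (abs_add_le _ _).trans (by
      rw [add_div]; exact add_le_add (h.1 x) (h'.1 x)), fun a k hk => ?_⟩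
    rw [show pd a (fun p => f p + g p) = fun p => pd a f p + pd a g p from funext fun p =>
      pd_add (contDiff_differentiable hf p) (contDiff_differentiable hg p) a]
    exact ih (pd_contDiff hf a) (pd_contDiff hg a) (h.2 a k hk) (h'.2 a k hk)

theorem const_mul (hf : ContDiff ℝ ∞ f) (c : ℝ) (h : SymbolBound C M j s f) :
    SymbolBound (|c| * C) M j s (fun p => c * f p) := by
  have hb : ∀ {s : ℕ} {f : Pt → ℝ}, (∀ x, |f (stp 0 x)| ≤ C / (1 + rad3 x) ^ s) →
      ∀ x, |c * f (stp 0 x)| ≤ |c| * C / (1 + rad3 x) ^ s := fun h x => by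
    rw [abs_mul, mul_div_assoc]
    exact mul_le_mul_of_nonneg_left (h x) (abs_nonneg c)
  induction M generalizing j s f with
  | zero => exact hb h
  | succ M ih =>
    refine ⟨hb h.1, fun a k hk => ?_⟩
    rw [show pd a (fun p => c * f p) = fun p => c * pd a f p from funext fun p =>
      pd_const_mul (contDiff_differentiable hf p) c a]
    exact ih (pd_contDiff hf a) (h.2 a k hk)

theorem zero (M j s : ℕ) : SymbolBound 0 M j s fun _ => 0 := by
  induction M generalizing j s with
  | zero => exact fun x => by simp
  | succ M ih =>
    refine ⟨fun x => by simp, fun a k _ => ?_⟩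
    rw [show pd a (fun _ => 0) = fun _ => 0 from funext (pd_zero a)]
    exact ih k (s + 1)

theorem sum {ι : Type*} (t : Finset ι) {f : ι → Pt → ℝ} {C : ι → ℝ}
    (hf : ∀ i ∈ t, ContDiff ℝ ∞ (f i)) (h : ∀ i ∈ t, SymbolBound (C i) M j s (f i)) :
    SymbolBound (∑ i ∈ t, C i) M j s (fun p => ∑ i ∈ t, f i p) := by
  classical
  induction t using Finset.induction_on with
  | empty => simpa using zero M j s
  | insert i t hi ih =>
    simp only [Finset.sum_insert hi]
    exact (h i (Finset.mem_insert_self i t)).add (hf i (Finset.mem_insert_self i t))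
      (ContDiff.sum fun k hk => hf k (Finset.mem_insert_of_mem hk))
      (ih (fun k hk => hf k (Finset.mem_insert_of_mem hk))
        fun k hk => h k (Finset.mem_insert_of_mem hk))

theorem mul {s' : ℕ} (h0 : 0 ≤ C) (h0' : 0 ≤ C') (hf : ContDiff ℝ ∞ f) (hg : ContDiff ℝ ∞ g)
    (h : SymbolBound C M j s f) (h' : SymbolBound C' M j s' g) :
    SymbolBound (2 ^ M * (C * C')) M j (s + s') (fun p => f p * g p) := by
  have hb : ∀ {s s' : ℕ} {f g : Pt → ℝ}, (∀ x, |f (stp 0 x)| ≤ C / (1 + rad3 x) ^ s) →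
      (∀ x, |g (stp 0 x)| ≤ C' / (1 + rad3 x) ^ s') →
      ∀ x, |f (stp 0 x) * g (stp 0 x)| ≤ C * C' / (1 + rad3 x) ^ (s + s') := fun h h' x => by
    have := rad3_nonneg x
    rw [abs_mul, pow_add, ← div_mul_div_comm]
    exact mul_le_mul (h x) (h' x) (abs_nonneg _) (by positivity)
  induction M generalizing j s s' f g with
  | zero => exact fun x => by simpa using hb h h' x
  | succ M ih =>
    refine ⟨fun x => (hb h.1 h'.1 x).trans ?_, fun a k hk => ?_⟩
    · have := rad3_nonneg x
      exact div_le_div_of_nonneg_right (le_mul_of_one_le_left (by positivity)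
        (one_le_pow₀ (by norm_num))) (by positivity)
    rw [show pd a (fun p => f p * g p) = fun p => pd a f p * g p + f p * pd a g p from
      funext fun p => pd_mul (contDiff_differentiable hf p) (contDiff_differentiable hg p) a]
    have h1 := ih (pd_contDiff hf a) hg (h.2 a k hk)
      (h'.mono h0' le_rfl (Nat.le_succ M) (by omega) le_rfl)
    have h2 := ih hf (pd_contDiff hg a) (h.mono h0 le_rfl (Nat.le_succ M) (by omega) le_rfl)
      (h'.2 a k hk)
    rw [add_right_comm] at h1
    rw [← add_assoc] at h2
    have := h1.add ((pd_contDiff hf a).mul hg) (hf.mul (pd_contDiff hg a)) h2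
    rwa [← two_mul, ← mul_assoc, ← pow_succ'] at this

end SymbolBound

theorem eq_of_eq_on_pos {f g : Pt → ℝ} (hf : Continuous f) (hg : Continuous g)
    (h : ∀ p : Pt, 0 < p 0 → f p = g p) {p : Pt} (hp : 0 ≤ p 0) : f p = g p := by
  have hc : Continuous fun s : ℝ => (fun a => p a + if a = 0 then s else 0 : Pt) := by
    refine continuous_pi fun a => ?_
    split_ifs <;> fun_prop
  have h1 := ((hf.comp hc).tendsto 0).mono_left (nhdsWithin_le_nhds (s := Set.Ioi 0))
  have h2 := ((hg.comp hc).tendsto 0).mono_left (nhdsWithin_le_nhds (s := Set.Ioi 0))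
  have h3 := tendsto_nhds_unique (h1.congr' (by
    filter_upwards [self_mem_nhdsWithin] with s hs
    refine h _ ?_
    simp only [if_true]
    exact add_pos_of_nonneg_of_pos hp hs)) h2
  simpa using h3

theorem pd_eq_of_eq_on_nonneg {f g : Pt → ℝ} (hf : ContDiff ℝ ∞ f) (hg : ContDiff ℝ ∞ g)
    (h : ∀ p : Pt, 0 ≤ p 0 → f p = g p) (a : Fin 4) {p : Pt} (hp : 0 ≤ p 0) :
    pd a f p = pd a g p := by
  refine eq_of_eq_on_pos (pd_contDiff hf a).continuous (pd_contDiff hg a).continuous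
    (fun q hq => ?_) hp
  have : {x : Pt | 0 < x 0} ∈ nhds q :=
    (isOpen_lt continuous_const (continuous_apply 0)).mem_nhds hq
  have he : f =ᶠ[nhds q] g := Filter.mem_of_superset this fun x hx => h x (le_of_lt hx)
  rw [pd, pd, he.fderiv_eq]

namespace SymbolBound

/-- Solving `w = R + a w` when `a` is small. -/
theorem exists_absorb (M : ℕ) : ∃ K, 0 ≤ K ∧ ∀ (C : ℝ) (j s : ℕ) (w R a : Pt → ℝ), 0 ≤ C →
    ContDiff ℝ ∞ w → ContDiff ℝ ∞ R → ContDiff ℝ ∞ a →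
    (∀ p : Pt, 0 ≤ p 0 → w p = R p + a p * w p) → SymbolBound C M j s R →
    SymbolBound (1 / 2) M j 0 a → SymbolBound (K * C) M j s w := by
  have hb : ∀ (C : ℝ) (s : ℕ) (w R a : Pt → ℝ), (∀ p : Pt, 0 ≤ p 0 → w p = R p + a p * w p) →
      (∀ x, |R (stp 0 x)| ≤ C / (1 + rad3 x) ^ s) → (∀ x, |a (stp 0 x)| ≤ 1 / 2 / (1 + rad3 x) ^ 0) →
      ∀ x, |w (stp 0 x)| ≤ 2 * C / (1 + rad3 x) ^ s := by
    intro C s w R a he hR ha x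
    have h1 := he (stp 0 x) (by simp)
    have h2 := ha x
    rw [pow_zero, div_one] at h2
    have h3 : |w (stp 0 x)| ≤ |R (stp 0 x)| + |a (stp 0 x)| * |w (stp 0 x)| := by
      rw [← abs_mul]
      exact (congrArg abs h1).trans_le (abs_add_le _ _)
    have h4 := mul_le_mul_of_nonneg_right h2 (abs_nonneg (w (stp 0 x)))
    rw [mul_div_assoc]
    linarith [hR x]
  induction M with
  | zero =>
    exact ⟨2, by norm_num, fun C j s w R a _ _ _ _ he hR ha => hb C s w R a he hR ha⟩
  | succ M ih =>
    obtain ⟨K, hK, ih⟩ := ih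
    refine ⟨max 2 (K * (1 + 2 ^ M * (1 / 2 * K))), by positivity,
      fun C j s w R a hC hw hRs has he hR ha => ⟨fun x => ?_, fun b k hk => ?_⟩⟩
    · have := rad3_nonneg x
      refine (hb C s w R a he hR.1 ha.1 x).trans ?_
      gcongr
      exact le_max_left _ _
    have hk' : k ≤ j := by omega
    have h1 := ih C k s w R a hC hw hRs has he (hR.mono hC le_rfl (Nat.le_succ M) hk' le_rfl)
      (ha.mono (by norm_num) le_rfl (Nat.le_succ M) hk' le_rfl)
    have h2 := (ha.2 b k hk).mul (by norm_num) (by positivity) (pd_contDiff has b) hw h1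
    rw [show 0 + 1 + s = s + 1 by ring] at h2
    have h3 := (hR.2 b k hk).add (pd_contDiff hRs b) ((pd_contDiff has b).mul hw) h2
    have h4 := ih _ k (s + 1) (pd b w) _ a (by positivity) (pd_contDiff hw b)
      ((pd_contDiff hRs b).add ((pd_contDiff has b).mul hw)) has (fun p hp => by
        refine (pd_eq_of_eq_on_nonneg hw (hRs.add (has.mul hw)) he b hp).trans ?_
        rw [pd_add (contDiff_differentiable hRs p) (contDiff_differentiable (has.mul hw) p),
          pd_mul (contDiff_differentiable has p) (contDiff_differentiable hw p)]
        ring) h3 (ha.mono (by norm_num) le_rfl (Nat.le_succ M) hk' le_rfl)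
    refine h4.mono (by positivity) ?_ le_rfl le_rfl le_rfl
    calc _ = K * (1 + 2 ^ M * (1 / 2 * K)) * C := by ring
      _ ≤ _ := mul_le_mul_of_nonneg_right (le_max_right _ _) hC

variable {C C' : ℝ} {M j s : ℕ} {f g : Pt → ℝ}

/-- Bounds with one more time derivative follow from bounds for the second time derivative. -/
theorem of_time (hg : ContDiff ℝ ∞ g) (h : SymbolBound C (M + 2) (j + 1) s g)
    (h2 : SymbolBound C M j (s + 2) (pd 0 (pd 0 g))) : SymbolBound C (M + 2) (j + 2) s g := by
  have hcomm : ∀ {g : Pt → ℝ}, ContDiff ℝ ∞ g → ∀ a b, pd a (pd b g) = pd b (pd a g) :=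
    fun hg a b => funext (pd_comm hg a b)
  have base : ∀ {s : ℕ} {g : Pt → ℝ}, (∀ a, SymbolBound C 0 0 (s + 1) (pd a g)) →
      (∀ x, |g (stp 0 x)| ≤ C / (1 + rad3 x) ^ s) → ∀ j, SymbolBound C 1 j s g :=
    fun h h0 j => ⟨h0, fun a k _ => h a⟩
  induction M generalizing s g with
  | zero =>
    refine ⟨h.1, fun a k hk => base (fun b => ?_) (h.2 a 0 (by split_ifs <;> omega)).1 k⟩
    by_cases ha : a = 0
    · subst ha
      by_cases hb : b = 0
      · subst hb; exact h2
      · rw [hcomm hg]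
        exact (h.2 b 1 (by simp [hb])).2 0 0 (by simp)
    · exact (h.2 a 1 (by simp [ha])).2 b 0 (by split_ifs <;> omega)
  | succ M ih =>
    have hsp : ∀ b, b ≠ 0 → SymbolBound C (M + 2) (j + 2) (s + 1) (pd b g) := fun b hb => by
      refine ih (pd_contDiff hg b) (h.2 b (j + 1) (by simp [hb])) ?_
      rw [hcomm hg 0 b, hcomm (pd_contDiff hg 0) 0 b]
      exact h2.2 b j (by simp [hb])
    have hm : ∀ {j k : ℕ} {s : ℕ} {g : Pt → ℝ}, SymbolBound C (M + 2) j s g → k ≤ j → 0 ≤ C →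
        SymbolBound C (M + 2) k s g := fun h hk hC => h.mono hC le_rfl le_rfl hk le_rfl
    have hC : 0 ≤ C := by
      have := (abs_nonneg _).trans (h.bound 0)
      have h0 := rad3_nonneg 0
      by_contra hC
      exact absurd this (not_le.2 (div_neg_of_neg_of_pos (not_le.1 hC) (by positivity)))
    refine ⟨h.1, fun a k hk => ?_⟩
    by_cases ha : a = 0
    · subst ha
      simp only [if_true] at hk
      refine ⟨(h.2 0 0 (by simp)).1, fun b l hl => ?_⟩
      by_cases hb : b = 0
      · subst hb
        simp only [if_true] at hl
        exact h2.mono hC le_rfl le_rfl (by omega) le_rfl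
      · rw [hcomm hg]
        exact (hsp b hb).2 0 l (by simp only [hb, if_false, if_true] at hl ⊢; omega)
    · exact hm (hsp a ha) (by simpa [ha] using hk) hC

end SymbolBound

theorem exists_abs_KF_stp_le : ∃ B, 0 ≤ B ∧ ∀ i a x, |KF i (stp 0 x) a| ≤ B * (1 + rad3 x) := by
  refine ⟨(∑ i, ∑ a, |KB i a|) + 4, by positivity, fun i a x => ?_⟩
  have h1 : |KB i a| ≤ ∑ i, ∑ a, |KB i a| :=
    (Finset.single_le_sum (f := fun a => |KB i a|) (fun _ _ => abs_nonneg _)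
      (Finset.mem_univ a)).trans (Finset.single_le_sum (f := fun i => ∑ a, |KB i a|)
        (fun _ _ => Finset.sum_nonneg fun _ _ => abs_nonneg _) (Finset.mem_univ i))
  have h2 : ∀ c, |stp 0 x c| ≤ rad3 x := fun c => by
    refine Fin.cases ?_ (fun j => ?_) c
    · rw [stp_zero_apply, abs_zero]; exact rad3_nonneg x
    · rw [← rr_stp 0 x]; exact abs_coord_le_rr _ j
  have h3 : |∑ c, KM i a c * stp 0 x c| ≤ 4 * rad3 x := by
    refine (Finset.abs_sum_le_sum_abs _ _).trans ?_
    calc _ ≤ ∑ _c : Fin 4, rad3 x := Finset.sum_le_sum fun c _ => by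
          rw [abs_mul]
          exact (mul_le_of_le_one_left (abs_nonneg _) (abs_KM_le i a c)).trans (h2 c)
      _ = _ := by simp
  rw [(KF_ckField i).eq]
  have h4 := mul_nonneg ((abs_nonneg _).trans h1) (rad3_nonneg x)
  linarith [abs_add_le (KB i a) (∑ c, KM i a c * stp 0 x c)]

namespace SymbolBound

theorem exists_vApp (M : ℕ) : ∃ K, 0 ≤ K ∧ ∀ (C : ℝ) (j s : ℕ) (g : Pt → ℝ) (i : Fin 11), 0 ≤ C →
    ContDiff ℝ ∞ g → SymbolBound C (M + 1) (j + 1) s g →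
    SymbolBound (K * C) M j s (vApp (KF i) g) := by
  obtain ⟨B, hB, hK⟩ := exists_abs_KF_stp_le
  have base : ∀ (C : ℝ) (M j s : ℕ) (g : Pt → ℝ) (i : Fin 11), 0 ≤ C →
      SymbolBound C (M + 1) (j + 1) s g →
      ∀ x, |vApp (KF i) g (stp 0 x)| ≤ 4 * B * C / (1 + rad3 x) ^ s := by
    intro C M j s g i hC h x
    have hr : 0 < 1 + rad3 x := by linarith [rad3_nonneg x]
    rw [vApp_eq_sum]
    refine (Finset.abs_sum_le_sum_abs _ _).trans ?_
    calc _ ≤ ∑ _a : Fin 4, B * C / (1 + rad3 x) ^ s := Finset.sum_le_sum fun a _ => by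
          rw [abs_mul]
          refine (mul_le_mul (hK i a x) ((h.2 a 0 (by split_ifs <;> omega)).bound x)
            (abs_nonneg _) (by positivity)).trans_eq ?_
          rw [pow_succ]
          field_simp
      _ = _ := by simp; ring
  induction M with
  | zero => exact ⟨4 * B, by positivity, fun C j s g i hC _ h => base C 0 j s g i hC h⟩
  | succ M ih =>
    obtain ⟨K, hK0, ih⟩ := ih
    refine ⟨max (4 * B) (K + 4), by positivity, fun C j s g i hC hg h =>
      ⟨fun x => ?_, fun a k hk => ?_⟩⟩
    · have := rad3_nonneg x
      refine (base C (M + 1) j s g i hC h x).trans ?_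
      exact div_le_div_of_nonneg_right (mul_le_mul_of_nonneg_right (le_max_left _ _) hC)
        (by positivity)
    rw [show pd a (vApp (KF i) g) = fun p => vApp (KF i) (pd a g) p + ∑ c, KM i c a * pd c g p from
      funext fun p => (KF_ckField i).pd_vApp hg a p]
    have h1 := ih C k (s + 1) (pd a g) i hC (pd_contDiff hg a) (h.2 a (k + 1) (by omega))
    have h2 := SymbolBound.sum (M := M) (j := k) (s := s + 1) Finset.univ
      (f := fun c p => KM i c a * pd c g p) (C := fun c => |KM i c a| * C)
      (fun c _ => contDiff_const.mul (pd_contDiff hg c)) (fun c _ =>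
        (((h.2 c k (by split_ifs at hk ⊢ <;> omega)).mono hC le_rfl (Nat.le_succ M) le_rfl
          le_rfl).const_mul (pd_contDiff hg c) _))
    have h3 := h1.add (vApp_contDiff (KF_contDiff i) (pd_contDiff hg a))
      (ContDiff.sum fun c _ => contDiff_const.mul (pd_contDiff hg c)) h2
    refine h3.mono (by positivity) ?_ le_rfl le_rfl le_rfl
    have h4 : ∑ c, |KM i c a| * C ≤ 4 * C := by
      calc _ ≤ ∑ _c : Fin 4, C :=
            Finset.sum_le_sum fun c _ => mul_le_of_le_one_left hC (abs_KM_le i c a)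
        _ = _ := by simp
    calc _ ≤ (K + 4) * C := by linarith
      _ ≤ _ := mul_le_mul_of_nonneg_right (le_max_right _ _) hC

theorem exists_kv (m s : ℕ) : ∃ K, 0 ≤ K ∧ ∀ (C : ℝ) (g : Pt → ℝ), 0 ≤ C → ContDiff ℝ ∞ g →
    SymbolBound C m m s g → ∀ (I : List (Fin 11)) (k : ℕ), I.length + k ≤ m →
    SymbolBound (K * C) k k s (kv I g) := by
  suffices H : ∀ l, ∃ K, 0 ≤ K ∧ ∀ (C : ℝ) (g : Pt → ℝ), 0 ≤ C → ContDiff ℝ ∞ g →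
      SymbolBound C m m s g → ∀ (I : List (Fin 11)) (k : ℕ), I.length ≤ l → I.length + k ≤ m →
      SymbolBound (K * C) k k s (kv I g) by
    obtain ⟨K, hK, h⟩ := H m
    exact ⟨K, hK, fun C g hC hg hs I k hk => h C g hC hg hs I k (by omega) hk⟩
  intro l
  induction l with
  | zero =>
    refine ⟨1, zero_le_one, fun C g hC _ hs I k hI hk => ?_⟩
    rw [List.length_eq_zero_iff.1 (Nat.le_zero.1 hI), one_mul]
    exact hs.mono hC le_rfl (by omega) (by omega) le_rfl
  | succ l ih =>
    obtain ⟨K, hK, ih⟩ := ih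
    choose V hV0 hV using exists_vApp
    refine ⟨max K (∑ M ∈ Finset.range m, V M * K), le_max_of_le_left hK,
      fun C g hC hg hs I k hI hk => ?_⟩
    have hS : ∀ M ∈ Finset.range m, V M * K ≤ ∑ M ∈ Finset.range m, V M * K := fun M hM =>
      Finset.single_le_sum (f := fun M => V M * K) (fun M _ => mul_nonneg (hV0 M) hK) hM
    rcases I with _ | ⟨i, I⟩
    · exact (ih C g hC hg hs [] k (by simp) hk).mono (by positivity)
        (mul_le_mul_of_nonneg_right (le_max_left _ _) hC) le_rfl le_rfl le_rfl
    · simp only [List.length_cons] at hI hk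
      have h1 := hV k _ k s _ i (by positivity) (kv_contDiff hg I)
        (ih C g hC hg hs I (k + 1) (by omega) (by omega))
      refine h1.mono (by have := hV0 k; positivity) ?_ le_rfl le_rfl le_rfl
      rw [← mul_assoc]
      exact mul_le_mul_of_nonneg_right ((hS k (Finset.mem_range.2 (by omega))).trans
        (le_max_right _ _)) hC

theorem of_spdIter {c : ℝ} {K s : ℕ} {g0 : Sp → ℝ}
    (h : ∀ k ≤ K, ∀ x, hatD k g0 x ≤ c / (1 + rad3 x) ^ (k + s)) (M : ℕ) (L : List (Fin 3))
    (hM : L.length + M ≤ K) {g : Pt → ℝ} (hg : ContDiff ℝ ∞ g)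
    (he : (fun x => g (stp 0 x)) = spdIter L g0) : SymbolBound c M 0 (L.length + s) g := by
  have hb : ∀ (L : List (Fin 3)), L.length ≤ K → ∀ x,
      |spdIter L g0 x| ≤ c / (1 + rad3 x) ^ (L.length + s) := fun L hL x => by
    refine le_trans ?_ (h _ hL x)
    have := Finset.single_le_sum (f := fun I : Fin L.length → Fin 3 => |spdIter (List.ofFn I) g0 x|)
      (fun _ _ => abs_nonneg _) (Finset.mem_univ L.get)
    simpa [hatD] using this
  induction M generalizing L g with
  | zero => exact fun x => by rw [congrFun he x]; exact hb L (by omega) x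
  | succ M ih =>
    refine ⟨fun x => by rw [show g (stp 0 x) = _ from congrFun he x]; exact hb L (by omega) x,
      fun a k hk => ?_⟩
    by_cases ha : a = 0
    · simp [ha] at hk
    · obtain ⟨i, rfl⟩ := Fin.exists_succ_eq.2 ha
      have := ih (i :: L) (by simp only [List.length_cons]; omega) (pd_contDiff hg i.succ)
        (funext fun x => by rw [← spd_stp hg 0 x i, he]; rfl)
      rw [List.length_cons, add_right_comm] at this
      simp only [Nat.le_zero, Nat.add_eq_zero_iff] at hk
      rwa [hk.1]

theorem of_data {c : ℝ} (hc : 0 ≤ c) {K s : ℕ} {g0 g1 : Sp → ℝ}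
    (h : ∀ k ≤ K, ∀ x, hatD k g0 x ≤ c / (1 + rad3 x) ^ (k + s))
    (h1 : ∀ k ≤ K, ∀ x, hatD k g1 x ≤ c / (1 + rad3 x) ^ (k + (s + 1))) (M : ℕ) (L : List (Fin 3))
    (hM : L.length + M ≤ K) {g : Pt → ℝ} (hg : ContDiff ℝ ∞ g)
    (he : (fun x => g (stp 0 x)) = spdIter L g0)
    (he1 : (fun x => pd 0 g (stp 0 x)) = spdIter L g1) :
    SymbolBound c M 1 (L.length + s) g := by
  induction M generalizing L g with
  | zero => exact (of_spdIter h 0 L hM hg he).bound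
  | succ M ih =>
    refine ⟨(of_spdIter h (M + 1) L hM hg he).bound, fun a k hk => ?_⟩
    by_cases ha : a = 0
    · subst ha
      obtain rfl : k = 0 := by simpa using hk
      exact of_spdIter h1 M L (by omega) (pd_contDiff hg 0) he1
    · obtain ⟨i, rfl⟩ := Fin.exists_succ_eq.2 ha
      have := ih (i :: L) (by simp only [List.length_cons]; omega) (pd_contDiff hg i.succ)
        (funext fun x => by rw [← spd_stp hg 0 x i, he]; rfl)
        (funext fun x => by
          rw [pd_comm hg, ← spd_stp (pd_contDiff hg 0) 0 x i, he1]; rfl)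
      rw [List.length_cons, add_right_comm] at this
      exact this.mono hc le_rfl le_rfl (by simpa using hk) le_rfl

end SymbolBound

theorem nf3_split (F : Fin 4 → Fin 4 → Fin 4 → ℝ) (f g : Pt → ℝ) (p : Pt) :
    nf3 F f g p = nf3 (fun a b c => if b = 0 ∧ c = 0 then 0 else F a b c) f g p +
      (∑ a, F a 0 0 * pd a f p) * pd 0 (pd 0 g) p := by
  simp only [nf3, Finset.sum_mul, ← Finset.sum_add_distrib]
  refine Finset.sum_congr rfl fun a _ => ?_
  simp only [Fin.sum_univ_four]
  simp
  ring

theorem SymbolBound.const_mul_mul {C M j s s' t} {f g : Pt → ℝ} (h0 : 0 ≤ C) (hf : ContDiff ℝ ∞ f)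
    (hg : ContDiff ℝ ∞ g) (c : ℝ) (h : SymbolBound C M j s f) (h' : SymbolBound C M j s' g)
    (ht : t ≤ s + s') :
    SymbolBound (|c| * (2 ^ M * C * C)) M j t (fun p => c * f p * g p) := by
  have hc : 0 ≤ |c| * C := mul_nonneg (abs_nonneg c) h0
  refine (SymbolBound.mul hc h0 (contDiff_const.mul hf) hg (h.const_mul hf c) h').mono ?_
    (le_of_eq ?_) le_rfl le_rfl ht
  · exact mul_nonneg (by positivity) (mul_nonneg hc h0)
  · ring

/-- The equation controls one more time derivative of small solutions at the initial time. -/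
theorem exists_time_step (F : Fin 4 → Fin 4 → Fin 4 → ℝ) (G : Fin 4 → Fin 4 → ℝ) {C : ℝ}
    (hC : 0 ≤ C) (M j : ℕ) : ∃ C', 0 ≤ C' ∧ ∃ ε0 > 0, ∀ ε, 0 < ε → ε < ε0 → ∀ f,
      ContDiff ℝ ∞ f → (∀ p : Pt, 0 ≤ p 0 → box f p + nf3 F f f p = nf2 G f f p) →
      SymbolBound (C * ε) (M + 2) (j + 1) 2 f → SymbolBound (C' * ε) (M + 2) (j + 2) 2 f := by
  obtain ⟨K, hK, habs⟩ := SymbolBound.exists_absorb M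
  set F' : Fin 4 → Fin 4 → Fin 4 → ℝ := fun a b c => if b = 0 ∧ c = 0 then 0 else F a b c with hF'
  set SF := ∑ a, ∑ b, ∑ c, |F' a b c| with hSF
  set SG := ∑ a, ∑ b, |G a b| with hSG
  set S0 := ∑ a, |F a 0 0| with hS0
  have hSF0 : 0 ≤ SF := by positivity
  have hSG0 : 0 ≤ SG := by positivity
  have hS00 : 0 ≤ S0 := by positivity
  clear_value F' SF SG S0
  refine ⟨max C (K * ((3 + 2 ^ M * C * (SF + SG)) * C)), by positivity,
    min 1 (1 / (2 * (S0 * C) + 1)), by positivity, fun ε h0 hε f hf he => ?_⟩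
  have hε1 : ε ≤ 1 := (hε.trans_le (min_le_left _ _)).le
  have hε2 : S0 * (C * ε) ≤ 1 / 2 := by
    have := (hε.trans_le (min_le_right _ _)).le
    rw [le_div_iff₀ (by positivity)] at this
    linarith
  have hCε : 0 ≤ C * ε := by positivity
  have hA : 0 ≤ 2 ^ M * (C * ε) * (C * ε) := by positivity
  have hB : 0 ≤ ((3 : ℕ) : ℝ) * (C * ε) + SF * (2 ^ M * (C * ε) * (C * ε)) +
      |(-1 : ℝ)| * (SG * (2 ^ M * (C * ε) * (C * ε))) := by positivity
  have hB' : 0 ≤ (3 + 2 ^ M * C * (SF + SG)) * C * ε := by positivity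
  have hS1 : 0 ≤ S0 * (C * ε) := by positivity
  have hconst : ((3 : ℕ) : ℝ) * (C * ε) + SF * (2 ^ M * (C * ε) * (C * ε)) +
      |(-1 : ℝ)| * (SG * (2 ^ M * (C * ε) * (C * ε))) ≤ (3 + 2 ^ M * C * (SF + SG)) * C * ε := by
    have h1 : 0 ≤ 2 ^ M * C * (C * ε) * (SF + SG) := by positivity
    have h2 := mul_le_of_le_one_right h1 hε1
    rw [abs_neg, abs_one, one_mul]
    push_cast
    linarith
  have hKB : 0 ≤ K * ((3 + 2 ^ M * C * (SF + SG)) * C * ε) := mul_nonneg hK hB'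
  intro h
  have hp1 : ∀ a, SymbolBound (C * ε) (M + 1) j 3 (pd a f) := fun a =>
    h.2 a j (by split_ifs <;> omega)
  have hp1' : ∀ a, SymbolBound (C * ε) M j 3 (pd a f) := fun a =>
    (hp1 a).mono hCε le_rfl (Nat.le_succ M) le_rfl le_rfl
  have hp2 : ∀ b c, ¬(b = 0 ∧ c = 0) → SymbolBound (C * ε) M j 4 (pd b (pd c f)) := fun b c hbc =>
    (h.2 c (j + if b = 0 then 1 else 0) (by split_ifs <;> omega)).2 b j le_rfl
  have s1 : ∀ a, ContDiff ℝ ∞ (pd a f) := pd_contDiff hf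
  have s2 : ∀ a b, ContDiff ℝ ∞ (pd a (pd b f)) := fun a b => pd_contDiff (s1 b) a
  have hL := SymbolBound.sum Finset.univ (f := fun i : Fin 3 => pd i.succ (pd i.succ f))
    (C := fun _ => C * ε) (fun i _ => s2 _ _) (fun i _ => hp2 i.succ i.succ (by simp))
  have hcub : SymbolBound (SF * (2 ^ M * (C * ε) * (C * ε))) M j 4 (nf3 F' f f) := by
    simp only [hSF, Finset.sum_mul]
    exact SymbolBound.sum _ (fun a _ => ContDiff.sum fun b _ => ContDiff.sum fun c _ =>
      (contDiff_const.mul (s1 a)).mul (s2 b c)) fun a _ =>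
      SymbolBound.sum _ (fun b _ => ContDiff.sum fun c _ => (contDiff_const.mul (s1 a)).mul (s2 b c))
        fun b _ => SymbolBound.sum _ (fun c _ => (contDiff_const.mul (s1 a)).mul (s2 b c))
          fun c _ => by
            by_cases hbc : b = 0 ∧ c = 0
            · have : (fun p => F' a b c * pd a f p * pd b (pd c f) p) = fun _ => 0 := by
                funext p; simp [hF', hbc]
              rw [this]
              exact (SymbolBound.zero M j 4).mono le_rfl (mul_nonneg (abs_nonneg _) hA) le_rfl le_rfl le_rfl
            · exact SymbolBound.const_mul_mul hCε (s1 a) (s2 b c) _ (hp1' a) (hp2 b c hbc) (by norm_num)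
  have hquad : SymbolBound (SG * (2 ^ M * (C * ε) * (C * ε))) M j 4 (nf2 G f f) := by
    simp only [hSG, Finset.sum_mul]
    exact SymbolBound.sum _ (fun a _ => ContDiff.sum fun b _ =>
      (contDiff_const.mul (s1 a)).mul (s1 b)) fun a _ => SymbolBound.sum _
        (fun b _ => (contDiff_const.mul (s1 a)).mul (s1 b)) fun b _ =>
          SymbolBound.const_mul_mul hCε (s1 a) (s1 b) _ (hp1' a) (hp1' b) (by norm_num)
  have ha := SymbolBound.sum Finset.univ (f := fun a p => F a 0 0 * pd a f p)
    (C := fun a => |F a 0 0| * (C * ε)) (fun a _ => contDiff_const.mul (s1 a))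
    (fun a _ => (hp1' a).const_mul (s1 a) (F a 0 0))
  rw [← Finset.sum_mul, ← hS0] at ha
  have sL : ContDiff ℝ ∞ fun p => ∑ i : Fin 3, pd i.succ (pd i.succ f) p :=
    ContDiff.sum fun i _ => s2 _ _
  have sC := nf3_contDiff F' hf hf
  have sQ := nf2_contDiff G hf hf
  simp only [Finset.sum_const, Finset.card_univ, Fintype.card_fin, nsmul_eq_mul] at hL
  have hR := (hL.add sL sC hcub).add (sL.add sC) (contDiff_const.mul sQ) (hquad.const_mul sQ (-1))
  have hR' := hR.mono hB hconst le_rfl le_rfl le_rfl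
  have hw := habs _ j 4 (pd 0 (pd 0 f)) _ _ hB' (s2 0 0)
    ((sL.add sC).add (contDiff_const.mul sQ))
    (ContDiff.sum fun a _ => contDiff_const.mul (s1 a)) (fun p hp => by
      have h1 := he p hp
      rw [nf3_split, ← hF', box] at h1
      simp only [Fin.sum_univ_three]
      change _ = pd 1 (pd 1 f) p + pd 2 (pd 2 f) p + pd 3 (pd 3 f) p + _ + _ + _
      linarith) hR' (ha.mono hS1 hε2 le_rfl le_rfl (by norm_num))
  refine SymbolBound.of_time hf (h.mono hCε ?_ le_rfl le_rfl le_rfl)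
    (hw.mono hKB ?_ le_rfl le_rfl le_rfl)
  · exact mul_le_mul_of_nonneg_right (le_max_left _ _) h0.le
  · rw [← mul_assoc]
    exact mul_le_mul_of_nonneg_right (le_max_right _ _) h0.le

/-- Decay at the initial time of all commuted derivatives of small solutions. -/
theorem exists_initial_bound (F : Fin 4 → Fin 4 → Fin 4 → ℝ) (G : Fin 4 → Fin 4 → ℝ) (n : ℕ) :
    ∃ C, 0 ≤ C ∧ ∃ ε0 > 0, ∀ ε, 0 < ε → ε < ε0 → ∀ (f : Pt → ℝ) (g0 g1 : Sp → ℝ),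
      ContDiff ℝ ∞ f → (∀ p : Pt, 0 ≤ p 0 → box f p + nf3 F f f p = nf2 G f f p) →
      (∀ x, f (stp 0 x) = g0 x) → (∀ x, pd 0 f (stp 0 x) = g1 x) →
      (∀ k ≤ n + 2, ∀ x, hatD k g0 x ≤ ε / (1 + rad3 x) ^ (k + 2)) →
      (∀ k ≤ n + 2, ∀ x, hatD k g1 x ≤ ε / (1 + rad3 x) ^ (k + 3)) →
      ∀ I : List (Fin 11), I.length ≤ n + 1 → ∀ x,
        |kv I f (stp 0 x)| ≤ C * ε / (1 + rad3 x) ^ 2 ∧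
        D1 (kv I f) (stp 0 x) ≤ C * ε / (1 + rad3 x) ^ 3 := by
  suffices H : ∀ j, ∃ C, 0 ≤ C ∧ ∃ ε0 > 0, ∀ ε, 0 < ε → ε < ε0 → ∀ (f : Pt → ℝ) (g0 g1 : Sp → ℝ),
      ContDiff ℝ ∞ f → (∀ p : Pt, 0 ≤ p 0 → box f p + nf3 F f f p = nf2 G f f p) →
      (∀ x, f (stp 0 x) = g0 x) → (∀ x, pd 0 f (stp 0 x) = g1 x) →
      (∀ k ≤ n + 2, ∀ x, hatD k g0 x ≤ ε / (1 + rad3 x) ^ (k + 2)) →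
      (∀ k ≤ n + 2, ∀ x, hatD k g1 x ≤ ε / (1 + rad3 x) ^ (k + 3)) →
      SymbolBound (C * ε) (n + 2) (j + 1) 2 f by
    obtain ⟨C, hC, ε0, hε0, H⟩ := H (n + 1)
    obtain ⟨K, hK, hkv⟩ := SymbolBound.exists_kv (n + 2) 2
    refine ⟨4 * (K * C), by positivity, ε0, hε0,
      fun ε h0 hε f g0 g1 hf he e0 e1 h1 h2 I hI x => ?_⟩
    have h3 := hkv _ f (by positivity) hf (H ε h0 hε f g0 g1 hf he e0 e1 h1 h2) I 1 (by omega)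
    have := rad3_nonneg x
    constructor
    · refine (h3.bound x).trans (div_le_div_of_nonneg_right ?_ (by positivity))
      have : 0 ≤ K * C * ε := by positivity
      linarith
    · calc _ ≤ ∑ _a : Fin 4, K * (C * ε) / (1 + rad3 x) ^ 3 :=
            Finset.sum_le_sum fun a _ => (h3.2 a 0 (by split_ifs <;> omega)).bound x
        _ = _ := by simp; ring
  intro j
  induction j with
  | zero =>
    exact ⟨1, zero_le_one, 1, one_pos, fun ε h0 hε f g0 g1 hf he e0 e1 h1 h2 => by
      have := SymbolBound.of_data h0.le h1 h2 (n + 2) [] (by simp) hf (funext e0) (funext e1)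
      simpa using this⟩
  | succ j ih =>
    obtain ⟨C, hC, ε0, hε0, ih⟩ := ih
    obtain ⟨C', hC', ε1, hε1, h⟩ := exists_time_step F G hC n j
    exact ⟨C', hC', min ε0 ε1, lt_min hε0 hε1, fun ε h0 hε f g0 g1 hf he e0 e1 h1 h2 =>
      h ε h0 (hε.trans_le (min_le_right _ _)) f hf he
        (ih ε h0 (hε.trans_le (min_le_left _ _)) f g0 g1 hf he e0 e1 h1 h2)⟩

/-- The lists of at most `k` commuting fields. -/
def Ls (k : ℕ) : Finset (List (Fin 11)) := (List.finite_length_le (Fin 11) k).toFinset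

theorem mem_Ls {k : ℕ} {I : List (Fin 11)} : I ∈ Ls k ↔ I.length ≤ k := by simp [Ls]

/-- Sum of the sizes of the first derivatives of the commuted functions of order at most `k`. -/
def DD (k : ℕ) (f : Pt → ℝ) (p : Pt) : ℝ := ∑ I ∈ Ls k, D1 (kv I f) p

/-- Sum of the sizes of the commuted functions of order at most `k`. -/
def VV (k : ℕ) (f : Pt → ℝ) (p : Pt) : ℝ := ∑ I ∈ Ls k, |kv I f p|

/-- Sum of the sizes of the tangential derivatives of the commuted functions. -/
def TT (k : ℕ) (f : Pt → ℝ) (p : Pt) : ℝ := ∑ I ∈ Ls k, TA (kv I f) p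

/-- Sum of the energy densities of the commuted functions of order at most `k`. -/
def ES (k : ℕ) (f : Pt → ℝ) (p : Pt) : ℝ := ∑ I ∈ Ls k, es (kv I f) p

theorem DD_nonneg (k : ℕ) (f : Pt → ℝ) (p : Pt) : 0 ≤ DD k f p :=
  Finset.sum_nonneg fun _ _ => D1_nonneg _ _

theorem VV_nonneg (k : ℕ) (f : Pt → ℝ) (p : Pt) : 0 ≤ VV k f p :=
  Finset.sum_nonneg fun _ _ => abs_nonneg _

theorem TT_nonneg (k : ℕ) (f : Pt → ℝ) (p : Pt) : 0 ≤ TT k f p :=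
  Finset.sum_nonneg fun _ _ => TA_nonneg _ _

theorem ES_nonneg (k : ℕ) (f : Pt → ℝ) (p : Pt) : 0 ≤ ES k f p :=
  Finset.sum_nonneg fun _ _ => es_nonneg _ _

section bounds

variable {f : Pt → ℝ} {p : Pt} {k : ℕ} {I : List (Fin 11)}

theorem D1_kv_le (h : I.length ≤ k) : D1 (kv I f) p ≤ DD k f p :=
  Finset.single_le_sum (f := fun I => D1 (kv I f) p) (fun _ _ => D1_nonneg _ _) (mem_Ls.2 h)

theorem abs_kv_le (h : I.length ≤ k) : |kv I f p| ≤ VV k f p :=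
  Finset.single_le_sum (f := fun I => |kv I f p|) (fun _ _ => abs_nonneg _) (mem_Ls.2 h)

theorem TA_kv_le (h : I.length ≤ k) : TA (kv I f) p ≤ TT k f p :=
  Finset.single_le_sum (f := fun I => TA (kv I f) p) (fun _ _ => TA_nonneg _ _) (mem_Ls.2 h)

theorem DD_mono {k l : ℕ} (h : k ≤ l) (f : Pt → ℝ) (p : Pt) : DD k f p ≤ DD l f p :=
  Finset.sum_le_sum_of_subset_of_nonneg (fun _ hI => mem_Ls.2 ((mem_Ls.1 hI).trans h))
    fun _ _ _ => D1_nonneg _ _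

theorem dK_kv_le (h : I.length + 1 ≤ k) : dK (kv I f) p ≤ 11 * VV k f p := by
  calc dK (kv I f) p ≤ ∑ _i : Fin 11, VV k f p :=
        Finset.sum_le_sum fun i _ => abs_kv_le (I := i :: I) (by simpa using h)
    _ = _ := by simp

theorem DK_kv_le (h : I.length + 1 ≤ k) : DK (kv I f) p ≤ 11 * DD k f p := by
  calc DK (kv I f) p ≤ ∑ _i : Fin 11, DD k f p :=
        Finset.sum_le_sum fun i _ => D1_kv_le (I := i :: I) (by simpa using h)
    _ = _ := by simp

theorem D2_kv_le (h : I.length + 1 ≤ k) : D2 (kv I f) p ≤ 4 * DD k f p := by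
  have e : ∀ c, ∃ i, pd c (kv I f) = kv (i :: I) f := by
    intro c
    have := vApp_KF (kv I f)
    fin_cases c
    exacts [⟨0, funext fun p => (this p).1.symm⟩, ⟨1, funext fun p => (this p).2.1.symm⟩,
      ⟨2, funext fun p => (this p).2.2.1.symm⟩, ⟨3, funext fun p => (this p).2.2.2.1.symm⟩]
  calc D2 (kv I f) p ≤ ∑ _c : Fin 4, DD k f p := Finset.sum_le_sum fun c _ => by
        obtain ⟨i, hi⟩ := e c
        rw [hi]
        exact D1_kv_le (by simpa using h)
    _ = _ := by simp

theorem D1_kv_le_div (hp : 0 ≤ p 0) (h : I.length + 1 ≤ k) :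
    D1 (kv I f) p ≤ 308 * (VV k f p / uu p) := by
  have h0 : 0 < uu p := zero_lt_one.trans_le (one_le_uu p)
  rw [← mul_div_assoc, le_div_iff₀ h0, mul_comm]
  linarith [uu_mul_D1_le hp (kv I f), dK_kv_le (f := f) (p := p) h]

theorem TA_kv_le_div (hp : 0 ≤ p 0) (h : I.length + 1 ≤ k) :
    TA (kv I f) p ≤ 2112 * (VV k f p / vv p) := by
  have h0 : 0 < vv p := zero_lt_one.trans_le (one_le_vv hp)
  rw [← mul_div_assoc, le_div_iff₀ h0, mul_comm]
  linarith [vv_mul_TA_le hp (kv I f), dK_kv_le (f := f) (p := p) h]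

theorem D2_kv_le_div (hf : ContDiff ℝ ∞ f) (hp : 0 ≤ p 0) (h : I.length + 1 ≤ k) :
    D2 (kv I f) p ≤ 2464 * (DD k f p / uu p) := by
  have h0 : 0 < uu p := zero_lt_one.trans_le (one_le_uu p)
  rw [← mul_div_assoc, le_div_iff₀ h0, mul_comm]
  linarith [uu_mul_D2_le (kv_contDiff hf I) hp, DK_kv_le (f := f) (p := p) h,
    D1_kv_le (f := f) (p := p) (I := I) (k := k) (by omega)]

theorem T2_kv_le_div (hf : ContDiff ℝ ∞ f) (hp : 0 ≤ p 0) (h : I.length + 1 ≤ k) :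
    T2 (kv I f) p ≤ 16896 * (DD k f p / vv p) := by
  have h0 : 0 < vv p := zero_lt_one.trans_le (one_le_vv hp)
  rw [← mul_div_assoc, le_div_iff₀ h0, mul_comm]
  linarith [vv_mul_T2_le (kv_contDiff hf I) hp, DK_kv_le (f := f) (p := p) h,
    D1_kv_le (f := f) (p := p) (I := I) (k := k) (by omega)]

theorem dK_vApp_pd_le {g : Pt → ℝ} (hg : ContDiff ℝ ∞ g) (p : Pt) (c : Fin 4) (i : Fin 11) :
    dK (vApp (KF i) (pd c g)) p ≤ dK (pd c (vApp (KF i) g)) p + ∑ d, dK (pd d g) p := by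
  have e : vApp (KF i) (pd c g) =
      fun p => pd c (vApp (KF i) g) p - ∑ d, KM i d c * pd d g p := by
    funext p
    rw [(KF_ckField i).pd_vApp hg]
    ring
  have s1 : ∀ d, Differentiable ℝ (pd d g) := fun d => contDiff_differentiable (pd_contDiff hg d)
  have s2 := contDiff_differentiable (pd_contDiff (vApp_contDiff (KF_contDiff i) hg) c)
  have s3 : ∀ d, Differentiable ℝ fun p => KM i d c * pd d g p := fun d => (s1 d).const_mul _
  simp only [dK]
  rw [Finset.sum_comm, ← Finset.sum_add_distrib]
  refine Finset.sum_le_sum fun j _ => ?_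
  rw [e, vApp_sub (s2 p) (by fun_prop), vApp_sum _ fun d _ => s3 d p]
  refine (abs_sub _ _).trans (add_le_add le_rfl ((Finset.abs_sum_le_sum_abs _ _).trans
    (Finset.sum_le_sum fun d _ => ?_)))
  rw [vApp_const_mul (s1 d p), abs_mul]
  exact mul_le_of_le_one_left (abs_nonneg _) (abs_KM_le i d c)

theorem KW_pd_kv_le (hf : ContDiff ℝ ∞ f) (h : I.length + 2 ≤ k) (c : Fin 4) :
    KW (pd c (kv I f)) p ≤ 1233 * DD k f p := by
  have h1 : ∀ J : List (Fin 11), J.length + 1 ≤ k → ∀ d, dK (pd d (kv J f)) p ≤ 22 * DD k f p :=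
    fun J hJ d => by
      linarith [dK_pd_le (kv_contDiff hf J) p d, DK_kv_le (f := f) (p := p) hJ,
        D1_kv_le (f := f) (p := p) (I := J) (k := k) (by omega)]
  have h2 : ∑ i, dK (vApp (KF i) (pd c (kv I f))) p ≤ ∑ _i : Fin 11, 110 * DD k f p :=
    Finset.sum_le_sum fun i _ => (dK_vApp_pd_le (kv_contDiff hf I) p c i).trans (by
      have e1 := h1 (i :: I) (by rw [List.length_cons]; omega) c
      have e2 : ∑ d, dK (pd d (kv I f)) p ≤ ∑ _d : Fin 4, 22 * DD k f p :=
        Finset.sum_le_sum fun d _ => h1 I (by omega) d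
      rw [kv_cons] at e1
      simp only [Finset.sum_const, Finset.card_univ, Fintype.card_fin, nsmul_eq_mul] at e2
      push_cast at e2
      linarith)
  simp only [Finset.sum_const, Finset.card_univ, Fintype.card_fin, nsmul_eq_mul] at h2
  push_cast at h2
  rw [KW]
  linarith [h1 I (by omega) c, abs_pd_le_D1 (kv I f) p c,
    D1_kv_le (f := f) (p := p) (I := I) (k := k) (by omega)]

end bounds

theorem inv_jb_sq_le_one (p : Pt) : (jb p ^ 2)⁻¹ ≤ 1 :=
  inv_le_one_of_one_le₀ (one_le_pow₀ (one_le_jb p))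

theorem g3_le_D (f g : Pt → ℝ) (p : Pt) : g3 f g p ≤ 11 * (D1 f p * D2 g p) := by
  have h1 := mul_le_mul_of_nonneg_right (TA_le_D1 f p) (D2_nonneg g p)
  have h2 := mul_le_mul_of_nonneg_left (T2_le_D2 g p) (D1_nonneg f p)
  have h3 := mul_le_of_le_one_left (mul_nonneg (D1_nonneg f p) (D2_nonneg g p)) (inv_jb_sq_le_one p)
  rw [g3]
  linarith

theorem g2_le_D (f g : Pt → ℝ) (p : Pt) : g2 f g p ≤ 11 * (D1 f p * D1 g p) := by
  have h1 := mul_le_mul_of_nonneg_right (TA_le_D1 f p) (D1_nonneg g p)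
  have h2 := mul_le_mul_of_nonneg_left (TA_le_D1 g p) (D1_nonneg f p)
  have h3 := mul_le_of_le_one_left (mul_nonneg (D1_nonneg f p) (D1_nonneg g p)) (inv_jb_sq_le_one p)
  rw [g2]
  linarith

theorem mul_le_of_max {a b x y : ℝ} {k l i j : ℕ} {D : ℕ → ℝ} (hD : Monotone D) (h0 : 0 ≤ D k)
    (hkl : k ≤ l) (hi : i ≤ l) (hj : j ≤ l) (hx0 : 0 ≤ x) (hx : x ≤ a * D i) (hy : y ≤ b * D j)
    (ha : 0 ≤ a) (hb : 0 ≤ b) (h : i ≤ k ∨ j ≤ k) : x * y ≤ a * b * (D k * D l) := by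
  have h1 : D k ≤ D l := hD hkl
  have hl := h0.trans h1
  rcases h with h | h
  · calc x * y ≤ x * (b * D l) :=
          mul_le_mul_of_nonneg_left (hy.trans (mul_le_mul_of_nonneg_left (hD hj) hb)) hx0
      _ ≤ (a * D k) * (b * D l) := mul_le_mul_of_nonneg_right
          (hx.trans (mul_le_mul_of_nonneg_left (hD h) ha)) (mul_nonneg hb hl)
      _ = _ := by ring
  · calc x * y ≤ x * (b * D k) :=
          mul_le_mul_of_nonneg_left (hy.trans (mul_le_mul_of_nonneg_left (hD h) hb)) hx0
      _ ≤ (a * D l) * (b * D k) := mul_le_mul_of_nonneg_right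
          (hx.trans (mul_le_mul_of_nonneg_left (hD hi) ha)) (mul_nonneg hb h0)
      _ = _ := by ring

section source

variable {F : Fin 4 → Fin 4 → Fin 4 → ℝ} {G : Fin 4 → Fin 4 → ℝ}

/-- Bound for the quasilinear commuted equations. -/
theorem exists_top_source (hF : NullForm3 F) (hG : NullForm2 G) (n : ℕ) : ∃ C, 0 ≤ C ∧ ∀ f,
    ContDiff ℝ ∞ f → (∀ p : Pt, 0 ≤ p 0 → box f p + nf3 F f f p = nf2 G f f p) →
    ∀ I : List (Fin 11), I.length ≤ n + 6 → ∀ p : Pt, 0 ≤ p 0 →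
      |box (kv I f) p + nf3 F f (kv I f) p| ≤ C * (DD (n + 3) f p * DD (n + 6) f p) := by
  obtain ⟨C, hC, h⟩ := exists_commuted_bound hF hG (n + 6)
  refine ⟨C * 44, by positivity, fun f hf he I hI p hp => ?_⟩
  have hD : Monotone fun k => DD k f p := fun k l h => DD_mono h f p
  rw [mul_assoc]
  refine h I hI f hf he p _ hp
    (mul_nonneg (by norm_num) (mul_nonneg (DD_nonneg _ _ _) (DD_nonneg _ _ _)))
    (fun A B h1 h2 => ?_) (fun A B h1 => ?_)
  · refine (g3_le_D _ _ _).trans ?_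
    linarith [mul_le_of_max hD (DD_nonneg (n + 3) f p) (l := n + 6) (by omega) (i := A.length)
      (j := B.length + 1) (by omega) (by omega) (D1_nonneg (kv A f) p)
      ((D1_kv_le le_rfl).trans (one_mul _).ge) (D2_kv_le le_rfl) zero_le_one (by norm_num)
      (by omega)]
  · refine (g2_le_D _ _ _).trans ?_
    have := mul_le_of_max hD (DD_nonneg (n + 3) f p) (l := n + 6) (by omega) (i := A.length)
      (j := B.length) (by omega) (by omega) (D1_nonneg (kv A f) p)
      ((D1_kv_le le_rfl).trans (one_mul _).ge) ((D1_kv_le le_rfl).trans (one_mul _).ge)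
      zero_le_one zero_le_one (by omega)
    have h0 := mul_nonneg (DD_nonneg (n + 3) f p) (DD_nonneg (n + 6) f p)
    linarith

/-- Bounds of `g3` and `g2` give bounds for the semilinear commuted equations. -/
theorem exists_flat_bound (hF : NullForm3 F) (hG : NullForm2 G) (k : ℕ) : ∃ C, 0 ≤ C ∧ ∀ f,
    ContDiff ℝ ∞ f → (∀ p : Pt, 0 ≤ p 0 → box f p + nf3 F f f p = nf2 G f f p) →
    ∀ (p : Pt) (X : ℝ), 0 ≤ p 0 → 0 ≤ X →
    (∀ A B : List (Fin 11), A.length + B.length ≤ k → g3 (kv A f) (kv B f) p ≤ X) →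
    (∀ A B : List (Fin 11), A.length + B.length ≤ k → g2 (kv A f) (kv B f) p ≤ X) →
    ∀ I : List (Fin 11), I.length ≤ k → |box (kv I f) p| ≤ C * X := by
  obtain ⟨C, hC, h⟩ := exists_commuted_bound hF hG k
  refine ⟨C + 3 * ∑ a, ∑ b, ∑ c, |F a b c|, by positivity,
    fun f hf he p X hp hX h3 h2 I hI => ?_⟩
  have e1 := h I hI f hf he p X hp hX (fun A B h1 _ => h3 A B (h1.trans hI))
    (fun A B h1 => h2 A B (h1.trans hI))
  have e2 := (nf3_bound hF (f := f) (kv_contDiff hf I) p).trans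
    (mul_le_mul_of_nonneg_left (h3 [] I (by simpa using hI)) (by positivity))
  calc |box (kv I f) p| = |(box (kv I f) p + nf3 F f (kv I f) p) - nf3 F f (kv I f) p| := by
        rw [add_sub_cancel_right]
    _ ≤ _ := (abs_sub _ _).trans (by linarith)

theorem exists_crude_source (hF : NullForm3 F) (hG : NullForm2 G) (n : ℕ) : ∃ C, 0 ≤ C ∧ ∀ f,
    ContDiff ℝ ∞ f → (∀ p : Pt, 0 ≤ p 0 → box f p + nf3 F f f p = nf2 G f f p) →
    ∀ p : Pt, 0 ≤ p 0 → ∀ I : List (Fin 11), I.length ≤ n + 3 →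
      |box (kv I f) p| ≤ C * DD (n + 4) f p ^ 2 := by
  obtain ⟨C, hC, h⟩ := exists_flat_bound hF hG (n + 3)
  refine ⟨C * 44, by positivity, fun f hf he p hp I hI => ?_⟩
  rw [mul_assoc]
  have h1 : ∀ A : List (Fin 11), A.length ≤ n + 3 → D1 (kv A f) p ≤ DD (n + 4) f p :=
    fun A hA => D1_kv_le (by omega)
  have h0 := DD_nonneg (n + 4) f p
  refine h f hf he p _ hp (by positivity) (fun A B hAB => (g3_le_D _ _ _).trans ?_)
    (fun A B hAB => (g2_le_D _ _ _).trans ?_) I hI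
  · have := mul_le_mul (h1 A (by omega)) (D2_kv_le (f := f) (p := p) (I := B) (k := n + 4)
      (by omega)) (D2_nonneg _ _) h0
    linarith
  · have := mul_le_mul (h1 A (by omega)) (h1 B (by omega)) (D1_nonneg _ _) h0
    have h3 := sq_nonneg (DD (n + 4) f p)
    linarith

theorem inv_jb_sq_div_le {p : Pt} (hp : 0 ≤ p 0) : (jb p ^ 2)⁻¹ * (1 / uu p) ≤ 3 / vv p ∧
    (jb p ^ 2)⁻¹ * (1 / uu p) * (1 / uu p) ≤ 9 / (vv p * uu p) := by
  have h1 := one_le_jb p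
  have h2 := one_le_uu p
  have h3 := one_le_vv hp
  have h4 := vv_le_jb_mul_uu p
  have h5 := uu_le_vv hp
  have e : (jb p ^ 2)⁻¹ * (1 / uu p) ≤ 3 / vv p := by
    rw [← one_div, one_div_mul_one_div, div_le_div_iff₀ (by positivity) (by positivity)]
    have : jb p * uu p ≤ jb p ^ 2 * uu p := by
      rw [sq, mul_assoc]; exact le_mul_of_one_le_left (by positivity) h1
    linarith
  refine ⟨e, ?_⟩
  calc _ ≤ 3 / vv p * (1 / uu p) := mul_le_mul_of_nonneg_right e (by positivity)
    _ = 3 / (vv p * uu p) := by rw [div_mul_div_comm, mul_one]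
    _ ≤ _ := div_le_div_of_nonneg_right (by norm_num) (by positivity)

/-- The null structure bound with one factor in low order. -/
theorem exists_ghost_source (hF : NullForm3 F) (hG : NullForm2 G) (n : ℕ) : ∃ C, 0 ≤ C ∧ ∀ f,
    ContDiff ℝ ∞ f → (∀ p : Pt, 0 ≤ p 0 → box f p + nf3 F f f p = nf2 G f f p) →
    ∀ p : Pt, 0 ≤ p 0 → ∀ I : List (Fin 11), I.length ≤ n + 5 →
      |box (kv I f) p| ≤ C * ((VV (n + 3) f p + DD (n + 4) f p) *
        (DD (n + 6) f p / vv p + TT (n + 5) f p / uu p)) := by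
  obtain ⟨C, hC, h⟩ := exists_flat_bound hF hG (n + 5)
  refine ⟨C * 40000, by positivity, fun f hf he p hp I hI => ?_⟩
  rw [mul_assoc]
  have hu := one_le_uu p
  have hv := one_le_vv hp
  have u0 : 0 < uu p := by linarith
  have v0 : 0 < vv p := by linarith
  obtain ⟨hj, -⟩ := inv_jb_sq_div_le hp
  set j := (jb p ^ 2)⁻¹ with hj_def
  have hj0 : 0 ≤ j := by positivity
  set V := VV (n + 3) f p with hV_def
  set D := DD (n + 4) f p with hD_def
  set D' := DD (n + 6) f p with hD'_def
  set T := TT (n + 5) f p with hT_def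
  have hV : 0 ≤ V := VV_nonneg _ _ _
  have hD : 0 ≤ D := DD_nonneg _ _ _
  have hD' : 0 ≤ D' := DD_nonneg _ _ _
  have hT : 0 ≤ T := TT_nonneg _ _ _
  have hTA : ∀ A : List (Fin 11), A.length ≤ n + 5 → TA (kv A f) p ≤ T := fun A => TA_kv_le
  have hTAl : ∀ A : List (Fin 11), A.length ≤ n + 2 → TA (kv A f) p ≤ 2112 * (V / vv p) :=
    fun A hA => TA_kv_le_div hp (by omega)
  have hD1 : ∀ A : List (Fin 11), A.length ≤ n + 6 → D1 (kv A f) p ≤ D' := fun A => D1_kv_le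
  have hD1l : ∀ A : List (Fin 11), A.length ≤ n + 2 → D1 (kv A f) p ≤ 308 * (V / uu p) :=
    fun A hA => D1_kv_le_div hp (by omega)
  have hD2 : ∀ A : List (Fin 11), A.length ≤ n + 5 → D2 (kv A f) p ≤ 4 * D' :=
    fun A hA => D2_kv_le (by omega)
  have hD2l : ∀ A : List (Fin 11), A.length ≤ n + 3 → D2 (kv A f) p ≤ 2464 * (D / uu p) :=
    fun A hA => D2_kv_le_div hf hp (by omega)
  have hT2l : ∀ A : List (Fin 11), A.length ≤ n + 3 → T2 (kv A f) p ≤ 16896 * (D / vv p) :=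
    fun A hA => T2_kv_le_div hf hp (by omega)
  have hT2 : ∀ A : List (Fin 11), A.length ≤ n + 5 → T2 (kv A f) p ≤ 16896 * (D' / vv p) :=
    fun A hA => T2_kv_le_div hf hp (by omega)
  have hD1m : ∀ A : List (Fin 11), A.length ≤ n + 3 → D1 (kv A f) p ≤ D :=
    fun A hA => D1_kv_le (by omega)
  clear_value V D D' T j
  have n1 : 0 ≤ V * D' / vv p := by positivity
  have n2 : 0 ≤ D * D' / vv p := by positivity
  have n3 : 0 ≤ V * T / uu p := by positivity
  have n4 : 0 ≤ D * T / uu p := by positivity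
  have hX : (V + D) * (D' / vv p + T / uu p) =
      V * D' / vv p + D * D' / vv p + V * T / uu p + D * T / uu p := by ring
  have hjx : ∀ x, 0 ≤ x → j * (x / uu p * D') ≤ 3 * (x * D' / vv p) := fun x hx =>
    calc j * (x / uu p * D') = j * (1 / uu p) * (x * D') := by ring
      _ ≤ 3 / vv p * (x * D') := mul_le_mul_of_nonneg_right hj (by positivity)
      _ = _ := by ring
  rw [hX]
  refine h f hf he p _ hp (by positivity) (fun A B hAB => ?_) (fun A B hAB => ?_) I hI
  · have b2 : D1 (kv A f) p * T2 (kv B f) p ≤ 16896 * (D * D' / vv p) := by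
      rcases le_or_gt A.length (n + 3) with hA | hA
      · calc _ ≤ D * (16896 * (D' / vv p)) :=
              mul_le_mul (hD1m A hA) (hT2 B (by omega)) (T2_nonneg _ _) hD
          _ = _ := by ring
      · calc _ ≤ D' * (16896 * (D / vv p)) :=
              mul_le_mul (hD1 A (by omega)) (hT2l B (by omega)) (T2_nonneg _ _) hD'
          _ = _ := by ring
    rw [g3, ← hj_def]
    rcases le_or_gt A.length (n + 2) with hA | hA
    · have b1 := mul_le_mul (hTAl A hA) (hD2 B (by omega)) (D2_nonneg _ _) (by positivity)
      have b3 := mul_le_mul_of_nonneg_left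
        (mul_le_mul (hD1l A hA) (hD2 B (by omega)) (D2_nonneg _ _) (by positivity)) hj0
      have b4 := hjx V hV
      have e1 : 2112 * (V / vv p) * (4 * D') = 8448 * (V * D' / vv p) := by ring
      have e2 : j * (308 * (V / uu p) * (4 * D')) = 1232 * (j * (V / uu p * D')) := by ring
      linarith
    · have b1 := mul_le_mul (hTA A (by omega)) (hD2l B (by omega)) (D2_nonneg _ _) hT
      have b3 := mul_le_mul_of_nonneg_left
        (mul_le_mul (hD1 A (by omega)) (hD2l B (by omega)) (D2_nonneg _ _) hD') hj0
      have b4 := hjx D hD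
      have e1 : T * (2464 * (D / uu p)) = 2464 * (D * T / uu p) := by ring
      have e2 : j * (D' * (2464 * (D / uu p))) = 2464 * (j * (D / uu p * D')) := by ring
      linarith
  · have key : ∀ A B : List (Fin 11), A.length ≤ n + 5 → B.length ≤ n + 5 →
        A.length ≤ n + 2 ∨ B.length ≤ n + 2 →
        TA (kv A f) p * D1 (kv B f) p ≤ 2112 * (V * D' / vv p + V * T / uu p) := by
      intro A B hA hB hAB
      rcases hAB with h | h
      · have := mul_le_mul (hTAl A h) (hD1 B (by omega)) (D1_nonneg _ _) (by positivity)
        have e : 2112 * (V / vv p) * D' = 2112 * (V * D' / vv p) := by ring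
        linarith
      · have := mul_le_mul (hTA A hA) (hD1l B h) (D1_nonneg _ _) hT
        have e : T * (308 * (V / uu p)) = 308 * (V * T / uu p) := by ring
        linarith
    have b1 := key A B (by omega) (by omega) (by omega)
    have b2 := key B A (by omega) (by omega) (by omega)
    have b3 : j * (D1 (kv A f) p * D1 (kv B f) p) ≤ 308 * (j * (V / uu p * D')) := by
      have e : 308 * (j * (V / uu p * D')) = j * (308 * (V / uu p) * D') := by ring
      rw [e]
      refine mul_le_mul_of_nonneg_left ?_ hj0
      rcases (by omega : A.length ≤ n + 2 ∨ B.length ≤ n + 2) with h | h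
      · exact mul_le_mul (hD1l A h) (hD1 B (by omega)) (D1_nonneg _ _) (by positivity)
      · rw [mul_comm]
        exact mul_le_mul (hD1l B h) (hD1 A (by omega)) (D1_nonneg _ _) (by positivity)
    have b4 := hjx V hV
    rw [g2, ← hj_def]
    linarith

/-- The null structure bound with all factors in low order. -/
theorem exists_low_source (hF : NullForm3 F) (hG : NullForm2 G) (n : ℕ) : ∃ C, 0 ≤ C ∧ ∀ f,
    ContDiff ℝ ∞ f → (∀ p : Pt, 0 ≤ p 0 → box f p + nf3 F f f p = nf2 G f f p) →
    ∀ p : Pt, 0 ≤ p 0 → ∀ I : List (Fin 11), I.length ≤ n + 2 →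
      |box (kv I f) p| ≤ C * ((VV (n + 3) f p + DD (n + 4) f p) ^ 2 / (vv p * uu p)) := by
  obtain ⟨C, hC, h⟩ := exists_flat_bound hF hG (n + 2)
  refine ⟨C * 20000000, by positivity, fun f hf he p hp I hI => ?_⟩
  rw [mul_assoc]
  have u0 : 0 < uu p := zero_lt_one.trans_le (one_le_uu p)
  have v0 : 0 < vv p := zero_lt_one.trans_le (one_le_vv hp)
  obtain ⟨-, hj⟩ := inv_jb_sq_div_le hp
  set j := (jb p ^ 2)⁻¹ with hj_def
  have hj0 : 0 ≤ j := by positivity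
  set Z := VV (n + 3) f p + DD (n + 4) f p with hZ_def
  have hV : 0 ≤ VV (n + 3) f p := VV_nonneg _ _ _
  have hD : 0 ≤ DD (n + 4) f p := DD_nonneg _ _ _
  have hZ : 0 ≤ Z := add_nonneg hV hD
  have hdiv : ∀ {x y : ℝ}, 0 < y → x ≤ Z → x / y ≤ Z / y := fun hy h =>
    div_le_div_of_nonneg_right h hy.le
  have hVZ : VV (n + 3) f p ≤ Z := by linarith
  have hDZ : DD (n + 4) f p ≤ Z := by linarith
  have hTA : ∀ A : List (Fin 11), A.length ≤ n + 2 → TA (kv A f) p ≤ 2112 * (Z / vv p) :=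
    fun A hA => (TA_kv_le_div (k := n + 3) hp (by omega)).trans (by linarith [hdiv v0 hVZ])
  have hD1 : ∀ A : List (Fin 11), A.length ≤ n + 2 → D1 (kv A f) p ≤ 308 * (Z / uu p) :=
    fun A hA => (D1_kv_le_div (k := n + 3) hp (by omega)).trans (by linarith [hdiv u0 hVZ])
  have hD2 : ∀ A : List (Fin 11), A.length ≤ n + 2 → D2 (kv A f) p ≤ 2464 * (Z / uu p) :=
    fun A hA => (D2_kv_le_div (k := n + 4) hf hp (by omega)).trans (by linarith [hdiv u0 hDZ])
  have hT2 : ∀ A : List (Fin 11), A.length ≤ n + 2 → T2 (kv A f) p ≤ 16896 * (Z / vv p) :=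
    fun A hA => (T2_kv_le_div (k := n + 4) hf hp (by omega)).trans (by linarith [hdiv v0 hDZ])
  clear_value Z j
  have hX : 0 ≤ Z ^ 2 / (vv p * uu p) := by positivity
  have e1 : Z / vv p * (Z / uu p) = Z ^ 2 / (vv p * uu p) := by rw [div_mul_div_comm, sq]
  have e2 : Z / uu p * (Z / vv p) = Z ^ 2 / (vv p * uu p) := by rw [← e1, mul_comm]
  have hjx : j * (Z / uu p * (Z / uu p)) ≤ 9 * (Z ^ 2 / (vv p * uu p)) := by
    calc j * (Z / uu p * (Z / uu p)) = j * (1 / uu p) * (1 / uu p) * Z ^ 2 := by ring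
      _ ≤ 9 / (vv p * uu p) * Z ^ 2 := mul_le_mul_of_nonneg_right hj (by positivity)
      _ = _ := by ring
  refine h f hf he p _ hp (by positivity) (fun A B hAB => ?_) (fun A B hAB => ?_) I hI
  · have b1 := mul_le_mul (hTA A (by omega)) (hD2 B (by omega)) (D2_nonneg _ _) (by positivity)
    have b2 := mul_le_mul (hD1 A (by omega)) (hT2 B (by omega)) (T2_nonneg _ _) (by positivity)
    have b3 := mul_le_mul_of_nonneg_left
      (mul_le_mul (hD1 A (by omega)) (hD2 B (by omega)) (D2_nonneg _ _) (by positivity)) hj0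
    rw [mul_mul_mul_comm, e1] at b1
    rw [mul_mul_mul_comm, e2] at b2
    rw [mul_mul_mul_comm, mul_left_comm] at b3
    rw [g3, ← hj_def]
    linarith
  · have b1 := mul_le_mul (hTA A (by omega)) (hD1 B (by omega)) (D1_nonneg _ _) (by positivity)
    have b2 := mul_le_mul (hD1 A (by omega)) (hTA B (by omega)) (TA_nonneg _ _) (by positivity)
    have b3 := mul_le_mul_of_nonneg_left
      (mul_le_mul (hD1 A (by omega)) (hD1 B (by omega)) (D1_nonneg _ _) (by positivity)) hj0
    rw [mul_mul_mul_comm, e1] at b1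
    rw [mul_mul_mul_comm, e2] at b2
    rw [mul_mul_mul_comm, mul_left_comm] at b3
    rw [g2, ← hj_def]
    linarith

end source

theorem DD_sq_le (k : ℕ) (f : Pt → ℝ) (p : Pt) :
    DD k f p ^ 2 ≤ 4 * (Ls k).card * ES k f p := by
  have h := sq_sum_le_card_mul_sum_sq (s := Ls k) (f := fun I => D1 (kv I f) p)
  have h2 : ∑ I ∈ Ls k, D1 (kv I f) p ^ 2 ≤ 4 * ES k f p := by
    rw [ES, Finset.mul_sum]
    exact Finset.sum_le_sum fun I _ => D1_sq_le_es _ _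
  have h3 := mul_le_mul_of_nonneg_left h2 (Nat.cast_nonneg (α := ℝ) (Ls k).card)
  rw [DD]
  linarith

theorem TT_sq_le (k : ℕ) (f : Pt → ℝ) (p : Pt) :
    TT k f p ^ 2 ≤ 4 * (Ls k).card * ∑ I ∈ Ls k, ∑ a, Tg a (kv I f) p ^ 2 := by
  have h := sq_sum_le_card_mul_sum_sq (s := Ls k) (f := fun I => TA (kv I f) p)
  have h2 : ∑ I ∈ Ls k, TA (kv I f) p ^ 2 ≤ 4 * ∑ I ∈ Ls k, ∑ a, Tg a (kv I f) p ^ 2 := by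
    rw [Finset.mul_sum]
    refine Finset.sum_le_sum fun I _ => ?_
    have := sq_sum_le_card_mul_sum_sq (s := Finset.univ) (f := fun a => |Tg a (kv I f) p|)
    simpa [TA] using this
  have h3 := mul_le_mul_of_nonneg_left h2 (Nat.cast_nonneg (α := ℝ) (Ls k).card)
  rw [TT]
  linarith

theorem ES_mono {k l : ℕ} (h : k ≤ l) (f : Pt → ℝ) (p : Pt) : ES k f p ≤ ES l f p :=
  Finset.sum_le_sum_of_subset_of_nonneg (fun _ hI => mem_Ls.2 ((mem_Ls.1 hI).trans h))
    fun _ _ _ => es_nonneg _ _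

theorem es_continuous {f : Pt → ℝ} (hf : ContDiff ℝ ∞ f) : Continuous (es f) := by
  unfold es
  exact continuous_finsetSum _ fun a _ => (pd_contDiff hf a).continuous.pow 2

theorem ES_continuous (k : ℕ) {f : Pt → ℝ} (hf : ContDiff ℝ ∞ f) : Continuous (ES k f) := by
  unfold ES
  exact continuous_finsetSum _ fun I _ => es_continuous (kv_contDiff hf I)

theorem sum_abs_pd_zero_le (k : ℕ) (f : Pt → ℝ) (p : Pt) :
    ∑ I ∈ Ls k, |pd 0 (kv I f) p| ≤ DD k f p :=
  Finset.sum_le_sum fun _ _ => abs_pd_le_D1 _ _ _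

/-- A weight decaying like a power of time. -/
def aw (c : ℝ) (p : Pt) : ℝ := Real.exp (-(c * Real.arsinh (p 0)))

theorem aw_contDiff (c : ℝ) : ContDiff ℝ ∞ (aw c) := by
  unfold aw
  exact Real.contDiff_exp.comp (contDiff_const.mul (Real.contDiff_arsinh.comp
    (coord_contDiff 0))).neg

theorem aw_pos (c : ℝ) (p : Pt) : 0 < aw c p := Real.exp_pos _

theorem pd_aw (c : ℝ) (a : Fin 4) (p : Pt) :
    pd a (aw c) p = if a = 0 then -(c / √(1 + p 0 ^ 2) * aw c p) else 0 := by
  have hd : HasDerivAt (fun s => Real.exp (-(c * Real.arsinh s)))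
      (Real.exp (-(c * Real.arsinh (p 0))) * -(c * (√(1 + p 0 ^ 2))⁻¹)) (p 0) :=
    ((Real.hasDerivAt_arsinh (p 0)).const_mul c).fun_neg.exp
  have h := pd_comp (φ := fun s => Real.exp (-(c * Real.arsinh s))) (g := fun q : Pt => q 0)
    (p := p) hd.differentiableAt (contDiff_differentiable (coord_contDiff 0) p) a
  rw [show aw c = fun q => Real.exp (-(c * Real.arsinh (q 0))) from rfl, h, hd.deriv, pd_coord]
  by_cases ha : a = 0
  · subst ha
    simp
    ring
  · simp [ha, Ne.symm ha]

theorem sqrt_one_add_sq_le {t : ℝ} (ht : 0 ≤ t) : √(1 + t ^ 2) ≤ 1 + t :=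
  Real.sqrt_le_iff.2 ⟨by linarith, by nlinarith⟩

theorem aw_sum_pd {c : ℝ} (hc : 0 ≤ c) {p : Pt} (hp : 0 ≤ p 0) {J : Fin 4 → ℝ} (hJ : 0 ≤ J 0) :
    ∑ a, pd a (aw c) p * J a ≤ -(c / (1 + p 0) * (aw c p * J 0)) := by
  simp only [pd_aw, ite_mul, zero_mul, Finset.sum_ite_eq', Finset.mem_univ, if_true]
  have h1 : c / (1 + p 0) ≤ c / √(1 + p 0 ^ 2) :=
    div_le_div_of_nonneg_left hc (Real.sqrt_pos.2 (by positivity)) (sqrt_one_add_sq_le hp)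
  have := mul_le_mul_of_nonneg_right h1 (mul_nonneg (aw_pos c p).le hJ)
  linarith

theorem pd_cw_mul_eq_zero {m R : ℝ} (hm : 0 < m) {p : Pt} (h : R ≤ 2 * p 0 + jb p)
    {J : Pt → ℝ} (hJ : ContDiff ℝ ∞ J) (a : Fin 4) : pd a (fun q => cw m R q * J q) p = 0 := by
  have h0 := cw_eq_zero hm h
  have hmin : IsLocalMin (cw m R) p := Filter.Eventually.of_forall fun q => by
    rw [h0]; exact cw_nonneg m R q
  have h1 : pd a (cw m R) p = 0 := by
    unfold pd
    simp [hmin.fderiv_eq_zero]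
  rw [pd_mul (contDiff_differentiable (cw_contDiff m R) p) (contDiff_differentiable hJ p), h0, h1]
  simp

section top

variable {F : Fin 4 → Fin 4 → Fin 4 → ℝ} {f : Pt → ℝ} {N : ℕ}

/-- The weighted sum of the quasilinear currents of the commuted functions. -/
def topJ (c : ℝ) (F : Fin 4 → Fin 4 → Fin 4 → ℝ) (f : Pt → ℝ) (N : ℕ) (a : Fin 4) (p : Pt) : ℝ :=
  aw c p * ∑ I ∈ Ls N, cur (gm F f) (kv I f) a p

theorem gm_cur_contDiff (hf : ContDiff ℝ ∞ f) {ψ : Pt → ℝ} (hψ : ContDiff ℝ ∞ ψ) (a : Fin 4) :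
    ContDiff ℝ ∞ (cur (gm F f) ψ a) :=
  cur_contDiff (gm_contDiff F hf) hψ a

theorem topJ_contDiff (c : ℝ) (hf : ContDiff ℝ ∞ f) (a : Fin 4) :
    ContDiff ℝ ∞ (topJ c F f N a) :=
  (aw_contDiff c).mul (ContDiff.sum fun I _ => gm_cur_contDiff hf (kv_contDiff hf I) a)

theorem topJ_zero_bounds (c : ℝ) {p : Pt} (h : (∑ a, ∑ b, ∑ c, |F a b c|) * D1 f p ≤ 1 / 60) :
    aw c p * ES N f p / 4 ≤ topJ c F f N 0 p ∧ topJ c F f N 0 p ≤ aw c p * ES N f p := by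
  have h1 : ES N f p / 4 ≤ ∑ I ∈ Ls N, cur (gm F f) (kv I f) 0 p := by
    rw [ES, Finset.sum_div]
    exact Finset.sum_le_sum fun I _ => (cur_gm_bounds h).1
  have h2 : ∑ I ∈ Ls N, cur (gm F f) (kv I f) 0 p ≤ ES N f p :=
    Finset.sum_le_sum fun I _ => (cur_gm_bounds h).2
  have h3 := aw_pos c p
  exact ⟨by rw [mul_div_assoc]; exact mul_le_mul_of_nonneg_left h1 h3.le,
    mul_le_mul_of_nonneg_left h2 h3.le⟩

theorem div_topJ_le {c m R Y : ℝ} {p : Pt} (hf : ContDiff ℝ ∞ f) (hm : 0 ≤ m) (hc : 0 ≤ c)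
    (hp : 0 ≤ p 0) (hS : (∑ a, ∑ b, ∑ c, |F a b c|) * D1 f p ≤ 1 / 60) (hY : 0 ≤ Y)
    (hsrc : ∀ I ∈ Ls N, |box (kv I f) p + nf3 F f (kv I f) p| ≤ Y * DD N f p)
    (hsm : 4 * (Ls N).card * Y + 18 * (∑ a, ∑ b, ∑ c, |F a b c|) * D2 f p ≤ c / 8 / (1 + p 0)) :
    ∑ a, pd a (fun q => cw m R q * topJ c F f N a q) p ≤
      -(c / 8 / (1 + p 0) * (aw c p * (cw m R p * ES N f p))) := by
  set S := ∑ a, ∑ b, ∑ c, |F a b c|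
  have sm : ∀ I a, ContDiff ℝ ∞ fun q => cw m R q * cur (gm F f) (kv I f) a q := fun I a =>
    (cw_contDiff m R).mul (gm_cur_contDiff hf (kv_contDiff hf I) a)
  have e : ∀ a, (fun q => cw m R q * topJ c F f N a q) =
      fun q => aw c q * ∑ I ∈ Ls N, cw m R q * cur (gm F f) (kv I f) a q := fun a => by
    funext q
    rw [topJ, ← Finset.mul_sum]
    ring
  have hw := cw_nonneg m R p
  have hES := ES_nonneg N f p
  have hA := aw_pos c p
  have hJ0 : cw m R p * (ES N f p / 4) ≤ ∑ I ∈ Ls N, cw m R p * cur (gm F f) (kv I f) 0 p := by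
    rw [← Finset.mul_sum, ES, Finset.sum_div]
    exact mul_le_mul_of_nonneg_left (Finset.sum_le_sum fun I _ => (cur_gm_bounds hS).1) hw
  have hdiv : ∑ a, pd a (fun q => ∑ I ∈ Ls N, cw m R q * cur (gm F f) (kv I f) a q) p ≤
      cw m R p * ES N f p * (c / 8 / (1 + p 0)) := by
    calc _ = ∑ I ∈ Ls N, ∑ a, pd a (fun q => cw m R q * cur (gm F f) (kv I f) a q) p := by
          rw [Finset.sum_comm]
          refine Finset.sum_congr rfl fun a _ => ?_
          exact pd_sum _ (fun I _ => contDiff_differentiable (sm I a) p) a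
      _ ≤ ∑ I ∈ Ls N, cw m R p * (|pd 0 (kv I f) p| * (Y * DD N f p) +
            18 * S * D2 f p * es (kv I f) p) := by
          refine Finset.sum_le_sum fun I hI => ?_
          refine (div_cw_cur_gm_le hf (kv_contDiff hf I) hm hS).trans ?_
          exact mul_le_mul_of_nonneg_left (add_le_add (mul_le_mul_of_nonneg_left (hsrc I hI)
            (abs_nonneg _)) le_rfl) hw
      _ = cw m R p * ((∑ I ∈ Ls N, |pd 0 (kv I f) p|) * (Y * DD N f p) +
            18 * S * D2 f p * ES N f p) := by
          rw [← Finset.mul_sum, Finset.sum_add_distrib, ← Finset.sum_mul, ← Finset.mul_sum, ES]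
      _ ≤ cw m R p * (DD N f p * (Y * DD N f p) + 18 * S * D2 f p * ES N f p) := by
          gcongr
          · exact mul_nonneg hY (DD_nonneg _ _ _)
          · exact sum_abs_pd_zero_le N f p
      _ ≤ cw m R p * (ES N f p * (4 * (Ls N).card * Y + 18 * S * D2 f p)) := by
          refine mul_le_mul_of_nonneg_left ?_ hw
          have := mul_le_mul_of_nonneg_left (DD_sq_le N f p) hY
          linarith
      _ ≤ _ := by
          rw [mul_assoc (cw m R p)]
          exact mul_le_mul_of_nonneg_left (mul_le_mul_of_nonneg_left hsm hES) hw
  have hnn : 0 ≤ cw m R p * (ES N f p / 4) := mul_nonneg hw (by linarith)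
  simp only [e]
  rw [pd_weight_mul (aw_contDiff c) (J := fun a q => ∑ I ∈ Ls N, cw m R q *
    cur (gm F f) (kv I f) a q) (fun a => ContDiff.sum fun I _ => sm I a)]
  have h1 := aw_sum_pd hc hp (J := fun a => ∑ I ∈ Ls N, cw m R p * cur (gm F f) (kv I f) a p)
    (hnn.trans hJ0)
  have h2 := mul_le_mul_of_nonneg_left hdiv hA.le
  have h3 : c / (1 + p 0) * (aw c p * (cw m R p * (ES N f p / 4))) ≤
      c / (1 + p 0) * (aw c p * ∑ I ∈ Ls N, cw m R p * cur (gm F f) (kv I f) 0 p) := by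
    gcongr
  have h4 : c / 8 / (1 + p 0) = c / (1 + p 0) / 8 := by ring
  rw [h4] at h2 ⊢
  linarith

end top

/-- Smooth fields cut off in a cone whose divergence there is nonpositive have decreasing
fluxes. -/
theorem cw_flux_le {m R T : ℝ} (hm : 0 < m) {J : Fin 4 → Pt → ℝ} (hJ : ∀ a, ContDiff ℝ ∞ (J a))
    (hdiv : ∀ p, Dm R T p → ∑ a, pd a (fun q => cw m R q * J a q) p ≤ 0) {t : ℝ} (ht : 0 ≤ t)
    (htT : t < T) :
    ∫ x : Sp, cw m R (stp t x) * J 0 (stp t x) ≤ ∫ x : Sp, cw m R (stp 0 x) * J 0 (stp 0 x) := by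
  refine slice_integral_le_initial (K := fun a q => cw m R q * J a q) (R := R)
    (fun a => (cw_contDiff m R).mul (hJ a)) (fun a p h => by simp [cw_eq_zero hm h.le])
    (fun p h0 hT => ?_) ht htT
  rcases lt_or_ge (2 * p 0 + jb p) R with h | h
  · exact hdiv p ⟨h0.le, hT, h⟩
  · exact (Finset.sum_eq_zero fun a _ => pd_cw_mul_eq_zero hm h (hJ a) a).le

theorem cw_mul_integrable {m R : ℝ} (hm : 0 < m) {g : Pt → ℝ} (hg : Continuous g) {t : ℝ}
    (ht : 0 ≤ t) : Integrable fun x : Sp => cw m R (stp t x) * g (stp t x) := by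
  refine integrable_of_slice (R := R) (((cw_contDiff m R).continuous.mul hg).comp
    (continuous_stp_right t)) fun x hx => ?_
  have h1 := (norm_le_rr_stp t x).trans (rr_le_jb (stp t x))
  rw [cw_eq_zero hm (by rw [stp_zero_apply]; linarith), zero_mul]

section energies

variable {F : Fin 4 → Fin 4 → Fin 4 → ℝ} {G : Fin 4 → Fin 4 → ℝ}

theorem exists_div_topJ_le (hF : NullForm3 F) (hG : NullForm2 G) (n : ℕ) {c : ℝ} (hc : 0 < c) :
    ∃ κ > 0, ∀ f, ContDiff ℝ ∞ f →
      (∀ p : Pt, 0 ≤ p 0 → box f p + nf3 F f f p = nf2 G f f p) →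
      ∀ p : Pt, 0 ≤ p 0 → DD (n + 3) f p ≤ κ / (1 + p 0) →
        (∑ a, ∑ b, ∑ c, |F a b c|) * D1 f p ≤ 1 / 60 ∧ ∀ m R, 0 ≤ m →
          ∑ a, pd a (fun q => cw m R q * topJ c F f (n + 6) a q) p ≤
            -(c / 8 / (1 + p 0) * (aw c p * (cw m R p * ES (n + 6) f p))) := by
  obtain ⟨C, hC, H⟩ := exists_top_source hF hG n
  set S := ∑ a, ∑ b, ∑ c, |F a b c|
  have hS : 0 ≤ S := Finset.sum_nonneg fun a _ => Finset.sum_nonneg fun b _ =>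
    Finset.sum_nonneg fun c _ => abs_nonneg _
  set L := 4 * (Ls (n + 6)).card * C + 72 * S with hL_def
  have hL : 0 ≤ L := by positivity
  refine ⟨min (1 / (60 * (S + 1))) (c / 8 / (L + 1)), by positivity, fun f hf he p hp h => ?_⟩
  have hp1 : 0 < 1 + p 0 := by linarith
  have hD := DD_nonneg (n + 3) f p
  have hD1 : D1 f p ≤ DD (n + 3) f p := D1_kv_le (I := []) (by simp)
  have hD2 : D2 f p ≤ 4 * DD (n + 3) f p := D2_kv_le (I := []) (by simp)
  have h1 : DD (n + 3) f p * (1 + p 0) ≤ 1 / (60 * (S + 1)) :=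
    ((le_div_iff₀ hp1).1 h).trans (min_le_left _ _)
  have h2 : DD (n + 3) f p * (1 + p 0) ≤ c / 8 / (L + 1) :=
    ((le_div_iff₀ hp1).1 h).trans (min_le_right _ _)
  rw [le_div_iff₀ (by positivity)] at h1 h2
  have hDp : DD (n + 3) f p ≤ DD (n + 3) f p * (1 + p 0) := le_mul_of_one_le_right hD (by linarith)
  have hsmall : S * D1 f p ≤ 1 / 60 := by
    have a1 := mul_le_mul_of_nonneg_left hD1 hS
    have a2 := mul_le_mul_of_nonneg_left hDp hS
    have a3 : 0 ≤ DD (n + 3) f p * (1 + p 0) := by positivity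
    linarith
  refine ⟨hsmall, fun m R hm => div_topJ_le hf hm hc.le hp hsmall
    (mul_nonneg hC hD) (fun I hI => ?_) ?_⟩
  · rw [mul_assoc]
    exact H f hf he I (mem_Ls.1 hI) p hp
  · rw [le_div_iff₀ hp1]
    have a1 : 18 * S * D2 f p ≤ 72 * S * DD (n + 3) f p := by
      have := mul_le_mul_of_nonneg_left hD2 hS
      linarith
    calc _ ≤ L * DD (n + 3) f p * (1 + p 0) := by
          refine mul_le_mul_of_nonneg_right ?_ hp1.le
          rw [hL_def]
          linarith
      _ ≤ _ := by
          have a3 : 0 ≤ DD (n + 3) f p * (1 + p 0) := by positivity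
          linarith

theorem exists_top_energy (hF : NullForm3 F) (hG : NullForm2 G) (n : ℕ) :
    ∃ κ > 0, ∀ f, ContDiff ℝ ∞ f →
      (∀ p : Pt, 0 ≤ p 0 → box f p + nf3 F f f p = nf2 G f f p) → ∀ R T,
      (∀ p, Dm R T p → DD (n + 3) f p ≤ κ / (1 + p 0)) → ∀ m, 0 < m → ∀ t, 0 ≤ t → t < T →
        ∫ x : Sp, cw m R (stp t x) * ES (n + 6) f (stp t x) ≤
          4 * Real.exp (1 / 8 * Real.arsinh t) *
            ∫ x : Sp, cw m R (stp 0 x) * ES (n + 6) f (stp 0 x) := by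
  obtain ⟨κ, hκ, H⟩ := exists_div_topJ_le hF hG n (c := 1 / 8) (by norm_num)
  refine ⟨κ, hκ, fun f hf he R T hs m hm t ht htT => ?_⟩
  have hcE := ES_continuous (n + 6) hf
  have hcJ := (topJ_contDiff (F := F) (N := n + 6) (1 / 8) hf 0).continuous
  have h1 := cw_flux_le (J := topJ (1 / 8) F f (n + 6)) (R := R) (T := T) hm
    (topJ_contDiff (1 / 8) hf) (fun p hp => ((H f hf he p hp.1 (hs p hp)).2 m R hm.le).trans
      (neg_nonpos.2 (by
        have := hp.1
        have := aw_pos (1 / 8) p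
        have := cw_nonneg m R p
        have := ES_nonneg (n + 6) f p
        positivity))) ht htT
  have hb : ∀ s, 0 ≤ s → s < T → ∀ x : Sp,
      Real.exp (-(1 / 8 * Real.arsinh s)) * (cw m R (stp s x) * ES (n + 6) f (stp s x)) / 4 ≤
        cw m R (stp s x) * topJ (1 / 8) F f (n + 6) 0 (stp s x) ∧
      cw m R (stp s x) * topJ (1 / 8) F f (n + 6) 0 (stp s x) ≤
        Real.exp (-(1 / 8 * Real.arsinh s)) * (cw m R (stp s x) * ES (n + 6) f (stp s x)) := by
    intro s hs0 hsT x
    rcases lt_or_ge (2 * stp s x 0 + jb (stp s x)) R with h | h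
    · have hd : Dm R T (stp s x) := ⟨by simpa using hs0, by simpa using hsT, h⟩
      have hw := cw_nonneg m R (stp s x)
      obtain ⟨b1, b2⟩ := topJ_zero_bounds (N := n + 6) (1 / 8) (H f hf he _ hd.1 (hs _ hd)).1
      have c1 := mul_le_mul_of_nonneg_left b1 hw
      have c2 := mul_le_mul_of_nonneg_left b2 hw
      rw [aw, stp_zero_apply] at c1 c2
      exact ⟨le_trans (le_of_eq (by ring)) c1, c2.trans (le_of_eq (by ring))⟩
    · simp [cw_eq_zero hm h]
  have h2 := integral_mono (((cw_mul_integrable (R := R) hm hcE ht).const_mul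
    (Real.exp (-(1 / 8 * Real.arsinh t)))).div_const 4) (cw_mul_integrable hm hcJ ht)
    fun x => (hb t ht htT x).1
  have h3 := integral_mono (cw_mul_integrable (R := R) hm hcJ le_rfl)
    ((cw_mul_integrable (R := R) hm hcE le_rfl).const_mul
    (Real.exp (-(1 / 8 * Real.arsinh 0)))) fun x => (hb 0 le_rfl (ht.trans_lt htT) x).2
  rw [integral_div, integral_const_mul] at h2
  rw [integral_const_mul] at h3
  simp only [Real.arsinh_zero, mul_zero, neg_zero, Real.exp_zero, one_mul] at h3
  have h4 := h2.trans (h1.trans h3)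
  rw [Real.exp_neg, div_le_iff₀ (by norm_num), inv_mul_le_iff₀ (Real.exp_pos _)] at h4
  linarith

end energies

section ghost

variable {F : Fin 4 → Fin 4 → Fin 4 → ℝ} {G : Fin 4 → Fin 4 → ℝ}

theorem two_inv_mul_rpow_le_aw {p : Pt} (hp : 0 ≤ p 0) :
    vv p ^ (-(5 / 4) : ℝ) / 2 ≤ 1 / (1 + p 0) * aw (1 / 4) p := by
  have h1 : 0 < 1 + p 0 := by linarith
  have hv : vv p ^ (-(5 / 4) : ℝ) ≤ (1 + p 0) ^ (-(5 / 4) : ℝ) :=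
    Real.rpow_le_rpow_of_nonpos h1 (by rw [vv]; linarith [rr_nonneg p]) (by norm_num)
  have e1 : (1 + p 0) ^ (-(5 / 4) : ℝ) = 1 / (1 + p 0) * (1 + p 0) ^ (-(1 / 4) : ℝ) := by
    rw [show (-(5 / 4) : ℝ) = -1 + -(1 / 4) by norm_num, Real.rpow_add h1, Real.rpow_neg_one, ← one_div]
  have e2 : aw (1 / 4) p = (p 0 + √(1 + p 0 ^ 2)) ^ (-(1 / 4) : ℝ) := by
    rw [aw, ← Real.exp_arsinh, ← Real.exp_mul]
    congr 1
    ring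
  have e3 : (2 * (1 + p 0)) ^ (-(1 / 4) : ℝ) ≤ aw (1 / 4) p := by
    rw [e2]
    refine Real.rpow_le_rpow_of_nonpos ?_ ?_ (by norm_num)
    · have : 0 < √(1 + p 0 ^ 2) := Real.sqrt_pos.2 (by positivity)
      linarith
    · linarith [sqrt_one_add_sq_le hp]
  have e4 : (1 / 2 : ℝ) ≤ 2 ^ (-(1 / 4) : ℝ) := by
    rw [show (1 / 2 : ℝ) = 2 ^ (-1 : ℝ) by rw [Real.rpow_neg_one]; norm_num]
    exact Real.rpow_le_rpow_of_exponent_le (by norm_num) (by norm_num)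
  rw [Real.mul_rpow (by norm_num) h1.le] at e3
  have e5 := mul_le_mul_of_nonneg_right e4 (Real.rpow_nonneg h1.le (-(1 / 4) : ℝ))
  have e6 := mul_le_mul_of_nonneg_left (e5.trans e3) (one_div_pos.2 h1).le
  linarith

theorem young_source {a b τ u v w y κ C X : ℝ} (ha : 0 ≤ a) (hab : a ≤ b) (hτ : 0 ≤ τ)
    (hu : 0 < u) (hv : 0 < v) (hw : 0 ≤ w) (hκ : 0 ≤ κ) (hC : 0 ≤ C) (hX : X ≤ κ * w)
    (hy : w ^ 2 ≤ y) (hy2 : w / v ≤ y) :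
    a * (C * (X * (b / v + τ / u))) ≤ C * κ * (2 * y * b ^ 2 + τ ^ 2 * (u ^ 2)⁻¹) := by
  have hb : 0 ≤ b := ha.trans hab
  have h1 : a * (C * (X * (b / v + τ / u))) ≤ a * (C * (κ * w * (b / v + τ / u))) := by gcongr
  have h2 : a * (w / v) * b ≤ b * y * b := by gcongr
  have h3 : (a * w) * (τ / u) ≤ ((a * w) ^ 2 + (τ / u) ^ 2) / 2 := by
    linarith [two_mul_le_add_sq (a * w) (τ / u)]
  have h4 : (a * w) ^ 2 ≤ b ^ 2 * y := by
    rw [mul_pow]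
    gcongr
  have h5 : 0 ≤ (τ / u) ^ 2 := sq_nonneg _
  have h6 : a * (w / v) * b + (a * w) * (τ / u) ≤ 2 * y * b ^ 2 + (τ / u) ^ 2 := by
    have : 0 ≤ b ^ 2 * y := (sq_nonneg _).trans h4
    linarith
  have h7 := mul_le_mul_of_nonneg_left h6 (mul_nonneg hC hκ)
  have e1 : a * (C * (κ * w * (b / v + τ / u))) =
      C * κ * (a * (w / v) * b + (a * w) * (τ / u)) := by ring
  have e2 : τ ^ 2 * (u ^ 2)⁻¹ = (τ / u) ^ 2 := by rw [div_pow, div_eq_mul_inv]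
  rw [e2]
  linarith

/-- The flat currents with ghost weight together with the weighted quasilinear currents. -/
def ghJ (F : Fin 4 → Fin 4 → Fin 4 → ℝ) (f : Pt → ℝ) (n : ℕ) (a : Fin 4) (p : Pt) : ℝ :=
  gw p * ∑ I ∈ Ls (n + 5), cur (fun b c _ => mg b c) (kv I f) a p +
    topJ (1 / 4) F f (n + 6) a p

theorem mg_cur_contDiff {ψ : Pt → ℝ} (hψ : ContDiff ℝ ∞ ψ) (a : Fin 4) :
    ContDiff ℝ ∞ (cur (fun b c _ => mg b c) ψ a) :=
  cur_contDiff (fun _ _ => contDiff_const) hψ a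

theorem ghJ_contDiff {f : Pt → ℝ} (hf : ContDiff ℝ ∞ f) (n : ℕ) (a : Fin 4) :
    ContDiff ℝ ∞ (ghJ F f n a) :=
  (gw_contDiff.mul (ContDiff.sum fun I _ => mg_cur_contDiff (kv_contDiff hf I) a)).add
    (topJ_contDiff (1 / 4) hf a)

theorem div_ghost_sum_le {f : Pt → ℝ} (hf : ContDiff ℝ ∞ f) {m R Y : ℝ} (hm : 0 ≤ m) {n : ℕ}
    {p : Pt} (hsrc : ∀ I ∈ Ls n, |box (kv I f) p| ≤ Y) :
    ∑ a, pd a (fun q => cw m R q * (gw q * ∑ I ∈ Ls n, cur (fun b c _ => mg b c) (kv I f) a q)) p ≤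
      cw m R p * (5 * (DD n f p * Y) -
        1 / 4 * (uu p ^ 2)⁻¹ * ∑ I ∈ Ls n, ∑ a, Tg a (kv I f) p ^ 2) := by
  have sm : ∀ I a, ContDiff ℝ ∞ fun q =>
      cw m R q * gw q * cur (fun b c _ => mg b c) (kv I f) a q := fun I a =>
    ((cw_contDiff m R).mul gw_contDiff).mul (mg_cur_contDiff (kv_contDiff hf I) a)
  have e : ∀ a, (fun q => cw m R q * (gw q * ∑ I ∈ Ls n, cur (fun b c _ => mg b c) (kv I f) a q)) =
      fun q => ∑ I ∈ Ls n, cw m R q * gw q * cur (fun b c _ => mg b c) (kv I f) a q := fun a => by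
    funext q
    rw [← Finset.mul_sum]
    ring
  have hY : 0 ≤ Y := (abs_nonneg _).trans (hsrc [] (mem_Ls.2 (by simp)))
  have hw := cw_nonneg m R p
  simp only [e]
  calc _ = ∑ I ∈ Ls n, ∑ a,
        pd a (fun q => cw m R q * gw q * cur (fun b c _ => mg b c) (kv I f) a q) p := by
        rw [Finset.sum_comm]
        exact Finset.sum_congr rfl fun a _ =>
          pd_sum _ (fun I _ => contDiff_differentiable (sm I a) p) a
    _ ≤ ∑ I ∈ Ls n, cw m R p * (5 * (|pd 0 (kv I f) p| * Y) -
          1 / 4 * (uu p ^ 2)⁻¹ * ∑ a, Tg a (kv I f) p ^ 2) := by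
        refine Finset.sum_le_sum fun I hI => (div_ghost_le (kv_contDiff hf I) hm p).trans ?_
        refine mul_le_mul_of_nonneg_left ?_ hw
        have h1 := mul_le_mul_of_nonneg_left (hsrc I hI) (abs_nonneg (pd 0 (kv I f) p))
        have h2 : 0 ≤ 1 / 4 * (uu p ^ 2)⁻¹ * ((jb p ^ 2)⁻¹ * pd 0 (kv I f) p ^ 2) := by positivity
        linarith
    _ = cw m R p * (5 * ((∑ I ∈ Ls n, |pd 0 (kv I f) p|) * Y) -
          1 / 4 * (uu p ^ 2)⁻¹ * ∑ I ∈ Ls n, ∑ a, Tg a (kv I f) p ^ 2) := by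
        rw [← Finset.mul_sum, Finset.sum_sub_distrib, ← Finset.mul_sum, ← Finset.mul_sum,
          Finset.sum_mul]
    _ ≤ _ := by
        refine mul_le_mul_of_nonneg_left ?_ hw
        have := mul_le_mul_of_nonneg_right (sum_abs_pd_zero_le n f p) hY
        linarith

theorem exists_div_ghJ_le (hF : NullForm3 F) (hG : NullForm2 G) (n : ℕ) :
    ∃ κ > 0, ∀ f, ContDiff ℝ ∞ f →
      (∀ p : Pt, 0 ≤ p 0 → box f p + nf3 F f f p = nf2 G f f p) →
      ∀ p : Pt, 0 ≤ p 0 → DD (n + 3) f p ≤ κ / (1 + p 0) →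
        VV (n + 3) f p + DD (n + 4) f p ≤ κ * vv p ^ (-(3 / 4) : ℝ) →
        (∑ a, ∑ b, ∑ c, |F a b c|) * D1 f p ≤ 1 / 60 ∧ ∀ m R, 0 ≤ m →
          ∑ a, pd a (fun q => cw m R q * ghJ F f n a q) p ≤ 0 := by
  obtain ⟨C, hC, H⟩ := exists_ghost_source hF hG n
  obtain ⟨κ0, hκ0, H0⟩ := exists_div_topJ_le hF hG n (c := 1 / 4) (by norm_num)
  set L : ℝ := 2560 * C * ((Ls (n + 5)).card + (Ls (n + 6)).card) with hL_def
  have hL : 0 ≤ L := by positivity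
  refine ⟨min κ0 (1 / (L + 1)), by positivity, fun f hf he p hp hD hX => ?_⟩
  have hp1 : 0 < 1 + p 0 := by linarith
  obtain ⟨hs, htop⟩ := H0 f hf he p hp (hD.trans (by gcongr; exact min_le_left _ _))
  refine ⟨hs, fun m R hm => ?_⟩
  set κ := min κ0 (1 / (L + 1))
  have hκ : 0 < κ := by positivity
  have hκL : κ * L ≤ 1 := by
    have : κ * (L + 1) ≤ 1 := (le_div_iff₀ (by linarith)).1 (min_le_right _ _)
    linarith
  have hu : 0 < uu p := zero_lt_one.trans_le (one_le_uu p)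
  have hv1 := one_le_vv hp
  have hv : 0 < vv p := zero_lt_one.trans_le hv1
  have y1 : (vv p ^ (-(3 / 4) : ℝ)) ^ 2 ≤ vv p ^ (-(5 / 4) : ℝ) := by
    rw [← Real.rpow_natCast, ← Real.rpow_mul hv.le]
    exact Real.rpow_le_rpow_of_exponent_le hv1 (by norm_num)
  have y2 : vv p ^ (-(3 / 4) : ℝ) / vv p ≤ vv p ^ (-(5 / 4) : ℝ) := by
    rw [div_eq_mul_inv, ← Real.rpow_neg_one, ← Real.rpow_add hv]
    exact Real.rpow_le_rpow_of_exponent_le hv1 (by norm_num)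
  have h1 := div_ghost_sum_le (R := R) hf hm (n := n + 5) (p := p)
    fun I hI => H f hf he p hp I (mem_Ls.1 hI)
  have h2 := young_source (DD_nonneg (n + 5) f p) (DD_mono (show n + 5 ≤ n + 6 by omega) f p)
    (TT_nonneg (n + 5) f p) hu hv (Real.rpow_nonneg hv.le _) hκ.le hC hX y1 y2
  have h3 := htop m R hm
  have hw := cw_nonneg m R p
  have hy := two_inv_mul_rpow_le_aw hp
  have hE := ES_nonneg (n + 6) f p
  set y := vv p ^ (-(5 / 4) : ℝ)
  have hy0 : 0 ≤ y := Real.rpow_nonneg hv.le _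
  set Θ := ∑ I ∈ Ls (n + 5), ∑ a, Tg a (kv I f) p ^ 2
  have h_tan : 0 ≤ Θ := Finset.sum_nonneg fun I _ => Finset.sum_nonneg fun a _ => sq_nonneg _
  have t1 : 5 * (C * κ * (TT (n + 5) f p ^ 2 * (uu p ^ 2)⁻¹)) ≤ 1 / 4 * (uu p ^ 2)⁻¹ * Θ := by
    have a1 := mul_le_mul_of_nonneg_left (TT_sq_le (n + 5) f p)
      (show 0 ≤ 5 * (C * κ * (uu p ^ 2)⁻¹) by positivity)
    have a2 : 20 * C * κ * (Ls (n + 5)).card ≤ 1 / 4 := by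
      have : 0 ≤ κ * (C * (Ls (n + 6)).card) := by positivity
      have : 0 ≤ κ * (C * (Ls (n + 5)).card) := by positivity
      rw [hL_def] at hκL
      linarith
    have a3 := mul_le_mul_of_nonneg_right a2 (show 0 ≤ (uu p ^ 2)⁻¹ * Θ by positivity)
    linarith
  have t2 : 5 * (C * κ * (2 * y * DD (n + 6) f p ^ 2)) ≤ y / 64 * ES (n + 6) f p := by
    have a1 := mul_le_mul_of_nonneg_left (DD_sq_le (n + 6) f p)
      (show 0 ≤ 10 * (C * κ * y) by positivity)
    have a2 : 40 * C * κ * (Ls (n + 6)).card ≤ 1 / 64 := by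
      have : 0 ≤ κ * (C * (Ls (n + 5)).card) := by positivity
      rw [hL_def] at hκL
      linarith
    have a3 := mul_le_mul_of_nonneg_right a2 (show 0 ≤ y * ES (n + 6) f p by positivity)
    linarith
  have e : ∀ a, (fun q => cw m R q * ghJ F f n a q) = fun q =>
      cw m R q * (gw q * ∑ I ∈ Ls (n + 5), cur (fun b c _ => mg b c) (kv I f) a q) +
        cw m R q * topJ (1 / 4) F f (n + 6) a q := fun a => by
    funext q
    rw [ghJ, mul_add]
  have d1 : ∀ a, Differentiable ℝ fun q =>
      cw m R q * (gw q * ∑ I ∈ Ls (n + 5), cur (fun b c _ => mg b c) (kv I f) a q) := fun a =>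
    contDiff_differentiable ((cw_contDiff m R).mul (gw_contDiff.mul
      (ContDiff.sum fun I _ => mg_cur_contDiff (kv_contDiff hf I) a)))
  have d2 : ∀ a, Differentiable ℝ fun q => cw m R q * topJ (1 / 4) F f (n + 6) a q := fun a =>
    contDiff_differentiable ((cw_contDiff m R).mul (topJ_contDiff (1 / 4) hf a))
  simp only [e, fun a => pd_add (d1 a p) (d2 a p) a]
  rw [Finset.sum_add_distrib]
  have t3 : cw m R p * (y / 64 * ES (n + 6) f p) ≤
      1 / 4 / 8 / (1 + p 0) * (aw (1 / 4) p * (cw m R p * ES (n + 6) f p)) := by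
    have a1 := mul_le_mul_of_nonneg_right hy (mul_nonneg hw hE)
    have : 1 / 4 / 8 / (1 + p 0) = 1 / 32 * (1 / (1 + p 0)) := by ring
    rw [this]
    linarith
  have t4 := mul_le_mul_of_nonneg_left (show 5 * (DD (n + 5) f p * (C * ((VV (n + 3) f p +
      DD (n + 4) f p) * (DD (n + 6) f p / vv p + TT (n + 5) f p / uu p)))) -
      1 / 4 * (uu p ^ 2)⁻¹ * Θ ≤ y / 64 * ES (n + 6) f p by linarith) hw
  linarith

theorem ghJ_zero_bounds {f : Pt → ℝ} {n : ℕ} {p : Pt} (hp : 0 ≤ p 0)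
    (h : (∑ a, ∑ b, ∑ c, |F a b c|) * D1 f p ≤ 1 / 60) :
    ES (n + 5) f p / 2 ≤ ghJ F f n 0 p ∧ ghJ F f n 0 p ≤ 4 * ES (n + 6) f p := by
  obtain ⟨h1, h2⟩ := topJ_zero_bounds (N := n + 6) (1 / 4) h
  have e : ∑ I ∈ Ls (n + 5), cur (fun b c _ => mg b c) (kv I f) 0 p = ES (n + 5) f p / 2 := by
    simp only [cur_mg_zero, ES, Finset.sum_div]
  have hA := aw_pos (1 / 4) p
  have hA1 : aw (1 / 4) p ≤ 1 := by
    have := Real.arsinh_nonneg_iff.2 hp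
    rw [aw, Real.exp_le_one_iff]
    linarith
  have hE5 := ES_nonneg (n + 5) f p
  have hE6 := ES_nonneg (n + 6) f p
  have h3 := mul_le_mul_of_nonneg_right hA1 hE6
  have h4 := mul_nonneg hA.le hE6
  have h5 := mul_le_mul_of_nonneg_right (one_le_gw p) hE5
  have h6 := mul_le_mul_of_nonneg_right (gw_le p) hE5
  have h7 := ES_mono (show n + 5 ≤ n + 6 by omega) f p
  rw [ghJ, e]
  constructor <;> linarith

theorem exists_ghost_energy (hF : NullForm3 F) (hG : NullForm2 G) (n : ℕ) :
    ∃ κ > 0, ∀ f, ContDiff ℝ ∞ f →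
      (∀ p : Pt, 0 ≤ p 0 → box f p + nf3 F f f p = nf2 G f f p) → ∀ R T,
      (∀ p, Dm R T p → DD (n + 3) f p ≤ κ / (1 + p 0)) →
      (∀ p, Dm R T p → VV (n + 3) f p + DD (n + 4) f p ≤ κ * vv p ^ (-(3 / 4) : ℝ)) →
      ∀ m, 0 < m → ∀ t, 0 ≤ t → t < T →
        ∫ x : Sp, cw m R (stp t x) * ES (n + 5) f (stp t x) ≤
          8 * ∫ x : Sp, cw m R (stp 0 x) * ES (n + 6) f (stp 0 x) := by
  obtain ⟨κ, hκ, H⟩ := exists_div_ghJ_le hF hG n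
  refine ⟨κ, hκ, fun f hf he R T hs hs2 m hm t ht htT => ?_⟩
  have hcE := fun k => ES_continuous k hf
  have hcJ := (ghJ_contDiff (F := F) hf n 0).continuous
  have h1 := cw_flux_le (J := ghJ F f n) (R := R) (T := T) hm (ghJ_contDiff hf n)
    (fun p hp => (H f hf he p hp.1 (hs p hp) (hs2 p hp)).2 m R hm.le) ht htT
  have hb : ∀ s, 0 ≤ s → s < T → ∀ x : Sp,
      cw m R (stp s x) * ES (n + 5) f (stp s x) / 2 ≤ cw m R (stp s x) * ghJ F f n 0 (stp s x) ∧
      cw m R (stp s x) * ghJ F f n 0 (stp s x) ≤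
        4 * (cw m R (stp s x) * ES (n + 6) f (stp s x)) := by
    intro s hs0 hsT x
    rcases lt_or_ge (2 * stp s x 0 + jb (stp s x)) R with h | h
    · have hd : Dm R T (stp s x) := ⟨by simpa using hs0, by simpa using hsT, h⟩
      have hw := cw_nonneg m R (stp s x)
      obtain ⟨b1, b2⟩ := ghJ_zero_bounds (n := n) hd.1 (H f hf he _ hd.1 (hs _ hd) (hs2 _ hd)).1
      have c1 := mul_le_mul_of_nonneg_left b1 hw
      have c2 := mul_le_mul_of_nonneg_left b2 hw
      exact ⟨by linarith, by linarith⟩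
    · simp [cw_eq_zero hm h]
  have h2 := integral_mono ((cw_mul_integrable (R := R) hm (hcE (n + 5)) ht).div_const 2)
    (cw_mul_integrable hm hcJ ht) fun x => (hb t ht htT x).1
  have h3 := integral_mono (cw_mul_integrable (R := R) hm hcJ le_rfl)
    ((cw_mul_integrable (R := R) hm (hcE (n + 6)) le_rfl).const_mul 4)
    fun x => (hb 0 le_rfl (ht.trans_lt htT) x).2
  rw [integral_div] at h2
  rw [integral_const_mul] at h3
  linarith

end ghost

theorem norm_le_rad3 (x : Sp) : ‖x‖ ≤ rad3 x := by
  simpa [rr_stp] using norm_le_rr_stp 0 x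

theorem exists_initial_energy (k : ℕ) : ∃ C, 0 ≤ C ∧ ∀ f, ContDiff ℝ ∞ f → ∀ E,
    (∀ I : List (Fin 11), I.length ≤ k → ∀ x, D1 (kv I f) (stp 0 x) ≤ E / (1 + rad3 x) ^ 3) →
    ∀ m R, 0 < m → ∫ x : Sp, cw m R (stp 0 x) * ES k f (stp 0 x) ≤ C * E ^ 2 := by
  have hint : Integrable fun x : Sp => (1 + ‖x‖) ^ (-(6 : ℝ)) :=
    integrable_one_add_norm (by simp; norm_num)
  refine ⟨(Ls k).card * ∫ x : Sp, (1 + ‖x‖) ^ (-(6 : ℝ)), mul_nonneg (by positivity)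
    (integral_nonneg fun x => by positivity), fun f hf E h m R hm => ?_⟩
  have h1 : ∀ x : Sp, cw m R (stp 0 x) * ES k f (stp 0 x) ≤
      (Ls k).card * E ^ 2 * (1 + ‖x‖) ^ (-(6 : ℝ)) := by
    intro x
    have hx := norm_le_rad3 x
    have hx0 := norm_nonneg x
    have e : (1 + ‖x‖) ^ (-(6 : ℝ)) = ((1 + ‖x‖) ^ 6)⁻¹ := by
      rw [Real.rpow_neg (by positivity)]
      norm_cast
    have h2 : ∀ I ∈ Ls k, es (kv I f) (stp 0 x) ≤ E ^ 2 * (1 + ‖x‖) ^ (-(6 : ℝ)) := by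
      intro I hI
      have h3 := h I (mem_Ls.1 hI) x
      have h4 := pow_le_pow_left₀ (D1_nonneg _ _) h3 2
      refine (es_le_D1_sq _ _).trans (h4.trans ?_)
      rw [e, div_pow, ← pow_mul, div_eq_mul_inv]
      gcongr
    calc _ ≤ ES k f (stp 0 x) :=
          mul_le_of_le_one_left (ES_nonneg _ _ _) (cw_le_one _ _ _)
      _ ≤ ∑ _I ∈ Ls k, E ^ 2 * (1 + ‖x‖) ^ (-(6 : ℝ)) := Finset.sum_le_sum h2
      _ = _ := by rw [Finset.sum_const, nsmul_eq_mul, mul_assoc]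
  refine (integral_mono (cw_mul_integrable hm (ES_continuous k hf) le_rfl)
    (hint.const_mul _) h1).trans (le_of_eq ?_)
  rw [integral_const_mul]
  ring

theorem DD_continuous (k : ℕ) {f : Pt → ℝ} (hf : ContDiff ℝ ∞ f) : Continuous (DD k f) := by
  unfold DD D1
  exact continuous_finsetSum _ fun I _ => continuous_finsetSum _ fun a _ =>
    (pd_contDiff (kv_contDiff hf I) a).continuous.abs

theorem exists_DD_sq_le (k : ℕ) : ∃ C, 0 ≤ C ∧ ∀ f, ContDiff ℝ ∞ f → ∀ t, 0 ≤ t → ∀ x : Sp,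
    vv (stp t x) ^ 2 * uu (stp t x) * DD k f (stp t x) ^ 2 ≤
      C * ∫ y in {y : Sp | rad3 y ≤ max (rad3 x) (3 * (1 + t) / 4)}, ES (k + 2) f (stp t y) := by
  obtain ⟨C, hC, H⟩ := klainerman_sobolev
  set M : ℝ := 1233 ^ 2 * (4 * (Ls (k + 2)).card)
  have hM : 0 ≤ M := by positivity
  refine ⟨(Ls k).card ^ 2 * 16 * (C * M), by positivity, fun f hf t ht x => ?_⟩
  set s := {y : Sp | rad3 y ≤ max (rad3 x) (3 * (1 + t) / 4)}
  have hs : IsCompact s := isCompact_rad3_le _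
  have hES : IntegrableOn (fun y => ES (k + 2) f (stp t y)) s :=
    ((ES_continuous _ hf).comp (continuous_stp_right t)).continuousOn.integrableOn_compact hs
  set P := stp t x
  have hI : ∀ I ∈ Ls k, ∀ c, vv P ^ 2 * uu P * pd c (kv I f) P ^ 2 ≤
      C * (M * ∫ y in s, ES (k + 2) f (stp t y)) := by
    intro I hI c
    have hg := pd_contDiff (kv_contDiff hf I) c
    refine (H _ hg t ht x).trans (mul_le_mul_of_nonneg_left ?_ hC)
    rw [← integral_const_mul]
    refine setIntegral_mono_on ((((KW_continuous hg).comp (continuous_stp_right t)).pow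
      2).continuousOn.integrableOn_compact hs) (hES.const_mul _) hs.measurableSet fun y _ => ?_
    have h1 := KW_pd_kv_le hf (I := I) (k := k + 2) (p := stp t y)
      (by have := mem_Ls.1 hI; omega) c
    have h2 := DD_sq_le (k + 2) f (stp t y)
    have h0 : 0 ≤ KW (pd c (kv I f)) (stp t y) := by
      unfold KW
      have := fun i => dK_nonneg (vApp (KF i) (pd c (kv I f))) (stp t y)
      have := dK_nonneg (pd c (kv I f)) (stp t y)
      have : 0 ≤ ∑ i, dK (vApp (KF i) (pd c (kv I f))) (stp t y) :=
        Finset.sum_nonneg fun i _ => dK_nonneg _ _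
      positivity
    have h3 := pow_le_pow_left₀ h0 h1 2
    simp only [M]
    linarith
  set W := C * (M * ∫ y in s, ES (k + 2) f (stp t y))
  have hw : 0 ≤ vv P ^ 2 * uu P := by
    have := one_le_uu P
    positivity
  have h4 : DD k f P ^ 2 ≤ (Ls k).card * ∑ I ∈ Ls k, (4 * ∑ c, pd c (kv I f) P ^ 2) := by
    refine (sq_sum_le_card_mul_sum_sq (s := Ls k) (f := fun I => D1 (kv I f) P)).trans ?_
    refine mul_le_mul_of_nonneg_left (Finset.sum_le_sum fun I _ => D1_sq_le_es _ _)
      (Nat.cast_nonneg _)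
  calc vv P ^ 2 * uu P * DD k f P ^ 2 ≤
        vv P ^ 2 * uu P * ((Ls k).card * ∑ I ∈ Ls k, (4 * ∑ c, pd c (kv I f) P ^ 2)) := by gcongr
    _ = (Ls k).card * ∑ I ∈ Ls k, (4 * ∑ c, vv P ^ 2 * uu P * pd c (kv I f) P ^ 2) := by
        simp only [Finset.mul_sum]
        refine Finset.sum_congr rfl fun I _ => Finset.sum_congr rfl fun c _ => ?_
        ring
    _ ≤ (Ls k).card * ∑ I ∈ Ls k, (4 * ∑ _c : Fin 4, W) := by
        gcongr with I hI' c
        exact hI I hI' c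
    _ = _ := by
        simp [W]
        ring

theorem exists_DD_sq_le_of_energy (k : ℕ) : ∃ C, 0 ≤ C ∧ ∀ f, ContDiff ℝ ∞ f → ∀ R T W, 10 ≤ R →
    T ≤ R / 10 → ∀ p, Dm R T p →
    (∀ m, 0 < m → ∫ y : Sp, cw m R (stp (p 0) y) * ES (k + 2) f (stp (p 0) y) ≤ W) →
    vv p ^ 2 * uu p * DD k f p ^ 2 ≤ C * W := by
  obtain ⟨C, hC, H⟩ := exists_DD_sq_le k
  refine ⟨C, hC, fun f hf R T W hR hT p hp hW => ?_⟩
  obtain ⟨t, x, rfl⟩ : ∃ t x, p = stp t x := ⟨_, _, (stp_eta p).symm⟩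
  obtain ⟨ht, htT, hpR⟩ := hp
  simp only [stp_zero_apply] at ht htT hpR hW
  set d := R - 2 * t - max (jb (stp t x)) (1 + 3 * (1 + t) / 4)
  have hd : 0 < d := by
    have : max (jb (stp t x)) (1 + 3 * (1 + t) / 4) < R - 2 * t :=
      max_lt (by linarith) (by linarith)
    linarith
  refine (H f hf t ht x).trans (mul_le_mul_of_nonneg_left ((?_ : _ ≤ _).trans
    (hW d⁻¹ (inv_pos.2 hd))) hC)
  set s := {y : Sp | rad3 y ≤ max (rad3 x) (3 * (1 + t) / 4)}
  have hs : IsCompact s := isCompact_rad3_le _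
  have h1 : ∀ y ∈ s, cw d⁻¹ R (stp t y) = 1 := by
    intro y hy
    refine cw_eq_one ?_
    rw [inv_mul_eq_div, one_le_div hd, stp_zero_apply]
    have : jb (stp t y) ≤ max (jb (stp t x)) (1 + 3 * (1 + t) / 4) := by
      have hy' : rad3 y ≤ max (rad3 x) (3 * (1 + t) / 4) := hy
      rcases le_max_iff.1 hy' with h | h
      · refine le_max_of_le_left ?_
        have := jb_stp_le (x := x) (y := y) (ρ := 0) (t := t) (s := t) le_rfl (by linarith)
        linarith
      · refine le_max_of_le_right ((jb_le _).trans ?_)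
        rw [rr_stp]
        linarith
    simp only [d]
    linarith
  calc ∫ y in s, ES (k + 2) f (stp t y) =
        ∫ y in s, cw d⁻¹ R (stp t y) * ES (k + 2) f (stp t y) :=
        setIntegral_congr_fun hs.measurableSet fun y hy => by simp only [h1 y hy, one_mul]
    _ ≤ _ := setIntegral_le_integral (cw_mul_integrable (inv_pos.2 hd) (ES_continuous _ hf) ht)
        (Filter.Eventually.of_forall fun y => mul_nonneg (cw_nonneg _ _ _) (ES_nonneg _ _ _))

theorem exp_arsinh_div_eight_le {p : Pt} (hp : 0 ≤ p 0) :
    Real.exp (1 / 8 * Real.arsinh (p 0)) ≤ 2 * vv p ^ (1 / 8 : ℝ) := by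
  have h0 : 0 ≤ p 0 + √(1 + p 0 ^ 2) := by positivity
  have h1 : p 0 + √(1 + p 0 ^ 2) ≤ 2 * vv p := by
    have := sqrt_one_add_sq_le hp
    have := rr_nonneg p
    rw [vv]
    linarith
  have hv : 0 ≤ vv p := zero_le_one.trans (one_le_vv hp)
  rw [mul_comm, Real.exp_mul, Real.exp_arsinh]
  refine (Real.rpow_le_rpow h0 h1 (by norm_num)).trans ?_
  rw [Real.mul_rpow (by norm_num) hv]
  have h2 : (2 : ℝ) ^ (1 / 8 : ℝ) ≤ 2 ^ (1 : ℝ) :=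
    Real.rpow_le_rpow_of_exponent_le (by norm_num) (by norm_num)
  rw [Real.rpow_one] at h2
  exact mul_le_mul_of_nonneg_right h2 (Real.rpow_nonneg hv _)

theorem sq_le_of_weighted {p : Pt} (hp : 0 ≤ p 0) {d K : ℝ} (hK : 0 ≤ K)
    (h : vv p ^ 2 * uu p * d ^ 2 ≤ K * vv p ^ (1 / 8 : ℝ)) :
    d ^ 2 ≤ K * (vv p ^ (-(1 + 3 / 4) : ℝ) * uu p ^ (-(9 / 8) : ℝ)) := by
  have hv : 0 < vv p := zero_lt_one.trans_le (one_le_vv hp)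
  have hu : 0 < uu p := zero_lt_one.trans_le (one_le_uu p)
  have h1 : d ^ 2 ≤ K * (vv p ^ (-(15 / 8) : ℝ) * uu p ^ (-1 : ℝ)) := by
    have e : vv p ^ (-(15 / 8) : ℝ) * uu p ^ (-1 : ℝ) =
        vv p ^ (1 / 8 : ℝ) / (vv p ^ 2 * uu p) := by
      rw [show (-(15 / 8) : ℝ) = 1 / 8 - 2 by norm_num, Real.rpow_sub hv, Real.rpow_neg_one,
        Real.rpow_two]
      field_simp
    rw [e, ← mul_div_assoc, le_div_iff₀ (by positivity)]
    linarith
  refine h1.trans (mul_le_mul_of_nonneg_left ?_ hK)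
  have e1 : vv p ^ (-(15 / 8) : ℝ) = vv p ^ (-(1 + 3 / 4) : ℝ) * vv p ^ (-(1 / 8) : ℝ) := by
    rw [← Real.rpow_add hv]
    norm_num
  have e2 : uu p ^ (-(9 / 8) : ℝ) = uu p ^ (-(1 / 8) : ℝ) * uu p ^ (-1 : ℝ) := by
    rw [← Real.rpow_add hu]
    norm_num
  rw [e1, e2, mul_assoc]
  gcongr ?_ * (?_ * ?_)
  exact Real.rpow_le_rpow_of_nonpos hu (uu_le_vv hp) (by norm_num)

theorem le_sqrt_mul_of_sq_le {d K ε w : ℝ} (hε : 0 ≤ ε) (hw : 0 ≤ w)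
    (h : d ^ 2 ≤ K * ε ^ 2 * w ^ 2) : d ≤ √K * ε * w := by
  rcases lt_or_ge K 0 with hK | hK
  · have h1 : K * ε ^ 2 * w ^ 2 ≤ 0 := by
      rw [mul_assoc]
      exact mul_nonpos_of_nonpos_of_nonneg hK.le (by positivity)
    have h2 : d = 0 := by
      rw [← sq_eq_zero_iff]
      exact le_antisymm (h.trans h1) (sq_nonneg d)
    rw [h2]
    positivity
  · refine le_of_sq_le_sq ?_ (by positivity)
    rwa [mul_pow, mul_pow, Real.sq_sqrt hK]

/-- The initial bounds of the commuted functions. -/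
def InitBound (k : ℕ) (E : ℝ) (f : Pt → ℝ) : Prop := ∀ I : List (Fin 11), I.length ≤ k → ∀ x : Sp,
  |kv I f (stp 0 x)| ≤ E / (1 + rad3 x) ^ 2 ∧ D1 (kv I f) (stp 0 x) ≤ E / (1 + rad3 x) ^ 3

section improvement

variable {F : Fin 4 → Fin 4 → Fin 4 → ℝ} {G : Fin 4 → Fin 4 → ℝ}

theorem exists_top_decay (hF : NullForm3 F) (hG : NullForm2 G) (n : ℕ) :
    ∃ K, 0 ≤ K ∧ ∃ κ > 0, ∀ f, ContDiff ℝ ∞ f →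
      (∀ p : Pt, 0 ≤ p 0 → box f p + nf3 F f f p = nf2 G f f p) → ∀ E, InitBound (n + 6) E f →
      ∀ R T, 10 ≤ R → T ≤ R / 10 → (∀ p, Dm R T p → DD (n + 3) f p ≤ κ / (1 + p 0)) →
      ∀ p, Dm R T p → DD (n + 4) f p ^ 2 ≤
        K * E ^ 2 * (vv p ^ (-(1 + 3 / 4) : ℝ) * uu p ^ (-(9 / 8) : ℝ)) := by
  obtain ⟨M, hM, HM⟩ := exists_initial_energy (n + 6)
  obtain ⟨κ, hκ, H⟩ := exists_top_energy hF hG n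
  obtain ⟨S, hS, HS⟩ := exists_DD_sq_le_of_energy (n + 4)
  refine ⟨S * (8 * M), by positivity, κ, hκ, fun f hf he E hE R T hR hT hs p hp => ?_⟩
  refine sq_le_of_weighted hp.1 (by positivity) ?_
  refine (HS f hf R T (8 * vv p ^ (1 / 8 : ℝ) * (M * E ^ 2)) hR hT p hp fun m hm => ?_).trans
    (le_of_eq (by ring))
  refine (H f hf he R T hs m hm (p 0) hp.1 hp.2.1).trans ?_
  have h1 := HM f hf E (fun I hI x => (hE I hI x).2) m R hm
  have h2 := exp_arsinh_div_eight_le hp.1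
  have hv : 0 ≤ vv p ^ (1 / 8 : ℝ) := Real.rpow_nonneg (zero_le_one.trans (one_le_vv hp.1)) _
  calc _ ≤ 4 * Real.exp (1 / 8 * Real.arsinh (p 0)) * (M * E ^ 2) := by gcongr
    _ ≤ 4 * (2 * vv p ^ (1 / 8 : ℝ)) * (M * E ^ 2) := by gcongr
    _ = _ := by ring

theorem exists_improvement (hF : NullForm3 F) (hG : NullForm2 G) (n : ℕ) {Cd : ℝ} (hCd : 0 ≤ Cd) :
    ∃ C0, 0 ≤ C0 ∧ ∀ B, 0 ≤ B → ∃ ε1 > 0, ∀ ε, 0 < ε → ε < ε1 → ∀ f, ContDiff ℝ ∞ f →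
      (∀ p : Pt, 0 ≤ p 0 → box f p + nf3 F f f p = nf2 G f f p) → InitBound (n + 6) (Cd * ε) f →
      ∀ R T, 10 ≤ R → T ≤ R / 10 → (∀ p, Dm R T p → DD (n + 3) f p ≤ B * ε / vv p) →
      (∀ p, Dm R T p → VV (n + 3) f p ≤ C0 * ε * vv p ^ (-(3 / 4) : ℝ) ∧
        DD (n + 4) f p ≤ C0 * ε * vv p ^ (-(3 / 4) : ℝ) ∧ DD (n + 3) f p ≤ C0 * ε * (vv p)⁻¹) ∧
      ∀ m, 0 < m → ∀ t, 0 ≤ t → t < T →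
        ∫ x : Sp, cw m R (stp t x) * ES (n + 5) f (stp t x) ≤ C0 * ε ^ 2 := by
  obtain ⟨M, hM, HM⟩ := exists_initial_energy (n + 6)
  obtain ⟨K, hK, κ, hκ, HK⟩ := exists_top_decay hF hG n
  obtain ⟨L, hL, HL⟩ := exists_crude_source hF hG n
  obtain ⟨κ', hκ', HG⟩ := exists_ghost_energy hF hG n
  obtain ⟨S, hS, HS⟩ := exists_DD_sq_le_of_energy (n + 3)
  set N : ℝ := 8 + kerMass / 4 * 32 with hN_def
  have hN : 0 ≤ N := by have := kerMass_nonneg; positivity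
  set K1 := √(K * Cd ^ 2) with hK1_def
  set K2 := (Ls (n + 3)).card * (N * (L * (K * Cd ^ 2) + Cd))
  set K3 := 8 * (M * Cd ^ 2)
  set K4 := √(S * K3) with hK4_def
  have hK1 : 0 ≤ K1 := Real.sqrt_nonneg _
  have hK2 : 0 ≤ K2 := by positivity
  have hK3 : 0 ≤ K3 := by positivity
  have hK4 : 0 ≤ K4 := Real.sqrt_nonneg _
  refine ⟨K1 + K2 + K3 + K4, by positivity, fun B hB =>
    ⟨min 1 (min κ κ' / (B + K1 + K2 + 1)), by positivity,
    fun ε hε hε1 f hf he hI R T hR hT hboot => ?_⟩⟩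
  have hε2 : ε ≤ 1 := hε1.le.trans (min_le_left _ _)
  have hε3 : ε * (B + K1 + K2 + 1) < min κ κ' :=
    (lt_div_iff₀ (by positivity)).1 (hε1.trans_le (min_le_right _ _))
  have hB1 : B * ε ≤ min κ κ' := by
    have : 0 ≤ ε * (K1 + K2 + 1) := by positivity
    linarith
  have hB2 : (K2 + K1) * ε ≤ κ' := by
    have : 0 ≤ ε * (B + 1) := by positivity
    linarith [min_le_right κ κ']
  have hvp : ∀ p, Dm R T p → 0 < vv p := fun p hp => zero_lt_one.trans_le (one_le_vv hp.1)
  have hs : ∀ k, min κ κ' ≤ k → ∀ p, Dm R T p → DD (n + 3) f p ≤ k / (1 + p 0) := by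
    intro k hk p hp
    have := hp.1
    have h1 : 1 + p 0 ≤ vv p := by rw [vv]; linarith [rr_nonneg p]
    refine (hboot p hp).trans ?_
    have h2 : 0 ≤ B * ε := by positivity
    exact div_le_div₀ (h2.trans (hB1.trans hk)) (hB1.trans hk) (by linarith) h1
  have hD4 := HK f hf he (Cd * ε) hI R T hR hT (hs κ (min_le_left _ _))
  have hD4' : ∀ p, Dm R T p → DD (n + 4) f p ≤ K1 * ε * vv p ^ (-(3 / 4) : ℝ) := by
    intro p hp
    have hv := hvp p hp
    refine le_sqrt_mul_of_sq_le hε.le (Real.rpow_nonneg hv.le _) ((hD4 p hp).trans ?_)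
    rw [mul_pow, ← mul_assoc K]
    refine mul_le_mul_of_nonneg_left ?_ (by positivity)
    have h1 : uu p ^ (-(9 / 8) : ℝ) ≤ 1 :=
      Real.rpow_le_one_of_one_le_of_nonpos (one_le_uu p) (by norm_num)
    have h2 : vv p ^ (-(1 + 3 / 4) : ℝ) ≤ (vv p ^ (-(3 / 4) : ℝ)) ^ 2 := by
      rw [← Real.rpow_natCast, ← Real.rpow_mul hv.le]
      exact Real.rpow_le_rpow_of_exponent_le (one_le_vv hp.1) (by norm_num)
    exact (mul_le_of_le_one_right (Real.rpow_nonneg hv.le _) h1).trans h2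
  have hV : ∀ p, Dm R T p → VV (n + 3) f p ≤ K2 * ε * vv p ^ (-(3 / 4) : ℝ) := by
    intro p hp
    have hw : ∀ I ∈ Ls (n + 3), |kv I f p| ≤
        N * (L * (K * Cd ^ 2) + Cd) * ε * vv p ^ (-(3 / 4) : ℝ) := by
      intro I hIm
      have hIl := mem_Ls.1 hIm
      have hW : WaveData (kv I f) R T (L * (K * (Cd * ε) ^ 2)) (Cd * ε) (3 / 4) :=
        { smooth := kv_contDiff hf I
          source_nonneg := by positivity
          data_nonneg := by positivity
          data := fun x _ => (hI I (by omega) x).1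
          data_D1 := fun x _ => (hI I (by omega) x).2
          source := fun q hq => by
            refine (HL f hf he q hq.1 I hIl).trans ?_
            have := mul_le_mul_of_nonneg_left (hD4 q hq) hL
            linarith }
      refine (hW.decay_weak hp).trans ?_
      refine mul_le_mul_of_nonneg_right ?_ (Real.rpow_nonneg (hvp p hp).le _)
      rw [← hN_def, mul_assoc]
      refine mul_le_mul_of_nonneg_left ?_ hN
      have : L * (K * Cd ^ 2) * (ε * ε) ≤ L * (K * Cd ^ 2) * (ε * 1) := by gcongr
      linarith
    refine (Finset.sum_le_sum hw).trans (le_of_eq ?_)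
    rw [Finset.sum_const, nsmul_eq_mul]
    ring
  have hsum : ∀ p, Dm R T p → VV (n + 3) f p + DD (n + 4) f p ≤ κ' * vv p ^ (-(3 / 4) : ℝ) := by
    intro p hp
    have := mul_le_mul_of_nonneg_right hB2 (Real.rpow_nonneg (hvp p hp).le (-(3 / 4) : ℝ))
    linarith [hV p hp, hD4' p hp]
  have hE : ∀ m, 0 < m → ∀ t, 0 ≤ t → t < T →
      ∫ x : Sp, cw m R (stp t x) * ES (n + 5) f (stp t x) ≤ K3 * ε ^ 2 := by
    intro m hm t ht htT
    have h1 := HG f hf he R T (hs κ' (min_le_right _ _)) hsum m hm t ht htT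
    have h2 := HM f hf (Cd * ε) (fun I hIl x => (hI I hIl x).2) m R hm
    calc _ ≤ 8 * (M * (Cd * ε) ^ 2) := h1.trans (by linarith)
      _ = _ := by ring
  refine ⟨fun p hp => ⟨(hV p hp).trans ?_, (hD4' p hp).trans ?_, ?_⟩, fun m hm t ht htT =>
    (hE m hm t ht htT).trans ?_⟩
  · have := Real.rpow_nonneg (hvp p hp).le (-(3 / 4) : ℝ)
    gcongr
    linarith
  · have := Real.rpow_nonneg (hvp p hp).le (-(3 / 4) : ℝ)
    gcongr
    linarith
  · have hv := hvp p hp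
    have h1 := HS f hf R T (K3 * ε ^ 2) hR hT p hp fun m hm => hE m hm (p 0) hp.1 hp.2.1
    have h2 : DD (n + 3) f p ≤ K4 * ε * (vv p)⁻¹ := by
      refine le_sqrt_mul_of_sq_le hε.le (inv_nonneg.2 hv.le) ?_
      have h3 : vv p ^ 2 * DD (n + 3) f p ^ 2 ≤ vv p ^ 2 * uu p * DD (n + 3) f p ^ 2 := by
        refine mul_le_mul_of_nonneg_right ?_ (sq_nonneg _)
        exact le_mul_of_one_le_right (sq_nonneg _) (one_le_uu p)
      rw [inv_pow, ← div_eq_mul_inv, le_div_iff₀ (by positivity)]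
      linarith
    refine h2.trans ?_
    gcongr
    linarith
  · gcongr
    linarith

end improvement

theorem rr_continuous : Continuous rr := by
  unfold rr
  fun_prop

theorem vv_continuous : Continuous vv := by
  unfold vv
  exact (continuous_const.add (continuous_apply 0)).add rr_continuous

theorem jb_continuous : Continuous jb := jb_contDiff.continuous

theorem isCompact_cone (T R : ℝ) : IsCompact {p : Pt | 0 ≤ p 0 ∧ p 0 ≤ T ∧ 2 * p 0 + jb p ≤ R} := by
  have h0 : Continuous fun p : Pt => p 0 := continuous_apply 0
  refine IsCompact.of_isClosed_subset (isCompact_Icc (a := fun _ : Fin 4 => -R)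
    (b := fun _ : Fin 4 => R)) ?_ fun p hp => ?_
  · exact (isClosed_le continuous_const h0).inter ((isClosed_le h0 continuous_const).inter
      (isClosed_le ((h0.const_mul 2).add jb_continuous) continuous_const))
  · obtain ⟨h1, -, h3⟩ := hp
    have h4 := rr_le_jb p
    have h5 : ∀ a, |p a| ≤ R := by
      intro a
      refine Fin.cases ?_ (fun i => ?_) a
      · rw [abs_of_nonneg h1]
        linarith [rr_nonneg p]
      · linarith [abs_coord_le_rr p i]
    exact ⟨fun a => (abs_le.1 (h5 a)).1, fun a => (abs_le.1 (h5 a)).2⟩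

/-- Continuous induction in time on truncated backward cones. -/
theorem cone_induction {g : Pt → ℝ} (hg : Continuous g) {a b : ℝ} (hab : a < b)
    (h0 : ∀ x : Sp, g (stp 0 x) < b)
    (hstep : ∀ R T, 10 ≤ R → T ≤ R / 10 → (∀ p, Dm R T p → g p ≤ b) → ∀ p, Dm R T p → g p ≤ a)
    {p : Pt} (hp0 : 0 ≤ p 0) : g p ≤ b := by
  by_contra! hlt
  set R' := max (max (2 * p 0 + jb p) (10 * p 0)) 10
  have hR1 : 2 * p 0 + jb p ≤ R' := (le_max_left _ _).trans (le_max_left _ _)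
  have hR2 : 10 * p 0 ≤ R' := (le_max_right _ _).trans (le_max_left _ _)
  have hR3 : 10 ≤ R' := le_max_right _ _
  set s := {q : Pt | 0 ≤ q 0 ∧ q 0 ≤ p 0 ∧ 2 * q 0 + jb q ≤ R'} ∩ {q | b ≤ g q}
  have hs : IsCompact s := (isCompact_cone _ _).inter_right (isClosed_le continuous_const hg)
  obtain ⟨q, ⟨⟨hq0, hqT, hqR⟩, hqb⟩, hmin⟩ := hs.exists_isMinOn ⟨p, ⟨hp0, le_rfl, hR1⟩, hlt.le⟩
    (continuous_apply (0 : Fin 4)).continuousOn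
  replace hqb : b ≤ g q := hqb
  obtain ⟨t, x, rfl⟩ : ∃ t x, q = stp t x := ⟨_, _, (stp_eta q).symm⟩
  simp only [stp_zero_apply] at hq0 hqT hqR
  rcases hq0.eq_or_lt with h | h
  · rw [← h] at hqb
    exact (h0 x).not_ge hqb
  · have h1 := hstep R' t hR3 (by linarith) fun y hy => by
      by_contra! hc
      have : stp t x 0 ≤ y 0 := hmin ⟨⟨hy.1, by linarith [hy.2.1], hy.2.2.le⟩, hc.le⟩
      rw [stp_zero_apply] at this
      exact this.not_gt hy.2.1
    have hj : ∀ s, jb (stp s x) = jb (stp t x) := fun s => by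
      simp only [jb, show (1 : Fin 4) = Fin.succ 0 from rfl, show (2 : Fin 4) = Fin.succ 1 from rfl,
        show (3 : Fin 4) = Fin.succ 2 from rfl, stp_succ_apply]
    have hcont : Continuous fun s => g (stp s x) :=
      hg.comp (stp_continuous.comp (Continuous.prodMk_left x))
    have h2 : g (stp t x) ≤ a := by
      refine le_of_tendsto (hcont.continuousAt.tendsto.mono_left
        (nhdsWithin_le_nhds (s := Set.Iio t))) ?_
      filter_upwards [Ioo_mem_nhdsLT h] with s hs'
      refine h1 _ ⟨by simpa using hs'.1.le, by simpa using hs'.2, ?_⟩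
      rw [stp_zero_apply, hj]
      linarith [hs'.2]
    linarith

section bootstrap

variable {F : Fin 4 → Fin 4 → Fin 4 → ℝ} {G : Fin 4 → Fin 4 → ℝ}

theorem exists_global_bounds (hF : NullForm3 F) (hG : NullForm2 G) (n : ℕ) {Cd : ℝ}
    (hCd : 0 ≤ Cd) :
    ∃ C0, 0 ≤ C0 ∧ ∃ ε1 > 0, ∀ ε, 0 < ε → ε < ε1 → ∀ f, ContDiff ℝ ∞ f →
      (∀ p : Pt, 0 ≤ p 0 → box f p + nf3 F f f p = nf2 G f f p) → InitBound (n + 6) (Cd * ε) f →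
      (∀ p : Pt, 0 ≤ p 0 → VV (n + 3) f p ≤ C0 * ε * vv p ^ (-(3 / 4) : ℝ) ∧
        DD (n + 4) f p ≤ C0 * ε * vv p ^ (-(3 / 4) : ℝ)) ∧
      ∀ R, 10 ≤ R → ∀ m, 0 < m → ∀ t, 0 ≤ t → t < R / 10 →
        ∫ x : Sp, cw m R (stp t x) * ES (n + 5) f (stp t x) ≤ C0 * ε ^ 2 := by
  obtain ⟨C0, hC0, H⟩ := exists_improvement hF hG n hCd
  set N : ℝ := ((Ls (n + 3)).card : ℝ)
  obtain ⟨ε1, hε1, H1⟩ := H (C0 + N * Cd + 1) (by positivity)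
  refine ⟨C0, hC0, ε1, hε1, fun ε hε hlt f hf he hI => ?_⟩
  have hdiv : ∀ {c : ℝ} {p : Pt}, 0 ≤ p 0 → (DD (n + 3) f p ≤ c / vv p ↔
      vv p * DD (n + 3) f p ≤ c) := fun {c p} hp => by
    rw [le_div_iff₀ (zero_lt_one.trans_le (one_le_vv hp)), mul_comm]
  have hb : ∀ p : Pt, 0 ≤ p 0 → DD (n + 3) f p ≤ (C0 + N * Cd + 1) * ε / vv p := by
    intro p hp
    rw [hdiv hp]
    refine cone_induction (g := fun p => vv p * DD (n + 3) f p) (a := C0 * ε)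
      (vv_continuous.mul (DD_continuous _ hf)) ?_ (fun x => ?_) (fun R T hR hT hs q hq => ?_) hp
    · have : 0 ≤ N * Cd * ε := by positivity
      linarith
    · have hx := rad3_nonneg x
      have h1 : DD (n + 3) f (stp 0 x) ≤ N * (Cd * ε / (1 + rad3 x) ^ 3) := by
        refine (Finset.sum_le_sum fun I hIm =>
          (hI I (by have := mem_Ls.1 hIm; omega) x).2).trans (le_of_eq ?_)
        rw [Finset.sum_const, nsmul_eq_mul]
      have h2 : vv (stp 0 x) * (Cd * ε / (1 + rad3 x) ^ 3) ≤ Cd * ε := by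
        rw [vv_stp, zero_add, ← mul_div_assoc, div_le_iff₀ (by positivity), mul_comm]
        refine mul_le_mul_of_nonneg_left ?_ (by positivity)
        exact le_self_pow₀ (by linarith) (by norm_num)
      have hv : 0 ≤ vv (stp 0 x) := zero_le_one.trans (one_le_vv (by simp))
      have hN : 0 ≤ N := Nat.cast_nonneg _
      have h3 := mul_le_mul_of_nonneg_left h1 hv
      have h4 := mul_le_mul_of_nonneg_left h2 hN
      have : 0 ≤ C0 * ε := by positivity
      linarith
    · have h1 := ((H1 ε hε hlt f hf he hI R T hR hT fun p hp => (hdiv hp.1).2 (hs p hp)).1 q hq).2.2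
      rwa [← div_eq_mul_inv, hdiv hq.1] at h1
  have hH := fun R hR => H1 ε hε hlt f hf he hI R (R / 10) hR le_rfl fun p hp => hb p hp.1
  refine ⟨fun p hp => ?_, fun R hR => (hH R hR).2⟩
  set R := max 10 (10 * p 0 + jb p + 1)
  have hR : 10 * p 0 + jb p + 1 ≤ R := le_max_right _ _
  have hj := jb_pos p
  obtain ⟨h1, h2, -⟩ := (hH R (le_max_left _ _)).1 p ⟨hp, by linarith, by linarith⟩
  exact ⟨h1, h2⟩

end bootstrap

theorem rpow_div_mul_le {u v : ℝ} (hu : 1 ≤ u) (huv : u ≤ v) :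
    (v ^ (-(3 / 4) : ℝ)) ^ 2 / (v * u) ≤ v ^ (-(1 + 5 / 4) : ℝ) * u ^ (-(9 / 8) : ℝ) := by
  have u0 : 0 < u := zero_lt_one.trans_le hu
  have v0 : 0 < v := u0.trans_le huv
  have h1 : (v ^ (-(3 / 4) : ℝ)) ^ 2 / (v * u) =
      v ^ (-(1 + 5 / 4) : ℝ) * (v ^ (-(1 / 4) : ℝ) * u ^ (-1 : ℝ)) := by
    rw [← mul_assoc, ← Real.rpow_add v0, ← Real.rpow_natCast, ← Real.rpow_mul v0.le,
      Real.rpow_neg_one u, div_mul_eq_div_div, div_eq_mul_inv, div_eq_mul_inv,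
      ← Real.rpow_neg_one v, ← Real.rpow_add v0]
    norm_num
  rw [h1]
  refine mul_le_mul_of_nonneg_left ?_ (Real.rpow_nonneg v0.le _)
  calc v ^ (-(1 / 4) : ℝ) * u ^ (-1 : ℝ) ≤ u ^ (-(1 / 4) : ℝ) * u ^ (-1 : ℝ) :=
        mul_le_mul_of_nonneg_right
          (Real.rpow_le_rpow_of_nonpos u0 huv (by norm_num)) (Real.rpow_nonneg u0.le _)
    _ = u ^ (-(5 / 4) : ℝ) := by rw [← Real.rpow_add u0]; norm_num
    _ ≤ _ := Real.rpow_le_rpow_of_exponent_le hu (by norm_num)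

section

variable {F : Fin 4 → Fin 4 → Fin 4 → ℝ} {G : Fin 4 → Fin 4 → ℝ}

/-- Bounded low-order norms improve to decay in both `t + r` and `t - r`. -/
theorem exists_strong_decay (hF : NullForm3 F) (hG : NullForm2 G) (n : ℕ) {Cd C0 : ℝ}
    (hCd : 0 ≤ Cd) :
    ∃ C, 0 ≤ C ∧ ∀ ε, 0 < ε → ε < 1 → ∀ f, ContDiff ℝ ∞ f →
      (∀ p : Pt, 0 ≤ p 0 → box f p + nf3 F f f p = nf2 G f f p) → InitBound (n + 6) (Cd * ε) f →
      (∀ p, 0 ≤ p 0 → VV (n + 3) f p ≤ C0 * ε * vv p ^ (-(3 / 4) : ℝ) ∧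
        DD (n + 4) f p ≤ C0 * ε * vv p ^ (-(3 / 4) : ℝ)) →
      ∀ p, 0 ≤ p 0 → VV (n + 2) f p ≤ C * ε * (vv p ^ (-1 : ℝ) * uu p ^ (-(1 / 4) : ℝ)) := by
  obtain ⟨L, hL, HL⟩ := exists_low_source hF hG n
  set N : ℝ := 8 + kerMass / 4 * 32 with hN_def
  have hN : 0 ≤ N := by have := kerMass_nonneg; positivity
  refine ⟨(Ls (n + 2)).card * (N * (L * (4 * C0 ^ 2) + Cd)), by positivity,
    fun ε hε hε1 f hf he hI hb p hp => ?_⟩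
  have hw : ∀ I ∈ Ls (n + 2), |kv I f p| ≤
      N * (L * (4 * C0 ^ 2) + Cd) * ε * (vv p ^ (-1 : ℝ) * uu p ^ (-(1 / 4) : ℝ)) := by
    intro I hIm
    have hIl := mem_Ls.1 hIm
    have hW : WaveData (kv I f) (2 * p 0 + jb p + 1) (p 0 + 1) (L * (4 * C0 ^ 2 * ε ^ 2))
        (Cd * ε) (5 / 4) :=
      { smooth := kv_contDiff hf I
        source_nonneg := by positivity
        data_nonneg := by positivity
        data := fun x _ => (hI I (by omega) x).1
        data_D1 := fun x _ => (hI I (by omega) x).2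
        source := fun q hq => by
          have u1 := one_le_uu q
          have uv := uu_le_vv hq.1
          have v0 : 0 < vv q := by linarith
          refine (HL f hf he q hq.1 I hIl).trans ?_
          rw [mul_assoc]
          refine mul_le_mul_of_nonneg_left ?_ hL
          have hs : (VV (n + 3) f q + DD (n + 4) f q) ^ 2 ≤
              4 * C0 ^ 2 * ε ^ 2 * (vv q ^ (-(3 / 4) : ℝ)) ^ 2 := by
            rw [show 4 * C0 ^ 2 * ε ^ 2 * (vv q ^ (-(3 / 4) : ℝ)) ^ 2 =
              (2 * (C0 * ε * vv q ^ (-(3 / 4) : ℝ))) ^ 2 by ring]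
            refine pow_le_pow_left₀ (add_nonneg (VV_nonneg _ _ _) (DD_nonneg _ _ _)) ?_ 2
            linarith [hb q hq.1]
          calc _ ≤ 4 * C0 ^ 2 * ε ^ 2 * (vv q ^ (-(3 / 4) : ℝ)) ^ 2 / (vv q * uu q) := by gcongr
            _ = 4 * C0 ^ 2 * ε ^ 2 * ((vv q ^ (-(3 / 4) : ℝ)) ^ 2 / (vv q * uu q)) := by ring
            _ ≤ _ := mul_le_mul_of_nonneg_left (rpow_div_mul_le u1 uv) (by positivity) }
    refine (hW.decay_strong ⟨hp, by linarith, by linarith⟩).trans ?_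
    have u0 := zero_lt_one.trans_le (one_le_uu p)
    have v0 := zero_lt_one.trans_le (one_le_vv hp)
    refine mul_le_mul_of_nonneg_right ?_
      (mul_nonneg (Real.rpow_nonneg v0.le _) (Real.rpow_nonneg u0.le _))
    rw [← hN_def, mul_assoc N]
    refine mul_le_mul_of_nonneg_left ?_ hN
    have : L * (4 * C0 ^ 2) * (ε * ε) ≤ L * (4 * C0 ^ 2) * (ε * 1) := by gcongr
    linarith
  refine (Finset.sum_le_sum hw).trans (le_of_eq ?_)
  rw [Finset.sum_const, nsmul_eq_mul]
  ring

end

theorem radq_o3 (p : Pt) : radq o3 p = rr p := by simp [radq, rr, o3]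

theorem vv_mul_abs_nullVF_le {p : Pt} (hp : 0 ≤ p 0) (f : Pt → ℝ) :
    vv p * |vApp (nullVF o3) f p| ≤ 8 * dK f p := by
  have hd := dK_nonneg f p
  have hsum : vApp (nullVF o3) f p = pd 0 f p + p 1 / rr p * pd 1 f p + p 2 / rr p * pd 2 f p +
      p 3 / rr p * pd 3 f p := by
    rw [vApp_eq_sum, Fin.sum_univ_four]
    simp only [nullVF, radq_o3]
    simp [o3]
  obtain ⟨-, -, -, -, -, -, -, h7, h8, h9, h10⟩ := vApp_KF f p
  rcases (rr_nonneg p).eq_or_lt with h0 | h0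
  · have hvu : vv p = uu p := by rw [vv, uu, ← h0, sub_zero, abs_of_nonneg hp, add_zero]
    rw [hsum, ← h0, hvu]
    have := uu_mul_abs_pd_le hp f 0
    simp only [div_zero, zero_mul, add_zero]
    linarith
  · have hw : ∀ i : Fin 3, |p i.succ / rr p| ≤ 1 := fun i => by
      rw [abs_div, abs_of_pos h0]
      exact div_le_one_of_le₀ (abs_coord_le_rr p i) h0.le
    have hx : ∀ i : Fin 3, ∀ j, |p i.succ / rr p * vApp (KF j) f p| ≤ dK f p := fun i j => by
      simpa using abs_mul_le_of_le (hw i) (abs_KF_le_dK f p j)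
    have hy : ∀ i : Fin 3, |p i.succ / rr p * pd i.succ f p| ≤ dK f p := fun i => by
      simpa using abs_mul_le_of_le (hw i) (abs_pd_le_dK f p i.succ)
    have e : vv p * vApp (nullVF o3) f p = (pd 0 f p + p 1 / rr p * pd 1 f p +
        p 2 / rr p * pd 2 f p + p 3 / rr p * pd 3 f p) + (vApp (KF 10) f p +
        p 1 / rr p * vApp (KF 7) f p + p 2 / rr p * vApp (KF 8) f p +
        p 3 / rr p * vApp (KF 9) f p) := by
      rw [h7, h8, h9, h10, hsum, vv]
      have hr := rr_sq p
      field_simp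
      linear_combination (pd 0 f p) * hr
    rw [← abs_of_pos (zero_lt_one.trans_le (one_le_vv hp)), ← abs_mul, e]
    have a0 := abs_le.1 (abs_pd_le_dK f p 0)
    have a1 := abs_le.1 (hy 0)
    have a2 := abs_le.1 (hy 1)
    have a3 := abs_le.1 (hy 2)
    have b0 := abs_le.1 (abs_KF_le_dK f p 10)
    have b1 := abs_le.1 (hx 0 7)
    have b2 := abs_le.1 (hx 1 8)
    have b3 := abs_le.1 (hx 2 9)
    simp only [show (0 : Fin 3).succ = (1 : Fin 4) from rfl,
      show (1 : Fin 3).succ = (2 : Fin 4) from rfl,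
      show (2 : Fin 3).succ = (3 : Fin 4) from rfl] at a1 a2 a3 b1 b2 b3
    exact abs_le.2 ⟨by linarith, by linarith⟩

theorem goodAbs_le {p : Pt} (hp : 0 ≤ p 0) (f : Pt → ℝ) :
    goodAbs o3 f p ≤ 11 * ((1 + rr p)⁻¹ * dK f p) := by
  have hr := rr_nonneg p
  have h1 : |vApp (nullVF o3) f p| ≤ (1 + rr p)⁻¹ * (8 * dK f p) := by
    rw [← div_eq_inv_mul, le_div_iff₀ (by positivity), mul_comm]
    refine le_trans ?_ (vv_mul_abs_nullVF_le hp f)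
    exact mul_le_mul_of_nonneg_right (by rw [vv]; linarith) (abs_nonneg _)
  have h2 : ∀ i, (1 + rr p)⁻¹ * |vApp (KF i) f p| ≤ (1 + rr p)⁻¹ * dK f p := fun i =>
    mul_le_mul_of_nonneg_left (abs_KF_le_dK f p i) (by positivity)
  rw [goodAbs, radq_o3]
  have h4 : (1 + rr p)⁻¹ * |vApp (rotVF o3 0 1) f p| ≤ (1 + rr p)⁻¹ * dK f p := h2 4
  have h5 : (1 + rr p)⁻¹ * |vApp (rotVF o3 0 2) f p| ≤ (1 + rr p)⁻¹ * dK f p := h2 5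
  have h6 : (1 + rr p)⁻¹ * |vApp (rotVF o3 1 2) f p| ≤ (1 + rr p)⁻¹ * dK f p := h2 6
  linarith

theorem pdAbs_eq_D1 (f : Pt → ℝ) (p : Pt) : pdAbs f p = D1 f p := by
  rw [pdAbs, D1, Fin.sum_univ_four]

theorem goodAbs_le_of_dK_le {f : Pt → ℝ} {p : Pt} (hp : 0 ≤ p 0) {c : ℝ} (hc : 0 ≤ c)
    (h : dK f p ≤ c * (vv p ^ (-1 : ℝ) * uu p ^ (-(1 / 4) : ℝ))) :
    goodAbs o3 f p ≤ 11 * c / ((1 + rr p ^ 2) * uu p ^ (1 / 4 : ℝ)) := by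
  have hr := rr_nonneg p
  have u0 := zero_lt_one.trans_le (one_le_uu p)
  have v0 := zero_lt_one.trans_le (one_le_vv hp)
  have k0 : 0 < uu p ^ (1 / 4 : ℝ) := Real.rpow_pos_of_pos u0 _
  rw [Real.rpow_neg_one, Real.rpow_neg u0.le] at h
  calc goodAbs o3 f p ≤ 11 * ((1 + rr p)⁻¹ * dK f p) := goodAbs_le hp f
    _ ≤ 11 * ((1 + rr p)⁻¹ * (c * ((vv p)⁻¹ * (uu p ^ (1 / 4 : ℝ))⁻¹))) := by gcongr
    _ = 11 * c / (((1 + rr p) * vv p) * uu p ^ (1 / 4 : ℝ)) := by field_simp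
    _ ≤ _ := by
      gcongr
      have h2 : (1 + rr p) * (1 + rr p) ≤ (1 + rr p) * vv p :=
        mul_le_mul_of_nonneg_left (by rw [vv]; linarith) (by positivity)
      nlinarith

theorem pdAbs_le_of_dK_le {f : Pt → ℝ} {p : Pt} (hp : 0 ≤ p 0) {c : ℝ}
    (h : dK f p ≤ c * (vv p ^ (-1 : ℝ) * uu p ^ (-(1 / 4) : ℝ))) :
    pdAbs f p ≤ 28 * c / (vv p * uu p ^ (1 + 1 / 4 : ℝ)) := by
  have u0 := zero_lt_one.trans_le (one_le_uu p)
  have v0 := zero_lt_one.trans_le (one_le_vv hp)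
  have k0 : 0 < uu p ^ (1 / 4 : ℝ) := Real.rpow_pos_of_pos u0 _
  rw [Real.rpow_neg_one, Real.rpow_neg u0.le] at h
  have h1 := uu_mul_D1_le hp f
  rw [pdAbs_eq_D1, le_div_iff₀ (by positivity), Real.rpow_add u0, Real.rpow_one]
  calc D1 f p * (vv p * (uu p * uu p ^ (1 / 4 : ℝ)))
      = (uu p * D1 f p) * (vv p * uu p ^ (1 / 4 : ℝ)) := by ring
    _ ≤ (28 * (c * ((vv p)⁻¹ * (uu p ^ (1 / 4 : ℝ))⁻¹))) * (vv p * uu p ^ (1 / 4 : ℝ)) := by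
        refine mul_le_mul_of_nonneg_right ?_ (by positivity)
        linarith
    _ = 28 * c := by field_simp

theorem integral_le_of_forall_ball {g : Sp → ℝ} {B : ℝ}
    (hB : 0 ≤ B) (h : ∀ ρ, ∫ x in {x : Sp | rad3 x ≤ ρ}, g x ≤ B) : ∫ x, g x ≤ B := by
  by_cases hi : Integrable g
  · have hm : ∀ N : ℕ, MeasurableSet {x : Sp | rad3 x ≤ N} := fun N =>
      (isClosed_le rad3_continuous continuous_const).measurableSet
    have hmono : Monotone fun N : ℕ => {x : Sp | rad3 x ≤ N} := fun a b hab x hx =>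
      le_trans (show rad3 x ≤ a from hx) (Nat.cast_le.2 hab)
    have hU : ⋃ N : ℕ, {x : Sp | rad3 x ≤ N} = Set.univ :=
      Set.eq_univ_of_forall fun x => Set.mem_iUnion.2 (exists_nat_ge (rad3 x))
    have ht := tendsto_setIntegral_of_monotone hm hmono hi.integrableOn
    rw [hU, setIntegral_univ] at ht
    exact le_of_tendsto' ht fun N => h N
  · rwa [integral_undef hi]

theorem integral_pdAbs_sq_le {f : Pt → ℝ} (hf : ContDiff ℝ ∞ f) {k : ℕ} {B : ℝ} (hB : 0 ≤ B)
    (h : ∀ R, 10 ≤ R → ∀ m, 0 < m → ∀ t, 0 ≤ t → t < R / 10 →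
      ∫ x : Sp, cw m R (stp t x) * ES k f (stp t x) ≤ B) {I : List (Fin 11)} (hI : I.length ≤ k)
    {t : ℝ} (ht : 0 ≤ t) : ∫ x : Sp, (pdAbs (kv I f) (stp t x)) ^ 2 ≤ 4 * B := by
  have hk := kv_contDiff hf I
  have hc : Continuous fun x => (pdAbs (kv I f) (stp t x)) ^ 2 := by
    have : Continuous (pdAbs (kv I f)) := by
      unfold pdAbs
      exact ((((pd_contDiff hk 0).continuous.abs.add (pd_contDiff hk 1).continuous.abs).add
        (pd_contDiff hk 2).continuous.abs).add (pd_contDiff hk 3).continuous.abs)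
    exact (this.comp (continuous_stp_right t)).pow 2
  refine integral_le_of_forall_ball (by positivity) fun ρ => ?_
  have hcl : IsClosed {x : Sp | rad3 x ≤ ρ} := isClosed_le rad3_continuous continuous_const
  set R : ℝ := 10 * t + |ρ| + 12 with hR
  have hρ := le_abs_self ρ
  have hρ0 := abs_nonneg ρ
  have hint : Integrable fun x => 4 * (cw 1 R (stp t x) * ES k f (stp t x)) :=
    (cw_mul_integrable one_pos (ES_continuous k hf) ht).const_mul 4
  calc ∫ x in {x : Sp | rad3 x ≤ ρ}, (pdAbs (kv I f) (stp t x)) ^ 2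
      ≤ ∫ x in {x : Sp | rad3 x ≤ ρ}, 4 * (cw 1 R (stp t x) * ES k f (stp t x)) := by
        refine setIntegral_mono_on (hc.continuousOn.integrableOn_compact (isCompact_rad3_le ρ))
          hint.integrableOn hcl.measurableSet fun x hx => ?_
        replace hx : rad3 x ≤ ρ := hx
        have hj : jb (stp t x) ≤ 1 + rad3 x := by
          have := jb_le (stp t x)
          rwa [rr_stp] at this
        rw [cw_eq_one (by rw [stp_zero_apply]; linarith), one_mul, pdAbs_eq_D1]
        refine (D1_sq_le_es _ _).trans (mul_le_mul_of_nonneg_left ?_ (by norm_num))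
        exact Finset.single_le_sum (f := fun J => es (kv J f) (stp t x))
          (fun J _ => es_nonneg _ _) (mem_Ls.2 hI)
    _ ≤ ∫ x, 4 * (cw 1 R (stp t x) * ES k f (stp t x)) :=
        setIntegral_le_integral hint (Filter.Eventually.of_forall fun x =>
          mul_nonneg (by norm_num) (mul_nonneg (cw_nonneg _ _ _) (ES_nonneg _ _ _)))
    _ = 4 * ∫ x, cw 1 R (stp t x) * ES k f (stp t x) := integral_const_mul _ _
    _ ≤ 4 * B := by
        have := h R (by linarith) 1 one_pos t ht (by linarith)
        linarith

/-- Lemma 5.1: improved `u`-decay and uniform energy bounds for smooth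
global solutions of quasilinear wave equations satisfying the null condition, with initial
data localized near the origin. -/
theorem improved_u_decay
    (F : Fin 4 → Fin 4 → Fin 4 → ℝ) (G : Fin 4 → Fin 4 → ℝ)
    (hF : NullForm3 F) (hG : NullForm2 G) (n : ℕ) :
    ∃ C > (0 : ℝ), ∃ δ > (0 : ℝ), ∃ ε0 > (0 : ℝ), ∀ ε : ℝ, 0 < ε → ε < ε0 →
      ∀ ζ : Pt → ℝ, ∀ ζ0 ζ1 : Sp → ℝ,
        ContDiff ℝ (⊤ : ℕ∞) ζ →
        (∀ q : Pt, 0 ≤ q 0 → box ζ q + nf3 F ζ ζ q = nf2 G ζ ζ q) →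
        (∀ x, ζ (stp 0 x) = ζ0 x) → (∀ x, pd 0 ζ (stp 0 x) = ζ1 x) →
        (∀ k ≤ n + 7, ∀ x, hatD k ζ0 x ≤ ε / (1 + rad3 x) ^ (k + 2)) →
        (∀ k ≤ n + 7, ∀ x, hatD k ζ1 x ≤ ε / (1 + rad3 x) ^ (k + 3)) →
        (∀ I : List (Pt → Pt), I.length ≤ n → (∀ X ∈ I, X ∈ Kfields o3) →
          ∀ q : Pt, 0 ≤ q 0 →
            goodAbs o3 (vIter I ζ) q ≤
               C * ε / ((1 + radq o3 q ^ 2) * (1 + |q 0 - radq o3 q|) ^ δ) ∧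
            pdAbs (vIter I ζ) q ≤
               C * ε / ((1 + (q 0 + radq o3 q)) * (1 + |q 0 - radq o3 q|) ^ (1 + δ))) ∧
        (∀ I : List (Pt → Pt), I.length ≤ n + 4 → (∀ X ∈ I, X ∈ Kfields o3) →
          ∀ t : ℝ, 0 ≤ t →
            Real.sqrt (∫ x : Sp, (pdAbs (vIter I ζ) (stp t x)) ^ 2) ≤ C * ε) := by
  obtain ⟨Cd, hCd, εd, hεd, Hd⟩ := exists_initial_bound F G (n + 5)
  obtain ⟨C0, hC0, ε1, hε1, H0⟩ := exists_global_bounds hF hG n hCd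
  obtain ⟨C1, hC1, H1⟩ := exists_strong_decay hF hG n (C0 := C0) hCd
  refine ⟨28 * (11 * C1) + 2 * √C0 + 1, by positivity, 1 / 4, by norm_num,
    min 1 (min εd ε1), by positivity, fun ε hε hlt ζ ζ0 ζ1 hζ he hz0 hz1 hd0 hd1 => ?_⟩
  have hε1' : ε < 1 := hlt.trans_le (min_le_left _ _)
  have hεd' : ε < εd := hlt.trans_le ((min_le_right _ _).trans (min_le_left _ _))
  have hεg : ε < ε1 := hlt.trans_le ((min_le_right _ _).trans (min_le_right _ _))
  have hI : InitBound (n + 6) (Cd * ε) ζ := Hd ε hε hεd' ζ ζ0 ζ1 hζ he hz0 hz1 hd0 hd1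
  obtain ⟨hlow, hen⟩ := H0 ε hε hεg ζ hζ he hI
  have hs := Real.sqrt_nonneg C0
  have hc : 28 * (11 * C1 * ε) ≤ (28 * (11 * C1) + 2 * √C0 + 1) * ε := by
    nlinarith [mul_nonneg hs hε.le]
  have hc1 : 0 ≤ 11 * C1 * ε := by positivity
  constructor
  · intro I hIl hIK q hq
    obtain ⟨J, rfl⟩ := exists_map_of_forall_mem_Kfields hIK
    rw [List.length_map] at hIl
    have hK : dK (kv J ζ) q ≤
        11 * C1 * ε * (vv q ^ (-1 : ℝ) * uu q ^ (-(1 / 4) : ℝ)) := by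
      have h1 := dK_kv_le (f := ζ) (p := q) (k := n + 2) (I := J) (by omega)
      have h2 := H1 ε hε hε1' ζ hζ he hI hlow q hq
      linarith
    have u0 := zero_lt_one.trans_le (one_le_uu q)
    have v0 := zero_lt_one.trans_le (one_le_vv hq)
    have hg := goodAbs_le_of_dK_le hq hc1 hK
    have hp := pdAbs_le_of_dK_le hq hK
    rw [radq_o3, ← add_assoc]
    have hk : ∀ a, 0 ≤ uu q ^ (a : ℝ) := fun a => Real.rpow_nonneg u0.le _
    exact ⟨hg.trans (div_le_div_of_nonneg_right (by linarith) (mul_nonneg (by positivity) (hk _))),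
      hp.trans (div_le_div_of_nonneg_right hc (mul_nonneg v0.le (hk _)))⟩
  · intro I hIl hIK t ht
    obtain ⟨J, rfl⟩ := exists_map_of_forall_mem_Kfields hIK
    rw [List.length_map] at hIl
    have h := integral_pdAbs_sq_le hζ (by positivity) hen (I := J) (by omega) ht
    calc _ ≤ √(4 * (C0 * ε ^ 2)) := Real.sqrt_le_sqrt h
      _ = 2 * √C0 * ε := by
        rw [show 4 * (C0 * ε ^ 2) = C0 * (2 * ε) ^ 2 by ring, Real.sqrt_mul hC0,
          Real.sqrt_sq (by positivity)]
        ring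
      _ ≤ _ := by
        have : 0 ≤ C1 * ε := by positivity
        nlinarith

end
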